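/- (Separation lemma for one packet with non-disconnection.) For every integer j ≥ 1 there exists a constant c = c(j) > 0 such that for all integers 1 ≤ r ≤ R/2, every D ⊇ B_R, every intensity α ∈ (0,1/2], and every initial configuration (L_r, U, V, x̄) with x̄ = (x_1,…,x_j) points of V ∩ ∂B_r: P(Q^j(R) > 1/(10j)) ≥ c · P(Q^j(R) > 0). Moreover, the same inequality holds with Q^j(R) replaced by Q^j(R)·1_𝒟 for any decreasing event 𝒟 of the loop soup. -/

import Mathlib

open MeasureTheory Set
open scoped ENNReal NNReal

noncomputable section

namespace RWLSPaper

open scoped Classical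

/-- Vertices of the square lattice `ℤ²`. -/
abbrev Lat : Type := ℤ × ℤ

/-- The plane `ℝ²`, with the Euclidean metric. -/
abbrev Plane : Type := EuclideanSpace ℝ (Fin 2)

/-- Embedding of the lattice into the plane. -/
def emb (z : Lat) : Plane := (WithLp.equiv 2 (Fin 2 → ℝ)).symm ![(z.1 : ℝ), (z.2 : ℝ)]

/-- Lattice adjacency: Euclidean distance one. -/
def Adj (a b : Lat) : Prop := (a.1 - b.1) ^ 2 + (a.2 - b.2) ^ 2 = 1

/-- ℓ∞ norm on the lattice. -/
def linf (a : Lat) : ℤ := max |a.1| |a.2|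

/-- The box `B_R(z) = {w : |w - z|_∞ ≤ R}`. -/
def box (z : Lat) (R : ℤ) : Set Lat := {w | linf (w - z) ≤ R}

/-- Inner vertex boundary of a set of vertices. -/
def bdry (A : Set Lat) : Set Lat := {z | z ∈ A ∧ ∃ w, w ∉ A ∧ linf (z - w) = 1}

/-- A set of vertices, embedded in the plane. -/
def embS (A : Set Lat) : Set Plane := emb '' A

/-- The boundary of the box `B_R(z)`, embedded in the plane. -/
def bdryE (z : Lat) (R : ℤ) : Set Plane := embS (bdry (box z R))

/-- The solid box `z + [-R,R]²` in the plane. -/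
def boxP (z : Lat) (R : ℤ) : Set Plane :=
  {p | |p 0 - (z.1 : ℝ)| ≤ (R : ℝ) ∧ |p 1 - (z.2 : ℝ)| ≤ (R : ℝ)}

/-- Trace of a list of vertices: the vertices, together with the segments joining
consecutive ones. -/
def traceL (l : List Lat) : Set Plane :=
  (⋃ z ∈ l, {emb z}) ∪ ⋃ p ∈ l.zip l.tail, segment ℝ (emb p.1) (emb p.2)

/-- Nearest-neighbour paths: nonempty lists of successively adjacent vertices. -/
def IsPath (l : List Lat) : Prop := l ≠ [] ∧ l.Chain' Adj

/-- Number of steps of a path. -/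
def steps (l : List Lat) : ℕ := l.length - 1

/-- Paths from `z` to `w` with at least one step. -/
def PathsBetween (z w : Lat) : Set (List Lat) :=
  {l | IsPath l ∧ l.head? = some z ∧ l.getLast? = some w ∧ 2 ≤ l.length}

/-- Total mass of a set of paths under the measure giving weight `4^{-|η|}` to each
path `η`. -/
def pathMass (M : Set (List Lat)) : ℝ≥0∞ :=
  ∑' l : M, (4 : ℝ≥0∞)⁻¹ ^ steps l.1

/-- `A` disconnects `B` from `C` in the plane: every continuous path joining a point
of `B` to a point of `C` meets `A`. -/
def Disconnects (A B C : Set Plane) : Prop :=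
  ∀ γ : ℝ → Plane, ContinuousOn γ (Icc 0 1) → γ 0 ∈ B → γ 1 ∈ C →
    ∃ t ∈ Icc (0 : ℝ) 1, γ t ∈ A

/-- The set `M^{z,w}_{r,R}` of paths from `z` to `w` which intersect `∂B_R` and do
not disconnect `B_r` from `∂B_R`. -/
def MSet (z w : Lat) (r R : ℤ) : Set (List Lat) :=
  {l | l ∈ PathsBetween z w ∧ (traceL l ∩ bdryE 0 R).Nonempty ∧
    ¬ Disconnects (traceL l) (embS (box 0 r)) (bdryE 0 R)}

/-- Nearest-neighbour walks from `u` to `v` staying in `D`. -/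
def WalksIn (D : Set Lat) (u v : Lat) : Set (List Lat) :=
  {l | IsPath l ∧ l.head? = some u ∧ l.getLast? = some v ∧ ∀ x ∈ l, x ∈ D}

/-- The Green's function of simple random walk killed upon exiting `D`, through the
path-sum formula `G_D(u,v) = Σ_{η : u → v, η ⊆ D} 4^{-|η|}`. -/
def green (D : Set Lat) (u v : Lat) : ℝ≥0∞ :=
  ∑' l : WalksIn D u v, (4 : ℝ≥0∞)⁻¹ ^ steps l.1

/-! ### Loops -/

/-- A rooted loop, encoded by its cyclic word: a nonempty list of vertices which,
cyclically, are successively adjacent. -/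
structure RootedLoop where
  word : List Lat
  ne : word ≠ []
  adj : (word ++ word.take 1).Chain' Adj

/-- Rerooting (cyclic relabeling) relation on rooted loops. -/
def loopRot (l l' : RootedLoop) : Prop := ∃ k, l'.word = l.word.rotate k

/-- Unrooted loops: rooted loops modulo rerooting. -/
def ULoop : Type := Quot loopRot

/-- A representative of an unrooted loop. -/
def ULoop.out (γ : ULoop) : RootedLoop := Quot.out γ

/-- Number of steps of a loop. -/
def ULoop.steps (γ : ULoop) : ℕ := γ.out.word.length

/-- Vertices visited by a loop. -/
def ULoop.verts (γ : ULoop) : Set Lat := {x | x ∈ γ.out.word}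

/-- The trace of a loop in the plane. -/
def ULoop.trace (γ : ULoop) : Set Plane := traceL (γ.out.word ++ γ.out.word.take 1)

/-- The multiplicity `J(γ)`: the largest `j` such that `γ` is the concatenation of
`j` copies of a single loop. -/
def ULoop.mult (γ : ULoop) : ℕ :=
  sSup {j : ℕ | ∃ u : List Lat, u ≠ [] ∧ γ.out.word = (List.replicate j u).flatten}

/-- The unrooted loop measure: `ν(γ) = 4^{-|γ|} / J(γ)`. -/
def loopWeight (γ : ULoop) : ℝ≥0 := (4 : ℝ≥0)⁻¹ ^ γ.steps / (γ.mult : ℝ≥0)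

/-- Total `ν`-mass of a set of loops. -/
def nuMass (S : Set ULoop) : ℝ≥0∞ := ∑' γ : S, (loopWeight γ.1 : ℝ≥0∞)

/-- `ν(γ)` if `γ` is contained in `D`, and `0` otherwise. -/
def nuD (D : Set Lat) (γ : ULoop) : ℝ≥0 := if ULoop.verts γ ⊆ D then loopWeight γ else 0

/-! ### The random walk loop soup -/

/-- Loop configurations: multiplicity functions on unrooted loops. -/
abbrev Config : Type := ULoop → ℕ

/-- The set of loops appearing in a configuration. -/
def Config.loops (ω : Config) : Set ULoop := {γ | ω γ ≠ 0}

/-- The Poisson probability mass function with mean `r`. -/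
def poissonProb (r : ℝ≥0) (k : ℕ) : ℝ≥0∞ :=
  ENNReal.ofReal (Real.exp (-(r : ℝ)) * (r : ℝ) ^ k / k.factorial)

/-- `P` is the law of the random walk loop soup in `D` with intensity `α`: a Poisson
point process with intensity `α·ν` restricted to loops contained in `D`; equivalently,
the multiplicities of the various loops are independent, the multiplicity of a loop
`γ ⊆ D` being Poisson-distributed with mean `α ν(γ)`. -/
def IsLoopSoup (D : Set Lat) (α : ℝ) (P : Measure Config) : Prop :=
  IsProbabilityMeasure P ∧
  ∀ (s : Finset ULoop) (m : ULoop → ℕ),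
    P {ω | ∀ γ ∈ s, ω γ = m γ} = ∏ γ ∈ s, poissonProb (α.toNNReal * nuD D γ) (m γ)

/-- Decreasing events of the loop soup. -/
def DecreasingEvent (E : Set Config) : Prop :=
  ∀ ω ω' : Config, (∀ γ, ω' γ ≤ ω γ) → ω ∈ E → ω' ∈ E

/-! ### Clusters -/

/-- Two loops are adjacent when they intersect. -/
def Touches (γ γ' : ULoop) : Prop := (ULoop.verts γ ∩ ULoop.verts γ').Nonempty

/-- Connection of loops within a family `L` of loops: transitive closure of adjacency. -/
def linkedL (L : Set ULoop) : ULoop → ULoop → Prop :=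
  Relation.ReflTransGen (fun a b => a ∈ L ∧ b ∈ L ∧ Touches a b)

/-- The cluster of `γ` in `L`, as a set of loops. -/
def clusterClass (L : Set ULoop) (γ : ULoop) : Set ULoop := {γ' | γ' ∈ L ∧ linkedL L γ γ'}

/-- The subset of the plane covered by a family of loops. -/
def classTrace (K : Set ULoop) : Set Plane := ⋃ γ ∈ K, ULoop.trace γ

/-- The clusters of a loop configuration, regarded as subsets of the plane. -/
def clusters (L : Set ULoop) : Set (Set Plane) :=
  {C | ∃ γ ∈ L, C = classTrace (clusterClass L γ)}

/-- `Λ(A, L)`: the union of `A` with all the clusters of `L` meeting `A`. -/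
def LamL (A : Set Plane) (L : Set ULoop) : Set Plane :=
  A ∪ ⋃ C ∈ {C | C ∈ clusters L ∧ (C ∩ A).Nonempty}, C

/-- Connection within an arbitrary family of subsets of the plane (two members being
adjacent when they intersect). -/
def linkedS (F : Set (Set Plane)) : Set Plane → Set Plane → Prop :=
  Relation.ReflTransGen (fun a b => a ∈ F ∧ b ∈ F ∧ (a ∩ b).Nonempty)

/-- Clusters of a family of subsets of the plane. -/
def clustersS (F : Set (Set Plane)) : Set (Set Plane) :=
  {C | ∃ S ∈ F, C = ⋃ S' ∈ {S' | S' ∈ F ∧ linkedS F S S'}, S'}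

/-- `Λ(A, F)` for a family `F` of subsets of the plane. -/
def LamS (A : Set Plane) (F : Set (Set Plane)) : Set Plane :=
  A ∪ ⋃ C ∈ {C | C ∈ clustersS F ∧ (C ∩ A).Nonempty}, C

/-- The traces of a family of loops. -/
def traces (L : Set ULoop) : Set (Set Plane) := ULoop.trace '' L

/-! ### Filling, frontier, outermost clusters, crossings -/

/-- The filling of a set: the complement of the union of all unbounded connected
subsets of the complement of its closure. -/
def Fill (A : Set Plane) : Set Plane :=
  {x | ∀ C : Set Plane, C ⊆ (closure A)ᶜ → IsConnected C → x ∈ C → Bornology.IsBounded C}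

/-- The frontier of a loop: the topological boundary of the filling of its trace. -/
def loopFrontier (γ : ULoop) : Set Plane := frontier (Fill (ULoop.trace γ))

/-- The frontiers of the loops of a family. -/
def frontiers (L : Set ULoop) : Set (Set Plane) := loopFrontier '' L

/-- An outermost cluster of `L`. -/
def Outermost (L : Set ULoop) (C : Set Plane) : Prop :=
  C ∈ clusters L ∧ ∀ C' ∈ clusters L, C' ≠ C → ¬ Fill C ⊆ Fill C'

/-- `S` crosses the annulus `A_{r,R}(z)`: it meets both `∂B_r(z)` and `∂B_R(z)`. -/
def CrossesAnn (S : Set Plane) (z : Lat) (r R : ℤ) : Prop :=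
  (S ∩ bdryE z r).Nonempty ∧ (S ∩ bdryE z R).Nonempty

/-! ### Arm events -/

/-- The four-arm event: at least two distinct outermost clusters cross `A_{l,d}(z)`. -/
def fourArm (z : Lat) (l d : ℤ) (L : Set ULoop) : Prop :=
  ∃ C1 C2 : Set Plane, Outermost L C1 ∧ Outermost L C2 ∧ C1 ≠ C2 ∧
    CrossesAnn C1 z l d ∧ CrossesAnn C2 z l d

/-- The four-arm event, as a set of configurations. -/
def A4 (z : Lat) (l d : ℤ) : Set Config := {ω | fourArm z l d ω.loops}

/-- The truncated four-arm event `→𝒜(z;l,d)`. -/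
def A4trunc (z : Lat) (l d : ℤ) : Set Config :=
  {ω | fourArm z l d ω.loops ∧ LamL (embS (box z l)) ω.loops ⊆ boxP z (2 * d)}

/-- The truncated inward four-arm event `←𝒜(z;l,d)`. -/
def A4in (z : Lat) (l d : ℤ) : Set Config :=
  {ω | fourArm z l d ω.loops ∧
    LamL (embS (bdry (box z d))) ω.loops ∩ embS (box z (l / 2)) = ∅}

/-- Lattice points in the open upper half-plane `ℍ`. -/
def upperLat : Set Lat := {w | 0 < w.2}

/-- The upper part of the boundary of `B_R`, embedded in the plane. -/
def bdryEP (R : ℤ) : Set Plane := embS (bdry (box 0 R) ∩ upperLat)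

/-- `S` crosses the half-annulus `A^+_{r,R}`. -/
def CrossesAnnP (S : Set Plane) (r R : ℤ) : Prop :=
  (S ∩ bdryEP r).Nonempty ∧ (S ∩ bdryEP R).Nonempty

/-- The interior two-arm event: some outermost cluster has a frontier crossing `A_{l,d}`. -/
def A2 (l d : ℤ) : Set Config :=
  {ω | ∃ C, Outermost ω.loops C ∧ CrossesAnn (frontier (Fill C)) 0 l d}

/-- The boundary two-arm event. -/
def A2P (l d : ℤ) : Set Config :=
  {ω | ∃ C, Outermost ω.loops C ∧ CrossesAnnP (frontier (Fill C)) l d}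

/-- The boundary four-arm event. -/
def A4P (l d : ℤ) : Set Config :=
  {ω | ∃ C1 C2, Outermost ω.loops C1 ∧ Outermost ω.loops C2 ∧ C1 ≠ C2 ∧
    CrossesAnnP C1 l d ∧ CrossesAnnP C2 l d}

/-- Outward truncation condition: `Λ(B_l, ·) ⊆ B_{2d}`. -/
def TruncOut (l d : ℤ) (ω : Config) : Prop :=
  LamL (embS (box 0 l)) ω.loops ⊆ boxP 0 (2 * d)

/-- Inward truncation condition: `Λ(∂B_d, ·) ∩ B_{⌊l/2⌋} = ∅`. -/
def TruncIn (l d : ℤ) (ω : Config) : Prop :=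
  LamL (embS (bdry (box 0 d))) ω.loops ∩ embS (box 0 (l / 2)) = ∅

/-! ### Random walks and qualities -/

/-- `μ` is the law of the simple random walk on `ℤ²` started at `z`, as a measure on
`ℕ → ℤ²`. -/
def IsSRW (z : Lat) (μ : Measure (ℕ → Lat)) : Prop :=
  IsProbabilityMeasure μ ∧
  ∀ (n : ℕ) (f : ℕ → Lat), f 0 = z → (∀ i < n, Adj (f i) (f (i + 1))) →
    μ {w | ∀ i ≤ n, w i = f i} = (4 : ℝ≥0∞)⁻¹ ^ n

/-- First hitting time of a set of vertices by a walk. -/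
def hitTime (w : ℕ → Lat) (A : Set Lat) : ℕ := sInf {i | w i ∈ A}

/-- Position of a walk at its first hitting of `A`. -/
def hitPt (w : ℕ → Lat) (A : Set Lat) : Lat := w (hitTime w A)

/-- Trace of a walk, stopped at its first hitting of `A`. -/
def stoppedTrace (w : ℕ → Lat) (A : Set Lat) : Set Plane :=
  traceL ((List.range (hitTime w A + 1)).map w)

/-- The walk stays in `D` up to its first hitting of `A`. -/
def StaysIn (w : ℕ → Lat) (D A : Set Lat) : Prop := ∀ i ≤ hitTime w A, w i ∈ D

/-- `μ` is the law of the simple random walk started at `z`, conditioned to stay in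
`D` until it first hits `A`. -/
def IsCondSRW (z : Lat) (D A : Set Lat) (μ : Measure (ℕ → Lat)) : Prop :=
  ∃ ν : Measure (ℕ → Lat), IsSRW z ν ∧
    μ = (ν {w | StaysIn w D A})⁻¹ • ν.restrict {w | StaysIn w D A}

/-- Lattice ball of real radius (ℓ∞ distance). -/
def ballV (c : Lat) (ρ : ℝ) : Set Lat := {w | ((linf (w - c) : ℤ) : ℝ) ≤ ρ}

/-- Union of the stopped traces of a packet of walks. -/
def packTrace {j : ℕ} (ws : Fin j → ℕ → Lat) (A : Set Lat) : Set Plane :=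
  ⋃ i, stoppedTrace (ws i) A

/-- Union of the balls of radius `ρ` around the hitting points of a packet of walks. -/
def packBalls {j : ℕ} (ws : Fin j → ℕ → Lat) (A : Set Lat) (ρ : ℝ) : Set Plane :=
  ⋃ i, embS (ballV (hitPt (ws i) A) ρ)

/-- The frontiers of the loops of `ω` not contained in `B_r`. -/
def outerFrontiers (r : ℤ) (ω : Config) : Set (Set Plane) :=
  frontiers {γ | γ ∈ ω.loops ∧ ¬ ULoop.verts γ ⊆ box 0 r}

/-- The frontiers of the loops of `ω` meeting `B_R`. -/
def meetFrontiers (R : ℤ) (ω : Config) : Set (Set Plane) :=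
  frontiers {γ | γ ∈ ω.loops ∧ (ULoop.verts γ ∩ box 0 R).Nonempty}

/-- Quality at scale `s` for two packets of walks inside a loop soup, with initial
configuration `(Lr, V1, V2)` at scale `r`. -/
def qualityJK (Lr : Set ULoop) (V1 V2 : Set Lat) (r : ℤ) {j k : ℕ}
    (w1 : Fin j → ℕ → Lat) (w2 : Fin k → ℕ → Lat) (ω : Config) (s : ℤ) : ℝ :=
  sSup {δ : ℝ | 0 ≤ δ ∧
    LamS (embS V1 ∪ packTrace w1 (bdry (box 0 s)) ∪ packBalls w1 (bdry (box 0 s)) (δ * (s : ℝ)))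
        (traces Lr ∪ outerFrontiers r ω) ∩
      (embS V2 ∪ packTrace w2 (bdry (box 0 s)) ∪
        packBalls w2 (bdry (box 0 s)) (δ * (s : ℝ))) = ∅}

/-- Quality at scale `s` for a single pair of walks. -/
def qualityPair (Lr : Set ULoop) (V1 V2 : Set Lat) (r : ℤ)
    (w1 w2 : ℕ → Lat) (ω : Config) (s : ℤ) : ℝ :=
  qualityJK Lr V1 V2 r (fun _ : Fin 1 => w1) (fun _ : Fin 1 => w2) ω s

/-- Reversed quality at scale `s`, for two packets walking inward from `∂B_R`. -/
def qualityRev (L : Set ULoop) (V1 V2 : Set Lat) (R : ℤ) {j k : ℕ}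
    (w1 : Fin j → ℕ → Lat) (w2 : Fin k → ℕ → Lat) (ω : Config) (s : ℤ) : ℝ :=
  sSup {δ : ℝ | 0 ≤ δ ∧
    LamS (embS V1 ∪ packTrace w1 (bdry (box 0 s)) ∪ packBalls w1 (bdry (box 0 s)) (δ * (s : ℝ)))
        (traces L ∪ meetFrontiers R ω) ∩
      (embS V2 ∪ packTrace w2 (bdry (box 0 s)) ∪
        packBalls w2 (bdry (box 0 s)) (δ * (s : ℝ))) = ∅}

/-- Quality at scale `s` for one packet of walks, with non-disconnection of `U`. -/
def qualityDisc (Lr : Set ULoop) (U : Set Lat) (r : ℤ) {j : ℕ}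
    (ws : Fin j → ℕ → Lat) (ω : Config) (s : ℤ) : ℝ :=
  sSup {δ : ℝ | 0 ≤ δ ∧
    embS U ∩ Fill (LamS
      (packTrace ws (bdry (box 0 s)) ∪ packBalls ws (bdry (box 0 s)) (δ * (s : ℝ)))
      (traces Lr ∪ outerFrontiers r ω)) = ∅}

/-! ### Crossing loops and bad clusters -/

/-- Crossing loops: loops contained in `D` which cross `A_{d,k}` without
disconnecting `B_d` from `∂B_k`. -/
def crossingLoops (D : Set Lat) (d k : ℤ) : Set ULoop :=
  {γ | ULoop.verts γ ⊆ D ∧ CrossesAnn (ULoop.trace γ) 0 d k ∧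
    ¬ Disconnects (ULoop.trace γ) (embS (box 0 d)) (bdryE 0 k)}

/-- `K` is a bad cluster of `L` for the annulus `A_{l,d}`, relative to the set `CL` of
crossing loops: an outermost cluster crossing `A_{l,d}` which no longer crosses it
once its crossing loops are removed. -/
def IsBad (CL : Set ULoop) (l d : ℤ) (L : Set ULoop) (K : Set ULoop) : Prop :=
  (∃ γ ∈ L, K = clusterClass L γ) ∧
  Outermost L (classTrace K) ∧ CrossesAnn (classTrace K) 0 l d ∧
  ¬ CrossesAnn (classTrace (K \ CL)) 0 l d

/-- `E_1`: the four-arm event holds, with exactly one bad cluster. -/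
def E1 (CL : Set ULoop) (l d : ℤ) : Set Config :=
  {ω | fourArm 0 l d ω.loops ∧ ∃! K : Set ULoop, IsBad CL l d ω.loops K}

/-- `E_2`: the four-arm event holds, with at least two bad clusters. -/
def E2 (CL : Set ULoop) (l d : ℤ) : Set Config :=
  {ω | fourArm 0 l d ω.loops ∧
    ∃ K K' : Set ULoop, K ≠ K' ∧ IsBad CL l d ω.loops K ∧ IsBad CL l d ω.loops K'}

/-- Number of crossing loops of a configuration, counted with multiplicity. -/
def crossingCount (CL : Set ULoop) (ω : Config) : ℝ≥0∞ := ∑' γ : CL, (ω γ.1 : ℝ≥0∞)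

/-! ### Arcs of the square -/

/-- The square curve `{‖p‖_∞ = n}`: the closed polygonal curve through `∂B_n`. -/
def sqCurve (n : ℤ) : Set Plane := {p | max |p 0| |p 1| = (n : ℝ)}

/-- `J` is one of the two arcs of the closed curve `∂B_n` with endpoints `x` and `y`. -/
def IsArc (n : ℤ) (x y : Lat) (J : Set Plane) : Prop :=
  IsClosed J ∧ IsConnected J ∧ J ⊆ sqCurve n ∧ emb x ∈ J ∧ emb y ∈ J ∧
  IsConnected ((sqCurve n \ J) ∪ {emb x, emb y})

section
open Finset (sum_congr mem_filter mul_sum sum_le_sum sum_add_distrib sum_nonneg sum_eq_zero prod_nonneg sum_comm sum_div sum_const)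
open ENNReal (ofReal ofReal_le_ofReal ofReal_mul)
open Real (exp log)

/-- A continuous nonvanishing function on a real normed space has a continuous logarithm. -/
lemma exists_clog {A : Type*} [NormedAddCommGroup A] [NormedSpace ℝ A] (g : A → ℂ)
    (hg : Continuous g) (h0 : ∀ a, g a ≠ 0) : ∃ f : A → ℂ, Continuous f ∧ ∀ a, Complex.exp (f a) = g a := by
  obtain ⟨F, ⟨_, hF⟩, _⟩ := Complex.isCoveringMapOn_exp.existsUnique_continuousMap_lifts
    (⟨g, hg⟩ : C(A, ℂ)) (a₀ := 0) (e₀ := Complex.log (g 0)) (Complex.exp_log (h0 0)) (by simpa using h0)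
  exact ⟨F, F.continuous, fun a => congrFun hF a⟩

def toC : Plane ≃ₗᵢ[ℝ] ℂ := Complex.orthonormalBasisOneI.repr.symm

lemma toC_re (p : Plane) : (toC p).re = p 0 := by
  have := Complex.orthonormalBasisOneI.repr.apply_symm_apply p
  conv_rhs => rw [← this]
  simp [toC]

lemma toC_im (p : Plane) : (toC p).im = p 1 := by
  have := Complex.orthonormalBasisOneI.repr.apply_symm_apply p
  conv_rhs => rw [← this]
  simp [toC]

def HasLog (S : Set Plane) (u : Plane) : Prop :=
  ∃ f : Plane → ℂ, ContinuousOn f S ∧ ∀ z ∈ S, Complex.exp (f z) = toC z - toC u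

lemma HasLog.mono {S T : Set Plane} {u : Plane} (h : HasLog T u) (hs : S ⊆ T) : HasLog S u := by
  obtain ⟨f, hf, hf'⟩ := h
  exact ⟨f, hf.mono hs, fun z hz => hf' z (hs hz)⟩

lemma HasLog.union {S T : Set Plane} {u : Plane} (h : HasLog S u) (h' : HasLog T u)
    (hS : IsClosed S) (hT : IsClosed T) (hd : Disjoint S T) : HasLog (S ∪ T) u := by
  obtain ⟨f, hf, hf'⟩ := h
  obtain ⟨g, hg, hg'⟩ := h'
  refine ⟨fun z => if z ∈ S then f z else g z, ?_, ?_⟩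
  · refine ContinuousOn.union_of_isClosed ?_ ?_ hS hT
    · exact hf.congr fun z hz => by simp [hz]
    · exact hg.congr fun z hz => by
        have : z ∉ S := fun h => Set.disjoint_left.1 hd h hz
        simp [this]
  · rintro z (hz | hz)
    · simpa [hz] using hf' z hz
    · have : z ∉ S := fun h => Set.disjoint_left.1 hd h hz
      simpa [this] using hg' z hz

/-- Log exists if `c (z-u)` stays in the slit plane. -/
lemma hasLog_of_slit {S : Set Plane} {u : Plane} (c : ℂ) (hc : c ≠ 0)
    (h : ∀ z ∈ S, c * (toC z - toC u) ∈ Complex.slitPlane) : HasLog S u := by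
  refine ⟨fun z => Complex.log (c * (toC z - toC u)) - Complex.log c, ?_, ?_⟩
  · refine ContinuousOn.sub (ContinuousOn.clog ?_ h) continuousOn_const
    exact (continuous_const.mul (toC.continuous.sub continuous_const)).continuousOn
  · intro z hz
    rw [Complex.exp_sub, Complex.exp_log (Complex.slitPlane_ne_zero (h z hz)), Complex.exp_log hc]
    field_simp

lemma hasLog_shift {S : Set Plane} {u v : Plane} {d : ℝ} (h : HasLog S u)
    (hS : ∀ z ∈ S, d ≤ dist z u) (hv : dist u v < d) : HasLog S v := by
  obtain ⟨f, hf, hf'⟩ := h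
  have key : ∀ z ∈ S, (toC z - toC v) / (toC z - toC u) ∈ Complex.slitPlane := by
    intro z hz
    have hne : toC z - toC u ≠ 0 := by
      rw [← hf' z hz]; exact Complex.exp_ne_zero _
    have h := Complex.mem_slitPlane_of_norm_lt_one (z := (toC u - toC v) / (toC z - toC u)) ?_
    · convert h using 1
      field_simp; ring
    · rw [norm_div, div_lt_one]
      · rw [← dist_eq_norm, ← dist_eq_norm, toC.dist_map, toC.dist_map]
        exact hv.trans_le (hS z hz)
      · rw [← dist_eq_norm, toC.dist_map]
        exact lt_of_le_of_lt dist_nonneg (hv.trans_le (hS z hz))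
  refine ⟨fun z => f z + Complex.log ((toC z - toC v) / (toC z - toC u)), ?_, ?_⟩
  · refine hf.add (ContinuousOn.clog ?_ key)
    refine ContinuousOn.div (toC.continuous.sub continuous_const).continuousOn
      (toC.continuous.sub continuous_const).continuousOn ?_
    intro z hz
    rw [← hf' z hz]; exact Complex.exp_ne_zero _
  · intro z hz
    have hne : toC z - toC u ≠ 0 := by
      rw [← hf' z hz]; exact Complex.exp_ne_zero _
    rw [Complex.exp_add, hf' z hz, Complex.exp_log (Complex.slitPlane_ne_zero (key z hz))]
    field_simp

lemma hasLog_far {S : Set Plane} {u : Plane} {ρ : ℝ} (hS : ∀ z ∈ S, ‖z‖ ≤ ρ) (hu : ρ < ‖u‖) :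
    HasLog S u := by
  by_cases hne : S.Nonempty
  swap
  · rw [Set.not_nonempty_iff_eq_empty] at hne
    subst hne
    exact ⟨0, continuousOn_empty _, by simp⟩
  obtain ⟨z0, hz0⟩ := hne
  have hρ : 0 ≤ ρ := (norm_nonneg _).trans (hS z0 hz0)
  have hu0 : toC u ≠ 0 := by
    intro h
    have : ‖toC u‖ = 0 := by simp [h]
    rw [toC.norm_map] at this
    linarith
  refine hasLog_of_slit (-(toC u)⁻¹) (by simpa using hu0) ?_
  intro z hz
  have := Complex.mem_slitPlane_of_norm_lt_one (z := -(toC z / toC u)) ?_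
  · convert this using 1
    field_simp; ring
  · rw [norm_neg, norm_div, toC.norm_map, toC.norm_map, div_lt_one (by linarith)]
    exact (hS z hz).trans_lt hu

lemma hasLog_of_notMem_fill {S : Set Plane} (hS : IsCompact S) {u : Plane} (hu : u ∉ Fill S) :
    HasLog S u := by
  simp only [Fill, Set.mem_ofPred_eq, not_forall] at hu
  obtain ⟨C, hC, hconn, huC, hb⟩ := hu
  rw [hS.isClosed.closure_eq] at hC
  obtain ⟨ρ, hρ⟩ := hS.isBounded.exists_norm_le
  have hop : ∀ v ∉ S, ∃ d > 0, ∀ z ∈ S, d ≤ dist z v := by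
    intro v hv
    obtain ⟨d, hd, h⟩ := Metric.isOpen_iff.1 hS.isClosed.isOpen_compl v hv
    refine ⟨d, hd, fun z hz => ?_⟩
    by_contra hlt
    exact h (Metric.mem_ball.2 (not_le.1 hlt)) hz
  -- clopen
  let A : Set Plane := {v | v ∉ S ∧ HasLog S v}
  let B : Set Plane := {v | v ∉ S ∧ ¬ HasLog S v}
  have hA : IsOpen A := by
    rw [Metric.isOpen_iff]
    rintro v ⟨hv, hl⟩
    obtain ⟨d, hd, h⟩ := hop v hv
    refine ⟨d, hd, fun w hw => ?_⟩
    have hw' : dist v w < d := by rw [dist_comm]; exact hw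
    refine ⟨fun hwS => ?_, hasLog_shift hl h hw'⟩
    have := h w hwS
    rw [Metric.mem_ball] at hw
    linarith
  have hB : IsOpen B := by
    rw [Metric.isOpen_iff]
    rintro v ⟨hv, hl⟩
    obtain ⟨d, hd, h⟩ := hop v hv
    refine ⟨d/2, by linarith, fun w hw => ?_⟩
    rw [Metric.mem_ball] at hw
    refine ⟨fun hwS => ?_, fun hlw => hl ?_⟩
    · have := h w hwS
      linarith
    · refine hasLog_shift (d := d/2) hlw ?_ hw
      intro z hz
      have h1 := h z hz
      have h2 := dist_triangle z w v
      linarith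
  by_contra hlog
  have hcov : C ⊆ A ∪ B := by
    intro v hv
    by_cases h : HasLog S v
    · exact Or.inl ⟨hC hv, h⟩
    · exact Or.inr ⟨hC hv, h⟩
  obtain ⟨v, hvC, hv⟩ : ∃ v ∈ C, ρ < ‖v‖ := by
    by_contra hcon
    push Not at hcon
    exact hb (isBounded_iff_forall_norm_le.2 ⟨ρ, hcon⟩)
  obtain ⟨w, -, hwA, hwB⟩ := hconn.isPreconnected A B hA hB hcov ⟨v, hvC, hC hvC, hasLog_far hρ hv⟩
    ⟨u, huC, hC huC, hlog⟩
  exact hwB.2 hwA.2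

lemma circle_no_log (f : ℝ → ℂ) (hf : Continuous f) (hp : f 0 = f (2 * Real.pi))
    (c : ℂ) (he : ∀ t : ℝ, Complex.exp (f t) = c * Complex.exp (t * Complex.I)) (hc : c ≠ 0) : False := by
  -- f t - t I is constant
  have hconst : ∀ t : ℝ, ∃ n : ℤ, f t - t * Complex.I = Complex.log c + n * (2 * Real.pi * Complex.I) := by
    intro t
    have : Complex.exp (f t - t * Complex.I) = Complex.exp (Complex.log c) := by
      rw [Complex.exp_sub, he, Complex.exp_log hc]
      field_simp [Complex.exp_ne_zero]
    rw [Complex.exp_eq_exp_iff_exists_int] at this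
    obtain ⟨n, hn⟩ := this
    exact ⟨n, hn⟩
  choose n hn using hconst
  have hcn : Continuous n := by
    have h1 : Continuous fun t : ℝ => ((n t : ℤ) : ℝ) := by
      have : (fun t : ℝ => ((n t : ℤ) : ℝ)) = fun t : ℝ => ((f t - t * Complex.I - Complex.log c) / (2 * Real.pi * Complex.I)).re := by
        funext t
        rw [hn t]
        have : (Complex.log c + n t * (2 * Real.pi * Complex.I) - Complex.log c) / (2 * Real.pi * Complex.I) = ((n t : ℝ) : ℂ) := by
          have := Real.pi_ne_zero
          have hI := Complex.I_ne_zero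
          push_cast
          rw [add_sub_cancel_left]
          rw [mul_div_assoc, div_self, mul_one]
          simp [this]
        rw [this, Complex.ofReal_re]
      rw [this]
      fun_prop
    exact Int.isClosedEmbedding_coe_real.isEmbedding.continuous_iff.2 h1
  have h0 := hn 0
  have h1 := hn (2 * Real.pi)
  have hnn : n 0 = n (2 * Real.pi) := by
    have := PreconnectedSpace.constant (inferInstance : PreconnectedSpace ℝ) hcn (x := 0) (y := 2 * Real.pi)
    exact this
  rw [← hnn, ← h0, ← hp] at h1
  have : (2 * Real.pi : ℂ) * Complex.I = 0 := by
    push_cast at h1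
    linear_combination -h1
  simp [Real.pi_ne_zero] at this

lemma notMem_fill_of_hasLog {S : Set Plane} (hS : IsCompact S) {u : Plane} (huS : u ∉ S)
    (h : HasLog S u) : u ∉ Fill S := by
  intro hu
  let O := connectedComponentIn Sᶜ u
  have hop : IsOpen O := hS.isClosed.isOpen_compl.connectedComponentIn
  have huO : u ∈ O := mem_connectedComponentIn huS
  have hOb : Bornology.IsBounded O := by
    refine hu O ?_ (isConnected_connectedComponentIn_iff.2 huS) huO
    rw [hS.isClosed.closure_eq]
    exact connectedComponentIn_subset _ _
  have hfr : frontier O ⊆ S := by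
    intro z hz
    by_contra hzS
    have hzO : z ∉ O := by
      rw [hop.frontier_eq] at hz; exact hz.2
    -- the component of z is open and disjoint from O
    have hop' : IsOpen (connectedComponentIn Sᶜ z) := hS.isClosed.isOpen_compl.connectedComponentIn
    have hz' : z ∈ connectedComponentIn Sᶜ z := mem_connectedComponentIn hzS
    obtain ⟨w, hw1, hw2⟩ := mem_closure_iff.1 (frontier_subset_closure hz) _ hop' hz'
    have e1 := connectedComponentIn_eq hw1
    have e2 := connectedComponentIn_eq hw2
    apply hzO
    change z ∈ connectedComponentIn Sᶜ u
    rw [e2, ← e1]; exact hz'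
  obtain ⟨f, hf, hf'⟩ := h
  obtain ⟨F, hF⟩ := ContinuousMap.exists_restrict_eq hS.isClosed (⟨S.domRestrict f, hf.domRestrict⟩ : C(S, ℂ))
  have hF' : ∀ z ∈ S, F z = f z := fun z hz => by
    have := DFunLike.congr_fun hF ⟨z, hz⟩
    exact this
  let g : Plane → ℂ := fun z => if z ∈ O then Complex.exp (F z) else toC z - toC u
  have hg : Continuous g := by
    refine Continuous.if ?_ (Complex.continuous_exp.comp F.continuous) (toC.continuous.sub continuous_const)
    intro z hz
    have := hfr hz
    rw [hF' z this, hf' z this]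
  have hg0 : ∀ z, g z ≠ 0 := by
    intro z
    by_cases hz : z ∈ O
    · simp [g, hz, Complex.exp_ne_zero]
    · simp only [g, hz, if_false]
      intro h0
      have : z = u := toC.injective (sub_eq_zero.1 h0)
      exact hz (this ▸ huO)
  obtain ⟨L, hL, hL'⟩ := exists_clog g hg hg0
  obtain ⟨ρ, hρ⟩ := hOb.exists_norm_le
  let r : ℝ := |ρ| + ‖u‖ + 1
  have hr : 0 < r := by positivity
  let path : ℝ → Plane := fun t => toC.symm (toC u + r * Complex.exp (t * Complex.I))
  have hpath : ∀ t, path t ∉ O := by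
    intro t ht
    have h1 := hρ _ ht
    have h2 : ‖path t - u‖ = r := by
      rw [← toC.norm_map, map_sub]
      simp [path, Complex.norm_exp_ofReal_mul_I, abs_of_pos hr]
    have h3 := norm_sub_le (path t) u
    have := le_abs_self ρ
    simp only [r] at h2
    linarith
  refine circle_no_log (fun t => L (path t)) ?_ ?_ r ?_ (by exact_mod_cast hr.ne')
  · refine hL.comp (toC.symm.continuous.comp ?_)
    fun_prop
  · simp [path]
  · intro t
    rw [hL']
    simp only [g, hpath t, if_false]
    simp [path]

lemma fill_mono {A B : Set Plane} (h : A ⊆ B) : Fill A ⊆ Fill B := by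
  intro x hx C hC
  exact hx C (hC.trans (compl_subset_compl.2 (closure_mono h)))

lemma subset_fill (A : Set Plane) : A ⊆ Fill A := by
  intro x hx C hC _ hxC
  exact absurd (subset_closure hx) (hC hxC)

lemma notMem_fill_union {A C : Set Plane} (hA : IsClosed A) (hC : IsCompact C) (hd : Disjoint A C)
    {u : Plane} (hu : u ∉ Fill A) (huC : u ∉ C) (hCl : HasLog C u) : u ∉ Fill (A ∪ C) := by
  intro hf
  have huA : u ∉ A := fun h => hu (subset_fill A h)
  have hcl : IsClosed (A ∪ C) := hA.union hC.isClosed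
  have huS : u ∈ (A ∪ C)ᶜ := by simp [huA, huC]
  let O := connectedComponentIn (A ∪ C)ᶜ u
  have hop : IsOpen O := hcl.isOpen_compl.connectedComponentIn
  have huO : u ∈ O := mem_connectedComponentIn huS
  have hOb : Bornology.IsBounded O := by
    refine hf O ?_ (isConnected_connectedComponentIn_iff.2 huS) huO
    rw [hcl.closure_eq]
    exact connectedComponentIn_subset _ _
  obtain ⟨ρ, hρ⟩ := hOb.exists_norm_le
  let A' := A ∩ Metric.closedBall 0 (ρ + 1)
  have hA' : IsCompact A' := (isCompact_closedBall _ _).inter_left hA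
  have hu' : u ∉ Fill A' := fun h => hu (fill_mono Set.inter_subset_left h)
  have hd' : Disjoint A' C := hd.mono_left Set.inter_subset_left
  have hlog := (hasLog_of_notMem_fill hA' hu').union hCl hA'.isClosed hC.isClosed hd'
  refine notMem_fill_of_hasLog (hA'.union hC) ?_ hlog ?_
  · rintro (h | h)
    · exact huA h.1
    · exact huC h
  · intro T hT hTc huT
    rw [(hA'.union hC).isClosed.closure_eq] at hT
    -- T ⊆ O
    have hTO : T ⊆ O := by
      let P : Set Plane := (closure O)ᶜ
      have hcov : T ⊆ O ∪ P := by
        intro z hz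
        by_cases hzc : z ∈ closure O
        · left
          by_contra hzO
          have hzn : ‖z‖ ≤ ρ := by
            have : closure O ⊆ Metric.closedBall 0 ρ :=
              closure_minimal (fun w hw => by simpa using hρ w hw) Metric.isClosed_closedBall
            simpa using this hzc
          have hzS : z ∈ (A ∪ C)ᶜ := by
            rintro (h | h)
            · exact hT hz (Or.inl ⟨h, by simp; linarith⟩)
            · exact hT hz (Or.inr h)
          have hop' : IsOpen (connectedComponentIn (A ∪ C)ᶜ z) := hcl.isOpen_compl.connectedComponentIn
          have hz' : z ∈ connectedComponentIn (A ∪ C)ᶜ z := mem_connectedComponentIn hzS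
          obtain ⟨w, hw1, hw2⟩ := mem_closure_iff.1 hzc _ hop' hz'
          have e1 := connectedComponentIn_eq hw1
          have e2 := connectedComponentIn_eq hw2
          apply hzO
          change z ∈ connectedComponentIn (A ∪ C)ᶜ u
          rw [e2, ← e1]; exact hz'
        · exact Or.inr hzc
      intro z hz
      by_contra hzO
      have hzP : z ∈ P := (hcov hz).resolve_left hzO
      obtain ⟨w, -, hw1, hw2⟩ := hTc.isPreconnected O P hop isClosed_closure.isOpen_compl hcov ⟨u, huT, huO⟩ ⟨z, hz, hzP⟩
      exact hw2 (subset_closure hw1)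
    exact hOb.subset hTO

lemma angle_const {X : Type*} [TopologicalSpace X] {S : Set X} (hS : IsPreconnected S) {θ : X → ℝ}
    (hθ : ContinuousOn θ S) {a : ℝ} (hc : ∀ x ∈ S, 0 < Real.cos (θ x - a)) {x0 : X} (hx0 : x0 ∈ S)
    (h0 : |θ x0 - a| < Real.pi / 2) : ∀ x ∈ S, |θ x - a| < Real.pi / 2 := by
  have hpre := (hS.image θ hθ).ordConnected
  intro x hx
  rw [abs_lt] at h0 ⊢
  constructor
  · by_contra hcon
    have : a - Real.pi / 2 ∈ θ '' S := hpre.out ⟨x, hx, rfl⟩ ⟨x0, hx0, rfl⟩ ⟨by linarith, by linarith⟩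
    obtain ⟨y, hy, hy'⟩ := this
    have := hc y hy
    rw [hy', show a - Real.pi / 2 - a = -(Real.pi/2) by ring, Real.cos_neg, Real.cos_pi_div_two] at this
    exact lt_irrefl _ this
  · by_contra hcon
    have : a + Real.pi / 2 ∈ θ '' S := hpre.out ⟨x0, hx0, rfl⟩ ⟨x, hx, rfl⟩ ⟨by linarith, by linarith⟩
    obtain ⟨y, hy, hy'⟩ := this
    have := hc y hy
    rw [hy', show a + Real.pi / 2 - a = (Real.pi/2) by ring, Real.cos_pi_div_two] at this
    exact lt_irrefl _ this

lemma angle_step {t : ℝ} (h : |t| < Real.pi / 2) (hs : 0 < Real.sin t) : |t - Real.pi / 2| < Real.pi / 2 := by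
  rw [abs_lt] at h ⊢
  have : 0 < t := by
    by_contra hcon
    have := Real.sin_nonpos_of_nonpos_of_neg_pi_le (not_lt.1 hcon) (by linarith [Real.pi_pos])
    linarith
  constructor <;> linarith

lemma four_sets {X : Type*} [TopologicalSpace X] {S1 S2 S3 S4 : Set X} {g f : X → ℂ}
    (hf : ContinuousOn f (S1 ∪ S2 ∪ S3 ∪ S4)) (hg : ∀ x ∈ S1 ∪ S2 ∪ S3 ∪ S4, Complex.exp (f x) = g x)
    (h1 : IsPreconnected S1) (h2 : IsPreconnected S2) (h3 : IsPreconnected S3) (h4 : IsPreconnected S4)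
    (k1 : ∀ x ∈ S1, 0 < (g x).re) (k2 : ∀ x ∈ S2, 0 < (g x).im)
    (k3 : ∀ x ∈ S3, (g x).re < 0) (k4 : ∀ x ∈ S4, (g x).im < 0)
    (i12 : (S1 ∩ S2).Nonempty) (i23 : (S2 ∩ S3).Nonempty) (i34 : (S3 ∩ S4).Nonempty)
    (i41 : (S4 ∩ S1).Nonempty) : False := by
  let θ : X → ℝ := fun x => (f x).im
  have hθ : ContinuousOn θ (S1 ∪ S2 ∪ S3 ∪ S4) := Complex.continuous_im.comp_continuousOn hf
  have s1 : S1 ⊆ S1 ∪ S2 ∪ S3 ∪ S4 := fun x hx => by simp [hx]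
  have s2 : S2 ⊆ S1 ∪ S2 ∪ S3 ∪ S4 := fun x hx => by simp [hx]
  have s3 : S3 ⊆ S1 ∪ S2 ∪ S3 ∪ S4 := fun x hx => by simp [hx]
  have s4 : S4 ⊆ S1 ∪ S2 ∪ S3 ∪ S4 := fun x hx => by simp [hx]
  have hre : ∀ x ∈ S1 ∪ S2 ∪ S3 ∪ S4, (g x).re = exp (f x).re * Real.cos (θ x) := fun x hx => by
    rw [← hg x hx, Complex.exp_re]
  have him : ∀ x ∈ S1 ∪ S2 ∪ S3 ∪ S4, (g x).im = exp (f x).re * Real.sin (θ x) := fun x hx => by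
    rw [← hg x hx, Complex.exp_im]
  have c1 : ∀ x ∈ S1, 0 < Real.cos (θ x) := fun x hx => by
    have := k1 x hx; rw [hre x (s1 hx)] at this; exact (pos_iff_pos_of_mul_pos this).1 (Real.exp_pos _)
  have c2 : ∀ x ∈ S2, 0 < Real.sin (θ x) := fun x hx => by
    have := k2 x hx; rw [him x (s2 hx)] at this; exact (pos_iff_pos_of_mul_pos this).1 (Real.exp_pos _)
  have c3 : ∀ x ∈ S3, Real.cos (θ x) < 0 := fun x hx => by
    have := k3 x hx; rw [hre x (s3 hx)] at this; exact neg_of_mul_neg_right this (Real.exp_pos _).le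
  have c4 : ∀ x ∈ S4, Real.sin (θ x) < 0 := fun x hx => by
    have := k4 x hx; rw [him x (s4 hx)] at this; exact neg_of_mul_neg_right this (Real.exp_pos _).le
  obtain ⟨x41, hx4, hx1⟩ := i41
  obtain ⟨x12, hy1, hy2⟩ := i12
  obtain ⟨x23, hz2, hz3⟩ := i23
  obtain ⟨x34, hw3, hw4⟩ := i34
  obtain ⟨n, hn⟩ : ∃ n : ℤ, |θ x41 - n * (2 * Real.pi)| < Real.pi / 2 := by
    have hm := toIocMod_mem_Ioc Real.two_pi_pos (-Real.pi) (θ x41)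
    refine ⟨toIocDiv Real.two_pi_pos (-Real.pi) (θ x41), ?_⟩
    have e : toIocMod Real.two_pi_pos (-Real.pi) (θ x41) = θ x41 - toIocDiv Real.two_pi_pos (-Real.pi) (θ x41) * (2 * Real.pi) := by
      rw [toIocMod, zsmul_eq_mul]
    rw [e] at hm
    have hc := c1 x41 hx1
    rw [← Real.cos_sub_int_mul_two_pi _ (toIocDiv Real.two_pi_pos (-Real.pi) (θ x41))] at hc
    generalize θ x41 - toIocDiv Real.two_pi_pos (-Real.pi) (θ x41) * (2 * Real.pi) = t at *
    by_contra hcon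
    rw [not_lt, le_abs] at hcon
    obtain ⟨hm1, hm2⟩ := hm
    rcases hcon with h | h
    · have := Real.cos_nonpos_of_pi_div_two_le_of_le h (by linarith)
      linarith
    · have := Real.cos_nonpos_of_pi_div_two_le_of_le (x := -t) h (by linarith)
      rw [Real.cos_neg] at this
      linarith
  set a := n * (2 * Real.pi) with ha
  have ea : ∀ t, Real.cos (t - a) = Real.cos t := fun t => Real.cos_sub_int_mul_two_pi _ _
  have eb : ∀ t, Real.sin (t - a) = Real.sin t := fun t => Real.sin_sub_int_mul_two_pi _ _
  have d1 := angle_const h1 (hθ.mono s1) (a := a) (fun x hx => by rw [ea]; exact c1 x hx) hx1 hn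
  have e1 := angle_step (d1 _ hy1) (by rw [eb]; exact c2 _ hy2)
  have e2 : ∀ t, Real.cos (t - (a + Real.pi/2)) = Real.sin t := fun t => by
    rw [← eb t, ← Real.cos_sub_pi_div_two]; congr 1; ring
  have e2' : ∀ t, Real.sin (t - (a + Real.pi/2)) = -Real.cos t := fun t => by
    rw [← ea t, ← Real.sin_sub_pi_div_two]; congr 1; ring
  rw [sub_sub] at e1
  have d2 := angle_const h2 (hθ.mono s2) (a := a + Real.pi/2) (fun x hx => by rw [e2]; exact c2 x hx) hy2 e1
  have e3 := angle_step (d2 _ hz2) (by rw [e2']; linarith [c3 _ hz3])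
  have e4 : ∀ t, Real.cos (t - (a + Real.pi/2 + Real.pi/2)) = -Real.cos t := fun t => by
    rw [← e2' t, ← Real.cos_sub_pi_div_two]; congr 1; ring
  have e4' : ∀ t, Real.sin (t - (a + Real.pi/2 + Real.pi/2)) = -Real.sin t := fun t => by
    rw [← e2 t, ← Real.sin_sub_pi_div_two]; congr 1; ring
  rw [sub_sub] at e3
  have d3 := angle_const h3 (hθ.mono s3) (a := a + Real.pi/2 + Real.pi/2) (fun x hx => by rw [e4]; linarith [c3 x hx]) hz3 e3
  have e5 := angle_step (d3 _ hw3) (by rw [e4']; linarith [c4 _ hw4])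
  have e6 : ∀ t, Real.cos (t - (a + Real.pi/2 + Real.pi/2 + Real.pi/2)) = -Real.sin t := fun t => by
    rw [← e4' t, ← Real.cos_sub_pi_div_two]; congr 1; ring
  have e6' : ∀ t, Real.sin (t - (a + Real.pi/2 + Real.pi/2 + Real.pi/2)) = Real.cos t := fun t => by
    rw [← neg_neg (Real.cos t), ← e4 t, ← Real.sin_sub_pi_div_two]; congr 1; ring
  rw [sub_sub] at e5
  have d4 := angle_const h4 (hθ.mono s4) (a := a + Real.pi/2 + Real.pi/2 + Real.pi/2) (fun x hx => by rw [e6]; linarith [c4 x hx]) hw4 e5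
  have e7 := angle_step (d4 _ hx4) (by rw [e6']; linarith [c1 _ hx1])
  rw [abs_lt] at hn e7
  linarith [hn.1, hn.2, e7.1, e7.2, Real.pi_pos]

lemma crossing {A B : Set Plane} {a0 a1 b0 b1 : Plane} (hA : JoinedIn A a0 a1) (hB : JoinedIn B b0 b1)
    (h0 : ∀ b ∈ B, b 0 < a0 0) (h1 : ∀ b ∈ B, a1 0 < b 0)
    (k0 : ∀ a ∈ A, b0 1 < a 1) (k1 : ∀ a ∈ A, a 1 < b1 1) : (A ∩ B).Nonempty := by
  by_contra hne
  obtain ⟨α, hα⟩ := hA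
  obtain ⟨β, hβ⟩ := hB
  have hα' : ∀ t, α.extend t ∈ A := fun t => hα (Set.projIcc 0 1 zero_le_one t)
  have hβ' : ∀ t, β.extend t ∈ B := fun t => hβ (Set.projIcc 0 1 zero_le_one t)
  let g : ℝ × ℝ → ℂ := fun p => toC (α.extend p.1) - toC (β.extend p.2)
  have hg : Continuous g := (toC.continuous.comp (α.continuous_extend.comp continuous_fst)).sub
    (toC.continuous.comp (β.continuous_extend.comp continuous_snd))
  have g0 : ∀ p, g p ≠ 0 := by
    intro p hp
    have := toC.injective (sub_eq_zero.1 hp)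
    exact hne ⟨_, hα' p.1, this ▸ hβ' p.2⟩
  obtain ⟨f, hf, hfe⟩ := exists_clog g hg g0
  have pc : ∀ s : Set (ℝ × ℝ), Convex ℝ s → IsPreconnected s := fun s hs => hs.isPreconnected
  refine four_sets (X := ℝ × ℝ) (S1 := {0} ×ˢ univ) (S2 := univ ×ˢ {0}) (S3 := {1} ×ˢ univ) (S4 := univ ×ˢ {1})
    (f := f) (g := g) hf.continuousOn (fun x _ => hfe x)
    (pc _ ((convex_singleton _).prod convex_univ)) (pc _ (convex_univ.prod (convex_singleton _)))
    (pc _ ((convex_singleton _).prod convex_univ)) (pc _ (convex_univ.prod (convex_singleton _)))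
    ?_ ?_ ?_ ?_ ⟨(0,0), by simp⟩ ⟨(1,0), by simp⟩ ⟨(1,1), by simp⟩ ⟨(0,1), by simp⟩
  · rintro ⟨s, t⟩ ⟨hs, -⟩
    simp only [Set.mem_singleton_iff] at hs
    subst hs
    simp only [g, Complex.sub_re, toC_re, Path.extend_zero]
    linarith [h0 _ (hβ' t)]
  · rintro ⟨s, t⟩ ⟨-, hs⟩
    simp only [Set.mem_singleton_iff] at hs
    subst hs
    simp only [g, Complex.sub_im, toC_im, Path.extend_zero]
    linarith [k0 _ (hα' s)]
  · rintro ⟨s, t⟩ ⟨hs, -⟩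
    simp only [Set.mem_singleton_iff] at hs
    subst hs
    simp only [g, Complex.sub_re, toC_re, Path.extend_one]
    linarith [h1 _ (hβ' t)]
  · rintro ⟨s, t⟩ ⟨-, hs⟩
    simp only [Set.mem_singleton_iff] at hs
    subst hs
    simp only [g, Complex.sub_im, toC_im, Path.extend_one]
    linarith [k1 _ (hα' s)]

/-- Four connected pieces surrounding `p` counterclockwise: top, left, bottom, right. -/
lemma not_hasLog_of_circuit {T : Set Plane} {p : Plane} {S1 S2 S3 S4 : Set Plane}
    (t1 : S1 ⊆ T) (t2 : S2 ⊆ T) (t3 : S3 ⊆ T) (t4 : S4 ⊆ T)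
    (h1 : IsPreconnected S1) (h2 : IsPreconnected S2) (h3 : IsPreconnected S3) (h4 : IsPreconnected S4)
    (k1 : ∀ x ∈ S1, p 0 < x 0) (k2 : ∀ x ∈ S2, p 1 < x 1)
    (k3 : ∀ x ∈ S3, x 0 < p 0) (k4 : ∀ x ∈ S4, x 1 < p 1)
    (i12 : (S1 ∩ S2).Nonempty) (i23 : (S2 ∩ S3).Nonempty) (i34 : (S3 ∩ S4).Nonempty)
    (i41 : (S4 ∩ S1).Nonempty) : ¬ HasLog T p := by
  rintro ⟨f, hf, hfe⟩
  have hsub : S1 ∪ S2 ∪ S3 ∪ S4 ⊆ T := by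
    intro x hx
    rcases hx with ((h | h) | h) | h
    exacts [t1 h, t2 h, t3 h, t4 h]
  refine four_sets (f := f) (g := fun z => toC z - toC p) (hf.mono hsub) (fun x hx => hfe x (hsub hx))
    h1 h2 h3 h4 ?_ ?_ ?_ ?_ i12 i23 i34 i41
  · intro x hx; simp only [Complex.sub_re, toC_re]; linarith [k1 x hx]
  · intro x hx; simp only [Complex.sub_im, toC_im]; linarith [k2 x hx]
  · intro x hx; simp only [Complex.sub_re, toC_re]; linarith [k3 x hx]
  · intro x hx; simp only [Complex.sub_im, toC_im]; linarith [k4 x hx]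

@[simp] theorem emb_zero (z : Lat) : emb z 0 = (z.1 : ℝ) := rfl
@[simp] theorem emb_one (z : Lat) : emb z 1 = (z.2 : ℝ) := rfl

lemma traceL_singleton (a : Lat) : traceL [a] = {emb a} := by
  simp [traceL]

lemma traceL_cons (a b : Lat) (l : List Lat) :
    traceL (a :: b :: l) = segment ℝ (emb a) (emb b) ∪ traceL (b :: l) := by
  ext p
  simp only [traceL, List.mem_cons, List.tail_cons, List.zip_cons_cons, Set.mem_union, Set.mem_iUnion,
    Set.mem_singleton_iff, exists_prop]
  constructor
  · rintro (⟨z, (rfl | hz), hp⟩ | ⟨q, (rfl | hq), hp⟩)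
    · left; rw [hp]; exact left_mem_segment _ _ _
    · right; left; exact ⟨z, hz, hp⟩
    · left; exact hp
    · right; right; exact ⟨q, hq, hp⟩
  · rintro (hp | ⟨z, hz, hp⟩ | ⟨q, hq, hp⟩)
    · right; exact ⟨(a, b), Or.inl rfl, hp⟩
    · left; exact ⟨z, Or.inr hz, hp⟩
    · right; exact ⟨q, Or.inr hq, hp⟩

lemma traceL_snoc (l : List Lat) (a b : Lat) :
    traceL (l ++ [a, b]) = traceL (l ++ [a]) ∪ segment ℝ (emb a) (emb b) := by
  induction l with
  | nil =>
    simp only [List.nil_append, traceL_cons, traceL_singleton]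
    rw [Set.union_comm]
    ext p
    simp only [Set.mem_union, Set.mem_singleton_iff]
    constructor
    · rintro (rfl | h)
      · right; exact right_mem_segment _ _ _
      · right; exact h
    · rintro (rfl | h)
      · right; exact left_mem_segment _ _ _
      · right; exact h
  | cons c l ih =>
    cases l with
    | nil =>
      simp only [List.nil_append, List.cons_append, traceL_cons, traceL_singleton] at ih ⊢
      rw [ih, Set.union_assoc]
    | cons d l =>
      simp only [List.cons_append, traceL_cons] at ih ⊢
      rw [ih, Set.union_assoc]

lemma emb_mem_traceL {l : List Lat} {a : Lat} (h : a ∈ l) : emb a ∈ traceL l :=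
  Or.inl (Set.mem_biUnion h rfl)

lemma isCompact_segment (a b : Plane) : IsCompact (segment ℝ a b) := by
  rw [segment_eq_image_lineMap]
  exact isCompact_Icc.image (by fun_prop)

lemma isCompact_traceL (l : List Lat) : IsCompact (traceL l) := by
  refine IsCompact.union ?_ ?_
  · exact (List.finite_toSet l).isCompact_biUnion fun z _ => isCompact_singleton
  · exact (List.finite_toSet (l.zip l.tail)).isCompact_biUnion fun z _ => isCompact_segment _ _

lemma traceL_subset_convex {l : List Lat} {K : Set Plane} (hK : Convex ℝ K) (h : ∀ a ∈ l, emb a ∈ K) :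
    traceL l ⊆ K := by
  rintro p (hp | hp)
  · simp only [Set.mem_iUnion, Set.mem_singleton_iff, exists_prop] at hp
    obtain ⟨z, hz, rfl⟩ := hp
    exact h z hz
  · simp only [Set.mem_iUnion, exists_prop] at hp
    obtain ⟨⟨a, b⟩, hq, hp⟩ := hp
    have := List.of_mem_zip hq
    exact hK.segment_subset (h _ this.1) (h _ (List.mem_of_mem_tail this.2)) hp

lemma traceL_subset_append_right (l l' : List Lat) : traceL l' ⊆ traceL (l ++ l') := by
  induction l with
  | nil => simp
  | cons a l ih =>
    refine ih.trans ?_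
    cases h : l ++ l' with
    | nil =>
      have : l' = [] := by simp at h; exact h.2
      simp [traceL]
    | cons b t =>
      rw [List.cons_append, h, traceL_cons]
      exact Set.subset_union_right

lemma traceL_subset_append_left (l l' : List Lat) : traceL l ⊆ traceL (l ++ l') := by
  induction l with
  | nil => simp [traceL]
  | cons a l ih =>
    cases l with
    | nil =>
      rw [traceL_singleton]
      rintro p rfl
      exact emb_mem_traceL (by simp)
    | cons b t =>
      rw [List.cons_append, List.cons_append, traceL_cons, traceL_cons]
      exact Set.union_subset_union_right _ ih

lemma traceL_infix {l l' : List Lat} (h : l <:+: l') : traceL l ⊆ traceL l' := by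
  obtain ⟨s, t, rfl⟩ := h
  exact (traceL_subset_append_right s l).trans (traceL_subset_append_left _ _)

lemma joinedIn_traceL_head (a : Lat) (l : List Lat) : ∀ b ∈ a :: l, JoinedIn (traceL (a :: l)) (emb a) (emb b) := by
  induction l generalizing a with
  | nil =>
    intro b hb
    simp only [List.mem_singleton] at hb
    subst hb
    exact JoinedIn.refl (emb_mem_traceL (by simp))
  | cons c l ih =>
    intro b hb
    rcases List.mem_cons.1 hb with rfl | hb
    · exact JoinedIn.refl (emb_mem_traceL (by simp))
    · rw [traceL_cons]
      have h1 : JoinedIn (segment ℝ (emb a) (emb c)) (emb a) (emb c) :=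
        JoinedIn.of_segment_subset subset_rfl
      exact (h1.mono Set.subset_union_left).trans ((ih c b hb).mono Set.subset_union_right)

lemma joinedIn_traceL {l : List Lat} {a b : Lat} (ha : a ∈ l) (hb : b ∈ l) :
    JoinedIn (traceL l) (emb a) (emb b) := by
  cases l with
  | nil => simp at ha
  | cons c l => exact (joinedIn_traceL_head c l a ha).symm.trans (joinedIn_traceL_head c l b hb)

lemma isPreconnected_traceL (l : List Lat) : IsPreconnected (traceL l) := by
  induction l with
  | nil => simp [traceL, isPreconnected_empty]
  | cons a l ih =>
    cases l with
    | nil => rw [traceL_singleton]; exact isPreconnected_singleton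
    | cons b l =>
      rw [traceL_cons]
      exact IsPreconnected.union (emb b) (right_mem_segment _ _ _) (emb_mem_traceL (by simp))
        (convex_segment _ _).isPreconnected ih

/-- closed trace of a cyclic word -/
def ctrace (w : List Lat) : Set Plane := traceL (w ++ w.take 1)

lemma ctrace_rotate_one (w : List Lat) : ctrace (w.rotate 1) = ctrace w := by
  cases w with
  | nil => rfl
  | cons a t =>
    cases t with
    | nil => simp
    | cons b t =>
      have h1 : ctrace ((a :: b :: t).rotate 1) = traceL ((b :: t) ++ [a, b]) := by
        simp [ctrace]
      have h2 : ctrace (a :: b :: t) = traceL (a :: b :: (t ++ [a])) := by simp [ctrace]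
      rw [h1, h2, traceL_cons, traceL_snoc, Set.union_comm]
      rfl

lemma ctrace_rotate (w : List Lat) (k : ℕ) : ctrace (w.rotate k) = ctrace w := by
  induction k with
  | zero => simp
  | succ k ih => rw [← List.rotate_rotate, ctrace_rotate_one, ih]

lemma trace_eq_ctrace (γ : ULoop) : γ.trace = ctrace γ.out.word := rfl

lemma isCompact_trace (γ : ULoop) : IsCompact γ.trace := isCompact_traceL _

lemma fill_component {T : Set Plane} {p q : Plane} {C : Set Plane} (hC : C ⊆ (closure T)ᶜ)
    (hc : IsPreconnected C) (hp : p ∈ C) (hq : q ∈ C) (h : p ∈ Fill T) : q ∈ Fill T := by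
  intro C' hC' hc' hq'
  have := h (C ∪ C') (Set.union_subset hC hC') ⟨⟨p, Or.inl hp⟩, hc.union q hq hq' hc'.isPreconnected⟩ (Or.inl hp)
  exact this.subset Set.subset_union_right

lemma frontier_fill_subset {T : Set Plane} (hT : IsClosed T) : frontier (Fill T) ⊆ T := by
  intro p hp
  by_contra hpT
  obtain ⟨d, hd, hb⟩ := Metric.isOpen_iff.1 hT.isOpen_compl p hpT
  have hb' : Metric.ball p d ⊆ (closure T)ᶜ := by rwa [hT.closure_eq]
  have hc : IsPreconnected (Metric.ball p d) := (convex_ball p d).isPreconnected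
  rw [frontier_eq_closure_inter_closure] at hp
  obtain ⟨x, hx, hxF⟩ := mem_closure_iff.1 hp.1 _ Metric.isOpen_ball (Metric.mem_ball_self hd)
  obtain ⟨y, hy, hyF⟩ := mem_closure_iff.1 hp.2 _ Metric.isOpen_ball (Metric.mem_ball_self hd)
  exact hyF (fill_component hb' hc hx hy hxF)

lemma loopFrontier_subset (γ : ULoop) : loopFrontier γ ⊆ γ.trace :=
  frontier_fill_subset (isCompact_trace γ).isClosed

lemma isCompact_loopFrontier (γ : ULoop) : IsCompact (loopFrontier γ) :=
  (isCompact_trace γ).of_isClosed_subset isClosed_frontier (loopFrontier_subset γ)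

/-- If every point `q` within `ε` of `p` has no log on `T`, then `p` is not on the frontier. -/
lemma notMem_frontier_of_noLog {T : Set Plane} (hT : IsCompact T) {p : Plane} {ε : ℝ} (hε : 0 < ε)
    (h : ∀ q, dist q p < ε → ¬ HasLog T q) : p ∉ frontier (Fill T) := by
  intro hp
  rw [frontier_eq_closure_inter_closure] at hp
  obtain ⟨y, hy, hyF⟩ := mem_closure_iff.1 hp.2 _ Metric.isOpen_ball (Metric.mem_ball_self hε)
  exact h y hy (hasLog_of_notMem_fill hT hyF)

lemma adj_cases {a b : Lat} (h : Adj a b) :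
    (b.1 = a.1 + 1 ∧ b.2 = a.2) ∨ (a.1 = b.1 + 1 ∧ b.2 = a.2) ∨ (b.1 = a.1 ∧ b.2 = a.2 + 1) ∨
      (b.1 = a.1 ∧ a.2 = b.2 + 1) := by
  unfold Adj at h
  have h1 : |a.1 - b.1| ≤ 1 := by
    rw [← sq_le_one_iff_abs_le_one]; nlinarith [sq_nonneg (a.2 - b.2)]
  have h2 : |a.2 - b.2| ≤ 1 := by
    rw [← sq_le_one_iff_abs_le_one]; nlinarith [sq_nonneg (a.1 - b.1)]
  rw [abs_le] at h1 h2
  obtain ⟨x, hx⟩ : ∃ x, x = a.1 - b.1 := ⟨_, rfl⟩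
  obtain ⟨y, hy⟩ : ∃ y, y = a.2 - b.2 := ⟨_, rfl⟩
  rw [← hx, ← hy] at h
  rw [← hx] at h1
  rw [← hy] at h2
  have : x = -1 ∨ x = 0 ∨ x = 1 := by omega
  have : y = -1 ∨ y = 0 ∨ y = 1 := by omega
  rcases ‹x = -1 ∨ _› with rfl | rfl | rfl <;> rcases ‹y = -1 ∨ _› with rfl | rfl | rfl <;> simp at h <;> omega

/-- Unoriented description of points on an edge. -/
lemma edge_pt {a b : Lat} (h : Adj a b) {p : Plane} (hp : p ∈ segment ℝ (emb a) (emb b)) :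
    ∃ m : Lat,
      ((m = a ∧ (m.1 + 1, m.2) = b ∨ m = b ∧ (m.1 + 1, m.2) = a) ∧ p 1 = m.2 ∧ (m.1 : ℝ) ≤ p 0 ∧ p 0 ≤ m.1 + 1) ∨
      ((m = a ∧ (m.1, m.2 + 1) = b ∨ m = b ∧ (m.1, m.2 + 1) = a) ∧ p 0 = m.1 ∧ (m.2 : ℝ) ≤ p 1 ∧ p 1 ≤ m.2 + 1) := by
  rw [segment_eq_image_lineMap] at hp
  obtain ⟨t, ⟨ht0, ht1⟩, rfl⟩ := hp
  obtain ⟨a1, a2⟩ := a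
  obtain ⟨b1, b2⟩ := b
  rcases adj_cases h with h | h | h | h <;> simp only at h <;> obtain ⟨h1, h2⟩ := h
  · refine ⟨(a1, a2), Or.inl ⟨Or.inl ⟨rfl, by simp [h1, h2]⟩, ?_, ?_, ?_⟩⟩ <;>
      simp [AffineMap.lineMap_apply, h1, h2] <;> nlinarith
  · refine ⟨(b1, b2), Or.inl ⟨Or.inr ⟨rfl, by simp [h1, h2]⟩, ?_, ?_, ?_⟩⟩ <;>
      simp [AffineMap.lineMap_apply, h1, h2] <;> nlinarith
  · refine ⟨(a1, a2), Or.inr ⟨Or.inl ⟨rfl, by simp [h1, h2]⟩, ?_, ?_, ?_⟩⟩ <;>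
      simp [AffineMap.lineMap_apply, h1, h2] <;> nlinarith
  · refine ⟨(b1, b2), Or.inr ⟨Or.inr ⟨rfl, by simp [h1, h2]⟩, ?_, ?_, ?_⟩⟩ <;>
      simp [AffineMap.lineMap_apply, h1, h2] <;> nlinarith

lemma edges_share {a b c d : Lat} (h : Adj a b) (h' : Adj c d) {p : Plane}
    (hp : p ∈ segment ℝ (emb a) (emb b)) (hp' : p ∈ segment ℝ (emb c) (emb d)) :
    ∃ v, (v = a ∨ v = b) ∧ (v = c ∨ v = d) := by
  obtain ⟨⟨m1, m2⟩, hm⟩ := edge_pt h hp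
  obtain ⟨⟨n1, n2⟩, hn⟩ := edge_pt h' hp'
  simp only at hm hn
  rcases hm with ⟨hm, e1, e2, e3⟩ | ⟨hm, e1, e2, e3⟩ <;> rcases hn with ⟨hn, f1, f2, f3⟩ | ⟨hn, f1, f2, f3⟩
  · have g1 : m2 = n2 := by exact_mod_cast e1.symm.trans f1
    have g2 : m1 ≤ n1 + 1 := by exact_mod_cast e2.trans f3
    have g3 : n1 ≤ m1 + 1 := by exact_mod_cast f2.trans e3
    subst g1
    have : m1 = n1 ∨ m1 = n1 + 1 ∨ n1 = m1 + 1 := by omega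
    rcases this with rfl | rfl | rfl
    · exact ⟨(m1, m2), by rcases hm with hm | hm <;> simp [hm], by rcases hn with hn | hn <;> simp [hn]⟩
    · exact ⟨(n1 + 1, m2), by rcases hm with hm | hm <;> simp [hm], by rcases hn with hn | hn <;> simp [hn]⟩
    · exact ⟨(m1 + 1, m2), by rcases hm with hm | hm <;> simp [hm], by rcases hn with hn | hn <;> simp [hn]⟩
  · rw [f1] at e2 e3
    rw [e1] at f2 f3
    norm_cast at e2 e3 f2 f3
    refine ⟨(n1, m2), ?_, ?_⟩
    · have : n1 = m1 ∨ n1 = m1 + 1 := by omega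
      rcases this with rfl | rfl <;> rcases hm with hm | hm <;> simp [hm]
    · have : m2 = n2 ∨ m2 = n2 + 1 := by omega
      rcases this with rfl | rfl <;> rcases hn with hn | hn <;> simp [hn]
  · rw [f1] at e2 e3
    rw [e1] at f2 f3
    norm_cast at e2 e3 f2 f3
    refine ⟨(m1, n2), ?_, ?_⟩
    · have : n2 = m2 ∨ n2 = m2 + 1 := by omega
      rcases this with rfl | rfl <;> rcases hm with hm | hm <;> simp [hm]
    · have : m1 = n1 ∨ m1 = n1 + 1 := by omega
      rcases this with rfl | rfl <;> rcases hn with hn | hn <;> simp [hn]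
  · have g1 : m1 = n1 := by exact_mod_cast e1.symm.trans f1
    have g2 : m2 ≤ n2 + 1 := by exact_mod_cast e2.trans f3
    have g3 : n2 ≤ m2 + 1 := by exact_mod_cast f2.trans e3
    subst g1
    have : m2 = n2 ∨ m2 = n2 + 1 ∨ n2 = m2 + 1 := by omega
    rcases this with rfl | rfl | rfl
    · exact ⟨(m1, m2), by rcases hm with hm | hm <;> simp [hm], by rcases hn with hn | hn <;> simp [hn]⟩
    · exact ⟨(m1, n2 + 1), by rcases hm with hm | hm <;> simp [hm], by rcases hn with hn | hn <;> simp [hn]⟩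
    · exact ⟨(m1, m2 + 1), by rcases hm with hm | hm <;> simp [hm], by rcases hn with hn | hn <;> simp [hn]⟩

lemma mem_box_iff {z w : Lat} {R : ℤ} : w ∈ box z R ↔ |w.1 - z.1| ≤ R ∧ |w.2 - z.2| ≤ R := by
  simp [box, linf]

lemma emb_mem_boxP {z w : Lat} {R : ℤ} : emb w ∈ boxP z R ↔ w ∈ box z R := by
  rw [mem_box_iff]
  simp only [boxP, Set.mem_setOf_eq, emb_zero, emb_one]
  norm_cast

lemma edge_box {a b z : Lat} {R : ℤ} (hR : 0 ≤ R) (h : Adj a b) {p : Plane}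
    (hp : p ∈ segment ℝ (emb a) (emb b)) (hb : p ∈ boxP z R) : a ∈ box z R ∨ b ∈ box z R := by
  obtain ⟨⟨m1, m2⟩, hm⟩ := edge_pt h hp
  obtain ⟨z1, z2⟩ := z
  obtain ⟨hb0, hb1⟩ := hb
  rw [abs_le] at hb0 hb1
  simp only at hm hb0 hb1
  rcases hm with ⟨hm, e1, e2, e3⟩ | ⟨hm, e1, e2, e3⟩
  · rw [e1] at hb1
    have g1 : -R ≤ m2 - z2 := by exact_mod_cast hb1.1
    have g2 : m2 - z2 ≤ R := by exact_mod_cast hb1.2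
    have g3 : z1 - R ≤ m1 + 1 := by
      have : (z1 : ℝ) - R ≤ m1 + 1 := by linarith
      exact_mod_cast this
    have g4 : m1 ≤ z1 + R := by
      have : (m1 : ℝ) ≤ z1 + R := by linarith
      exact_mod_cast this
    rcases hm with ⟨rfl, rfl⟩ | ⟨rfl, rfl⟩ <;> simp only [mem_box_iff, abs_le] <;> omega
  · rw [e1] at hb0
    have g1 : -R ≤ m1 - z1 := by exact_mod_cast hb0.1
    have g2 : m1 - z1 ≤ R := by exact_mod_cast hb0.2
    have g3 : z2 - R ≤ m2 + 1 := by
      have : (z2 : ℝ) - R ≤ m2 + 1 := by linarith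
      exact_mod_cast this
    have g4 : m2 ≤ z2 + R := by
      have : (m2 : ℝ) ≤ z2 + R := by linarith
      exact_mod_cast this
    rcases hm with ⟨rfl, rfl⟩ | ⟨rfl, rfl⟩ <;> simp only [mem_box_iff, abs_le] <;> omega

lemma convex_boxP (z : Lat) (R : ℤ) : Convex ℝ (boxP z R) := by
  have : boxP z R = {p : Plane | (z.1 : ℝ) - R ≤ p 0} ∩ {p : Plane | p 0 ≤ z.1 + R} ∩
    ({p : Plane | (z.2 : ℝ) - R ≤ p 1} ∩ {p : Plane | p 1 ≤ z.2 + R}) := by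
    ext p
    simp only [boxP, abs_le, Set.mem_setOf_eq, Set.mem_inter_iff]
    constructor
    · rintro ⟨⟨h1, h2⟩, h3, h4⟩
      refine ⟨⟨?_, ?_⟩, ?_, ?_⟩ <;> linarith
    · rintro ⟨⟨h1, h2⟩, h3, h4⟩
      refine ⟨⟨?_, ?_⟩, ?_, ?_⟩ <;> linarith
  rw [this]
  have l0 : IsLinearMap ℝ fun p : Plane => p 0 := ⟨fun _ _ => rfl, fun _ _ => rfl⟩
  have l1 : IsLinearMap ℝ fun p : Plane => p 1 := ⟨fun _ _ => rfl, fun _ _ => rfl⟩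
  exact ((convex_halfSpace_ge l0 _).inter (convex_halfSpace_le l0 _)).inter
    ((convex_halfSpace_ge l1 _).inter (convex_halfSpace_le l1 _))

/-- Points of the trace of a loop lie on edges joining vertices of the loop. -/
lemma mem_trace_edge {γ : ULoop} {p : Plane} (hp : p ∈ γ.trace) :
    ∃ a b, a ∈ γ.verts ∧ b ∈ γ.verts ∧ Adj a b ∧ p ∈ segment ℝ (emb a) (emb b) := by
  have hadj := γ.out.adj
  have hne := γ.out.ne
  have hmem : ∀ x ∈ γ.out.word ++ γ.out.word.take 1, x ∈ γ.verts := by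
    intro x hx
    rcases List.mem_append.1 hx with h | h
    · exact h
    · exact List.mem_of_mem_take h
  rw [trace_eq_ctrace, ctrace] at hp
  obtain ⟨l, hl⟩ : ∃ l, l = γ.out.word ++ γ.out.word.take 1 := ⟨_, rfl⟩
  have hlen : 2 ≤ l.length := by
    cases h : γ.out.word with
    | nil => exact absurd h hne
    | cons a t => simp [hl, h]
  rw [← hl] at hp hadj hmem
  clear hl hne
  induction l with
  | nil => simp at hlen
  | cons a t ih =>
    cases t with
    | nil => simp at hlen
    | cons b t =>
      rw [traceL_cons] at hp
      have hab : Adj a b := (List.isChain_cons_cons.1 hadj).1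
      rcases hp with hp | hp
      · exact ⟨a, b, hmem _ (by simp), hmem _ (by simp), hab, hp⟩
      · cases t with
        | nil =>
          rw [traceL_singleton] at hp
          rw [Set.mem_singleton_iff] at hp
          exact ⟨a, b, hmem _ (by simp), hmem _ (by simp), hab, hp ▸ right_mem_segment _ _ _⟩
        | cons c t =>
          exact ih (fun x hx => hmem x (List.mem_cons_of_mem _ hx)) (List.isChain_cons_cons.1 hadj).2 hp (by simp)

lemma touches_of_trace {γ γ' : ULoop} (h : (γ.trace ∩ γ'.trace).Nonempty) : Touches γ γ' := by
  obtain ⟨p, h1, h2⟩ := h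
  obtain ⟨a, b, ha, hb, hab, hp⟩ := mem_trace_edge h1
  obtain ⟨c, d, hc, hd, hcd, hp'⟩ := mem_trace_edge h2
  obtain ⟨v, hv, hv'⟩ := edges_share hab hcd hp hp'
  exact ⟨v, by rcases hv with rfl | rfl <;> assumption, by rcases hv' with rfl | rfl <;> assumption⟩

lemma verts_box_of_trace {γ : ULoop} {z : Lat} {R : ℤ} (hR : 0 ≤ R) {p : Plane} (hp : p ∈ γ.trace)
    (hb : p ∈ boxP z R) : ∃ v ∈ γ.verts, v ∈ box z R := by
  obtain ⟨a, b, ha, hb', hab, hp⟩ := mem_trace_edge hp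
  rcases edge_box hR hab hp hb with h | h
  exacts [⟨a, ha, h⟩, ⟨b, hb', h⟩]

lemma trace_subset_boxP {γ : ULoop} {z : Lat} {R : ℤ} (h : γ.verts ⊆ box z R) : γ.trace ⊆ boxP z R := by
  refine traceL_subset_convex (convex_boxP z R) ?_
  intro a ha
  rw [emb_mem_boxP]
  apply h
  rcases List.mem_append.1 ha with h | h
  · exact h
  · exact List.mem_of_mem_take h

lemma finite_box (z : Lat) (R : ℤ) : (box z R).Finite := by
  refine Set.Finite.subset ((Set.finite_Icc (z.1 - R) (z.1 + R)).prod (Set.finite_Icc (z.2 - R) (z.2 + R))) ?_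
  intro w hw
  rw [mem_box_iff, abs_le, abs_le] at hw
  simp only [Set.mem_prod, Set.mem_Icc]
  omega

/-- finitely many traces in a finite box -/
lemma finite_traces {A : Set Lat} (hA : A.Finite) : (ULoop.trace '' {γ | γ.verts ⊆ A}).Finite := by
  let F : Set (Lat × Lat) × Set Lat → Set Plane := fun q => (⋃ z ∈ q.2, {emb z}) ∪ ⋃ p ∈ q.1, segment ℝ (emb p.1) (emb p.2)
  refine Set.Finite.subset (((hA.prod hA).finite_subsets.prod hA.finite_subsets).image F) ?_
  rintro _ ⟨γ, hγ, rfl⟩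
  have hγ' : ∀ x ∈ γ.out.word ++ γ.out.word.take 1, x ∈ A := by
    intro x hx
    rcases List.mem_append.1 hx with h | h
    · exact hγ h
    · exact hγ (List.mem_of_mem_take h)
  refine ⟨({p | p ∈ (γ.out.word ++ γ.out.word.take 1).zip (γ.out.word ++ γ.out.word.take 1).tail}, {x | x ∈ γ.out.word ++ γ.out.word.take 1}), ⟨?_, ?_⟩, ?_⟩
  · rintro ⟨a, b⟩ hab
    have := List.of_mem_zip hab
    exact ⟨hγ' _ this.1, hγ' _ (List.mem_of_mem_tail this.2)⟩
  · exact hγ'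
  · rfl

/-- Good event around a box. -/
def Good (ω : Config) (z : Lat) (n N : ℤ) : Prop :=
  (∀ S S', S ∈ frontiers ω.loops → linkedS (frontiers ω.loops) S S' →
    (S ∩ embS (box z n)).Nonempty → S' ⊆ boxP z N) ∧
  ∀ γ ∈ ω.loops, (loopFrontier γ ∩ boxP z (N + 1)).Nonempty → γ.verts ⊆ box z (2 * (N + 1))

lemma linkedS_symm {F : Set (Set Plane)} {a b : Set Plane} (h : linkedS F a b) : linkedS F b a := by
  unfold linkedS at *
  induction h with
  | refl => exact Relation.ReflTransGen.refl
  | tail _ hbc ih =>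
    refine Relation.ReflTransGen.head ⟨hbc.2.1, hbc.1, ?_⟩ ih
    rw [inter_comm]; exact hbc.2.2

lemma linkedS_mem {F : Set (Set Plane)} {a b : Set Plane} (h : linkedS F a b) (ha : a ∈ F) : b ∈ F := by
  induction h with
  | refl => exact ha
  | tail _ hbc _ => exact hbc.2.1

lemma linkedS_step {F : Set (Set Plane)} {a b : Set Plane} (ha : a ∈ F) (hb : b ∈ F) {q : Plane}
    (h : q ∈ a) (h' : q ∈ b) : linkedS F a b := Relation.ReflTransGen.single ⟨ha, hb, q, h, h'⟩

lemma mem_LamS {X : Set Plane} {F : Set (Set Plane)} {y : Plane} :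
    y ∈ LamS X F ↔ y ∈ X ∨ ∃ S S', S ∈ F ∧ linkedS F S S' ∧ (S ∩ X).Nonempty ∧ y ∈ S' := by
  unfold LamS clustersS
  simp only [mem_union, mem_iUnion, mem_ofPred_eq, exists_prop]
  constructor
  · rintro (h | ⟨C, ⟨⟨S, hS, rfl⟩, ⟨q, hq, hqX⟩⟩, hy⟩)
    · exact Or.inl h
    · simp only [mem_iUnion, exists_prop] at hq hy
      obtain ⟨S1, ⟨h1, l1⟩, hq⟩ := hq
      obtain ⟨S2, ⟨h2, l2⟩, hy⟩ := hy
      exact Or.inr ⟨S1, S2, h1, (linkedS_symm l1).trans l2, ⟨q, hq, hqX⟩, hy⟩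
  · rintro (h | ⟨S, S', hS, hl, ⟨q, hq, hqX⟩, hy⟩)
    · exact Or.inl h
    · refine Or.inr ⟨_, ⟨⟨S, hS, rfl⟩, ⟨q, ?_, hqX⟩⟩, ?_⟩
      · simp only [mem_iUnion, exists_prop]
        exact ⟨S, ⟨hS, Relation.ReflTransGen.refl⟩, hq⟩
      · simp only [mem_iUnion, exists_prop]
        exact ⟨S', ⟨linkedS_mem hl hS, hl⟩, hy⟩

lemma LamS_mono {X Y : Set Plane} {F : Set (Set Plane)} (h : X ⊆ Y) : LamS X F ⊆ LamS Y F := by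
  intro y hy
  rw [mem_LamS] at *
  rcases hy with hy | ⟨S, S', a, b, c, d⟩
  exacts [Or.inl (h hy), Or.inr ⟨S, S', a, b, c.mono (inter_subset_inter_right _ h), d⟩]

lemma LamS_mono_right {X : Set Plane} {F F' : Set (Set Plane)} (h : F ⊆ F') : LamS X F ⊆ LamS X F' := by
  intro y hy
  rw [mem_LamS] at *
  rcases hy with hy | ⟨S, S', a, b, c, d⟩
  · exact Or.inl hy
  · refine Or.inr ⟨S, S', h a, ?_, c, d⟩
    unfold linkedS at b ⊢
    refine Relation.ReflTransGen.mono ?_ _ _ b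
    exact fun x y hxy => ⟨h hxy.1, h hxy.2.1, hxy.2.2⟩

lemma LamS_absorb {X : Set Plane} {F : Set (Set Plane)} {p : Plane}
    (h : (LamS {p} F ∩ LamS X F).Nonempty) : LamS {p} F ⊆ LamS X F := by
  have hp : p ∈ LamS X F := by
    obtain ⟨q, h1, h2⟩ := h
    rw [mem_LamS] at h1 h2
    rcases h1 with h1 | ⟨S, S', hS, hl, ⟨p', hp, rfl⟩, hq⟩
    · rw [mem_singleton_iff] at h1; subst h1
      exact mem_LamS.2 h2
    · have hS' := linkedS_mem hl hS
      rw [mem_LamS]; right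
      rcases h2 with h2 | ⟨S1, S1', h1, l1, hx, hq1⟩
      · exact ⟨S', S, hS', linkedS_symm hl, ⟨q, hq, h2⟩, hp⟩
      · exact ⟨S1, S, h1, (l1.trans (linkedS_step (linkedS_mem l1 h1) hS' hq1 hq)).trans (linkedS_symm hl), hx, hp⟩
  intro y hy
  rw [mem_LamS] at hy
  rcases hy with hy | ⟨S, S', hS, hl, ⟨p', hpS, rfl⟩, hy⟩
  · rw [mem_singleton_iff] at hy; rwa [hy]
  · rw [mem_LamS] at hp ⊢
    right
    rcases hp with hp | ⟨S1, S1', h1, l1, hx, hq1⟩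
    · exact ⟨S, S', hS, hl, ⟨_, hpS, hp⟩, hy⟩
    · exact ⟨S1, S', h1, (l1.trans (linkedS_step (linkedS_mem l1 h1) hS hq1 hpS)).trans hl, hx, hy⟩

lemma LamS_union_points {X : Set Plane} {B : Set Plane} {F : Set (Set Plane)} :
    LamS (X ∪ B) F ⊆ LamS X F ∪ ⋃ p ∈ B, LamS {p} F := by
  intro y hy
  rw [mem_LamS] at hy
  simp only [mem_union, mem_iUnion, exists_prop]
  rcases hy with (hy | hy) | ⟨S, S', hS, hl, ⟨p, hpS, hp | hp⟩, hy⟩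
  · exact Or.inl (mem_LamS.2 (Or.inl hy))
  · exact Or.inr ⟨y, hy, mem_LamS.2 (Or.inl rfl)⟩
  · exact Or.inl (mem_LamS.2 (Or.inr ⟨S, S', hS, hl, ⟨p, hpS, hp⟩, hy⟩))
  · exact Or.inr ⟨p, hp, mem_LamS.2 (Or.inr ⟨S, S', hS, hl, ⟨p, hpS, rfl⟩, hy⟩)⟩

lemma hasLog_boxP {z : Lat} {N r : ℤ} (hd : Disjoint (boxP z N) (boxP 0 r)) {u : Plane} (hu : u ∈ boxP 0 r) :
    HasLog (boxP z N) u := by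
  by_cases hN : 0 ≤ N
  swap
  · refine hasLog_of_slit 1 one_ne_zero ?_
    rintro p ⟨hp, _⟩
    exfalso
    have h1 : (N:ℝ) < 0 := by exact_mod_cast not_le.1 hN
    linarith [abs_nonneg (p 0 - (z.1:ℝ))]
  have hr : 0 ≤ (r:ℝ) := (abs_nonneg _).trans hu.1
  have hr' : 0 ≤ r := by exact_mod_cast hr
  obtain ⟨u0, u1⟩ := hu
  simp only [Prod.fst_zero, Prod.snd_zero, Int.cast_zero, sub_zero, abs_le] at u0 u1
  have key : z.1 - N > r ∨ z.1 + N < - r ∨ z.2 - N > r ∨ z.2 + N < -r := by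
    by_contra hcon
    push Not at hcon
    obtain ⟨c1, c2, c3, c4⟩ := hcon
    refine (Set.disjoint_left.1 hd : ∀ ⦃a⦄, _ → _) (a := emb (max (-r) (z.1 - N), max (-r) (z.2-N))) ?_ ?_ <;>
    rw [emb_mem_boxP, mem_box_iff, abs_le, abs_le] <;> simp <;> omega
  rcases key with h | h | h | h
  · have h' : (z.1:ℝ) - N > r := by exact_mod_cast h
    refine hasLog_of_slit 1 one_ne_zero fun p hp => Or.inl ?_
    have := abs_le.1 hp.1
    simp [toC_re]; linarith
  · have h' : (z.1:ℝ) + N < -r := by exact_mod_cast h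
    refine hasLog_of_slit (-1) (by simp) fun p hp => Or.inl ?_
    have := abs_le.1 hp.1
    simp [toC_re]; linarith
  · have h' : (z.2:ℝ) - N > r := by exact_mod_cast h
    refine hasLog_of_slit (-Complex.I) (by simp) fun p hp => Or.inl ?_
    have := abs_le.1 hp.2
    simp [toC_im]; linarith
  · have h' : (z.2:ℝ) + N < -r := by exact_mod_cast h
    refine hasLog_of_slit (Complex.I) (by simp) fun p hp => Or.inl ?_
    have := abs_le.1 hp.2
    simp [toC_im]; linarith

lemma finite_F {Lr : Set ULoop} {r : ℤ} (hLr : ∀ γ ∈ Lr, ULoop.verts γ ⊆ box 0 r) {ω : Config} {z : Lat}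
    {n N : ℤ} (hg : Good ω z n N) :
    {S | S ∈ traces Lr ∪ outerFrontiers r ω ∧ (S ∩ boxP z (N + 1)).Nonempty}.Finite := by
  refine Set.Finite.subset ((finite_traces (finite_box 0 r)).union
    (((finite_traces (finite_box z (2 * (N + 1))))).image fun T => frontier (Fill T))) ?_
  rintro S ⟨hS | hS, hne⟩
  · left
    obtain ⟨γ, hγ, rfl⟩ := hS
    exact ⟨γ, hLr γ hγ, rfl⟩
  · right
    obtain ⟨γ, hγ, rfl⟩ := hS
    exact ⟨γ.trace, ⟨γ, hg.2 γ hγ.1 hne, rfl⟩, rfl⟩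

lemma compact_F {Lr : Set ULoop} {r : ℤ} {ω : Config} {S : Set Plane} (hS : S ∈ traces Lr ∪ outerFrontiers r ω) :
    IsCompact S := by
  rcases hS with ⟨γ, _, rfl⟩ | ⟨γ, _, rfl⟩
  exacts [isCompact_trace γ, isCompact_loopFrontier γ]

lemma boxP_mono (z : Lat) {N N' : ℤ} (h : N ≤ N') : boxP z N ⊆ boxP z N' := by
  intro p hp
  have : (N:ℝ) ≤ N' := by exact_mod_cast h
  exact ⟨hp.1.trans this, hp.2.trans this⟩

lemma closure_LamS_local {Lr : Set ULoop} {r : ℤ} (hLr : ∀ γ ∈ Lr, ULoop.verts γ ⊆ box 0 r) {ω : Config} {z : Lat}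
    {n N : ℤ} (hg : Good ω z n N) {X : Set Plane} (hX : IsClosed X) {y : Plane} (hy : y ∈ boxP z N)
    (hc : y ∈ closure (LamS X (traces Lr ∪ outerFrontiers r ω))) : y ∈ LamS X (traces Lr ∪ outerFrontiers r ω) := by
  set F := traces Lr ∪ outerFrontiers r ω with hF
  set Fin := {S | (S ∈ F ∧ (S ∩ boxP z (N + 1)).Nonempty) ∧ S ⊆ LamS X F} with hFin
  have hfin : Fin.Finite := (finite_F hLr hg).subset fun S hS => hS.1
  have hYc : IsClosed (X ∪ ⋃ S ∈ Fin, S) := by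
    refine hX.union (hfin.isClosed_biUnion fun S hS => (compact_F hS.1.1).isClosed)
  have hYs : X ∪ ⋃ S ∈ Fin, S ⊆ LamS X F := by
    refine union_subset (fun x hx => mem_LamS.2 (Or.inl hx)) (iUnion₂_subset fun S hS => hS.2)
  apply hYs
  rw [← hYc.closure_eq]
  rw [Metric.mem_closure_iff] at hc ⊢
  intro ε hε
  obtain ⟨b, hb, hd⟩ := hc (min ε 1) (lt_min hε one_pos)
  refine ⟨b, ?_, hd.trans_le (min_le_left _ _)⟩
  have hd1 : dist y b < 1 := hd.trans_le (min_le_right _ _)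
  have hcoord : ∀ i, |y i - b i| ≤ 1 := by
    intro i
    have := PiLp.norm_apply_le (y - b) i
    rw [← dist_eq_norm] at this
    have h2 : ‖(y - b) i‖ = |y i - b i| := rfl
    rw [h2] at this
    linarith
  have hbb : b ∈ boxP z (N + 1) := by
    have h0 := abs_le.1 (hcoord 0)
    have h1 := abs_le.1 (hcoord 1)
    have h2 := abs_le.1 hy.1
    have h3 := abs_le.1 hy.2
    constructor <;> rw [abs_le] <;> push_cast <;> constructor <;> linarith
  rcases mem_LamS.1 hb with h | ⟨S, S', hS, hl, hne, hbS⟩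
  · exact Or.inl h
  · refine Or.inr (mem_biUnion (x := S') ⟨⟨linkedS_mem hl hS, b, hbS, hbb⟩, ?_⟩ hbS)
    intro x hx
    exact mem_LamS.2 (Or.inr ⟨S, S', hS, hl, hne, hx⟩)

lemma LamS_point {Lr : Set ULoop} {r : ℤ} (hLr : ∀ γ ∈ Lr, ULoop.verts γ ⊆ box 0 r) {ω : Config} {z v : Lat}
    {n N : ℤ} (hnN : n ≤ N) (hg : Good ω z n N) (hd : Disjoint (boxP z N) (boxP 0 r)) (hv : v ∈ box z n) :
    LamS {emb v} (traces Lr ∪ outerFrontiers r ω) ⊆ boxP z N ∧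
      IsCompact (LamS {emb v} (traces Lr ∪ outerFrontiers r ω)) := by
  set F := traces Lr ∪ outerFrontiers r ω with hF
  have hvN : emb v ∈ boxP z N := boxP_mono z hnN (emb_mem_boxP.2 hv)
  have hout : outerFrontiers r ω ⊆ frontiers ω.loops := by
    rintro _ ⟨γ, hγ, rfl⟩; exact ⟨γ, hγ.1, rfl⟩
  have hLrS : ∀ S ∈ traces Lr, ∀ q ∈ S, q ∉ boxP z N := by
    rintro _ ⟨γ, hγ, rfl⟩ q hq hq'
    exact Set.disjoint_left.1 hd hq' (trace_subset_boxP (hLr γ hγ) hq)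
  have key : ∀ S S', S ∈ F → linkedS F S S' → emb v ∈ S →
      S ∈ outerFrontiers r ω ∧ linkedS (frontiers ω.loops) S S' ∧ S' ⊆ boxP z N := by
    intro S S' hS hl hvS
    have hSo : S ∈ outerFrontiers r ω := by
      rcases hS with h | h
      · exact absurd hvN (hLrS S h _ hvS)
      · exact h
    have hne : (S ∩ embS (box z n)).Nonempty := ⟨emb v, hvS, v, hv, rfl⟩
    refine ⟨hSo, ?_⟩
    induction hl with
    | refl => exact ⟨Relation.ReflTransGen.refl, hg.1 S S (hout hSo) Relation.ReflTransGen.refl hne⟩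
    | @tail b c _ hbc ih =>
      obtain ⟨q, hqb, hqc⟩ := hbc.2.2
      have hc : c ∈ outerFrontiers r ω := by
        rcases hbc.2.1 with h | h
        · exact absurd (ih.2 hqb) (hLrS c h _ hqc)
        · exact h
      have hb : b ∈ frontiers ω.loops := linkedS_mem ih.1 (hout hSo)
      have hl2 := ih.1.trans (linkedS_step hb (hout hc) hqb hqc)
      exact ⟨hl2, hg.1 S c (hout hSo) hl2 hne⟩
  have hsub : LamS {emb v} F ⊆ boxP z N := by
    intro y hy
    rcases mem_LamS.1 hy with h | ⟨S, S', hS, hl, ⟨_, hp, rfl⟩, hy⟩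
    · rw [mem_singleton_iff.1 h]; exact hvN
    · exact (key S S' hS hl hp).2.2 hy
  refine ⟨hsub, ?_⟩
  set Fin := {S | (S ∈ F ∧ (S ∩ boxP z (N + 1)).Nonempty) ∧ S ⊆ LamS {emb v} F} with hFin
  have hfin : Fin.Finite := (finite_F hLr hg).subset fun S hS => hS.1
  have : LamS {emb v} F = {emb v} ∪ ⋃ S ∈ Fin, S := by
    apply Subset.antisymm
    · intro y hy
      rcases mem_LamS.1 hy with h | ⟨S, S', hS, hl, hne, hyS⟩
      · exact Or.inl h
      · refine Or.inr (mem_biUnion (x := S') ⟨⟨linkedS_mem hl hS, y, hyS, boxP_mono z (by omega) (hsub hy)⟩, ?_⟩ hyS)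
        intro x hx
        exact mem_LamS.2 (Or.inr ⟨S, S', hS, hl, hne, hx⟩)
    · exact union_subset (fun x hx => mem_LamS.2 (Or.inl hx)) (iUnion₂_subset fun S hS => hS.2)
  rw [this]
  exact isCompact_singleton.union (hfin.isCompact_biUnion fun S hS => compact_F hS.1.1)

lemma finite_ballV (c : Lat) (ρ : ℝ) : (ballV c ρ).Finite := by
  refine (finite_box c ⌈ρ⌉).subset ?_
  intro w hw
  have : ((linf (w - c) : ℤ) : ℝ) ≤ ρ := hw
  have h2 : ((linf (w - c) : ℤ) : ℝ) ≤ ⌈ρ⌉ := this.trans (Int.le_ceil ρ)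
  exact_mod_cast h2

lemma quality_of_good {Lr : Set ULoop} {U : Set Lat} {r R : ℤ} (hLr : ∀ γ ∈ Lr, ULoop.verts γ ⊆ box 0 r)
    (hU : U ⊆ box 0 r) {j : ℕ} (hj : 1 ≤ j) {ws : Fin j → ℕ → Lat} {ω : Config}
    (hgood : ∀ i, ∀ v ∈ ballV (hitPt (ws i) (bdry (box 0 R))) (1 / (9 * (j:ℝ)) * (R:ℝ)), ∃ z n N, n ≤ N ∧ v ∈ box z n ∧
      Disjoint (boxP z N) (boxP 0 r) ∧ Good ω z n N)
    (hQ : 0 < qualityDisc Lr U r ws ω R) : 1 / (10 * (j:ℝ)) < qualityDisc Lr U r ws ω R := by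
  unfold qualityDisc at hQ ⊢
  set F := traces Lr ∪ outerFrontiers r ω with hF
  set Pi0 := packTrace ws (bdry (box 0 R)) with hPi0
  set Sd := {δ : ℝ | 0 ≤ δ ∧ embS U ∩ Fill (LamS (Pi0 ∪ packBalls ws (bdry (box 0 R)) (δ * (R:ℝ))) F) = ∅} with hSd
  have hbdd : BddAbove Sd := by
    by_contra h
    rw [Real.sSup_of_not_bddAbove h] at hQ
    exact lt_irrefl _ hQ
  have hne : Sd.Nonempty := by
    by_contra h
    rw [not_nonempty_iff_eq_empty] at h
    rw [h, Real.sSup_empty] at hQ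
    exact lt_irrefl _ hQ
  have hj' : (1:ℝ) ≤ j := by exact_mod_cast hj
  suffices hmem : 1 / (9 * (j:ℝ)) ∈ Sd by
    refine lt_of_lt_of_le ?_ (le_csSup hbdd hmem)
    apply one_div_lt_one_div_of_lt <;> linarith
  obtain ⟨δ, hδ0, hδ⟩ := hne
  refine ⟨by positivity, ?_⟩
  rw [← Set.disjoint_iff_inter_eq_empty, Set.disjoint_left] at hδ ⊢
  intro p hp
  have hpF : p ∉ Fill (LamS Pi0 F) := fun h => hδ hp (fill_mono (LamS_mono subset_union_left) h)
  obtain ⟨u, huU, rfl⟩ := hp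
  have hub : emb u ∈ boxP 0 r := emb_mem_boxP.2 (hU huU)
  set B := ⋃ i, ballV (hitPt (ws i) (bdry (box 0 R))) (1 / (9 * (j:ℝ)) * (R:ℝ)) with hB
  have hBfin : B.Finite := Set.finite_iUnion fun i => finite_ballV _ _
  have hBg : ∀ v ∈ B, ∃ z n N, n ≤ N ∧ v ∈ box z n ∧ Disjoint (boxP z N) (boxP 0 r) ∧ Good ω z n N := by
    intro v hv
    obtain ⟨i, hi⟩ := mem_iUnion.1 hv
    exact hgood i v hi
  have hPi0c : IsClosed Pi0 := isClosed_iUnion_of_finite fun i => (isCompact_traceL _).isClosed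
  have main : ∀ s : Set Lat, s.Finite → s ⊆ B →
      IsClosed (closure (LamS Pi0 F) ∪ ⋃ v ∈ s, LamS {emb v} F) ∧
      emb u ∉ Fill (closure (LamS Pi0 F) ∪ ⋃ v ∈ s, LamS {emb v} F) := by
    intro s hs
    refine Set.Finite.induction_on s hs ?_ ?_
    · intro _
      simp only [mem_empty_iff_false, iUnion_of_empty, iUnion_empty, union_empty]
      refine ⟨isClosed_closure, ?_⟩
      have : Fill (closure (LamS Pi0 F)) = Fill (LamS Pi0 F) := by unfold Fill; rw [closure_closure]
      rwa [this]
    · intro v s hvs hsf ih hsB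
      obtain ⟨ih1, ih2⟩ := ih ((subset_insert v s).trans hsB)
      obtain ⟨z, n, N, hnN, hvz, hdis, hg⟩ := hBg v (hsB (mem_insert v s))
      obtain ⟨hsub, hcomp⟩ := LamS_point hLr hnN hg hdis hvz
      rw [biUnion_insert, union_comm (LamS {emb v} F), ← union_assoc]
      by_cases hdj : Disjoint (closure (LamS Pi0 F) ∪ ⋃ v ∈ s, LamS {emb v} F) (LamS {emb v} F)
      · refine ⟨ih1.union hcomp.isClosed, notMem_fill_union ih1 hcomp hdj ih2 ?_ ((hasLog_boxP hdis hub).mono hsub)⟩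
        intro h
        exact Set.disjoint_left.1 hdis (hsub h) hub
      · have : LamS {emb v} F ⊆ closure (LamS Pi0 F) ∪ ⋃ v ∈ s, LamS {emb v} F := by
          rw [Set.not_disjoint_iff] at hdj
          obtain ⟨q, hq | hq, hq'⟩ := hdj
          · have := closure_LamS_local hLr hg hPi0c (hsub hq') hq
            exact (LamS_absorb ⟨q, hq', this⟩).trans (subset_closure.trans subset_union_left)
          · simp only [mem_iUnion, exists_prop] at hq
            obtain ⟨v', hv', hq⟩ := hq
            refine (LamS_absorb ⟨q, hq', hq⟩).trans (Subset.trans ?_ subset_union_right)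
            exact subset_biUnion_of_mem (u := fun v => LamS {emb v} F) hv'
        rw [union_eq_self_of_subset_right this]
        exact ⟨ih1, ih2⟩
  obtain ⟨_, h2⟩ := main B hBfin Subset.rfl
  intro hf
  apply h2
  refine fill_mono ?_ hf
  refine LamS_union_points.trans (union_subset_union subset_closure ?_)
  refine iUnion₂_subset ?_
  intro p hp
  obtain ⟨i, v, hv, rfl⟩ := mem_iUnion.1 hp
  exact subset_biUnion_of_mem (u := fun v => LamS {emb v} F) (mem_iUnion.2 ⟨i, hv⟩)

lemma outerFrontiers_mono {r : ℤ} {ω ω' : Config} (h : ∀ γ, ω' γ ≤ ω γ) :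
    outerFrontiers r ω' ⊆ outerFrontiers r ω := by
  rintro _ ⟨γ, ⟨h1, h2⟩, rfl⟩
  refine ⟨γ, ⟨?_, h2⟩, rfl⟩
  have h1' : ω' γ ≠ 0 := h1
  have := h γ
  show ω γ ≠ 0
  omega

lemma quality_decreasing {Lr : Set ULoop} {U : Set Lat} {r R : ℤ} (hR : 1 ≤ R) {j : ℕ} (hj : 1 ≤ j)
    {ws : Fin j → ℕ → Lat} {ω ω' : Config} (h : ∀ γ, ω' γ ≤ ω γ)
    (hQ : 0 < qualityDisc Lr U r ws ω R) : 0 < qualityDisc Lr U r ws ω' R := by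
  unfold qualityDisc at hQ ⊢
  set Sd := {δ : ℝ | 0 ≤ δ ∧ embS U ∩ Fill (LamS (packTrace ws (bdry (box 0 R)) ∪
    packBalls ws (bdry (box 0 R)) (δ * (R:ℝ))) (traces Lr ∪ outerFrontiers r ω)) = ∅} with hSd
  set Sd' := {δ : ℝ | 0 ≤ δ ∧ embS U ∩ Fill (LamS (packTrace ws (bdry (box 0 R)) ∪
    packBalls ws (bdry (box 0 R)) (δ * (R:ℝ))) (traces Lr ∪ outerFrontiers r ω')) = ∅} with hSd'
  have hbdd : BddAbove Sd := by
    by_contra h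
    rw [Real.sSup_of_not_bddAbove h] at hQ
    exact lt_irrefl _ hQ
  have hne : Sd.Nonempty := by
    by_contra h
    rw [not_nonempty_iff_eq_empty] at h
    rw [h, Real.sSup_empty] at hQ
    exact lt_irrefl _ hQ
  have hsub : Sd ⊆ Sd' := by
    rintro δ ⟨h0, h1⟩
    refine ⟨h0, ?_⟩
    rw [← Set.subset_empty_iff] at h1 ⊢
    refine Subset.trans ?_ h1
    exact inter_subset_inter_right _ (fill_mono (LamS_mono_right (union_subset_union_right _ (outerFrontiers_mono h))))
  have hUne : U.Nonempty := by
    by_contra hU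
    rw [not_nonempty_iff_eq_empty] at hU
    obtain ⟨b, hb⟩ := hbdd
    have : max b 0 + 1 ∈ Sd := ⟨by positivity, by simp [hU, embS]⟩
    have := hb this
    linarith [le_max_left b 0]
  obtain ⟨u, hu⟩ := hUne
  have hR' : (1:ℝ) ≤ R := by exact_mod_cast hR
  have hbdd' : BddAbove Sd' := by
    let i0 : Fin j := ⟨0, hj⟩
    refine ⟨|((linf (u - hitPt (ws i0) (bdry (box 0 R))) : ℤ) : ℝ)|, ?_⟩
    rintro δ ⟨h0, h1⟩
    by_contra hlt
    push Not at hlt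
    rw [← Set.disjoint_iff_inter_eq_empty, Set.disjoint_left] at h1
    refine h1 ⟨u, hu, rfl⟩ (subset_fill _ (mem_LamS.2 (Or.inl (Or.inr ?_))))
    refine mem_iUnion.2 ⟨i0, u, ?_, rfl⟩
    show ((linf (u - hitPt (ws i0) (bdry (box 0 R))) : ℤ) : ℝ) ≤ δ * R
    have := le_abs_self ((linf (u - hitPt (ws i0) (bdry (box 0 R))) : ℤ) : ℝ)
    nlinarith
  obtain ⟨δ, hδ, hδ0⟩ := exists_lt_of_lt_csSup hne hQ
  exact hδ0.trans_le (le_csSup hbdd' (hsub hδ))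

instance countable_ULoop : Countable ULoop := by
  have : Countable RootedLoop := by
    refine Function.Injective.countable (f := RootedLoop.word) ?_
    rintro ⟨a, _, _⟩ ⟨b, _, _⟩ h
    simp only at h; subst h; rfl
  unfold ULoop
  exact inferInstance

lemma poissonProb_eq (r : ℝ≥0) (k : ℕ) : ProbabilityTheory.poissonMeasure r {k} = poissonProb r k := by
  rw [ProbabilityTheory.poissonMeasure_singleton]; rfl

lemma soup_eq {D : Set Lat} {α : ℝ} {Ps : Measure Config} (h : IsLoopSoup D α Ps) :
    Ps = Measure.infinitePi (fun γ => ProbabilityTheory.poissonMeasure (α.toNNReal * nuD D γ)) := by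
  have := h.1
  refine (Measure.isProjectiveLimit_infinitePi _).unique ?_ |>.symm
  intro s
  have hm : Measurable (s.restrict : Config → (s → ℕ)) := Finset.measurable_restrict s
  refine Measure.ext_of_singleton fun f => ?_
  rw [Measure.map_apply hm (measurableSet_singleton f), ← Set.univ_pi_singleton, Measure.pi_pi]
  have := h.2 s (fun γ => if hγ : γ ∈ s then f ⟨γ, hγ⟩ else 0)
  rw [← Finset.prod_coe_sort] at this
  rw [Set.univ_pi_singleton]
  refine Eq.trans ?_ (this.trans ?_)
  · congr 1
    ext ω
    simp only [mem_preimage, mem_singleton_iff, mem_ofPred_eq]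
    constructor
    · rintro rfl γ hγ
      simp [hγ]
    · intro h
      ext ⟨γ, hγ⟩
      have := h γ hγ
      simpa [hγ] using this
  · refine Finset.prod_congr rfl fun γ _ => ?_
    simp [poissonProb_eq]

lemma infinitePi_split {ι : Type*} [Countable ι] (μ : ι → Measure ℕ) [∀ i, IsProbabilityMeasure (μ i)] (p : ι → Prop) [DecidablePred p] :
    ((Measure.infinitePi fun i : {i // p i} => μ i).prod (Measure.infinitePi fun i : {i // ¬ p i} => μ i)).map
      (MeasurableEquiv.piEquivPiSubtypeProd (fun _ => ℕ) p).symm = Measure.infinitePi μ := by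
  refine Measure.eq_infinitePi _ fun s t ht => ?_
  rw [MeasurableEquiv.map_apply]
  have : (MeasurableEquiv.piEquivPiSubtypeProd (fun _ : ι => ℕ) p).symm ⁻¹' (Set.pi s t) =
      (Set.pi ((s.subtype p : Finset {i // p i}) : Set {i // p i}) (fun i => t i)) ×ˢ
        (Set.pi ((s.subtype (fun i => ¬ p i) : Finset {i // ¬ p i}) : Set {i // ¬ p i}) (fun i => t i)) := by
    ext ⟨f, g⟩
    simp only [mem_preimage, Set.mem_pi, Finset.mem_coe, mem_prod, Finset.mem_subtype]
    constructor
    · intro h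
      refine ⟨fun i hi => ?_, fun i hi => ?_⟩
      · have := h i hi
        simpa [MeasurableEquiv.piEquivPiSubtypeProd, i.2] using this
      · have := h i hi
        simpa [MeasurableEquiv.piEquivPiSubtypeProd, i.2] using this
    · rintro ⟨h1, h2⟩ i hi
      by_cases hp : p i
      · have := h1 ⟨i, hp⟩ hi
        simpa [MeasurableEquiv.piEquivPiSubtypeProd, hp] using this
      · have := h2 ⟨i, hp⟩ hi
        simpa [MeasurableEquiv.piEquivPiSubtypeProd, hp] using this
  rw [this, Measure.prod_prod, Measure.infinitePi_pi (fun i : {i // p i} => μ i) (t := fun i => t i) (fun i _ => ht i),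
    Measure.infinitePi_pi (fun i : {i // ¬ p i} => μ i) (t := fun i => t i) (fun i _ => ht i)]
  rw [Finset.prod_subtype_eq_prod_filter (s := s) (p := p) (fun i => μ i (t i)),
    Finset.prod_subtype_eq_prod_filter (s := s) (p := fun i => ¬ p i) (fun i => μ i (t i))]
  exact Finset.prod_filter_mul_prod_filter_not s p _

/-- Intensity of a loop. -/
def inten (D : Set Lat) (α : ℝ) (γ : ULoop) : ℝ≥0∞ := ((α.toNNReal * nuD D γ : ℝ≥0) : ℝ≥0∞)

lemma tprod_exp_ge {ι : Type*} (f : ι → ℝ≥0) {l : ℝ} (hl : 0 ≤ l) (h : ∑' i, (f i : ℝ≥0∞) ≤ ofReal l) :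
    ofReal (exp (-l)) ≤ ∏' i, ofReal (exp (-(f i : ℝ))) := by
  have hs : Summable f := by
    rw [← ENNReal.tsum_coe_ne_top_iff_summable]
    exact ne_top_of_le_ne_top ENNReal.ofReal_ne_top h
  have hsR : HasSum (fun i => (f i : ℝ)) (∑' i, (f i : ℝ)) := (NNReal.summable_coe.2 hs).hasSum
  have hle : ∑' i, (f i:ℝ) ≤ l := by
    rw [← ENNReal.coe_tsum hs, ofReal, ENNReal.coe_le_coe] at h
    have := NNReal.coe_le_coe.2 h
    rwa [NNReal.coe_tsum, Real.coe_toNNReal _ hl] at this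
  have hp : HasProd (fun i => ofReal (exp (-(f i : ℝ)))) (ofReal (exp (-∑' i, (f i:ℝ)))) := by
    unfold HasProd
    have h1 : Filter.Tendsto (fun s : Finset ι => ofReal (exp (-∑ i ∈ s, (f i:ℝ)))) Filter.atTop
      (nhds (ofReal (exp (-∑' i, (f i:ℝ))))) :=
      (ENNReal.continuous_ofReal.tendsto _).comp ((Real.continuous_exp.tendsto _).comp (Filter.Tendsto.neg hsR))
    refine h1.congr fun s => ?_
    rw [← ENNReal.ofReal_prod_of_nonneg (fun _ _ => (Real.exp_pos _).le), ← Real.exp_sum, Finset.sum_neg_distrib]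
  rw [hp.tprod_eq]
  exact ofReal_le_ofReal (Real.exp_le_exp.2 (by linarith))

/-- Zeroing out a class of loops. -/
def zeroOut (Γ : Set ULoop) (ω : Config) : Config := fun γ => if γ ∈ Γ then 0 else ω γ

lemma zeroOut_step {D : Set Lat} {α : ℝ} {Ps : Measure Config} (hPs : IsLoopSoup D α Ps)
    {W : Type*} [MeasurableSpace W] {ρ : Measure W} [IsProbabilityMeasure ρ] (Γ : Set ULoop) {l : ℝ} (hl : 0 ≤ l)
    (hΓ : ∑' γ : Γ, inten D α γ ≤ ofReal l) {S S' : Set (W × Config)}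
    (h1 : ∀ u ∈ S, ∃ γ ∈ Γ, u.2 γ ≠ 0) (h2 : ∀ u ∈ S, (u.1, zeroOut Γ u.2) ∈ S') :
    ρ.prod Ps S ≤ ofReal (exp l - 1) * ρ.prod Ps S' := by
  set μ : ULoop → Measure ℕ := fun γ => ProbabilityTheory.poissonMeasure (α.toNNReal * nuD D γ) with hμ
  set A := Measure.infinitePi fun i : {i // i ∉ Γ} => μ i with hA
  set B := Measure.infinitePi fun i : {i // ¬ i ∉ Γ} => μ i with hB
  set e := MeasurableEquiv.piEquivPiSubtypeProd (fun _ : ULoop => ℕ) (fun i => i ∉ Γ) with he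
  have hsplit : Ps = (A.prod B).map e.symm := by
    rw [soup_eq hPs]; exact (infinitePi_split μ (fun i => i ∉ Γ)).symm
  let e2 : (W × ({i // i ∉ Γ} → ℕ)) × ({i // ¬ i ∉ Γ} → ℕ) ≃ᵐ W × Config :=
    MeasurableEquiv.prodAssoc.trans (MeasurableEquiv.prodCongr (MeasurableEquiv.refl W) e.symm)
  have hprod : ρ.prod Ps = ((ρ.prod A).prod B).map e2 := by
    have : ⇑e2 = (Prod.map id e.symm) ∘ MeasurableEquiv.prodAssoc := rfl
    rw [this, ← Measure.map_map (by fun_prop) (by fun_prop), Measure.prodAssoc_prod,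
      ← Measure.map_prod_map _ _ (by fun_prop) (by fun_prop), Measure.map_id, ← hsplit]
  rw [hprod, MeasurableEquiv.map_apply, MeasurableEquiv.map_apply]
  set Y : Set (W × ({i // i ∉ Γ} → ℕ)) := {q | e2 (q, 0) ∈ S'} with hY
  have he2 : ∀ (w : W) f g γ, (e2 ((w, f), g)).2 γ = if h : γ ∉ Γ then f ⟨γ, h⟩ else g ⟨γ, h⟩ := fun _ _ _ _ => rfl
  have he1 : ∀ (w : W) f g, (e2 ((w, f), g)).1 = w := fun _ _ _ => rfl
  have hS : e2 ⁻¹' S ⊆ Y ×ˢ {0}ᶜ := by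
    rintro ⟨⟨w, f⟩, g⟩ h
    have h' : e2 ((w, f), g) ∈ S := h
    refine ⟨?_, ?_⟩
    · show e2 ((w, f), 0) ∈ S'
      have := h2 _ h'
      convert this using 1
      refine Prod.ext rfl ?_
      funext γ
      rw [he2]
      simp only [zeroOut, he2, Pi.zero_apply]
      by_cases hγ : γ ∈ Γ <;> simp [hγ]
    · rintro h0
      rw [mem_singleton_iff] at h0
      simp only at h0
      subst h0
      obtain ⟨γ, hγ, hne⟩ := h1 _ h'
      rw [he2] at hne
      simp [hγ] at hne
  have hS' : Y ×ˢ {0} ⊆ e2 ⁻¹' S' := by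
    rintro ⟨q, g⟩ ⟨hq, hg⟩
    rw [mem_singleton_iff] at hg
    simp only at hg hq
    subst hg
    exact hq
  have hB0 : ofReal (exp (-l)) ≤ B {0} := by
    rw [hB, Measure.infinitePi_singleton]
    have : ∀ i : {i // ¬ i ∉ Γ}, μ i {(0 : {i // ¬ i ∉ Γ} → ℕ) i} = ofReal (exp (-((α.toNNReal * nuD D i.1 : ℝ≥0) : ℝ))) := by
      intro i
      rw [hμ, Pi.zero_apply, poissonProb_eq]
      simp [poissonProb]
    simp_rw [this]
    refine tprod_exp_ge (fun i : {i // ¬ i ∉ Γ} => α.toNNReal * nuD D i.1) hl (le_trans (le_of_eq ?_) hΓ)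
    refine Equiv.tsum_eq_tsum_of_support ?_ ?_
    · refine Equiv.subtypeEquiv (Equiv.subtypeEquivRight (fun x => by simp)) ?_
      intro a; rfl
    · intro x; rfl
  have hBc : B {0}ᶜ ≤ 1 - ofReal (exp (-l)) := by
    rw [prob_compl_eq_one_sub (measurableSet_singleton _)]
    exact tsub_le_tsub_left hB0 1
  calc _ ≤ ((ρ.prod A).prod B) (Y ×ˢ {0}ᶜ) := measure_mono hS
    _ = (ρ.prod A) Y * B {0}ᶜ := Measure.prod_prod _ _
    _ ≤ (ρ.prod A) Y * (ofReal (exp l - 1) * B {0}) := by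
        gcongr
        refine hBc.trans (le_trans ?_ (mul_le_mul_right hB0 _))
        rw [← ENNReal.ofReal_one, ← ENNReal.ofReal_sub _ (Real.exp_pos _).le,
          ← ofReal_mul (by linarith [Real.add_one_le_exp l])]
        refine ofReal_le_ofReal ?_
        rw [sub_mul, ← Real.exp_add]; simp
    _ = ofReal (exp l - 1) * ((ρ.prod A).prod B) (Y ×ˢ {0}) := by
        rw [Measure.prod_prod]; ring
    _ ≤ _ := by gcongr

/-- Which classes are occupied. -/
def chi {ι : Type*} [Fintype ι] (Γ : ι → Set ULoop) (ω : Config) : Finset ι :=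
  Finset.univ.filter fun i => ∃ γ ∈ Γ i, ω γ ≠ 0

lemma measurableSet_chi {ι : Type*} [Fintype ι] (Γ : ι → Set ULoop) (a : Finset ι) :
    MeasurableSet {ω : Config | chi Γ ω = a} := by
  have : {ω : Config | chi Γ ω = a} = ⋂ i, {ω : Config | (∃ γ ∈ Γ i, ω γ ≠ 0) ↔ i ∈ a} := by
    ext ω
    simp [chi, Finset.ext_iff]
  rw [this]
  refine MeasurableSet.iInter fun i => ?_
  have h1 : MeasurableSet {ω : Config | ∃ γ ∈ Γ i, ω γ ≠ 0} := by
    have : {ω : Config | ∃ γ ∈ Γ i, ω γ ≠ 0} = ⋃ γ ∈ Γ i, (fun ω : Config => ω γ) ⁻¹' {0}ᶜ := by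
      ext ω; simp
    rw [this]
    exact MeasurableSet.biUnion (Set.to_countable _) fun γ _ =>
      (measurable_pi_apply γ) (measurableSet_singleton 0).compl
  by_cases h : i ∈ a
  · simpa [h] using h1
  · have : {ω : Config | (∃ γ ∈ Γ i, ω γ ≠ 0) ↔ i ∈ a} = {ω : Config | ∃ γ ∈ Γ i, ω γ ≠ 0}ᶜ := by
      ext ω; simp [h]
    rw [this]; exact h1.compl

lemma harris {D : Set Lat} {α : ℝ} {Ps : Measure Config} (hPs : IsLoopSoup D α Ps)
    {W : Type*} [MeasurableSpace W] {ρ : Measure W} [IsProbabilityMeasure ρ]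
    {ι : Type*} [Fintype ι] (Γ : ι → Set ULoop) (hdis : ∀ i j, i ≠ j → Disjoint (Γ i) (Γ j))
    (l : ι → ℝ) (hl : ∀ i, 0 ≤ l i) (hΓ : ∀ i, ∑' γ : Γ i, inten D α γ ≤ ofReal (l i))
    {X : Set (W × Config)} (hX : ∀ w ω ω', (∀ γ, ω' γ ≤ ω γ) → (w, ω) ∈ X → (w, ω') ∈ X)
    (DD : Set (Finset ι)) (hDD : ∀ a ∈ DD, ∀ b, b ⊆ a → b ∈ DD) :
    ofReal (∑ b : Finset ι, if b ∈ DD then ∏ i ∈ b, (exp (l i) - 1) else 0) * ρ.prod Ps X ≤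
      ofReal (∏ i, exp (l i)) * ρ.prod Ps (X ∩ {u | chi Γ u.2 ∈ DD}) := by
  have := hPs.1
  set P := ρ.prod Ps with hP
  set t : ι → ℝ := fun i => exp (l i) - 1 with ht
  have ht0 : ∀ i, 0 ≤ t i := fun i => by simp [ht, hl i]
  set C : Finset ι → Set (W × Config) := fun a => {u | chi Γ u.2 = a} with hC
  have hCm : ∀ a, MeasurableSet (C a) := fun a => measurable_snd (measurableSet_chi Γ a)
  set f1 : Finset ι → ℝ := fun a => (P (X ∩ C a)).toReal with hf1
  have hf10 : ∀ a, 0 ≤ f1 a := fun a => ENNReal.toReal_nonneg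
  have step : ∀ a, ∀ i ∈ a, f1 a ≤ t i * f1 (a.erase i) := by
    intro a i hi
    have := zeroOut_step hPs (ρ := ρ) (Γ i) (hl i) (hΓ i) (S := X ∩ C a) (S' := X ∩ C (a.erase i)) ?_ ?_
    · have h2 := ENNReal.toReal_mono (ENNReal.mul_ne_top ENNReal.ofReal_ne_top (measure_ne_top _ _)) this
      rw [ENNReal.toReal_mul, ENNReal.toReal_ofReal (ht0 i)] at h2
      exact h2
    · rintro u ⟨_, hu⟩
      have hu' : chi Γ u.2 = a := hu
      rw [← hu'] at hi
      simpa [chi] using hi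
    · rintro u ⟨huX, hu⟩
      refine ⟨hX u.1 u.2 _ ?_ huX, ?_⟩
      · intro γ; unfold zeroOut; split_ifs <;> simp
      · have hu' : chi Γ u.2 = a := hu
        show chi Γ (zeroOut (Γ i) u.2) = a.erase i
        rw [← hu']
        ext k
        simp only [chi, mem_filter, Finset.mem_univ, true_and, Finset.mem_erase]
        constructor
        · rintro ⟨γ, hγ, hne⟩
          unfold zeroOut at hne
          split_ifs at hne with h
          · exact absurd rfl hne
          · refine ⟨?_, γ, hγ, hne⟩
            rintro rfl; exact h hγ
        · rintro ⟨hki, γ, hγ, hne⟩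
          refine ⟨γ, hγ, ?_⟩
          unfold zeroOut
          rw [if_neg]
          · exact hne
          · intro h; exact Set.disjoint_left.1 (hdis k i hki) hγ h
  have multi : ∀ s a : Finset ι, s ⊆ a → f1 a ≤ (∏ i ∈ s, t i) * f1 (a \ s) := by
    intro s
    induction s using Finset.induction_on with
    | empty => intro a _; simp
    | insert i s his ih =>
      intro a hsa
      have h1 := ih a ((Finset.subset_insert i s).trans hsa)
      have h2 := step (a \ s) i (by simp [his, hsa (Finset.mem_insert_self i s)])
      have h3 : (a \ s).erase i = a \ insert i s := by
        ext k; simp; tauto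
      rw [h3] at h2
      rw [Finset.prod_insert his]
      calc f1 a ≤ _ := h1
        _ ≤ (∏ i ∈ s, t i) * (t i * f1 (a \ insert i s)) := by
          refine mul_le_mul_of_nonneg_left h2 (prod_nonneg fun i _ => ht0 i)
        _ = _ := by ring
  have ff := four_functions_theorem_univ f1 (fun b => if b ∈ DD then ∏ i ∈ b, t i else 0)
    (fun a => if a ∈ DD then f1 a else 0) (fun b => ∏ i ∈ b, t i) (fun a => hf10 a)
    (fun b => by
      simp only [Pi.zero_apply]; split_ifs
      · exact prod_nonneg fun i _ => ht0 i
      · exact le_rfl)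
    (fun a => by
      simp only [Pi.zero_apply]; split_ifs
      · exact hf10 a
      · exact le_rfl) (fun b => prod_nonneg fun i _ => ht0 i) ?_
  swap
  · intro a b
    by_cases hb : b ∈ DD
    · have hab : a ⊓ b ∈ DD := hDD b hb _ inf_le_right
      simp only [hb, hab, if_true]
      have h1 := multi (a \ b) a Finset.sdiff_subset
      have h2 : a \ (a \ b) = a ⊓ b := by
        ext k; simp
      rw [h2] at h1
      have h3 : ∏ i ∈ a ⊔ b, t i = (∏ i ∈ a \ b, t i) * ∏ i ∈ b, t i := by
        rw [← Finset.prod_union Finset.sdiff_disjoint]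
        congr 1; ext k; simp
      rw [h3]
      have h4 : 0 ≤ ∏ i ∈ b, t i := prod_nonneg fun i _ => ht0 i
      nlinarith [mul_le_mul_of_nonneg_right h1 h4]
    · simp only [hb, if_false, mul_zero]
      refine mul_nonneg ?_ (prod_nonneg fun i _ => ht0 i)
      split_ifs
      · exact hf10 _
      · exact le_rfl
  have hprod : ∑ b : Finset ι, ∏ i ∈ b, t i = ∏ i, exp (l i) := by
    have := Finset.prod_one_add (f := t) (s := (Finset.univ : Finset ι))
    rw [Finset.powerset_univ] at this
    rw [← this]
    refine Finset.prod_congr rfl fun i _ => ?_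
    simp [ht]
  rw [hprod] at ff
  have hpd : Set.Pairwise (Finset.univ : Finset (Finset ι)) (fun a b => Disjoint (C a) (C b)) := by
    intro a _ b _ hab
    rw [Set.disjoint_left]
    intro u h1 h2
    exact hab ((show chi Γ u.2 = a from h1).symm.trans h2)
  have hsum : ∀ E : Set (Finset ι), (P (X ∩ {u | chi Γ u.2 ∈ E})).toReal = ∑ a, if a ∈ E then f1 a else 0 := by
    intro E
    have hU : {u : W × Config | chi Γ u.2 ∈ E} = ⋃ a ∈ Finset.univ.filter (· ∈ E), C a := by
      ext u; simp [hC]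
    have hUm : MeasurableSet {u : W × Config | chi Γ u.2 ∈ E} := by
      rw [hU]; exact Finset.measurableSet_biUnion _ fun a _ => hCm a
    rw [inter_comm, ← Measure.restrict_apply hUm, hU, measure_biUnion_finset (fun a _ b _ hab => hpd (by simp) (by simp) hab)
      (fun a _ => hCm a), ENNReal.toReal_sum (fun a _ => measure_ne_top _ _), Finset.sum_filter]
    refine sum_congr rfl fun a _ => ?_
    split_ifs
    · rw [Measure.restrict_apply (hCm a), inter_comm]
    · rfl
  have hXs := hsum Set.univ
  simp only [mem_univ, ofPred_true, inter_univ, if_true] at hXs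
  rw [← hXs, ← hsum DD] at ff
  rw [← ENNReal.ofReal_toReal (measure_ne_top P X), ← ENNReal.ofReal_toReal (measure_ne_top P (X ∩ {u | chi Γ u.2 ∈ DD})),
    ← ofReal_mul (sum_nonneg fun b _ => by
      split_ifs
      · exact prod_nonneg fun i _ => ht0 i
      · exact le_rfl),
    ← ofReal_mul (prod_nonneg fun i _ => (Real.exp_pos _).le)]
  refine ofReal_le_ofReal ?_
  linarith [mul_comm (P X).toReal (∑ b : Finset ι, if b ∈ DD then ∏ i ∈ b, (exp (l i) - 1) else 0),
    mul_comm (P (X ∩ {u | chi Γ u.2 ∈ DD})).toReal (∏ i, exp (l i))]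

/-- Kill event: no loop from a class. -/
def NoLoop (Γ : Set ULoop) : Set Config := {ω | ∀ γ ∈ Γ, ω γ = 0}

lemma kill_event {D : Set Lat} {α : ℝ} {Ps : Measure Config} (hPs : IsLoopSoup D α Ps)
    {W : Type*} [MeasurableSpace W] {ρ : Measure W} [IsProbabilityMeasure ρ]
    (Γ : Set ULoop) {l : ℝ} (hl : 0 ≤ l) (hΓ : ∑' γ : Γ, inten D α γ ≤ ofReal l)
    {X : Set (W × Config)} (hX : ∀ w ω ω', (∀ γ, ω' γ ≤ ω γ) → (w, ω) ∈ X → (w, ω') ∈ X) :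
    ofReal (exp (-l)) * ρ.prod Ps X ≤ ρ.prod Ps (X ∩ {u | u.2 ∈ NoLoop Γ}) := by
  have := hPs.1
  have h := harris hPs (ρ := ρ) (fun _ : Unit => Γ) (by simp) (fun _ => l) (fun _ => hl) (fun _ => hΓ) hX {∅} (by
    intro a ha b hb; rw [mem_singleton_iff] at ha ⊢; subst ha; exact Finset.subset_empty.1 hb)
  simp only [mem_singleton_iff, Finset.sum_ite_eq', Finset.mem_univ, if_true, Finset.prod_empty, ENNReal.ofReal_one,
    one_mul, Finset.univ_unique, Finset.prod_singleton] at h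
  have hset : {u : W × Config | chi (fun _ : Unit => Γ) u.2 = ∅} = {u | u.2 ∈ NoLoop Γ} := by
    ext u; simp [chi, NoLoop, Finset.filter_eq_empty_iff]
  rw [hset] at h
  calc _ ≤ ofReal (exp (-l)) * (ofReal (exp l) * ρ.prod Ps (X ∩ {u | u.2 ∈ NoLoop Γ})) := by gcongr
    _ = _ := by
      rw [← mul_assoc, ← ofReal_mul (Real.exp_pos _).le, ← Real.exp_add]; simp

/-! ### Finite Gaussian fields and closed walks -/

/-- The quadratic form `∑ f² - ∑ A f f`. -/
def qf {V : Type*} [Fintype V] (A : Matrix V V ℝ) (f : V → ℝ) : ℝ :=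
  ∑ x, f x ^ 2 - ∑ x, ∑ y, A x y * f x * f y

lemma spectral_real {V : Type*} [Fintype V] [DecidableEq V] (A : Matrix V V ℝ)
    (hA : A.IsHermitian) :
    ∃ (U : Matrix V V ℝ) (l : V → ℝ), U * U.transpose = 1 ∧ U.transpose * U = 1 ∧
      A = U * Matrix.diagonal l * U.transpose := by
  refine ⟨hA.eigenvectorUnitary, hA.eigenvalues, ?_, ?_, ?_⟩
  · have := Unitary.mul_star_self_of_mem hA.eigenvectorUnitary.2
    rwa [Matrix.star_eq_conjTranspose, Matrix.conjTranspose_eq_transpose_of_trivial] at this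
  · have := Unitary.star_mul_self_of_mem hA.eigenvectorUnitary.2
    rwa [Matrix.star_eq_conjTranspose, Matrix.conjTranspose_eq_transpose_of_trivial] at this
  · have h := hA.spectral_theorem
    conv_lhs => rw [h]
    rw [Unitary.conjStarAlgAut_apply, Matrix.star_eq_conjTranspose,
      Matrix.conjTranspose_eq_transpose_of_trivial]
    rfl

lemma qf_eq_dot {V : Type*} [Fintype V] [DecidableEq V] (A : Matrix V V ℝ) (f : V → ℝ) :
    qf A f = f ⬝ᵥ f - f ⬝ᵥ (A.mulVec f) := by
  unfold qf dotProduct Matrix.mulVec dotProduct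
  congr 1
  · exact sum_congr rfl fun x _ => by ring
  · refine sum_congr rfl fun x _ => ?_
    rw [mul_sum]
    exact sum_congr rfl fun y _ => by ring

lemma qf_spectral {V : Type*} [Fintype V] [DecidableEq V] {A U : Matrix V V ℝ} {l : V → ℝ}
    (h1 : U * U.transpose = 1) (hA : A = U * Matrix.diagonal l * U.transpose) (f : V → ℝ) :
    qf A f = ∑ i, (1 - l i) * (U.transpose.mulVec f i) ^ 2 := by
  rw [qf_eq_dot]
  have e1 : f ⬝ᵥ f = (U.transpose.mulVec f) ⬝ᵥ (U.transpose.mulVec f) := by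
    rw [Matrix.dotProduct_mulVec, Matrix.vecMul_mulVec, Matrix.transpose_transpose, h1]
    simp
  have e2 : f ⬝ᵥ (A.mulVec f) =
      (U.transpose.mulVec f) ⬝ᵥ ((Matrix.diagonal l).mulVec (U.transpose.mulVec f)) := by
    conv_lhs => rw [hA, ← Matrix.mulVec_mulVec, ← Matrix.mulVec_mulVec]
    rw [Matrix.dotProduct_mulVec f U, ← Matrix.mulVec_transpose]
  rw [e1, e2]
  unfold dotProduct
  rw [← Finset.sum_sub_distrib]
  refine sum_congr rfl fun i _ => ?_
  rw [Matrix.mulVec_diagonal]; ring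

lemma trace_spectral {V : Type*} [Fintype V] [DecidableEq V] {A U : Matrix V V ℝ} {l : V → ℝ}
    (h2 : U.transpose * U = 1) (hA : A = U * Matrix.diagonal l * U.transpose) (n : ℕ) :
    (A ^ n).trace = ∑ i, l i ^ n := by
  have h1 : U * U.transpose = 1 := by rw [mul_eq_one_comm]; exact h2
  have : A ^ n = U * Matrix.diagonal (fun i => l i ^ n) * U.transpose := by
    induction n with
    | zero => simp [h1]
    | succ k ih =>
      rw [pow_succ, ih, hA]
      calc U * Matrix.diagonal (fun i => l i ^ k) * U.transpose *
            (U * Matrix.diagonal l * U.transpose)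
          = U * Matrix.diagonal (fun i => l i ^ k) * (U.transpose * U) * Matrix.diagonal l
            * U.transpose := by simp only [Matrix.mul_assoc]
        _ = _ := by
          rw [h2, Matrix.mul_one, Matrix.mul_assoc U, Matrix.diagonal_mul_diagonal]
          simp only [pow_succ]
  rw [this, Matrix.trace_mul_cycle, h2, Matrix.one_mul, Matrix.trace_diagonal]

lemma orth_preserving {V : Type*} [Fintype V] [DecidableEq V] {U : Matrix V V ℝ}
    (h1 : U * U.transpose = 1) :
    MeasurePreserving (fun f : V → ℝ => U.transpose.mulVec f) volume volume := by
  have hd : U.det * U.det = 1 := by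
    have := congrArg Matrix.det h1
    rwa [Matrix.det_mul, Matrix.det_transpose, Matrix.det_one] at this
  have hne : U.transpose.det ≠ 0 := by
    rw [Matrix.det_transpose]; intro h; rw [h] at hd; simp at hd
  refine ⟨?_, ?_⟩
  · exact (Matrix.toLin' U.transpose).continuous_of_finiteDimensional.measurable
  · have := Real.map_matrix_volume_pi_eq_smul_volume_pi hne
    rw [Matrix.det_transpose] at this
    have h3 : |(U.det)⁻¹| = 1 := by
      rw [abs_inv]
      have : |U.det| = 1 := by
        rcases mul_self_eq_one_iff.1 hd with h | h <;> simp [h]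
      rw [this, inv_one]
    rw [h3, ENNReal.ofReal_one, one_smul] at this
    exact this

/-- Gaussian integral = exponential of the closed-walk generating function. -/
lemma gauss_loop {V : Type*} [Fintype V] [DecidableEq V] (A : Matrix V V ℝ)
    (hA : A.IsHermitian) (hpos : ∀ f : V → ℝ, f ≠ 0 → 0 < qf A f)
    (hneg : ∀ f : V → ℝ, f ≠ 0 → 0 < qf (-A) f) :
    Integrable (fun f : V → ℝ => exp (-(qf A f) / 2)) ∧
    Summable (fun n : ℕ => (A ^ (n + 1)).trace / (n + 1)) ∧
    ∫ f : V → ℝ, exp (-(qf A f) / 2) =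
      √(2 * Real.pi) ^ Fintype.card V *
        exp ((∑' n : ℕ, (A ^ (n + 1)).trace / (n + 1)) / 2) := by
  obtain ⟨U, l, h1, h2, hU⟩ := spectral_real A hA
  have hneg' : -A = U * Matrix.diagonal (-l) * U.transpose := by
    rw [hU]
    have : Matrix.diagonal (-l) = - Matrix.diagonal l := (Matrix.diagonal_neg l).symm
    rw [this, Matrix.mul_neg, Matrix.neg_mul]
  have hl : ∀ i, |l i| < 1 := by
    intro i
    have hne : U.mulVec (Pi.single i 1) ≠ 0 := by
      intro h
      have : U.transpose.mulVec (U.mulVec (Pi.single i 1)) = 0 := by rw [h]; simp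
      rw [Matrix.mulVec_mulVec, h2, Matrix.one_mulVec] at this
      have := congrFun this i
      simp at this
    have e : ∀ B : Matrix V V ℝ, ∀ k : V → ℝ, B = U * Matrix.diagonal k * U.transpose →
        qf B (U.mulVec (Pi.single i 1)) = 1 - k i := by
      intro B k hB
      rw [qf_spectral h1 hB, Matrix.mulVec_mulVec, h2, Matrix.one_mulVec]
      rw [Finset.sum_eq_single i]
      · simp
      · intro j _ hj; simp [hj]
      · simp
    have a1 := hpos _ hne
    have a2 := hneg _ hne
    rw [e A l hU] at a1
    rw [e (-A) (-l) hneg'] at a2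
    rw [abs_lt]; constructor
    · simp at a2; linarith
    · linarith
  have hfun : (fun f : V → ℝ => exp (-(qf A f) / 2)) =
      (fun g : V → ℝ => ∏ i, exp (-((1 - l i) / 2) * (g i) ^ 2)) ∘
        (fun f : V → ℝ => U.transpose.mulVec f) := by
    funext f
    simp only [Function.comp]
    rw [← Real.exp_sum, qf_spectral h1 hU]
    congr 1
    rw [← Finset.sum_neg_distrib, sum_div]
    exact sum_congr rfl fun i _ => by ring
  have hmp := orth_preserving h1
  have hgIt : Integrable (fun g : V → ℝ => ∏ i, exp (-((1 - l i) / 2) * (g i) ^ 2)) := by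
    apply Integrable.fintype_prod (f := fun i (t : ℝ) => exp (-((1 - l i) / 2) * t ^ 2))
    intro i
    exact integrable_exp_neg_mul_sq (by have := (abs_lt.1 (hl i)).2; linarith)
  have hsum : ∀ i, HasSum (fun n : ℕ => l i ^ (n + 1) / (n + 1)) (-log (1 - l i)) :=
    fun i => Real.hasSum_pow_div_log_of_abs_lt_one (hl i)
  have hS : HasSum (fun n : ℕ => (A ^ (n + 1)).trace / (n + 1))
      (∑ i, -log (1 - l i)) := by
    have := hasSum_sum (fun i (_ : i ∈ (Finset.univ : Finset V)) => hsum i)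
    have e : (fun n : ℕ => (A ^ (n + 1)).trace / (n + 1)) =
        fun n : ℕ => ∑ i, l i ^ (n + 1) / ((n : ℝ) + 1) := by
      funext n
      rw [trace_spectral h2 hU, sum_div]
    rw [e]; exact this
  refine ⟨?_, hS.summable, ?_⟩
  · rw [hfun]; exact hmp.integrable_comp_of_integrable hgIt
  · rw [hS.tsum_eq, hfun]
    have := integral_map (μ := volume) hmp.measurable.aemeasurable
      (f := fun g : V → ℝ => ∏ i, exp (-((1 - l i) / 2) * (g i) ^ 2))
      (by rw [hmp.map_eq]; exact hgIt.aestronglyMeasurable)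
    rw [hmp.map_eq] at this
    rw [Function.comp_def, ← this, integral_fintype_prod_volume_eq_prod
      (f := fun i (t : ℝ) => exp (-((1 - l i) / 2) * t ^ 2)), sum_div, Real.exp_sum,
      ← Finset.card_univ, ← Finset.prod_const, ← Finset.prod_mul_distrib]
    refine Finset.prod_congr rfl fun i _ => ?_
    have hp : 0 < 1 - l i := by have := (abs_lt.1 (hl i)).2; linarith
    rw [integral_gaussian, show -log (1 - l i) / 2 = log (√(1 - l i))⁻¹ by
      rw [Real.log_inv, Real.log_sqrt hp.le]; ring, Real.exp_log (by positivity)]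
    rw [← Real.sqrt_inv, ← Real.sqrt_mul (by positivity)]
    congr 1
    field_simp

section
section closedWalks
variable {V : Type*} [Fintype V] [DecidableEq V]

/-- Restriction of a matrix to a set of edges. -/
def resM (A : Matrix V V ℝ) (E : Finset (Sym2 V)) : Matrix V V ℝ :=
  fun x y => if s(x, y) ∈ E then A x y else 0

/-- Weight of the walk `x, l, y`. -/
def lw (A : Matrix V V ℝ) : V → List V → V → ℝ
  | x, [], y => A x y
  | x, z :: l, y => A x z * lw A z l y

/-- Edge support of the walk `x, l, y`. -/
def es : V → List V → V → Finset (Sym2 V)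
  | x, [], y => {s(x, y)}
  | x, z :: l, y => insert s(x, z) (es z l y)

lemma pow_lw (A : Matrix V V ℝ) (n : ℕ) : ∀ x y : V,
    (A ^ (n + 1)) x y = ∑ w : Fin n → V, lw A x (List.ofFn w) y := by
  induction n with
  | zero => intro x y; simp [lw]
  | succ n ih =>
    intro x y
    rw [pow_succ', Matrix.mul_apply]
    rw [← (Fin.consEquiv (fun _ : Fin (n + 1) => V)).sum_comp, Fintype.sum_prod_type]
    refine sum_congr rfl fun z _ => ?_
    rw [ih, mul_sum]
    refine sum_congr rfl fun w _ => ?_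
    simp [Fin.consEquiv, List.ofFn_succ, lw]

lemma lw_res (A : Matrix V V ℝ) (E : Finset (Sym2 V)) : ∀ (l : List V) (x y : V),
    lw (resM A E) x l y = if es x l y ⊆ E then lw A x l y else 0 := by
  intro l
  induction l with
  | nil => intro x y; simp [lw, es, resM]
  | cons z l ih =>
    intro x y
    simp only [lw, es, ih, resM, Finset.insert_subset_iff]
    by_cases h1 : s(x, z) ∈ E <;> by_cases h2 : es z l y ⊆ E <;> simp [h1, h2]

/-- Total weight of the closed walks of length `n+1` with support `s`. -/
def cw (A : Matrix V V ℝ) (n : ℕ) (s : Finset (Sym2 V)) : ℝ :=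
  ∑ x : V, ∑ w : Fin n → V, if es x (List.ofFn w) x = s then lw A x (List.ofFn w) x else 0

/-- Loop mass (at intensity one half) of the closed walks with support `s`. -/
def lam (A : Matrix V V ℝ) (s : Finset (Sym2 V)) : ℝ := (∑' n : ℕ, cw A n s / (n + 1)) / 2

lemma trace_res (A : Matrix V V ℝ) (E : Finset (Sym2 V)) (n : ℕ) :
    ((resM A E) ^ (n + 1)).trace = ∑ s ∈ E.powerset, cw A n s := by
  unfold Matrix.trace cw
  rw [sum_comm]
  refine sum_congr rfl fun x _ => ?_
  rw [sum_comm, Matrix.diag_apply, pow_lw]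
  refine sum_congr rfl fun w _ => ?_
  rw [lw_res, Finset.sum_ite_eq]
  simp only [Finset.mem_powerset]

lemma lw_nonneg {A : Matrix V V ℝ} (hA : ∀ x y, 0 ≤ A x y) : ∀ (l : List V) (x y : V),
    0 ≤ lw A x l y := by
  intro l
  induction l with
  | nil => intro x y; exact hA x y
  | cons z l ih => intro x y; exact mul_nonneg (hA _ _) (ih _ _)

lemma cw_nonneg {A : Matrix V V ℝ} (hA : ∀ x y, 0 ≤ A x y) (n : ℕ) (s : Finset (Sym2 V)) :
    0 ≤ cw A n s := by
  unfold cw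
  refine sum_nonneg fun x _ => sum_nonneg fun w _ => ?_
  split_ifs
  · exact lw_nonneg hA _ _ _
  · exact le_rfl

lemma lam_nonneg {A : Matrix V V ℝ} (hA : ∀ x y, 0 ≤ A x y) (s : Finset (Sym2 V)) :
    0 ≤ lam A s := by
  unfold lam
  have : 0 ≤ ∑' n : ℕ, cw A n s / ((n : ℝ) + 1) :=
    tsum_nonneg fun n => div_nonneg (cw_nonneg hA n s) (by positivity)
  linarith

lemma exists_of_lam_ne {A : Matrix V V ℝ} {s : Finset (Sym2 V)} (h : lam A s ≠ 0) :
    ∃ x l, es x l x = s ∧ lw A x l x ≠ 0 := by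
  by_contra hc
  push Not at hc
  apply h
  unfold lam
  have : ∀ n : ℕ, cw A n s / ((n : ℝ) + 1) = 0 := by
    intro n
    have : cw A n s = 0 := by
      unfold cw
      refine sum_eq_zero fun x _ => sum_eq_zero fun w _ => ?_
      split_ifs with h1
      · exact hc _ _ h1
      · rfl
    rw [this, zero_div]
  simp [this]

/-- Standing hypotheses on the weights. -/
structure PosW (A : Matrix V V ℝ) : Prop where
  symm : ∀ x y, A x y = A y x
  nonneg : ∀ x y, 0 ≤ A x y
  pos : ∀ f : V → ℝ, f ≠ 0 → 0 < qf A f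

lemma qf_abs_le {A B : Matrix V V ℝ} (h : ∀ x y, |B x y| ≤ A x y) (f : V → ℝ) :
    qf A (fun x => |f x|) ≤ qf B f := by
  unfold qf
  have h1 : ∑ x, |f x| ^ 2 = ∑ x, f x ^ 2 := sum_congr rfl fun x _ => sq_abs _
  rw [h1]
  apply sub_le_sub_left
  refine sum_le_sum fun x _ => sum_le_sum fun y _ => ?_
  calc B x y * f x * f y ≤ |B x y * f x * f y| := le_abs_self _
    _ = |B x y| * |f x| * |f y| := by rw [abs_mul, abs_mul]
    _ ≤ A x y * |f x| * |f y| := by gcongr; exact h x y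

lemma PosW.pos_of_le {A B : Matrix V V ℝ} (hA : PosW A) (h : ∀ x y, |B x y| ≤ A x y)
    (f : V → ℝ) (hf : f ≠ 0) : 0 < qf B f := by
  refine lt_of_lt_of_le (hA.pos (fun x => |f x|) ?_) (qf_abs_le h f)
  intro h0
  apply hf
  funext x
  have := congrFun h0 x
  simpa using this

lemma PosW.of_le {A B : Matrix V V ℝ} (hA : PosW A) (hs : ∀ x y, B x y = B y x)
    (h0 : ∀ x y, 0 ≤ B x y) (h : ∀ x y, B x y ≤ A x y) : PosW B :=
  ⟨hs, h0, hA.pos_of_le fun x y => by rw [abs_of_nonneg (h0 x y)]; exact h x y⟩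

lemma PosW.res {A : Matrix V V ℝ} (hA : PosW A) (E : Finset (Sym2 V)) : PosW (resM A E) := by
  refine hA.of_le ?_ ?_ ?_
  · intro x y; unfold resM; rw [Sym2.eq_swap, hA.symm x y]
  · intro x y; unfold resM; split_ifs; exacts [hA.nonneg x y, le_rfl]
  · intro x y; unfold resM; split_ifs; exacts [le_rfl, hA.nonneg x y]

lemma PosW.gauss {A : Matrix V V ℝ} (hA : PosW A) :
    Integrable (fun f : V → ℝ => exp (-(qf A f) / 2)) ∧
    Summable (fun n : ℕ => (A ^ (n + 1)).trace / (n + 1)) ∧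
    ∫ f : V → ℝ, exp (-(qf A f) / 2) =
      √(2 * Real.pi) ^ Fintype.card V *
        exp ((∑' n : ℕ, (A ^ (n + 1)).trace / (n + 1)) / 2) := by
  refine gauss_loop A ?_ hA.pos ?_
  · ext x y; simp [Matrix.conjTranspose_apply, hA.symm x y]
  · exact hA.pos_of_le fun x y => by simp [abs_of_nonneg (hA.nonneg x y)]

lemma PosW.summable_cw {A : Matrix V V ℝ} (hA : PosW A) (s : Finset (Sym2 V)) :
    Summable (fun n : ℕ => cw A n s / ((n : ℝ) + 1)) := by
  refine Summable.of_nonneg_of_le (fun n => div_nonneg (cw_nonneg hA.nonneg n s) (by positivity))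
    (fun n => ?_) ((hA.res s).gauss.2.1)
  rw [trace_res]
  gcongr
  exact Finset.single_le_sum (f := fun t => cw A n t) (fun t _ => cw_nonneg hA.nonneg n t)
    (Finset.mem_powerset_self s)

/-- Partition function of the edges in `E`. -/
def Zp (A : Matrix V V ℝ) (E : Finset (Sym2 V)) : ℝ :=
  ∫ f : V → ℝ, exp (-(qf (resM A E) f) / 2)

lemma PosW.Zp_eq {A : Matrix V V ℝ} (hA : PosW A) (E : Finset (Sym2 V)) :
    Zp A E = √(2 * Real.pi) ^ Fintype.card V * exp (∑ s ∈ E.powerset, lam A s) := by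
  unfold Zp
  rw [(hA.res E).gauss.2.2]
  congr 2
  unfold lam
  rw [← sum_div, ← Summable.tsum_finsetSum (fun s _ => hA.summable_cw s)]
  congr 2
  funext n
  rw [trace_res, sum_div]

end closedWalks
end

section
section signs
variable {V : Type*} [Fintype V] [DecidableEq V]
set_option linter.unusedSectionVars false

/-- Sign of an edge. -/
def sg (σ : V → ℤˣ) (e : Sym2 V) : ℤˣ :=
  Sym2.lift ⟨fun x y => σ x * σ y, fun _ _ => mul_comm _ _⟩ e

lemma sg_mk (σ : V → ℤˣ) (x y : V) : sg σ s(x, y) = σ x * σ y := rfl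

lemma sg_mul (σ τ : V → ℤˣ) (e : Sym2 V) : sg (σ * τ) e = sg σ e * sg τ e := by
  induction e with
  | h x y => simp only [sg_mk, Pi.mul_apply]; exact mul_mul_mul_comm _ _ _ _

/-- The sign as a real number. -/
def rs (u : ℤˣ) : ℝ := ((u : ℤ) : ℝ)

lemma rs_mul (u v : ℤˣ) : rs (u * v) = rs u * rs v := by simp [rs]

lemma rs_cases (u : ℤˣ) : rs u = 1 ∨ rs u = -1 := by
  rcases Int.units_eq_one_or u with h | h <;> simp [rs, h]

/-- Connection through a set of edges. -/
def cn (w : Finset (Sym2 V)) : V → V → Prop :=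
  Relation.ReflTransGen (fun u v => s(u, v) ∈ w)

lemma cn_mono {w w' : Finset (Sym2 V)} (h : w ⊆ w') {u v : V} (hc : cn w u v) : cn w' u v :=
  Relation.ReflTransGen.mono (fun _ _ hab => h hab) _ _ hc

lemma cn_symm {w : Finset (Sym2 V)} {u v : V} (hc : cn w u v) : cn w v u := by
  induction hc with
  | refl => exact Relation.ReflTransGen.refl
  | tail _ h ih =>
    refine Relation.ReflTransGen.head ?_ ih
    rw [Sym2.eq_swap]; exact h

lemma sum_sign_nonneg (w : Finset (Sym2 V)) : 0 ≤ ∑ σ : V → ℤˣ, ∏ e ∈ w, rs (sg σ e) := by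
  by_cases h : ∃ τ : V → ℤˣ, ∏ e ∈ w, rs (sg τ e) ≠ 1
  · obtain ⟨τ, hτ⟩ := h
    have e1 : ∑ σ : V → ℤˣ, ∏ e ∈ w, rs (sg σ e) =
        (∏ e ∈ w, rs (sg τ e)) * ∑ σ : V → ℤˣ, ∏ e ∈ w, rs (sg σ e) := by
      conv_lhs => rw [← Equiv.sum_comp (Equiv.mulLeft τ)]
      rw [mul_sum]
      refine sum_congr rfl fun σ _ => ?_
      rw [← Finset.prod_mul_distrib]
      refine Finset.prod_congr rfl fun e _ => ?_
      rw [Equiv.coe_mulLeft, sg_mul, rs_mul]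
    have : (1 - ∏ e ∈ w, rs (sg τ e)) * ∑ σ : V → ℤˣ, ∏ e ∈ w, rs (sg σ e) = 0 := by
      linarith
    rcases mul_eq_zero.1 this with h | h
    · exact absurd (by linarith) hτ
    · rw [h]
  · push Not at h
    exact sum_nonneg fun σ _ => by rw [h σ]; exact zero_le_one

lemma exp_sign (J : ℝ) (u : ℤˣ) :
    exp (J * rs u) = Real.cosh J + rs u * Real.sinh J := by
  rcases rs_cases u with h | h <;> rw [h]
  · rw [mul_one, one_mul, Real.cosh_add_sinh]
  · rw [mul_neg_one, neg_one_mul, ← sub_eq_add_neg, Real.cosh_sub_sinh]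

lemma T_nonneg (J : Sym2 V → ℝ) (hJ : ∀ e, 0 ≤ J e) (w : Finset (Sym2 V)) :
    0 ≤ ∑ σ : V → ℤˣ, ∏ e ∈ w, (exp (J e * rs (sg σ e)) - 1) := by
  have e1 : ∀ σ : V → ℤˣ, ∏ e ∈ w, (exp (J e * rs (sg σ e)) - 1) =
      ∑ t ∈ w.powerset, (∏ e ∈ t, Real.sinh (J e)) * (∏ e ∈ w \ t, (Real.cosh (J e) - 1)) *
        ∏ e ∈ t, rs (sg σ e) := by
    intro σ
    have : ∏ e ∈ w, (exp (J e * rs (sg σ e)) - 1) =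
        ∏ e ∈ w, (rs (sg σ e) * Real.sinh (J e) + (Real.cosh (J e) - 1)) :=
      Finset.prod_congr rfl fun e _ => by rw [exp_sign]; ring
    rw [this, Finset.prod_add]
    refine sum_congr rfl fun t _ => ?_
    rw [Finset.prod_mul_distrib]; ring
  simp_rw [e1]
  rw [sum_comm]
  refine sum_nonneg fun t _ => ?_
  rw [← mul_sum]
  refine mul_nonneg (mul_nonneg ?_ ?_) (sum_sign_nonneg t)
  · exact prod_nonneg fun e _ => Real.sinh_nonneg_iff.2 (hJ e)
  · exact prod_nonneg fun e _ => by linarith [Real.one_le_cosh (J e)]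

lemma cluster_flip (J : Sym2 V → ℝ) (w : Finset (Sym2 V)) (b d : V) (hbd : ¬ cn w b d) :
    ∑ σ : V → ℤˣ, ∏ e ∈ w, (exp (J e * rs (sg σ e)) - exp (-J e)) =
    2 * ∑ σ : V → ℤˣ, if σ b ≠ σ d then
      ∏ e ∈ w, (exp (J e * rs (sg σ e)) - exp (-J e)) else 0 := by
  set k : (V → ℤˣ) → ℝ := fun σ =>
    ∏ e ∈ w, (exp (J e * rs (sg σ e)) - exp (-J e)) with hk
  set τ : V → ℤˣ := fun v => if cn w b v then -1 else 1 with hτ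
  have hτ1 : ∀ e ∈ w, sg τ e = 1 := by
    intro e
    induction e with
    | h x y =>
      intro he
      rw [sg_mk]
      have : cn w b x ↔ cn w b y := by
        constructor
        · intro h; exact Relation.ReflTransGen.tail h he
        · intro h; refine Relation.ReflTransGen.tail h ?_
          rw [Sym2.eq_swap]; exact he
      simp only [hτ, this]
      split_ifs <;> simp
  have hkτ : ∀ σ, k (τ * σ) = k σ := by
    intro σ
    refine Finset.prod_congr rfl fun e he => ?_
    rw [sg_mul, hτ1 e he, one_mul]
  have hb : τ b = -1 := by simp only [hτ]; exact if_pos Relation.ReflTransGen.refl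
  have hd : τ d = 1 := by simp only [hτ]; exact if_neg hbd
  have e1 : ∑ σ : V → ℤˣ, (if σ b ≠ σ d then 0 else k σ) =
      ∑ σ : V → ℤˣ, if σ b ≠ σ d then k σ else 0 := by
    conv_lhs => rw [← Equiv.sum_comp (Equiv.mulLeft τ)]
    refine sum_congr rfl fun σ _ => ?_
    rw [Equiv.coe_mulLeft, hkτ]
    simp only [Pi.mul_apply, hb, hd, one_mul]
    rcases Int.units_eq_one_or (σ b) with h | h <;> rcases Int.units_eq_one_or (σ d) with h' | h' <;>
      simp [h, h']
  have e2 : ∑ σ : V → ℤˣ, k σ = ∑ σ : V → ℤˣ, (if σ b ≠ σ d then 0 else k σ) +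
      ∑ σ : V → ℤˣ, if σ b ≠ σ d then k σ else 0 := by
    rw [← sum_add_distrib]
    refine sum_congr rfl fun σ _ => ?_
    split_ifs <;> simp
  rw [e2, e1]; ring

lemma const_of_cn (J : Sym2 V → ℝ) (w : Finset (Sym2 V)) (b d : V) (hbd : cn w b d)
    (σ : V → ℤˣ) (hσ : σ b ≠ σ d) :
    ∏ e ∈ w, (exp (J e * rs (sg σ e)) - exp (-J e)) = 0 := by
  by_contra hne
  have hall : ∀ e ∈ w, sg σ e = 1 := by
    intro e he
    rcases Int.units_eq_one_or (sg σ e) with h | h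
    · exact h
    · exfalso; apply hne
      refine Finset.prod_eq_zero he ?_
      rw [h]; simp [rs]
  apply hσ
  induction hbd with
  | refl => rfl
  | tail _ h ih =>
    rename_i u v _
    have h1 := hall _ h
    rw [sg_mk] at h1
    by_cases h2 : σ b = σ u
    · rw [h2]
      have := eq_inv_of_mul_eq_one_left h1
      rw [this, Int.units_inv_eq_self]
    · exact absurd (ih h2) h2

lemma sum_powerset_powerset (E : Finset (Sym2 V))
    (F : Finset (Sym2 V) → Finset (Sym2 V) → ℝ) :
    ∑ w' ∈ E.powerset, ∑ w ∈ w'.powerset, F w (w' \ w) =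
      ∑ w ∈ E.powerset, ∑ β ∈ (E \ w).powerset, F w β := by
  rw [Finset.sum_sigma', Finset.sum_sigma']
  refine Finset.sum_bij' (fun p _ => ⟨p.2, p.1 \ p.2⟩) (fun p _ => ⟨p.1 ∪ p.2, p.1⟩) ?_ ?_ ?_ ?_ ?_
  · rintro ⟨a, b⟩ h
    simp only [Finset.mem_sigma, Finset.mem_powerset] at h ⊢
    exact ⟨h.2.trans h.1, Finset.sdiff_subset_sdiff h.1 le_rfl⟩
  · rintro ⟨a, b⟩ h
    simp only [Finset.mem_sigma, Finset.mem_powerset] at h ⊢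
    exact ⟨Finset.union_subset h.1 (h.2.trans Finset.sdiff_subset), Finset.subset_union_left⟩
  · rintro ⟨a, b⟩ h
    simp only [Finset.mem_sigma, Finset.mem_powerset] at h
    simp [Finset.union_sdiff_of_subset h.2]
  · rintro ⟨a, b⟩ h
    simp only [Finset.mem_sigma, Finset.mem_powerset] at h
    have : Disjoint a b := by
      rw [Finset.disjoint_left]; intro x hx hx'
      exact (Finset.mem_sdiff.1 (h.2 hx')).2 hx
    simp [Finset.union_sdiff_cancel_left this]
  · rintro ⟨a, b⟩ h; rfl

lemma sign_ineq (J : Sym2 V → ℝ) (hJ : ∀ e, 0 ≤ J e) (E : Finset (Sym2 V)) (b d : V) :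
    2 * ∑ σ : V → ℤˣ, (if σ b ≠ σ d then ∏ e ∈ E, exp (J e * rs (sg σ e)) else 0) ≤
    ∑ w ∈ E.powerset, if cn w b d then 0 else
      ∑ σ : V → ℤˣ, ∏ e ∈ w, (exp (J e * rs (sg σ e)) - 1) := by
  set T : Finset (Sym2 V) → ℝ := fun w =>
    ∑ σ : V → ℤˣ, ∏ e ∈ w, (exp (J e * rs (sg σ e)) - 1) with hT
  set k : (V → ℤˣ) → Finset (Sym2 V) → ℝ := fun σ w =>
    ∏ e ∈ w, (exp (J e * rs (sg σ e)) - exp (-J e)) with hk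
  set r : Finset (Sym2 V) → ℝ := fun t => ∏ e ∈ t, exp (-J e) with hr
  set s : Finset (Sym2 V) → ℝ := fun t => ∏ e ∈ t, (1 - exp (-J e)) with hs
  have r0 : ∀ t, 0 ≤ r t := fun t => prod_nonneg fun e _ => (Real.exp_pos _).le
  have s0 : ∀ t, 0 ≤ s t := fun t => prod_nonneg fun e _ => by
    have : exp (-J e) ≤ 1 := Real.exp_le_one_iff.2 (by linarith [hJ e])
    linarith
  have T0 : ∀ w, 0 ≤ T w := T_nonneg J hJ
  have hL : 2 * ∑ σ : V → ℤˣ, (if σ b ≠ σ d then ∏ e ∈ E, exp (J e * rs (sg σ e)) else 0)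
      = ∑ w' ∈ E.powerset, if cn w' b d then 0 else r (E \ w') * ∑ σ, k σ w' := by
    have e1 : ∀ σ : V → ℤˣ, ∏ e ∈ E, exp (J e * rs (sg σ e)) =
        ∑ w' ∈ E.powerset, k σ w' * r (E \ w') := by
      intro σ
      rw [← Finset.prod_add]
      exact Finset.prod_congr rfl fun e _ => by ring
    have e2 : ∀ σ : V → ℤˣ,
        (if σ b ≠ σ d then ∏ e ∈ E, exp (J e * rs (sg σ e)) else 0) =
        ∑ w' ∈ E.powerset, (if σ b ≠ σ d then k σ w' else 0) * r (E \ w') := by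
      intro σ
      split_ifs
      · exact e1 σ
      · simp
    simp_rw [e2]
    rw [sum_comm, mul_sum]
    refine sum_congr rfl fun w' _ => ?_
    rw [← Finset.sum_mul]
    split_ifs with hc
    · have : ∑ σ : V → ℤˣ, (if σ b ≠ σ d then k σ w' else 0) = 0 := by
        refine sum_eq_zero fun σ _ => ?_
        split_ifs with h
        · exact const_of_cn J w' b d hc σ h
        · rfl
      rw [this]; ring
    · rw [hk, cluster_flip J w' b d hc]; ring
  rw [hL]
  have e3 : ∀ w', ∑ σ, k σ w' = ∑ w ∈ w'.powerset, T w * s (w' \ w) := by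
    intro w'
    have : ∀ σ, k σ w' = ∑ w ∈ w'.powerset,
        (∏ e ∈ w, (exp (J e * rs (sg σ e)) - 1)) * s (w' \ w) := by
      intro σ
      rw [← Finset.prod_add]
      exact Finset.prod_congr rfl fun e _ => by ring
    simp_rw [this]
    rw [sum_comm]
    refine sum_congr rfl fun w _ => ?_
    rw [← Finset.sum_mul]
  have e4 : ∀ w, ∑ β ∈ (E \ w).powerset, s β * r ((E \ w) \ β) = 1 := by
    intro w
    rw [← Finset.prod_add]
    exact Finset.prod_eq_one fun e _ => by ring
  calc ∑ w' ∈ E.powerset, (if cn w' b d then 0 else r (E \ w') * ∑ σ, k σ w')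
      ≤ ∑ w' ∈ E.powerset, ∑ w ∈ w'.powerset,
          (if cn w b d then 0 else T w) * (s (w' \ w) * r ((E \ w) \ (w' \ w))) := by
        refine sum_le_sum fun w' hw' => ?_
        rw [Finset.mem_powerset] at hw'
        split_ifs with hc
        · refine sum_nonneg fun w _ => mul_nonneg ?_ (mul_nonneg (s0 _) (r0 _))
          split_ifs; exacts [le_rfl, T0 w]
        · rw [e3, mul_sum]
          refine le_of_eq (sum_congr rfl fun w hw => ?_)
          rw [Finset.mem_powerset] at hw
          rw [if_neg (fun h => hc (cn_mono hw h))]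
          have : (E \ w) \ (w' \ w) = E \ w' := by
            ext e; simp only [Finset.mem_sdiff]
            constructor
            · rintro ⟨⟨h1, h2⟩, h3⟩; exact ⟨h1, fun h => h3 ⟨h, h2⟩⟩
            · rintro ⟨h1, h2⟩; exact ⟨⟨h1, fun h => h2 (hw h)⟩, fun h => h2 h.1⟩
          rw [this]; ring
    _ = ∑ w ∈ E.powerset, ∑ β ∈ (E \ w).powerset,
          (if cn w b d then 0 else T w) * (s β * r ((E \ w) \ β)) :=
        sum_powerset_powerset E
          (fun w β => (if cn w b d then 0 else T w) * (s β * r ((E \ w) \ β)))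
    _ = _ := by
        refine sum_congr rfl fun w _ => ?_
        rw [← mul_sum, e4, mul_one]

end signs
end

section
section moebius
variable {V : Type*} [Fintype V] [DecidableEq V]
set_option linter.unusedSectionVars false

lemma sum_pairs (F : Sym2 V → ℝ) (h0 : ∀ x, F s(x, x) = 0) :
    ∑ x, ∑ y, F s(x, y) = 2 * ∑ e : Sym2 V, F e := by
  rw [← Fintype.sum_prod_type' (f := fun x y => F s(x, y))]
  rw [← Finset.sum_fiberwise (s := Finset.univ) (g := fun p : V × V => s(p.1, p.2)), mul_sum]
  refine sum_congr rfl fun e _ => ?_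
  induction e with
  | h a b =>
    by_cases hab : a = b
    · subst hab
      rw [h0, mul_zero]
      refine sum_eq_zero fun p hp => ?_
      rw [(mem_filter.1 hp).2, h0]
    · have : Finset.univ.filter (fun p : V × V => s(p.1, p.2) = s(a, b)) = {(a, b), (b, a)} := by
        ext p
        simp only [mem_filter, Finset.mem_univ, true_and, Sym2.eq_iff, Finset.mem_insert,
          Finset.mem_singleton, Prod.ext_iff]
      rw [this, Finset.sum_pair (by simp [hab]), Sym2.eq_swap]; ring

/-- Edge energy. -/
def ep (A : Matrix V V ℝ) (f : V → ℝ) (e : Sym2 V) : ℝ :=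
  Sym2.lift ⟨fun x y => (A x y + A y x) / 2 * (f x * f y), fun x y => by ring⟩ e

lemma ep_mk (A : Matrix V V ℝ) (f : V → ℝ) (x y : V) :
    ep A f s(x, y) = (A x y + A y x) / 2 * (f x * f y) := rfl

lemma exp_qf {A : Matrix V V ℝ} (hA : PosW A) (hd : ∀ x, A x x = 0) (E : Finset (Sym2 V))
    (f : V → ℝ) : exp (-(qf (resM A E) f) / 2) =
      exp (-(∑ x, f x ^ 2) / 2) * ∏ e ∈ E, exp (ep A f e) := by
  rw [← Real.exp_sum, ← Real.exp_add]
  congr 1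
  have h1 : ∑ x, ∑ y, resM A E x y * f x * f y =
      ∑ x, ∑ y, (fun e : Sym2 V => if e ∈ E then ep A f e else 0) s(x, y) := by
    refine sum_congr rfl fun x _ => sum_congr rfl fun y _ => ?_
    simp only [resM, ep_mk, hA.symm y x]
    split_ifs <;> ring
  rw [qf, h1, sum_pairs (fun e : Sym2 V => if e ∈ E then ep A f e else 0)
    (fun x => by simp [ep_mk, hd]), Finset.sum_ite_mem, Finset.univ_inter]
  ring

/-- Density of the random edge set. -/
def th (A : Matrix V V ℝ) (w : Finset (Sym2 V)) (f : V → ℝ) : ℝ :=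
  exp (-(∑ x, f x ^ 2) / 2) * ∏ e ∈ w, (exp (ep A f e) - 1)

lemma th_integrable {A : Matrix V V ℝ} (hA : PosW A) (hd : ∀ x, A x x = 0)
    (w : Finset (Sym2 V)) : Integrable (th A w) := by
  have : th A w = fun f => ∑ t ∈ w.powerset,
      exp (-(qf (resM A t) f) / 2) * ∏ e ∈ w \ t, (-1 : ℝ) := by
    funext f
    simp only [th, exp_qf hA hd, sub_eq_add_neg, Finset.prod_add, mul_sum]
    exact sum_congr rfl fun t _ => by ring
  rw [this]
  exact integrable_finsetSum _ fun t _ => ((hA.res t).gauss.1).mul_const _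

lemma Zp_eq_sum {A : Matrix V V ℝ} (hA : PosW A) (hd : ∀ x, A x x = 0)
    (E : Finset (Sym2 V)) : Zp A E = ∑ w ∈ E.powerset, ∫ f, th A w f := by
  rw [← integral_finsetSum _ (fun w _ => th_integrable hA hd w)]
  unfold Zp
  congr 1
  funext f
  rw [exp_qf hA hd]
  unfold th
  rw [← mul_sum]
  congr 1
  have := Finset.prod_add (fun e => exp (ep A f e) - 1) (fun _ => (1 : ℝ)) E
  simp only [sub_add_cancel, Finset.prod_const_one, mul_one] at this
  exact this

/-- Weight of a family of supports. -/
def bw (A : Matrix V V ℝ) (c : Finset (Finset (Sym2 V))) : ℝ :=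
  ∏ s ∈ c, (exp (lam A s) - 1)

lemma bw_nonneg {A : Matrix V V ℝ} (hA : PosW A) (c : Finset (Finset (Sym2 V))) :
    0 ≤ bw A c :=
  prod_nonneg fun s _ => by
    have := Real.one_le_exp (lam_nonneg hA.nonneg s)
    linarith

lemma sum_bw (A : Matrix V V ℝ) (F : Finset (Finset (Sym2 V))) :
    ∑ c ∈ F.powerset, bw A c = exp (∑ s ∈ F, lam A s) := by
  rw [Real.exp_sum]
  have := Finset.prod_add (fun s => exp (lam A s) - 1) (fun _ => (1 : ℝ)) F
  simp only [sub_add_cancel, Finset.prod_const_one, mul_one] at this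
  exact this.symm

lemma sum_union {A : Matrix V V ℝ} (hA : PosW A) (hd : ∀ x, A x x = 0) (w : Finset (Sym2 V)) :
    √(2 * Real.pi) ^ Fintype.card V * ∑ c : Finset (Finset (Sym2 V)),
      (if c.sup id = w then bw A c else 0) = ∫ f, th A w f := by
  induction w using Finset.strongInduction with
  | H w ih =>
    have h1 := Zp_eq_sum hA hd w
    rw [hA.Zp_eq w, ← sum_bw A w.powerset] at h1
    have h2 : ∑ c ∈ w.powerset.powerset, bw A c = ∑ t ∈ w.powerset,
        ∑ c : Finset (Finset (Sym2 V)), (if c.sup id = t then bw A c else 0) := by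
      rw [sum_comm]
      have e : ∀ c : Finset (Finset (Sym2 V)),
          ∑ t ∈ w.powerset, (if c.sup id = t then bw A c else 0) =
          if c ∈ w.powerset.powerset then bw A c else 0 := by
        intro c
        rw [Finset.sum_ite_eq]
        have : c.sup id ∈ w.powerset ↔ c ∈ w.powerset.powerset := by
          rw [Finset.mem_powerset, Finset.mem_powerset, Finset.sup_le_iff]
          simp [Finset.subset_iff]
        simp only [this]
      simp_rw [e]
      rw [Finset.sum_ite_mem, Finset.univ_inter]
    rw [h2, ← Finset.insert_erase (Finset.mem_powerset_self w),
      Finset.sum_insert (Finset.notMem_erase _ _), Finset.sum_insert (Finset.notMem_erase _ _),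
      mul_add, mul_sum (s := w.powerset.erase w)] at h1
    have h3 : ∑ t ∈ w.powerset.erase w, √(2 * Real.pi) ^ Fintype.card V *
        ∑ c : Finset (Finset (Sym2 V)), (if c.sup id = t then bw A c else 0) =
        ∑ t ∈ w.powerset.erase w, ∫ f, th A t f := by
      refine sum_congr rfl fun t ht => ih t ?_
      rw [Finset.mem_erase, Finset.mem_powerset] at ht
      exact Finset.ssubset_iff_subset_ne.2 ⟨ht.2, ht.1⟩
    linarith

/-- Flip the signs of a field. -/
def fl (σ : V → ℤˣ) (f : V → ℝ) : V → ℝ := fun x => rs (σ x) * f x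

lemma fl_preserving (σ : V → ℤˣ) : MeasurePreserving (fl σ) volume volume := by
  have : ∀ x, MeasurePreserving (fun t : ℝ => rs (σ x) * t) volume volume := by
    intro x
    rcases rs_cases (σ x) with h | h <;> rw [h]
    · simp only [one_mul]; exact MeasurePreserving.id volume
    · simpa using Measure.measurePreserving_neg (volume : Measure ℝ)
  exact volume_preserving_pi this

lemma integral_le_of_sign {F G : (V → ℝ) → ℝ} (hF : Integrable F) (hG : Integrable G)
    (h : ∀ f : V → ℝ, (∀ x, 0 ≤ f x) → ∑ σ : V → ℤˣ, F (fl σ f) ≤ ∑ σ : V → ℤˣ, G (fl σ f)) :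
    ∫ f, F f ≤ ∫ f, G f := by
  have h' : ∀ f : V → ℝ, ∑ σ : V → ℤˣ, F (fl σ f) ≤ ∑ σ : V → ℤˣ, G (fl σ f) := by
    intro f
    set τ : V → ℤˣ := fun x => if 0 ≤ f x then 1 else -1 with hτ
    have hf : ∀ σ, fl σ f = fl (Equiv.mulRight τ σ) (fun x => |f x|) := by
      intro σ
      funext x
      simp only [fl, Equiv.coe_mulRight, Pi.mul_apply, rs_mul, hτ]
      split_ifs with hx
      · rw [abs_of_nonneg hx]; simp [rs]
      · rw [abs_of_neg (not_le.1 hx)]; simp [rs]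
    simp_rw [hf]
    rw [Equiv.sum_comp (Equiv.mulRight τ) (fun σ => F (fl σ fun x => |f x|)),
      Equiv.sum_comp (Equiv.mulRight τ) (fun σ => G (fl σ fun x => |f x|))]
    exact h _ fun x => abs_nonneg _
  have key : ∀ H : (V → ℝ) → ℝ, Integrable H →
      ∫ f, ∑ σ : V → ℤˣ, H (fl σ f) = Fintype.card (V → ℤˣ) * ∫ f, H f := by
    intro H hH
    rw [integral_finsetSum (f := fun (σ : V → ℤˣ) f => H (fl σ f)) _
      (fun σ _ => (fl_preserving σ).integrable_comp_of_integrable hH)]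
    have : ∀ σ : V → ℤˣ, ∫ f, H (fl σ f) = ∫ f, H f := by
      intro σ
      have := integral_map (μ := volume) (fl_preserving σ).measurable.aemeasurable (f := H)
        (by rw [(fl_preserving σ).map_eq]; exact hH.aestronglyMeasurable)
      rw [(fl_preserving σ).map_eq] at this
      exact this.symm
    simp [this]
  have hm : ∫ f, ∑ σ : V → ℤˣ, F (fl σ f) ≤ ∫ f, ∑ σ : V → ℤˣ, G (fl σ f) :=
    integral_mono
      (integrable_finsetSum _ fun σ _ => (fl_preserving σ).integrable_comp_of_integrable hF)
      (integrable_finsetSum _ fun σ _ => (fl_preserving σ).integrable_comp_of_integrable hG) h'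
  rw [key F hF, key G hG] at hm
  exact le_of_mul_le_mul_left hm (by exact_mod_cast Fintype.card_pos)

lemma ep_fl (A : Matrix V V ℝ) (σ : V → ℤˣ) (f : V → ℝ) (e : Sym2 V) :
    ep A (fl σ f) e = ep A f e * rs (sg σ e) := by
  induction e with
  | h x y => simp only [ep_mk, fl, sg_mk, rs_mul]; ring

lemma resM_univ (A : Matrix V V ℝ) : resM A Finset.univ = A := by
  ext x y; simp [resM]

/-- Probability of disconnection bounded below by the probability of opposite signs. -/
lemma disc_ge {A : Matrix V V ℝ} (hA : PosW A) (hd : ∀ x, A x x = 0) (b d : V) :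
    2 * ∫ f in {f : V → ℝ | f b * f d < 0}, exp (-(qf A f) / 2) ≤
    √(2 * Real.pi) ^ Fintype.card V * ∑ c : Finset (Finset (Sym2 V)),
      (if cn (c.sup id) b d then 0 else bw A c) := by
  have h1 : √(2 * Real.pi) ^ Fintype.card V * ∑ c : Finset (Finset (Sym2 V)),
      (if cn (c.sup id) b d then 0 else bw A c) =
      ∫ f, ∑ w : Finset (Sym2 V), if cn w b d then 0 else th A w f := by
    rw [integral_finsetSum]
    · have e : ∑ c : Finset (Finset (Sym2 V)), (if cn (c.sup id) b d then 0 else bw A c) =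
          ∑ w : Finset (Sym2 V), if cn w b d then 0 else ∑ c : Finset (Finset (Sym2 V)),
            (if c.sup id = w then bw A c else 0) := by
        have : ∀ w : Finset (Sym2 V), (if cn w b d then 0 else ∑ c : Finset (Finset (Sym2 V)),
            (if c.sup id = w then bw A c else 0)) = ∑ c : Finset (Finset (Sym2 V)),
            if c.sup id = w then (if cn (c.sup id) b d then 0 else bw A c) else 0 := by
          intro w
          split_ifs with h
          · refine (sum_eq_zero fun c _ => ?_).symm
            split_ifs with h1 h2
            · rfl
            · rw [h1] at h2; exact absurd h h2
            · rfl
          · refine sum_congr rfl fun c _ => ?_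
            split_ifs with h1 h2
            · rw [h1] at h2; exact absurd h2 h
            · rfl
            · rfl
        simp_rw [this]
        rw [sum_comm]
        refine sum_congr rfl fun c _ => ?_
        rw [Finset.sum_ite_eq]; simp
      rw [e, mul_sum]
      refine sum_congr rfl fun w _ => ?_
      split_ifs
      · simp
      · exact sum_union hA hd w
    · intro w _
      split_ifs
      · exact integrable_zero _ _ _
      · exact th_integrable hA hd w
  have hms : MeasurableSet {f : V → ℝ | f b * f d < 0} :=
    measurableSet_lt ((measurable_pi_apply b).mul (measurable_pi_apply d)) measurable_const
  rw [h1, ← integral_indicator hms, ← integral_const_mul]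
  have hgi := hA.gauss.1
  refine integral_le_of_sign ((hgi.indicator hms).const_mul 2) ?_ ?_
  · refine integrable_finsetSum _ fun w _ => ?_
    split_ifs
    · exact integrable_zero _ _ _
    · exact th_integrable hA hd w
  · intro f hf
    have hS := sign_ineq (ep A f) (fun e => by
      induction e with
      | h x y =>
        rw [ep_mk]
        have := hA.nonneg x y; have := hA.nonneg y x
        have := mul_nonneg (hf x) (hf y); positivity) Finset.univ b d
    set g := exp (-(∑ x, f x ^ 2) / 2) with hg
    have hsq : ∀ σ : V → ℤˣ, exp (-(∑ x, fl σ f x ^ 2) / 2) = g := by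
      intro σ
      rw [hg]; congr 3
      refine sum_congr rfl fun x _ => ?_
      simp only [fl, mul_pow]
      rcases rs_cases (σ x) with h | h <;> rw [h] <;> ring
    calc _ ≤ g * (2 * ∑ σ : V → ℤˣ, (if σ b ≠ σ d then
            ∏ e : Sym2 V, exp (ep A f e * rs (sg σ e)) else 0)) := by
          rw [← mul_assoc, mul_sum]
          refine sum_le_sum fun σ _ => ?_
          rw [mul_comm g 2, mul_assoc]
          gcongr
          rw [indicator_apply]
          split_ifs with h h2 h2
          · have := exp_qf hA hd Finset.univ (fl σ f)
            rw [resM_univ] at this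
            rw [this, hsq]
            simp_rw [ep_fl]; exact le_rfl
          · exfalso
            push Not at h2
            have h' : fl σ f b * fl σ f d < 0 := h
            simp only [fl, h2] at h'
            have := mul_nonneg (hf b) (hf d)
            rcases rs_cases (σ d) with h | h <;> rw [h] at h' <;> linarith
          · exact mul_nonneg (Real.exp_pos _).le (prod_nonneg fun e _ => (Real.exp_pos _).le)
          · simp
      _ ≤ g * _ := mul_le_mul_of_nonneg_left hS (Real.exp_pos _).le
      _ = _ := by
          rw [sum_comm, mul_sum, Finset.powerset_univ]
          refine sum_congr rfl fun w _ => ?_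
          split_ifs
          · simp
          · rw [mul_sum]
            refine sum_congr rfl fun σ _ => ?_
            unfold th
            rw [hsq]
            simp_rw [ep_fl]

end moebius
end

section
section split
variable {V : Type*} [Fintype V] [DecidableEq V]
set_option linter.unusedSectionVars false

/-- Delete the edges at `b`. -/
def del (A : Matrix V V ℝ) (b : V) : Matrix V V ℝ := fun x y => if x = b ∨ y = b then 0 else A x y

lemma PosW.del {A : Matrix V V ℝ} (hA : PosW A) (b : V) : PosW (del A b) := by
  refine hA.of_le ?_ ?_ ?_
  · intro x y; unfold RWLSPaper.del; rw [hA.symm x y]; simp only [or_comm]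
  · intro x y; unfold RWLSPaper.del; split_ifs; exacts [le_rfl, hA.nonneg x y]
  · intro x y; unfold RWLSPaper.del; split_ifs; exacts [hA.nonneg x y, le_rfl]

lemma qf_add {A : Matrix V V ℝ} (hA : ∀ x y, A x y = A y x) (f g : V → ℝ) :
    qf A (f + g) = qf A f + qf A g + 2 * ∑ x, g x * (f x - ∑ y, A x y * f y) := by
  unfold qf
  have h1 : ∑ x, ∑ y, A x y * (f + g) x * (f + g) y = ∑ x, ∑ y, A x y * f x * f y +
      ∑ x, ∑ y, A x y * g x * g y + 2 * ∑ x, ∑ y, g x * (A x y * f y) := by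
    have h2 : ∑ x, ∑ y, A x y * f x * g y = ∑ x, ∑ y, g x * (A x y * f y) := by
      rw [sum_comm]
      refine sum_congr rfl fun x _ => sum_congr rfl fun y _ => ?_
      rw [hA y x]; ring
    have h3 : ∀ x y, A x y * (f + g) x * (f + g) y = A x y * f x * f y + A x y * g x * g y +
        (A x y * f x * g y + g x * (A x y * f y)) := by
      intro x y; simp only [Pi.add_apply]; ring
    simp_rw [h3, sum_add_distrib]
    rw [h2]; ring
  rw [h1]
  simp only [mul_sub, Finset.sum_sub_distrib, mul_sum, Pi.add_apply, add_sq,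
    sum_add_distrib]
  have : ∀ i, 2 * f i * g i = 2 * (g i * f i) := fun i => by ring
  simp_rw [this]
  ring

lemma qf_smul (A : Matrix V V ℝ) (c : ℝ) (f : V → ℝ) : qf A (c • f) = c ^ 2 * qf A f := by
  unfold qf
  rw [mul_sub, mul_sum, mul_sum]
  congr 1
  · exact sum_congr rfl fun x _ => by simp only [Pi.smul_apply, smul_eq_mul]; ring
  · refine sum_congr rfl fun x _ => ?_
    rw [mul_sum]
    exact sum_congr rfl fun y _ => by simp only [Pi.smul_apply, smul_eq_mul]; ring

lemma PosW.qf_nonneg {A : Matrix V V ℝ} (hA : PosW A) (f : V → ℝ) : 0 ≤ qf A f := by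
  by_cases h : f = 0
  · subst h; simp [qf]
  · exact (hA.pos f h).le

/-- Harmonicity at `x`. -/
def Harm (A : Matrix V V ℝ) (h : V → ℝ) (x : V) : Prop := h x = ∑ y, A x y * h y

lemma qf_harm {A : Matrix V V ℝ} (hA : ∀ x y, A x y = A y x) {f g : V → ℝ}
    (h : ∀ x, g x = 0 ∨ Harm A f x) : qf A (f + g) = qf A f + qf A g := by
  rw [qf_add hA]
  have : ∑ x, g x * (f x - ∑ y, A x y * f y) = 0 := by
    refine sum_eq_zero fun x _ => ?_
    rcases h x with h | h
    · rw [h, zero_mul]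
    · unfold Harm at h; rw [← h, sub_self, mul_zero]
  rw [this]; ring

lemma exists_harm {A : Matrix V V ℝ} (hA : PosW A) (p : V → Prop) (g : V → ℝ) :
    ∃ h : V → ℝ, (∀ x, p x → h x = g x) ∧ ∀ x, ¬ p x → Harm A h x := by
  let N : (V → ℝ) →ₗ[ℝ] (V → ℝ) :=
    { toFun := fun f x => if p x then f x else f x - ∑ y, A x y * f y
      map_add' := by
        intro f f'; funext x
        simp only [Pi.add_apply, mul_add, sum_add_distrib]
        split_ifs
        · rfl
        · ring
      map_smul' := by
        intro c f; funext x
        simp only [Pi.smul_apply, smul_eq_mul, RingHom.id_apply]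
        split_ifs
        · rfl
        · rw [mul_sub, mul_sum]
          congr 1
          exact sum_congr rfl fun y _ => by ring }
  have hN : ∀ f x, N f x = if p x then f x else f x - ∑ y, A x y * f y := fun f x => rfl
  have hinj : Function.Injective N := by
    rw [← LinearMap.ker_eq_bot, LinearMap.ker_eq_bot']
    intro f hf
    by_contra hne
    have hpos := hA.pos f hne
    have : qf A f = ∑ x, f x * (f x - ∑ y, A x y * f y) := by
      unfold qf
      rw [← Finset.sum_sub_distrib]
      refine sum_congr rfl fun x _ => ?_
      rw [mul_sub, mul_sum]
      congr 1
      · ring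
      · exact sum_congr rfl fun y _ => by ring
    have h0 : qf A f = 0 := by
      rw [this]
      refine sum_eq_zero fun x _ => ?_
      have hx := congrFun hf x
      rw [hN] at hx
      split_ifs at hx with hp
      · rw [hx]; simp
      · rw [hx]; simp
    linarith
  obtain ⟨h, hh⟩ := (LinearMap.injective_iff_surjective.1 hinj) (fun x => if p x then g x else 0)
  refine ⟨h, fun x hx => ?_, fun x hx => ?_⟩
  · have := congrFun hh x
    rw [hN] at this
    simpa [hx] using this
  · have := congrFun hh x
    rw [hN] at this
    simp only [hx, if_false] at this
    unfold Harm; linarith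

/-- One-column linear map. -/
def col (b : V) (v : V → ℝ) (f : V → ℝ) : V → ℝ := fun x => if x = b then f b * v b else f x + f b * v x

lemma cov0 (b : V) (v : V → ℝ) (hv : v b ≠ 0) : MeasurableEmbedding (col b v) ∧
    Measure.map (col b v) volume = ofReal |(v b)⁻¹| • volume := by
  have hdet : ((1 : Matrix V V ℝ).updateCol b v).det = v b := by
    rw [← Matrix.cramer_apply, Matrix.cramer_one]; rfl
  set M := (1 : Matrix V V ℝ).updateCol b v with hM
  have hne : M.det ≠ 0 := by rw [hdet]; exact hv
  have hcol : ∀ f, col b v f = Matrix.toLin' M f := by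
    intro f
    funext x
    rw [Matrix.toLin'_apply, Matrix.mulVec, dotProduct]
    rw [← Finset.add_sum_erase _ _ (Finset.mem_univ b)]
    have h1 : M x b * f b = f b * v x := by rw [hM, Matrix.updateCol_self]; ring
    have h2 : ∑ y ∈ Finset.univ.erase b, M x y * f y = if x = b then 0 else f x := by
      have : ∀ y ∈ Finset.univ.erase b, M x y * f y = if x = y then f y else 0 := by
        intro y hy
        rw [hM, Matrix.updateCol_ne (Finset.ne_of_mem_erase hy), Matrix.one_apply]
        split_ifs <;> simp
      rw [sum_congr rfl this, Finset.sum_ite_eq]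
      simp
    rw [h1, h2]
    unfold col
    split_ifs with h
    · rw [h]; ring
    · ring
  have hmap := Real.map_matrix_volume_pi_eq_smul_volume_pi hne
  let Le : (V → ℝ) ≃ₗ[ℝ] (V → ℝ) := Matrix.toLinearEquiv' M (Matrix.invertibleOfIsUnitDet M (Ne.isUnit hne))
  have hemb : MeasurableEmbedding (Matrix.toLin' M) :=
    (Le.toContinuousLinearEquiv.toHomeomorph).measurableEmbedding
  have hc : col b v = Matrix.toLin' M := funext hcol
  rw [hc, hmap, hdet]
  exact ⟨hemb, rfl⟩

lemma cov1 (b : V) (v : V → ℝ) (hv : v b ≠ 0) (F : (V → ℝ) → ℝ) :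
    ∫ f, F f = |v b| * ∫ f, F (col b v f) := by
  obtain ⟨hemb, hmap⟩ := cov0 b v hv
  have h2 := hemb.integral_map (μ := volume) F
  rw [hmap, integral_smul_measure, ENNReal.toReal_ofReal (abs_nonneg _), abs_inv] at h2
  rw [← h2, smul_eq_mul, mul_inv_cancel_left₀ (abs_ne_zero.2 hv)]

lemma cov1_int (b : V) (v : V → ℝ) (hv : v b ≠ 0) {F : (V → ℝ) → ℝ} (hF : Integrable F) :
    Integrable (fun f => F (col b v f)) := by
  obtain ⟨hemb, hmap⟩ := cov0 b v hv
  have := hemb.integrable_map_iff (μ := volume) (g := F)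
  rw [hmap] at this
  exact this.1 (hF.smul_measure ENNReal.ofReal_ne_top)

/-- `f` with the value at `b` replaced by zero. -/
def zr (b : V) (f : V → ℝ) : V → ℝ := fun x => if x = b then 0 else f x

lemma qf_del (A : Matrix V V ℝ) (_hd : ∀ x, A x x = 0) (b : V) (f : V → ℝ) :
    qf (del A b) f = f b ^ 2 + qf A (zr b f) := by
  unfold qf
  have h1 : ∑ x, f x ^ 2 = f b ^ 2 + ∑ x, zr b f x ^ 2 := by
    rw [← Finset.add_sum_erase _ _ (Finset.mem_univ b),
      ← Finset.add_sum_erase _ (fun x => zr b f x ^ 2) (Finset.mem_univ b)]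
    have : zr b f b = 0 := if_pos rfl
    rw [this]
    have : ∑ x ∈ Finset.univ.erase b, f x ^ 2 = ∑ x ∈ Finset.univ.erase b, zr b f x ^ 2 :=
      sum_congr rfl fun x hx => by rw [zr, if_neg (Finset.ne_of_mem_erase hx)]
    rw [this]; ring
  have h2 : ∀ x y, del A b x y * f x * f y = A x y * zr b f x * zr b f y := by
    intro x y
    unfold del zr
    by_cases hx : x = b <;> by_cases hy : y = b <;> simp [hx, hy]
  simp_rw [h2]
  rw [h1]; ring

lemma col_eq (b : V) (h : V → ℝ) (hb : h b = 1) (s : ℝ) (f : V → ℝ) :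
    col b (s⁻¹ • h) f = (f b / s) • h + zr b f := by
  funext x
  simp only [col, zr, Pi.smul_apply, Pi.add_apply, smul_eq_mul]
  split_ifs with hx
  · rw [hx, hb]; ring
  · ring

lemma harm_smul {A : Matrix V V ℝ} {h : V → ℝ} {x : V} (hh : Harm A h x) (c : ℝ) :
    Harm A (c • h) x := by
  unfold Harm at *
  simp only [Pi.smul_apply, smul_eq_mul]
  rw [hh, mul_sum]
  exact sum_congr rfl fun y _ => by ring

lemma ne_zero_of_one {h : V → ℝ} {b : V} (hb : h b = 1) : h ≠ 0 := by
  intro h0; rw [h0] at hb; simp at hb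

lemma split1 {A : Matrix V V ℝ} (hA : PosW A) (hd : ∀ x, A x x = 0) {b : V} {h : V → ℝ}
    (hb : h b = 1) (hh : ∀ x, x ≠ b → Harm A h x) :
    ∫ f : V → ℝ, exp (-(qf A f) / 2) =
      (√(qf A h))⁻¹ * ∫ f : V → ℝ, exp (-(qf (del A b) f) / 2) := by
  have hq : 0 < qf A h := hA.pos h (ne_zero_of_one hb)
  have hs : 0 < √(qf A h) := Real.sqrt_pos.2 hq
  have hv : ((√(qf A h))⁻¹ • h) b = (√(qf A h))⁻¹ := by simp [hb]
  rw [cov1 b ((√(qf A h))⁻¹ • h) (by rw [hv]; positivity), hv, abs_of_pos (by positivity)]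
  congr 2
  funext f
  rw [col_eq b h hb, qf_harm hA.symm (fun x => ?_), qf_smul, qf_del A hd, div_pow,
    Real.sq_sqrt hq.le, div_mul_cancel₀ _ hq.ne']
  by_cases hx : x = b
  · left; simp [zr, hx]
  · right; exact harm_smul (hh x hx) _

lemma qf_min {A : Matrix V V ℝ} (hA : PosW A) {p : V → Prop} {h g : V → ℝ}
    (hp : ∀ x, p x → h x = g x) (hh : ∀ x, ¬ p x → Harm A h x) : qf A h ≤ qf A g := by
  have : g = h + (g - h) := by simp
  rw [this, qf_harm hA.symm (fun x => ?_)]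
  · linarith [hA.qf_nonneg (g - h)]
  · by_cases hx : p x
    · left; simp [hp x hx]
    · right; exact hh x hx

lemma half_integral {F : (V → ℝ) → ℝ} (hF : Integrable F) {b d : V} (hbd : b ≠ d)
    (hsym : ∀ σ f, F (fl σ f) = F f ∨ ∃ x, x ≠ b ∧ σ x ≠ 1) :
    ∫ f in {f : V → ℝ | f b * f d < 0}, F f = (∫ f, F f) / 2 := by
  set S := {f : V → ℝ | f b * f d < 0} with hS
  have hms : MeasurableSet S :=
    measurableSet_lt ((measurable_pi_apply b).mul (measurable_pi_apply d)) measurable_const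
  set σ : V → ℤˣ := fun x => if x = b then -1 else 1 with hσ
  have hFσ : ∀ f, F (fl σ f) = F f := by
    intro f
    rcases hsym σ f with h | ⟨x, hx, h⟩
    · exact h
    · simp [hσ, hx] at h
  have h1 : ∫ f, S.indicator F f = ∫ f, S.indicator F (fl σ f) := by
    have := integral_map (μ := volume) (fl_preserving σ).measurable.aemeasurable
      (f := S.indicator F)
      (by rw [(fl_preserving σ).map_eq]; exact (hF.indicator hms).aestronglyMeasurable)
    rwa [(fl_preserving σ).map_eq] at this
  have hnull : ∀ x : V, volume {f : V → ℝ | f x = 0} = 0 := fun x => by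
    rw [volume_pi]; exact Measure.pi_hyperplane _ x 0
  have h2 : ∀ᵐ f : V → ℝ, S.indicator F f + S.indicator F (fl σ f) = F f := by
    have hb := measure_eq_zero_iff_ae_notMem.1 (hnull b)
    have hdd := measure_eq_zero_iff_ae_notMem.1 (hnull d)
    filter_upwards [hb, hdd] with f hfb hfd
    have hfb' : f b ≠ 0 := hfb
    have hfd' : f d ≠ 0 := hfd
    have e1 : fl σ f ∈ S ↔ 0 < f b * f d := by
      simp only [hS, mem_ofPred_eq, fl, hσ, if_true, if_neg hbd.symm, rs]
      simp
    have e2 : f ∈ S ↔ f b * f d < 0 := Iff.rfl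
    rw [indicator_apply, indicator_apply, hFσ]
    simp only [e1, e2]
    rcases lt_or_gt_of_ne (mul_ne_zero hfb' hfd') with h | h
    · simp [h, h.not_gt]
    · simp [h, h.not_gt]
  rw [← integral_indicator hms]
  have h3 : ∫ f, S.indicator F f + S.indicator F (fl σ f) = ∫ f, F f := integral_congr_ae h2
  have h4 := integral_add (μ := volume) (f := S.indicator F)
    (g := fun f => S.indicator F (fl σ f)) (hF.indicator hms)
    ((fl_preserving σ).integrable_comp_of_integrable (hF.indicator hms))
  linarith

end split
end

section
section opp
variable {V : Type*} [Fintype V] [DecidableEq V]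
set_option linter.unusedSectionVars false

lemma opp_sign {A : Matrix V V ℝ} (hA : PosW A) (hd : ∀ x, A x x = 0) {b d : V} (hbd : b ≠ d)
    {e1 m1 : ℝ} {h : V → ℝ} (hb : h b = 1) (hd0 : h d = 0) (he : qf A h ≤ e1)
    (hm : ∀ f : V → ℝ, f b = 1 → m1 ≤ qf A f) :
    √(m1 / e1) / 4 * ∫ f : V → ℝ, exp (-(qf A f) / 2) ≤
      ∫ f in {f : V → ℝ | f b * f d < 0}, exp (-(qf A f) / 2) := by
  have hdb := hbd.symm
  obtain ⟨hB, hB1, hB2⟩ := exists_harm hA (fun x => x = b) (fun _ => 1)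
  obtain ⟨h1, h11, h12⟩ := exists_harm hA (fun x => x = b ∨ x = d) (fun x => if x = b then 1 else 0)
  obtain ⟨h2, h21, h22⟩ := exists_harm hA (fun x => x = b ∨ x = d) (fun x => if x = d then 1 else 0)
  have hBb : hB b = 1 := hB1 b rfl
  have h1b : h1 b = 1 := by rw [h11 b (Or.inl rfl), if_pos rfl]
  have h1d : h1 d = 0 := by rw [h11 d (Or.inr rfl), if_neg hdb]
  have h2b : h2 b = 0 := by rw [h21 b (Or.inl rfl), if_neg hbd]
  have h2d : h2 d = 1 := by rw [h21 d (Or.inr rfl), if_pos rfl]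
  have hqB : 0 < qf A hB := hA.pos _ (ne_zero_of_one hBb)
  have hq1 : 0 < qf A h1 := hA.pos _ (ne_zero_of_one h1b)
  have hq2 : 0 < qf A h2 := hA.pos _ (ne_zero_of_one h2d)
  have hzr : zr b h2 = h2 := by
    funext x; unfold zr; split_ifs with hx
    · rw [hx, h2b]
    · rfl
  have hq2' : qf (del A b) h2 = qf A h2 := by rw [qf_del A hd, h2b, hzr]; ring
  have hhar : ∀ x, x ≠ d → Harm (del A b) h2 x := by
    intro x hx
    by_cases hxb : x = b
    · unfold Harm; rw [hxb, h2b, sum_eq_zero]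
      intro y _; simp [del]
    · have := h22 x (by tauto)
      unfold Harm at *
      rw [this]
      refine sum_congr rfl fun y _ => ?_
      by_cases hy : y = b
      · rw [hy, h2b]; simp
      · simp [del, hxb, hy]
  have hdz : ∀ x, del A b x x = 0 := by intro x; simp [del, hd]
  have hZ1 := split1 hA hd hBb (fun x hx => hB2 x hx)
  have hZ2 := split1 (hA.del b) hdz h2d hhar
  rw [hq2'] at hZ2
  set Zd := ∫ f : V → ℝ, exp (-(qf (del (del A b) d) f) / 2) with hZd
  set S := {f : V → ℝ | f b * f d < 0} with hS
  have hms : MeasurableSet S :=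
    measurableSet_lt ((measurable_pi_apply b).mul (measurable_pi_apply d)) measurable_const
  set s1 := √(2 * qf A h1) with hs1
  set s2 := √(2 * qf A h2) with hs2
  have hs1p : 0 < s1 := Real.sqrt_pos.2 (by positivity)
  have hs2p : 0 < s2 := Real.sqrt_pos.2 (by positivity)
  set F : (V → ℝ) → ℝ := S.indicator (fun f => exp (-(qf A f) / 2)) with hF
  have hFi : Integrable F := hA.gauss.1.indicator hms
  have hv1 : (s1⁻¹ • h1) b = s1⁻¹ := by simp [h1b]
  have hv2 : (s2⁻¹ • h2) d = s2⁻¹ := by simp [h2d]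
  have hc1 := cov1 b (s1⁻¹ • h1) (by rw [hv1]; positivity) F
  have hc1i := cov1_int b (s1⁻¹ • h1) (by rw [hv1]; positivity) hFi
  have hc2 := cov1 d (s2⁻¹ • h2) (by rw [hv2]; positivity) (fun f => F (col b (s1⁻¹ • h1) f))
  have hc2i := cov1_int d (s2⁻¹ • h2) (by rw [hv2]; positivity) hc1i
  rw [hv1, abs_of_pos (by positivity)] at hc1
  rw [hv2, abs_of_pos (by positivity)] at hc2
  set G : (V → ℝ) → ℝ := S.indicator (fun f => exp (-(qf (del (del A b) d) f) / 2)) with hG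
  have hGi : Integrable G := ((hA.del b).del d).gauss.1.indicator hms
  have hqd : ∀ f, qf (del (del A b) d) f = f d ^ 2 + (f b ^ 2 + qf A (zr b (zr d f))) := by
    intro f
    rw [qf_del _ hdz, qf_del _ hd]
    have : zr d f b = f b := if_neg hbd
    rw [this]
  have hle : ∀ f, G f ≤ F (col b (s1⁻¹ • h1) (col d (s2⁻¹ • h2) f)) := by
    intro f
    have e1 : col d (s2⁻¹ • h2) f = (f d / s2) • h2 + zr d f := col_eq d h2 h2d s2 f
    set g := col d (s2⁻¹ • h2) f with hg
    have gb : g b = f b := by rw [e1]; simp [h2b, zr, hbd]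
    have gd : g d = f d / s2 := by rw [e1]; simp [h2d, zr]
    have e2 : col b (s1⁻¹ • h1) g = (f b / s1) • h1 + zr b g := by rw [col_eq b h1 h1b s1 g, gb]
    have e3 : zr b g = (f d / s2) • h2 + zr b (zr d f) := by
      rw [e1]; funext x; simp only [zr, Pi.add_apply, Pi.smul_apply, smul_eq_mul]
      split_ifs with hx
      · rw [hx, h2b]; ring
      all_goals ring
    set φ := col b (s1⁻¹ • h1) g with hφ
    have φb : φ b = f b / s1 := by rw [e2]; simp [h1b, zr]
    have φd : φ d = f d / s2 := by rw [e2]; simp [h1d, zr, hdb, gd]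
    have hmem : φ ∈ S ↔ f ∈ S := by
      simp only [hS, mem_ofPred_eq, φb, φd]
      have : f b / s1 * (f d / s2) = f b * f d / (s1 * s2) := by field_simp
      rw [this, div_neg_iff]
      have : 0 < s1 * s2 := by positivity
      constructor
      · rintro (⟨_, h⟩ | ⟨h, _⟩)
        · linarith
        · exact h
      · intro h; right; exact ⟨h, this⟩
    have hqle : qf A φ ≤ qf (del (del A b) d) f := by
      rw [hqd, e2, e3, ← add_assoc, qf_harm hA.symm (fun x => ?_)]
      · have hp : qf A ((f b / s1) • h1 + (f d / s2) • h2) +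
            qf A ((f b / s1) • h1 + (-1 : ℝ) • ((f d / s2) • h2)) =
            2 * (qf A ((f b / s1) • h1) + qf A ((f d / s2) • h2)) := by
          rw [qf_add hA.symm, qf_add hA.symm, qf_smul A (-1)]
          have : ∑ x, ((-1 : ℝ) • ((f d / s2) • h2)) x * (((f b / s1) • h1) x -
              ∑ y, A x y * ((f b / s1) • h1) y) = - ∑ x, ((f d / s2) • h2) x *
              (((f b / s1) • h1) x - ∑ y, A x y * ((f b / s1) • h1) y) := by
            rw [← Finset.sum_neg_distrib]
            refine sum_congr rfl fun x _ => ?_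
            simp only [Pi.smul_apply, smul_eq_mul]; ring
          rw [this]; ring
        have hn := hA.qf_nonneg ((f b / s1) • h1 + (-1 : ℝ) • ((f d / s2) • h2))
        rw [qf_smul, qf_smul, div_pow, div_pow, hs1, hs2, Real.sq_sqrt (by positivity),
          Real.sq_sqrt (by positivity)] at hp
        have : 2 * (f b ^ 2 / (2 * qf A h1) * qf A h1 + f d ^ 2 / (2 * qf A h2) * qf A h2) =
            f b ^ 2 + f d ^ 2 := by field_simp
        rw [this] at hp
        linarith
      · by_cases hx : x = b ∨ x = d
        · left
          rcases hx with hx | hx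
          · simp [zr, hx]
          · simp [zr, hx]
        · right
          have a1 := harm_smul (h12 x hx) (f b / s1)
          have a2 := harm_smul (h22 x hx) (f d / s2)
          unfold Harm at *
          simp only [Pi.add_apply, mul_add, sum_add_distrib]
          rw [← a1, ← a2]
    rw [hG, hF, indicator_apply, indicator_apply]
    simp only [hmem]
    split_ifs
    · apply Real.exp_le_exp.2; linarith
    · exact le_rfl
  have hI := integral_mono hGi hc2i hle
  have hhalf : ∫ f, G f = Zd / 2 := by
    rw [hG, integral_indicator hms]
    refine half_integral ((hA.del b).del d).gauss.1 hbd fun σ f => ?_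
    by_cases hσ : ∃ x, x ≠ b ∧ σ x ≠ 1
    · right; exact hσ
    · left
      push Not at hσ
      rw [hqd, hqd]
      have hz : zr b (zr d (fl σ f)) = zr b (zr d f) := by
        funext x; unfold zr fl
        split_ifs with h1 h2
        · rfl
        · rfl
        · rw [hσ x h1]; simp [rs]
      have hfd : fl σ f d ^ 2 = f d ^ 2 := by
        unfold fl; rcases rs_cases (σ d) with h | h <;> rw [h] <;> ring
      have hfb : fl σ f b ^ 2 = f b ^ 2 := by
        unfold fl; rcases rs_cases (σ b) with h | h <;> rw [h] <;> ring
      rw [hz, hfd, hfb]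
  rw [hhalf] at hI
  rw [← integral_indicator hms]
  change _ ≤ ∫ f, F f
  rw [hc1, hc2, hZ1, hZ2]
  have hZdp : 0 ≤ Zd := integral_nonneg fun f => (Real.exp_pos _).le
  have hα : qf A h1 ≤ e1 := by
    refine le_trans (qf_min hA (p := fun x => x = b ∨ x = d) ?_ h12) he
    rintro x (hx | hx)
    · rw [hx, h1b, hb]
    · rw [hx, h1d, hd0]
  have hmB : m1 ≤ qf A hB := hm _ hBb
  have hr : √(m1 / e1) ≤ √(qf A hB) / √(qf A h1) := by
    rw [← Real.sqrt_div hqB.le]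
    apply Real.sqrt_le_sqrt
    exact div_le_div₀ hqB.le hmB hq1 hα
  have p1 : 0 < √(qf A hB) := Real.sqrt_pos.2 hqB
  have p2 : 0 < √(qf A h1) := Real.sqrt_pos.2 hq1
  have p3 : 0 < √(qf A h2) := Real.sqrt_pos.2 hq2
  have hss : s1 * s2 = 2 * (√(qf A h1) * √(qf A h2)) := by
    rw [hs1, hs2, Real.sqrt_mul (by norm_num), Real.sqrt_mul (by norm_num)]
    have : √(2:ℝ) * √2 = 2 := Real.mul_self_sqrt (by norm_num)
    rw [mul_mul_mul_comm, this]
  calc √(m1 / e1) / 4 * ((√(qf A hB))⁻¹ * ((√(qf A h2))⁻¹ * Zd))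
      ≤ (√(qf A hB) / √(qf A h1)) / 4 * ((√(qf A hB))⁻¹ * ((√(qf A h2))⁻¹ * Zd)) := by gcongr
    _ = (s1 * s2)⁻¹ * (Zd / 2) := by rw [hss]; field_simp; ring
    _ = s1⁻¹ * (s2⁻¹ * (Zd / 2)) := by rw [mul_inv]; ring
    _ ≤ _ := by gcongr

end opp
end

section
section crossing
variable {V : Type*} [Fintype V] [DecidableEq V]
set_option linter.unusedSectionVars false

/-- Edges avoiding `K`. -/
def av (K : Finset V) : Finset (Sym2 V) := Finset.univ.filter (fun e => ∀ x ∈ K, x ∉ e)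

/-- The edge set `s` touches `x`. -/
def tch (s : Finset (Sym2 V)) (x : V) : Prop := ∃ e ∈ s, x ∈ e

lemma subset_av {s : Finset (Sym2 V)} {K : Finset V} : s ⊆ av K ↔ ∀ x ∈ K, ¬ tch s x := by
  simp only [av, tch, Finset.subset_iff, mem_filter, Finset.mem_univ, true_and]
  constructor
  · rintro h x hx ⟨e, he, hxe⟩; exact h he x hx hxe
  · intro h e he x hx hxe; exact h x hx ⟨e, he, hxe⟩

/-- Supports touching both `b` and `K`. -/
def tbk (b : V) (K : Finset V) : Finset (Finset (Sym2 V)) :=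
  Finset.univ.filter (fun s => tch s b ∧ ∃ x ∈ K, tch s x)

lemma sum_tbk (A : Matrix V V ℝ) (b : V) (K : Finset V) :
    ∑ s ∈ tbk b K, lam A s = ∑ s ∈ (Finset.univ : Finset (Sym2 V)).powerset, lam A s
      - ∑ s ∈ (av {b}).powerset, lam A s - ∑ s ∈ (av K).powerset, lam A s
      + ∑ s ∈ (av (insert b K)).powerset, lam A s := by
  have key : ∀ p : Finset (Sym2 V) → Prop, ∀ F : Finset (Finset (Sym2 V)), (∀ s, s ∈ F ↔ p s) →
      ∑ s ∈ F, lam A s = ∑ s, if p s then lam A s else 0 := by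
    intro p F h
    rw [← Finset.sum_filter]
    refine sum_congr ?_ fun _ _ => rfl
    ext s; simp [h]
  rw [key (fun s => tch s b ∧ ∃ x ∈ K, tch s x) _ (by simp [tbk]), key (fun s => True) _ (by simp),
    key (fun s => ¬ tch s b) _ (by simp [subset_av]),
    key (fun s => ∀ x ∈ K, ¬ tch s x) _ (by simp [subset_av]),
    key (fun s => ¬ tch s b ∧ ∀ x ∈ K, ¬ tch s x) _ (by simp [subset_av])]
  rw [← Finset.sum_sub_distrib, ← Finset.sum_sub_distrib, ← sum_add_distrib]
  refine sum_congr rfl fun s _ => ?_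
  have : (∃ x ∈ K, tch s x) ↔ ¬ ∀ x ∈ K, ¬ tch s x := by push Not; rfl
  rw [this]
  by_cases h1 : tch s b <;> by_cases h2 : ∀ x ∈ K, ¬ tch s x
  · rw [if_neg (by tauto), if_pos trivial, if_neg (by tauto), if_pos h2, if_neg (by tauto)]; ring
  · rw [if_pos (by tauto), if_pos trivial, if_neg (by tauto), if_neg h2, if_neg (by tauto)]; ring
  · rw [if_neg (by tauto), if_pos trivial, if_pos (by tauto), if_pos h2, if_pos (by tauto)]; ring
  · rw [if_neg (by tauto), if_pos trivial, if_pos (by tauto), if_neg h2, if_neg (by tauto)]; ring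

lemma resM_av_single (A : Matrix V V ℝ) (b : V) : resM A (av {b}) = del A b := by
  ext x y
  simp only [resM, del, av, mem_filter, Finset.mem_univ, true_and, Finset.mem_singleton,
    forall_eq, Sym2.mem_iff, eq_comm (a := b)]
  by_cases h : x = b ∨ y = b
  · rw [if_neg (by tauto), if_pos h]
  · rw [if_pos h, if_neg h]

lemma del_resM_av (A : Matrix V V ℝ) (b : V) (K : Finset V) :
    del (resM A (av K)) b = resM A (av (insert b K)) := by
  ext x y
  simp only [resM, del, av, mem_filter, Finset.mem_univ, true_and, Finset.mem_insert,
    forall_eq_or_imp, Sym2.mem_iff, eq_comm (a := b)]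
  by_cases h : x = b ∨ y = b
  · rw [if_pos h, if_neg (by tauto)]
  · rw [if_neg h]
    by_cases h2 : ∀ x_1 ∈ K, ¬(x_1 = x ∨ x_1 = y)
    · rw [if_pos h2, if_pos ⟨h, h2⟩]
    · rw [if_neg h2, if_neg (by tauto)]

lemma qf_av_ge (A : Matrix V V ℝ) (K : Finset V) (f : V → ℝ) :
    qf A (fun x => if x ∈ K then 0 else f x) ≤ qf (resM A (av K)) f := by
  unfold qf
  have h1 : ∑ x, (if x ∈ K then (0:ℝ) else f x) ^ 2 ≤ ∑ x, f x ^ 2 := by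
    refine sum_le_sum fun x _ => ?_
    split_ifs
    · simpa using sq_nonneg (f x)
    · exact le_rfl
  have h2 : ∀ x y, A x y * (if x ∈ K then (0:ℝ) else f x) * (if y ∈ K then (0:ℝ) else f y) =
      resM A (av K) x y * f x * f y := by
    intro x y
    simp only [resM, av, mem_filter, Finset.mem_univ, true_and, Sym2.mem_iff]
    by_cases hx : x ∈ K
    · have hn : ¬ ∀ z ∈ K, ¬ (z = x ∨ z = y) := fun h => h x hx (Or.inl rfl)
      rw [if_pos hx, if_neg hn]; ring
    · by_cases hy : y ∈ K
      · have hn : ¬ ∀ z ∈ K, ¬ (z = x ∨ z = y) := fun h => h y hy (Or.inr rfl)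
        rw [if_pos hy, if_neg hn]; ring
      · rw [if_neg hx, if_neg hy, if_pos]
        rintro z hz (rfl | rfl) <;> contradiction
  simp_rw [h2]
  linarith

lemma K_ratio {A : Matrix V V ℝ} (hA : PosW A) (hd : ∀ x, A x x = 0) {b : V} {K : Finset V}
    (hbK : b ∉ K) {e1 c1 : ℝ} {h : V → ℝ} (hb : h b = 1) (he : qf A h ≤ e1) (hc0 : 0 < c1)
    (hc : ∀ f : V → ℝ, f b = 1 → (∀ x ∈ K, f x = 0) → c1 ≤ qf A f) :
    exp (-∑ s ∈ tbk b K, lam A s) ≤ √(e1 / c1) := by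
  obtain ⟨hB, hB1, hB2⟩ := exists_harm hA (fun x => x = b) (fun _ => 1)
  have hBb : hB b = 1 := hB1 b rfl
  have hA' := hA.res (av K)
  have hd' : ∀ x, resM A (av K) x x = 0 := by intro x; simp [resM, hd]
  obtain ⟨hC, hC1, hC2⟩ := exists_harm hA' (fun x => x = b) (fun _ => 1)
  have hCb : hC b = 1 := hC1 b rfl
  have s1 := split1 hA hd hBb (fun x hx => hB2 x hx)
  have s2 := split1 hA' hd' hCb (fun x hx => hC2 x hx)
  rw [← resM_av_single] at s1
  rw [del_resM_av] at s2
  have z0 := hA.Zp_eq Finset.univ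
  have z1 := hA.Zp_eq (av {b})
  have z2 := hA.Zp_eq (av K)
  have z3 := hA.Zp_eq (av (insert b K))
  have z0' : Zp A Finset.univ = ∫ f : V → ℝ, exp (-(qf A f) / 2) := by
    unfold Zp; rw [resM_univ]
  rw [← z0'] at s1
  change _ = _ * Zp A (av {b}) at s1
  change Zp A (av K) = _ * Zp A (av (insert b K)) at s2
  have hqB : 0 < qf A hB := hA.pos _ (ne_zero_of_one hBb)
  have hqBe : qf A hB ≤ e1 := by
    refine le_trans (qf_min hA (p := fun x => x = b) ?_ (fun x hx => hB2 x hx)) he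
    rintro x rfl; rw [hBb, hb]
  have hqC : c1 ≤ qf (resM A (av K)) hC := by
    refine le_trans (hc _ ?_ ?_) (qf_av_ge A K hC)
    · simp [hbK, hCb]
    · intro x hx; simp [hx]
  rw [z0, z1] at s1
  rw [z2, z3] at s2
  have hπ : 0 < √(2 * Real.pi) ^ Fintype.card V := by positivity
  rw [sum_tbk]
  set a0 := ∑ s ∈ (Finset.univ : Finset (Sym2 V)).powerset, lam A s
  set a1 := ∑ s ∈ (av {b}).powerset, lam A s
  set a2 := ∑ s ∈ (av K).powerset, lam A s
  set a3 := ∑ s ∈ (av (insert b K)).powerset, lam A s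
  have t1 : exp (a1 - a0) = √(qf A hB) := by
    have p := Real.sqrt_pos.2 hqB
    rw [Real.exp_sub, div_eq_iff (Real.exp_pos _).ne']
    have : exp a0 = (√(qf A hB))⁻¹ * exp a1 := by
      apply mul_left_cancel₀ hπ.ne'; rw [s1]; ring
    rw [this]; field_simp
  have t2 : exp (a2 - a3) = (√(qf (resM A (av K)) hC))⁻¹ := by
    rw [Real.exp_sub, div_eq_iff (Real.exp_pos _).ne']
    apply mul_left_cancel₀ hπ.ne'; rw [s2]; ring
  have : -(a0 - a1 - a2 + a3) = (a1 - a0) + (a2 - a3) := by ring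
  rw [this, Real.exp_add, t1, t2, Real.sqrt_div (hqB.le.trans hqBe), div_eq_mul_inv]
  have p := Real.sqrt_pos.2 hc0
  gcongr

lemma es_conn : ∀ (l : List V) (x y : V), cn (es x l y) x y ∧
    ∀ p, tch (es x l y) p → cn (es x l y) x p := by
  intro l
  induction l with
  | nil =>
    intro x y
    have h : cn (es x [] y) x y := Relation.ReflTransGen.single (by simp [es])
    refine ⟨h, ?_⟩
    rintro p ⟨e, he, hp⟩
    simp only [es, Finset.mem_singleton] at he
    subst he
    rcases Sym2.mem_iff.1 hp with rfl | rfl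
    · exact Relation.ReflTransGen.refl
    · exact h
  | cons z l ih =>
    intro x y
    obtain ⟨h1, h2⟩ := ih z y
    have hsub : es z l y ⊆ es x (z :: l) y := Finset.subset_insert _ _
    have hxz : cn (es x (z :: l) y) x z := Relation.ReflTransGen.single (by simp [es])
    refine ⟨hxz.trans (cn_mono hsub h1), ?_⟩
    rintro p ⟨e, he, hp⟩
    simp only [es, Finset.mem_insert] at he
    rcases he with rfl | he
    · rcases Sym2.mem_iff.1 hp with rfl | rfl
      · exact Relation.ReflTransGen.refl
      · exact hxz
    · exact hxz.trans (cn_mono hsub (h2 p ⟨e, he, hp⟩))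

lemma lw_edge {A : Matrix V V ℝ} (hA : PosW A) : ∀ (l : List V) (x y : V), lw A x l y ≠ 0 →
    ∀ p q, s(p, q) ∈ es x l y → A p q ≠ 0 := by
  have aux : ∀ x y p q : V, A x y ≠ 0 → s(p, q) = s(x, y) → A p q ≠ 0 := by
    intro x y p q h e
    rcases Sym2.eq_iff.1 e with ⟨rfl, rfl⟩ | ⟨rfl, rfl⟩
    · exact h
    · rwa [hA.symm]
  intro l
  induction l with
  | nil =>
    intro x y h p q hpq
    simp only [es, Finset.mem_singleton] at hpq
    exact aux x y p q h hpq
  | cons z l ih =>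
    intro x y h p q hpq
    simp only [lw] at h
    simp only [es, Finset.mem_insert] at hpq
    rcases hpq with hpq | hpq
    · exact aux x z p q (left_ne_zero_of_mul h) hpq
    · exact ih z y (right_ne_zero_of_mul h) p q hpq

lemma lam_conn {A : Matrix V V ℝ} {s : Finset (Sym2 V)} (h : lam A s ≠ 0) {p q : V}
    (hp : tch s p) (hq : tch s q) : cn s p q := by
  obtain ⟨x, l, rfl, _⟩ := exists_of_lam_ne h
  exact (cn_symm ((es_conn l x x).2 p hp)).trans ((es_conn l x x).2 q hq)

lemma bw_lam {A : Matrix V V ℝ} {c : Finset (Finset (Sym2 V))} (h : bw A c ≠ 0)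
    {s : Finset (Sym2 V)} (hs : s ∈ c) : lam A s ≠ 0 := by
  intro h0
  apply h
  unfold bw
  exact Finset.prod_eq_zero hs (by rw [h0]; simp)

lemma fib_sum (A : Matrix V V ℝ) (F0 c0 T : Finset (Finset (Sym2 V))) (hc : c0 ⊆ F0)
    (hT : Disjoint T F0) :
    ∑ c ∈ Finset.univ.filter (fun c => c ∩ F0 = c0 ∧ Disjoint c T), bw A c =
      bw A c0 * exp (∑ s ∈ F0ᶜ \ T, lam A s) := by
  rw [← sum_bw, mul_sum]
  refine Finset.sum_nbij' (fun c => c \ F0) (fun c1 => c0 ∪ c1) ?_ ?_ ?_ ?_ ?_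
  · intro c hc'
    simp only [mem_filter, Finset.mem_univ, true_and] at hc'
    rw [Finset.mem_powerset]
    intro s hs
    simp only [Finset.mem_sdiff, Finset.mem_compl] at hs ⊢
    exact ⟨hs.2, fun h => Finset.disjoint_left.1 hc'.2 hs.1 h⟩
  · intro c1 hc1
    rw [Finset.mem_powerset] at hc1
    simp only [mem_filter, Finset.mem_univ, true_and]
    constructor
    · ext s
      simp only [Finset.mem_inter, Finset.mem_union]
      constructor
      · rintro ⟨h | h, h2⟩
        · exact h
        · have := hc1 h; simp only [Finset.mem_sdiff, Finset.mem_compl] at this; exact absurd h2 this.1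
      · intro h; exact ⟨Or.inl h, hc h⟩
    · rw [Finset.disjoint_left]
      intro s hs hsT
      rcases Finset.mem_union.1 hs with h | h
      · exact Finset.disjoint_left.1 hT hsT (hc h)
      · have := hc1 h; simp only [Finset.mem_sdiff, Finset.mem_compl] at this; exact this.2 hsT
  · intro c hc'
    simp only [mem_filter, Finset.mem_univ, true_and] at hc'
    rw [← hc'.1]
    ext s; simp only [Finset.mem_union, Finset.mem_inter, Finset.mem_sdiff]; tauto
  · intro c1 hc1
    rw [Finset.mem_powerset] at hc1
    ext s; simp only [Finset.mem_union, Finset.mem_sdiff]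
    constructor
    · rintro ⟨h | h, h2⟩
      · exact absurd (hc h) h2
      · exact h
    · intro h
      have := hc1 h; simp only [Finset.mem_sdiff, Finset.mem_compl] at this
      exact ⟨Or.inr h, this.1⟩
  · intro c hc'
    simp only [mem_filter, Finset.mem_univ, true_and] at hc'
    change bw A c = bw A c0 * bw A (c \ F0)
    unfold bw
    rw [← hc'.1, ← Finset.prod_union]
    · congr 1; ext s; simp only [Finset.mem_union, Finset.mem_inter, Finset.mem_sdiff]; tauto
    · rw [Finset.disjoint_left]; intro s h1 h2
      simp only [Finset.mem_inter, Finset.mem_sdiff] at h1 h2; exact h2.2 h1.2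

/-- Supports avoiding `b` and `d`. -/
def Fz (b d : V) : Finset (Finset (Sym2 V)) := Finset.univ.filter (fun s => ¬ tch s b ∧ ¬ tch s d)

/-- No crossing from `I` to `O` by supports avoiding `b` and `d`. -/
def NoCross (b d : V) (I O : V → Prop) : Set (Finset (Finset (Sym2 V))) :=
  {c | ¬ ∃ u v, I u ∧ O v ∧ cn ((c ∩ Fz b d).sup id) u v}

lemma F_main {A : Matrix V V ℝ} (hA : PosW A) (hd : ∀ x, A x x = 0) {b d : V} (hbd : b ≠ d)
    {e m c e' c' : ℝ} (hc0 : 0 < c) (hc0' : 0 < c') {h h' : V → ℝ} (hb : h b = 1) (hbd0 : h d = 0) (he : qf A h ≤ e)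
    (hd1 : h' d = 1) (he' : qf A h' ≤ e')
    (hm : ∀ f : V → ℝ, f b = 1 → m ≤ qf A f) (I O : V → Prop) (hIb : ¬ I b) (hId : ¬ I d)
    (hK : ∀ K : Finset V, b ∉ K → d ∉ K → (∃ u v, I u ∧ O v ∧
      Relation.ReflTransGen (fun x y => x ∈ K ∧ y ∈ K ∧ A x y ≠ 0) u v ∧ u ∈ K) →
      ∀ f : V → ℝ, (∀ x ∈ K, f x = 0) → (f b = 1 → c ≤ qf A f) ∧ (f d = 1 → c' ≤ qf A f)) :
    (√(m / e) / 2 - (√(e / c) + √(e' / c'))) * ∏ s : Finset (Sym2 V), exp (lam A s) ≤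
      ∑ χ : Finset (Finset (Sym2 V)), if χ ∈ NoCross b d I O then
        ∏ s ∈ χ, (exp (lam A s) - 1) else 0 := by
  have h1 := opp_sign hA hd hbd hb hbd0 he hm
  have h2 := disc_ge hA hd b d
  have z0 := hA.Zp_eq Finset.univ
  have z0' : Zp A Finset.univ = ∫ f : V → ℝ, exp (-(qf A f) / 2) := by
    unfold Zp; rw [resM_univ]
  rw [← z0', z0] at h1
  have hπ : 0 < √(2 * Real.pi) ^ Fintype.card V := by positivity
  rw [← Real.exp_sum]
  rw [Finset.powerset_univ] at h1
  set Z := exp (∑ s : Finset (Sym2 V), lam A s) with hZ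
  have h3 : √(m / e) / 2 * Z ≤ ∑ χ : Finset (Finset (Sym2 V)),
      (if cn (χ.sup id) b d then 0 else bw A χ) := by
    refine le_of_mul_le_mul_left ?_ hπ
    refine le_trans ?_ h2
    linarith
  -- fibers
  have h4 : ∀ c0 ∈ (Fz b d).powerset, c0 ∉ NoCross b d I O →
      ∑ χ ∈ Finset.univ.filter (fun χ => χ ∩ Fz b d = c0),
        (if cn (χ.sup id) b d then 0 else bw A χ) ≤
        bw A c0 * ((√(e / c) + √(e' / c')) * exp (∑ s ∈ (Fz b d)ᶜ, lam A s)) := by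
    intro c0 hc0m hcr
    have hsub := Finset.mem_powerset.1 hc0m
    have hbw0 := bw_nonneg hA c0
    by_cases hz : bw A c0 = 0
    · rw [hz, zero_mul]
      refine le_of_eq (sum_eq_zero fun χ hχ => ?_)
      simp only [mem_filter, Finset.mem_univ, true_and] at hχ
      have : bw A χ = 0 := by
        unfold bw at hz ⊢
        obtain ⟨s, hs, h0⟩ := Finset.prod_eq_zero_iff.1 hz
        refine Finset.prod_eq_zero (i := s) ?_ h0
        rw [← hχ] at hs; exact (Finset.mem_inter.1 hs).1
      rw [this]; simp
    have hcr' : ∃ u v, I u ∧ O v ∧ cn (c0.sup id) u v := by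
      by_contra hno
      apply hcr
      unfold NoCross
      rw [Set.mem_ofPred_eq, Finset.inter_eq_left.2 hsub]
      exact hno
    obtain ⟨u, v, hu, hv, huv⟩ := hcr'
    set K : Finset V := Finset.univ.filter (fun x => cn (c0.sup id) u x) with hKd
    have hedge : ∀ x y, s(x, y) ∈ c0.sup id → A x y ≠ 0 ∧ x ≠ b ∧ y ≠ b ∧ x ≠ d ∧ y ≠ d := by
      intro x y hxy
      obtain ⟨s, hs, hxs⟩ := Finset.mem_sup.1 hxy
      have hF := hsub hs
      simp only [Fz, mem_filter, Finset.mem_univ, true_and] at hF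
      have hne : ∀ w z : V, ¬ tch s w → z ∈ s(x, y) → z ≠ w := by
        rintro w z hw hz rfl; exact hw ⟨_, hxs, hz⟩
      refine ⟨?_, hne b x hF.1 (by simp), hne b y hF.1 (by simp), hne d x hF.2 (by simp),
        hne d y hF.2 (by simp)⟩
      obtain ⟨x0, l, hes, hlw⟩ := exists_of_lam_ne (bw_lam hz hs)
      exact lw_edge hA l x0 x0 hlw x y (by rw [hes]; exact hxs)
    have hKne : ∀ w, ¬ I w → (∀ x y, s(x, y) ∈ c0.sup id → y ≠ w) → w ∉ K := by
      intro w hw hyw hwK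
      simp only [hKd, mem_filter, Finset.mem_univ, true_and] at hwK
      rcases Relation.ReflTransGen.cases_tail hwK with h | ⟨x, _, hx⟩
      · rw [h] at hw; exact hw hu
      · exact hyw x w hx rfl
    have hbK : b ∉ K := hKne b hIb fun x y hxy => (hedge x y hxy).2.2.1
    have hdK : d ∉ K := hKne d hId fun x y hxy => (hedge x y hxy).2.2.2.2
    have hconn : ∀ w, cn (c0.sup id) u w →
        Relation.ReflTransGen (fun x y => x ∈ K ∧ y ∈ K ∧ A x y ≠ 0) u w := by
      intro w hw
      induction hw with
      | refl => exact Relation.ReflTransGen.refl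
      | @tail x y hx hxy ih =>
        refine ih.tail ⟨?_, ?_, (hedge x y hxy).1⟩
        · simp only [hKd, mem_filter, Finset.mem_univ, true_and]; exact hx
        · simp only [hKd, mem_filter, Finset.mem_univ, true_and]; exact hx.tail hxy
    have huK : u ∈ K := by
      simp only [hKd, mem_filter, Finset.mem_univ, true_and]
      exact Relation.ReflTransGen.refl
    have hKf := hK K hbK hdK ⟨u, v, hu, hv, hconn v huv, huK⟩
    have r1 := K_ratio hA hd hbK hb he hc0 (fun f hf h0 => (hKf f h0).1 hf)
    have r2 := K_ratio hA hd hdK hd1 he' hc0' (fun f hf h0 => (hKf f h0).2 hf)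
    have hTF : ∀ w, w = b ∨ w = d → Disjoint (tbk w K) (Fz b d) := by
      intro w hw
      rw [Finset.disjoint_left]
      intro s hs hs'
      simp only [tbk, Fz, mem_filter, Finset.mem_univ, true_and] at hs hs'
      rcases hw with rfl | rfl
      · exact hs'.1 hs.1
      · exact hs'.2 hs.1
    have hfib : ∀ w, ∀ ρ : ℝ, w = b ∨ w = d → exp (-∑ s ∈ tbk w K, lam A s) ≤ ρ →
        ∑ χ ∈ Finset.univ.filter (fun χ => χ ∩ Fz b d = c0 ∧ Disjoint χ (tbk w K)), bw A χ ≤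
        bw A c0 * (ρ * exp (∑ s ∈ (Fz b d)ᶜ, lam A s)) := by
      intro w ρ hw hr
      rw [fib_sum A _ _ _ hsub (hTF w hw)]
      refine mul_le_mul_of_nonneg_left ?_ hbw0
      have hs : tbk w K ⊆ (Fz b d)ᶜ := by
        intro s hs; rw [Finset.mem_compl]; exact Finset.disjoint_left.1 (hTF w hw) hs
      have : ∑ s ∈ (Fz b d)ᶜ \ tbk w K, lam A s = -∑ s ∈ tbk w K, lam A s + ∑ s ∈ (Fz b d)ᶜ, lam A s := by
        rw [← Finset.sum_sdiff hs]; ring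
      rw [this, Real.exp_add]
      gcongr
    have f1 := hfib b _ (Or.inl rfl) r1
    have f2 := hfib d _ (Or.inr rfl) r2
    have : ∑ χ ∈ Finset.univ.filter (fun χ => χ ∩ Fz b d = c0),
        (if cn (χ.sup id) b d then 0 else bw A χ) ≤
        ∑ χ ∈ Finset.univ.filter (fun χ => χ ∩ Fz b d = c0 ∧ Disjoint χ (tbk b K)), bw A χ +
        ∑ χ ∈ Finset.univ.filter (fun χ => χ ∩ Fz b d = c0 ∧ Disjoint χ (tbk d K)), bw A χ := by
      rw [← Finset.filter_filter, ← Finset.filter_filter, Finset.sum_filter (p := fun χ => Disjoint χ (tbk b K)),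
        Finset.sum_filter (p := fun χ => Disjoint χ (tbk d K)), ← sum_add_distrib]
      refine sum_le_sum fun χ hχ => ?_
      simp only [mem_filter, Finset.mem_univ, true_and] at hχ
      have hbwχ := bw_nonneg hA χ
      have n1 : 0 ≤ (if Disjoint χ (tbk b K) then bw A χ else 0) := by split_ifs <;> simp [hbwχ]
      have n2 : 0 ≤ (if Disjoint χ (tbk d K) then bw A χ else 0) := by split_ifs <;> simp [hbwχ]
      by_cases q0 : cn (χ.sup id) b d
      · rw [if_pos q0]; linarith
      rw [if_neg q0]
      by_cases q1 : Disjoint χ (tbk b K)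
      · rw [if_pos q1]; linarith
      by_cases q2 : Disjoint χ (tbk d K)
      · rw [if_pos q2]; linarith
      · rw [if_neg q1, if_neg q2]
        by_contra hlt
        push Not at hlt
        have hne : bw A χ ≠ 0 := by intro h0; rw [h0] at hlt; simp at hlt
        apply q0
        rw [Finset.not_disjoint_iff] at q1 q2
        obtain ⟨s, hs, hs'⟩ := q1
        obtain ⟨t, ht, ht'⟩ := q2
        simp only [tbk, mem_filter, Finset.mem_univ, true_and] at hs' ht'
        obtain ⟨hsb, x, hxK, hsx⟩ := hs'
        obtain ⟨htd, y, hyK, hty⟩ := ht'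
        simp only [hKd, mem_filter, Finset.mem_univ, true_and] at hxK hyK
        have hle : ∀ s ∈ χ, s ⊆ χ.sup id := fun s hs => Finset.le_sup (f := id) hs
        have c1 := cn_mono (hle s hs) (lam_conn (bw_lam hne hs) hsb hsx)
        have c2 := cn_mono (hle t ht) (lam_conn (bw_lam hne ht) hty htd)
        have hc0χ : c0.sup id ⊆ χ.sup id := by
          apply Finset.sup_mono
          rw [← hχ]; exact Finset.inter_subset_left
        exact c1.trans ((cn_mono hc0χ ((cn_symm hxK).trans hyK)).trans c2)
    linarith
  have hmap : ∀ χ ∈ (Finset.univ : Finset (Finset (Finset (Sym2 V)))), χ ∩ Fz b d ∈ (Fz b d).powerset :=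
    fun χ _ => Finset.mem_powerset.2 Finset.inter_subset_right
  have hNC : ∀ χ : Finset (Finset (Sym2 V)), χ ∈ NoCross b d I O ↔ χ ∩ Fz b d ∈ NoCross b d I O := by
    intro χ; unfold NoCross
    rw [Set.mem_ofPred_eq, Set.mem_ofPred_eq, Finset.inter_assoc, Finset.inter_self]
  change _ ≤ ∑ χ : Finset (Finset (Sym2 V)), if χ ∈ NoCross b d I O then bw A χ else 0
  have h5 : ∑ χ : Finset (Finset (Sym2 V)), (if cn (χ.sup id) b d then 0 else bw A χ) ≤
      ∑ χ : Finset (Finset (Sym2 V)), (if χ ∈ NoCross b d I O then bw A χ else 0) +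
      ∑ c0 ∈ (Fz b d).powerset, bw A c0 * ((√(e / c) + √(e' / c')) * exp (∑ s ∈ (Fz b d)ᶜ, lam A s)) := by
    rw [← Finset.sum_fiberwise_of_maps_to hmap,
      ← Finset.sum_fiberwise_of_maps_to hmap (fun χ => if χ ∈ NoCross b d I O then bw A χ else 0),
      ← sum_add_distrib]
    refine sum_le_sum fun c0 hc0m => ?_
    have hbw0 := bw_nonneg hA c0
    by_cases hcr : c0 ∈ NoCross b d I O
    · refine le_trans ?_ (le_add_of_nonneg_right (by positivity))
      refine sum_le_sum fun χ hχ => ?_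
      simp only [mem_filter, Finset.mem_univ, true_and] at hχ
      rw [if_pos ((hNC χ).2 (by rw [hχ]; exact hcr))]
      have := bw_nonneg hA χ
      split_ifs
      · exact this
      · exact le_rfl
    · refine le_trans (h4 c0 hc0m hcr) (le_add_of_nonneg_left (sum_nonneg fun χ _ => ?_))
      have := bw_nonneg hA χ
      split_ifs
      · exact this
      · exact le_rfl
  rw [← Finset.sum_mul, sum_bw] at h5
  have h6 : exp (∑ s ∈ Fz b d, lam A s) * ((√(e / c) + √(e' / c')) * exp (∑ s ∈ (Fz b d)ᶜ, lam A s)) =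
      (√(e / c) + √(e' / c')) * Z := by
    rw [hZ, ← Finset.sum_add_sum_compl (Fz b d), Real.exp_add]; ring
  rw [h6] at h5
  linarith

lemma NoCross_mono {b d : V} {I O : V → Prop} {c c' : Finset (Finset (Sym2 V))} (h : c' ⊆ c)
    (hc : c ∈ NoCross b d I O) : c' ∈ NoCross b d I O := by
  rintro ⟨u, v, hu, hv, huv⟩
  exact hc ⟨u, v, hu, hv, cn_mono (Finset.sup_mono (Finset.inter_subset_inter_right h)) huv⟩

end crossing
end

section
section network
variable {V ε : Type*} [Fintype V] [DecidableEq V] [Fintype ε]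
set_option linter.unusedSectionVars false

/-- Conductances. -/
def netC (s t : ε → V) (u v : V) : ℝ := if u = v then 0 else
  (∑ e : ε, ((if s e = u ∧ t e = v then (1:ℝ) else 0) + if s e = v ∧ t e = u then 1 else 0)) / 4

/-- Total conductance plus mass. -/
def netL (s t : ε → V) (m : V → ℝ) (u : V) : ℝ := ∑ v, netC s t u v + m u

/-- Normalised matrix. -/
def netA (s t : ε → V) (m : V → ℝ) : Matrix V V ℝ :=
  fun u v => netC s t u v / (√(netL s t m u) * √(netL s t m v))

lemma netC_symm (s t : ε → V) (u v : V) : netC s t u v = netC s t v u := by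
  unfold netC
  by_cases h : u = v
  · rw [if_pos h, if_pos h.symm]
  · rw [if_neg h, if_neg (Ne.symm h)]
    congr 1
    exact sum_congr rfl fun e _ => add_comm _ _

lemma netC_nonneg (s t : ε → V) (u v : V) : 0 ≤ netC s t u v := by
  unfold netC
  split_ifs
  · exact le_rfl
  · apply div_nonneg _ (by norm_num)
    refine sum_nonneg fun e _ => ?_
    apply add_nonneg <;> split_ifs <;> norm_num

lemma netC_sum (s t : ε → V) (F : V → V → ℝ) (hF : ∀ u, F u u = 0) :
    ∑ u, ∑ v, netC s t u v * F u v = (∑ e : ε, (F (s e) (t e) + F (t e) (s e))) / 4 := by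
  have h1 : ∀ u v, netC s t u v * F u v = (∑ e : ε,
      ((if s e = u then if t e = v then F u v else 0 else 0) +
        if t e = u then if s e = v then F u v else 0 else 0)) / 4 := by
    intro u v
    unfold netC
    by_cases h : u = v
    · subst h; rw [if_pos rfl, hF]; simp
    · rw [if_neg h, div_mul_eq_mul_div, Finset.sum_mul]
      congr 1
      refine sum_congr rfl fun e _ => ?_
      by_cases h1 : s e = u <;> by_cases h2 : t e = v <;> by_cases h3 : s e = v <;>
        by_cases h4 : t e = u <;> simp [h1, h2, h3, h4, h, Ne.symm h]
  simp_rw [h1, ← sum_div]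
  congr 1
  have h2 : ∀ u, ∑ v, ∑ e : ε, ((if s e = u then if t e = v then F u v else 0 else 0) +
        if t e = u then if s e = v then F u v else 0 else 0) =
      ∑ e : ε, ((if s e = u then F u (t e) else 0) + if t e = u then F u (s e) else 0) := by
    intro u
    rw [sum_comm]
    refine sum_congr rfl fun e _ => ?_
    rw [sum_add_distrib]
    congr 1
    · split_ifs <;> simp
    · split_ifs <;> simp
  simp_rw [h2]
  rw [sum_comm]
  refine sum_congr rfl fun e _ => ?_
  rw [sum_add_distrib]
  simp

lemma net_qf (s t : ε → V) (m : V → ℝ) (hL : ∀ u, 0 < netL s t m u) (g : V → ℝ) :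
    qf (netA s t m) (fun u => √(netL s t m u) * g u) =
      (∑ e : ε, (g (s e) - g (t e)) ^ 2) / 4 + ∑ u, m u * g u ^ 2 := by
  have h1 : ∀ u v, netA s t m u v * (√(netL s t m u) * g u) * (√(netL s t m v) * g v) =
      netC s t u v * (g u * g v) := by
    intro u v
    have := Real.sqrt_pos.2 (hL u)
    have := Real.sqrt_pos.2 (hL v)
    unfold netA; field_simp
  unfold qf
  simp_rw [h1]
  have h2 : ∀ u, (√(netL s t m u) * g u) ^ 2 = ∑ v, netC s t u v * g u ^ 2 + m u * g u ^ 2 := by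
    intro u
    rw [mul_pow, Real.sq_sqrt (hL u).le, ← Finset.sum_mul, ← add_mul]; rfl
  simp_rw [h2, sum_add_distrib]
  have h3 := netC_sum s t (fun u v => g u ^ 2 - g u * g v) (fun u => by ring)
  have h4 : ∑ u, ∑ v, netC s t u v * (g u ^ 2 - g u * g v) =
      ∑ u, ∑ v, netC s t u v * g u ^ 2 - ∑ u, ∑ v, netC s t u v * (g u * g v) := by
    simp only [mul_sub, Finset.sum_sub_distrib]
  have h5 : ∑ e : ε, (g (s e) ^ 2 - g (s e) * g (t e) + (g (t e) ^ 2 - g (t e) * g (s e))) =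
      ∑ e : ε, (g (s e) - g (t e)) ^ 2 := sum_congr rfl fun e _ => by ring
  rw [h5] at h3
  linarith

lemma netC_deg (s t : ε → V) (u : V) : ∑ v, netC s t u v =
    (∑ e : ε, ((if s e = u ∧ t e ≠ u then (1:ℝ) else 0) + if t e = u ∧ s e ≠ u then 1 else 0)) / 4 := by
  have h := netC_sum s t (fun a b => if a = u ∧ b ≠ u then 1 else 0) (fun a => by
    rw [if_neg]; rintro ⟨h1, h2⟩; exact h2 h1)
  rw [← h, sum_comm]
  refine sum_congr rfl fun v _ => ?_
  simp only [ite_and]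
  rw [Finset.sum_eq_single u]
  · by_cases hv : v = u
    · subst hv; simp [netC]
    · simp [hv]
  · intro a _ ha; simp [ha]
  · simp

lemma net_PosW (s t : ε → V) (m : V → ℝ) (hL : ∀ u, 0 < netL s t m u) (hm : ∀ u, 0 ≤ m u)
    (hcon : ∀ g : V → ℝ, (∀ e, g (s e) = g (t e)) → (∀ u, m u = 0 ∨ g u = 0) → g = 0) :
    PosW (netA s t m) := by
  refine ⟨fun x y => ?_, fun x y => ?_, fun f hf => ?_⟩
  · unfold netA; rw [netC_symm, mul_comm]
  · unfold netA; exact div_nonneg (netC_nonneg _ _ _ _) (by positivity)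
  · have hfg : f = fun u => √(netL s t m u) * (f u / √(netL s t m u)) := by
      funext u; have := Real.sqrt_pos.2 (hL u); field_simp
    set g : V → ℝ := fun u => f u / √(netL s t m u) with hg
    have hq := net_qf s t m hL g
    rw [hfg, hq]
    have n1 : 0 ≤ (∑ e : ε, (g (s e) - g (t e)) ^ 2) / 4 := by positivity
    have n2 : 0 ≤ ∑ u, m u * g u ^ 2 := sum_nonneg fun u _ => mul_nonneg (hm u) (sq_nonneg _)
    by_contra hle
    have e1 : ∑ e : ε, (g (s e) - g (t e)) ^ 2 = 0 := by linarith
    have e2 : ∑ u, m u * g u ^ 2 = 0 := by linarith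
    rw [Finset.sum_eq_zero_iff_of_nonneg (fun _ _ => sq_nonneg _)] at e1
    rw [Finset.sum_eq_zero_iff_of_nonneg (fun u _ => mul_nonneg (hm u) (sq_nonneg _))] at e2
    have hg0 := hcon g (fun e => by
      have := e1 e (Finset.mem_univ e)
      have := pow_eq_zero_iff (two_ne_zero) |>.1 this
      linarith) (fun u => by
      have := e2 u (Finset.mem_univ u)
      rcases mul_eq_zero.1 this with h | h
      · exact Or.inl h
      · exact Or.inr (pow_eq_zero_iff (two_ne_zero) |>.1 h))
    apply hf
    funext u
    have h3 := congrFun hg0 u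
    have h4 := congrFun hfg u
    change g u = 0 at h3
    change f u = √(netL s t m u) * g u at h4
    rw [h4, h3]; simp

end network
end

/-- Step directions. -/
def dir (i : Bool) : Lat := if i then (0, 1) else (1, 0)

/-- Annulus vertices. -/
def Wf (n N : ℤ) : Finset Lat :=
  (Finset.Icc (-N) N ×ˢ Finset.Icc (-N) N).filter (fun w => n < linf w)

lemma mem_Wf {n N : ℤ} {w : Lat} : w ∈ Wf n N ↔ n < linf w ∧ linf w ≤ N := by
  unfold Wf linf
  rw [mem_filter, Finset.mem_product, Finset.mem_Icc, Finset.mem_Icc, max_le_iff, abs_le, abs_le]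
  tauto

/-- Network vertices. -/
abbrev Vt (n N : ℤ) : Type := {w : Lat // w ∈ Wf n N} ⊕ Bool

/-- Projection. -/
def proj (n N : ℤ) (w : Lat) : Vt n N :=
  if h : w ∈ Wf n N then Sum.inl ⟨w, h⟩ else if linf w ≤ n then Sum.inr false else Sum.inr true

lemma proj_inl {n N : ℤ} {w : Lat} (h : w ∈ Wf n N) : proj n N w = Sum.inl ⟨w, h⟩ := dif_pos h

lemma proj_b {n N : ℤ} {w : Lat} (h : linf w ≤ n) : proj n N w = Sum.inr false := by
  unfold proj
  rw [dif_neg, if_pos h]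
  rw [mem_Wf]; omega

lemma proj_d {n N : ℤ} (hn : n ≤ N) {w : Lat} (h : N < linf w) : proj n N w = Sum.inr true := by
  unfold proj
  rw [dif_neg, if_neg]
  · omega
  · rw [mem_Wf]; omega

lemma proj_eq_inl {n N : ℤ} {w : Lat} {u : {w : Lat // w ∈ Wf n N}} (h : proj n N w = Sum.inl u) :
    w = u.1 := by
  unfold proj at h
  split_ifs at h with h1 h2
  · rw [← Sum.inl.inj h]

/-- Network edges. -/
abbrev Et (N : ℤ) : Type :=
  {w : Lat // w ∈ Finset.Icc (-(N+1)) (N+1) ×ˢ Finset.Icc (-(N+1)) (N+1)} × Bool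

/-- Source. -/
def eS (n N : ℤ) (e : Et N) : Vt n N := proj n N e.1.1

/-- Target. -/
def eT (n N : ℤ) (e : Et N) : Vt n N := proj n N (e.1.1 + dir e.2)

/-- Mass. -/
def eM (n N : ℤ) (m : ℝ) (u : Vt n N) : ℝ := Sum.elim (fun _ => 0) (fun _ => m) u

/-- Lattice energy. -/
def En (T : ℤ) (G : Lat → ℝ) : ℝ := ∑ x ∈ Finset.Icc (-T) T, ∑ y ∈ Finset.Icc (-T) T,
  ((G (x, y + 1) - G (x, y)) ^ 2 + (G (x + 1, y) - G (x, y)) ^ 2)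

lemma sum_En (n N : ℤ) (g : Vt n N → ℝ) :
    ∑ e : Et N, (g (eS n N e) - g (eT n N e)) ^ 2 = En (N + 1) (fun w => g (proj n N w)) := by
  unfold En eS eT dir
  rw [Fintype.sum_prod_type]
  simp only [Fintype.sum_bool]
  rw [Finset.sum_coe_sort (Finset.Icc (-(N+1)) (N+1) ×ˢ Finset.Icc (-(N+1)) (N+1))
    (fun w : Lat => (g (proj n N w) - g (proj n N (w + if True then ((0:ℤ), (1:ℤ)) else (1, 0)))) ^ 2 +
      (g (proj n N w) - g (proj n N (w + if false = true then ((0:ℤ), (1:ℤ)) else (1, 0)))) ^ 2), Finset.sum_product]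
  refine sum_congr rfl fun x _ => sum_congr rfl fun y _ => ?_
  simp only [if_true, Prod.mk_add_mk, add_zero, Bool.false_eq_true, if_false]
  ring

/-- The lattice network matrix. -/
def latA (n N : ℤ) (m : ℝ) : Matrix (Vt n N) (Vt n N) ℝ := netA (eS n N) (eT n N) (eM n N m)

/-- Normalisation. -/
def latL (n N : ℤ) (m : ℝ) (u : Vt n N) : ℝ := netL (eS n N) (eT n N) (eM n N m) u

lemma netC_inl_le (n N : ℤ) (w : {w : Lat // w ∈ Wf n N}) :
    ∑ v, netC (eS n N) (eT n N) (Sum.inl w) v ≤ 1 := by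
  rw [netC_deg, sum_add_distrib]
  have key : ∀ (f : Lat → Lat) (i : Bool), Function.Injective f → ∀ q : Et N → Prop,
      (∀ e, q e → f e.1.1 = w.1) → ∑ u : {w : Lat // w ∈ Finset.Icc (-(N+1)) (N+1) ×ˢ Finset.Icc (-(N+1)) (N+1)},
        (if q (u, i) then (1:ℝ) else 0) ≤ 1 := by
    intro f i hf q hq
    rw [Finset.sum_boole]
    have : (Finset.univ.filter (fun u => q (u, i))).card ≤ 1 := by
      rw [Finset.card_le_one]
      intro a ha b hb
      have h1 := hq _ (mem_filter.1 ha).2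
      have h2 := hq _ (mem_filter.1 hb).2
      exact Subtype.ext (hf (h1.trans h2.symm))
    exact_mod_cast this
  have k1 : ∀ i, ∑ u, (if eS n N (u, i) = Sum.inl w ∧ eT n N (u, i) ≠ Sum.inl w then (1:ℝ) else 0) ≤ 1 :=
    fun i => by
      convert key id i Function.injective_id
        (fun e => eS n N e = Sum.inl w ∧ eT n N e ≠ Sum.inl w) (fun e h => proj_eq_inl h.1)
  have k2 : ∀ i, ∑ u, (if eT n N (u, i) = Sum.inl w ∧ eS n N (u, i) ≠ Sum.inl w then (1:ℝ) else 0) ≤ 1 := by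
    intro i
    refine key (· + dir i) i (add_left_injective _)
      (fun e => e.2 = i ∧ eT n N e = Sum.inl w ∧ eS n N e ≠ Sum.inl w) (fun e h => ?_) |>.trans' ?_
    · have := proj_eq_inl h.2.1
      rw [h.1] at this; exact this
    · simp
  rw [Fintype.sum_prod_type_right, Fintype.sum_prod_type_right, Fintype.sum_bool, Fintype.sum_bool]
  linarith [k1 true, k1 false, k2 true, k2 false]

lemma latL_inl_le (n N : ℤ) (m : ℝ) (w : {w : Lat // w ∈ Wf n N}) : latL n N m (Sum.inl w) ≤ 1 := by
  unfold latL netL eM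
  simpa using netC_inl_le n N w

lemma netC_adj (n N : ℤ) (w : Lat) (i : Bool) (hw : w ∈ Wf n N) (hne : proj n N (w + dir i) ≠ proj n N w) :
    1 / 4 ≤ netC (eS n N) (eT n N) (proj n N w) (proj n N (w + dir i)) := by
  unfold netC
  rw [if_neg (Ne.symm hne)]
  have hmem : w ∈ Finset.Icc (-(N+1)) (N+1) ×ˢ Finset.Icc (-(N+1)) (N+1) := by
    have := (mem_Wf.1 hw).2
    unfold linf at this
    rw [max_le_iff, abs_le, abs_le] at this
    rw [Finset.mem_product, Finset.mem_Icc, Finset.mem_Icc]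
    omega
  have := Finset.single_le_sum (f := fun e : Et N =>
    ((if eS n N e = proj n N w ∧ eT n N e = proj n N (w + dir i) then (1:ℝ) else 0) +
      if eS n N e = proj n N (w + dir i) ∧ eT n N e = proj n N w then 1 else 0))
    (fun e _ => by apply add_nonneg <;> split_ifs <;> norm_num) (Finset.mem_univ (⟨⟨w, hmem⟩, i⟩ : Et N))
  have h2 : (1:ℝ) ≤ ((if eS n N (⟨⟨w, hmem⟩, i⟩ : Et N) = proj n N w ∧ eT n N (⟨⟨w, hmem⟩, i⟩ : Et N) = proj n N (w + dir i) then (1:ℝ) else 0) +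
      if eS n N (⟨⟨w, hmem⟩, i⟩ : Et N) = proj n N (w + dir i) ∧ eT n N (⟨⟨w, hmem⟩, i⟩ : Et N) = proj n N w then 1 else 0) := by
    rw [if_pos ⟨rfl, rfl⟩]
    have : (0:ℝ) ≤ if eS n N (⟨⟨w, hmem⟩, i⟩ : Et N) = proj n N (w + dir i) ∧ eT n N (⟨⟨w, hmem⟩, i⟩ : Et N) = proj n N w then 1 else 0 := by
      split_ifs <;> norm_num
    linarith
  have h3 := h2.trans this
  linarith

lemma dir_ne (i : Bool) (w : Lat) : w + dir i ≠ w := by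
  intro h
  have : dir i = 0 := by simpa using h
  cases i <;> simp [dir, Prod.ext_iff] at this

lemma latL_pos (n N : ℤ) {m : ℝ} (hm : 0 < m) (u : Vt n N) : 0 < latL n N m u := by
  unfold latL netL
  have h0 : 0 ≤ ∑ v, netC (eS n N) (eT n N) u v := sum_nonneg fun v _ => netC_nonneg _ _ _ _
  rcases u with w | i
  · have hne : proj n N (w.1 + dir false) ≠ proj n N w.1 := by
      rw [proj_inl w.2]
      intro h
      exact dir_ne _ _ (proj_eq_inl h)
    have h1 := netC_adj n N w.1 false w.2 hne
    rw [proj_inl w.2] at h1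
    have h2 := Finset.single_le_sum (f := fun v => netC (eS n N) (eT n N) (Sum.inl w) v)
      (fun v _ => netC_nonneg _ _ _ _) (Finset.mem_univ (proj n N (w.1 + dir false)))
    have h3 := h1.trans h2
    simp only [eM, Sum.elim_inl]
    linarith
  · simp only [eM, Sum.elim_inr]; linarith

lemma latA_adj {n N : ℤ} {m : ℝ} (hm : 0 < m) {w w' : Lat} (hw : w ∈ Wf n N) (hw' : w' ∈ Wf n N)
    (h : Adj w w') : 1 / 4 ≤ latA n N m (Sum.inl ⟨w, hw⟩) (Sum.inl ⟨w', hw'⟩) := by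
  have hC : 1 / 4 ≤ netC (eS n N) (eT n N) (Sum.inl ⟨w, hw⟩) (Sum.inl ⟨w', hw'⟩) := by
    have key : ∀ (a b : Lat) (ha : a ∈ Wf n N) (hb : b ∈ Wf n N) (i : Bool), b = a + dir i →
        1 / 4 ≤ netC (eS n N) (eT n N) (Sum.inl ⟨a, ha⟩) (Sum.inl ⟨b, hb⟩) := by
      rintro a b ha hb i rfl
      have := netC_adj n N a i ha (by
        rw [proj_inl ha]; intro h; exact dir_ne i a (proj_eq_inl h))
      rwa [proj_inl ha, proj_inl hb] at this
    have hc : w' = w + dir false ∨ w' = w + dir true ∨ w = w' + dir false ∨ w = w' + dir true := by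
      obtain ⟨a, b⟩ := w; obtain ⟨c, d⟩ := w'
      unfold Adj at h
      simp only [dir, Prod.mk_add_mk, Prod.mk.injEq, if_true, Bool.false_eq_true, if_false] at h ⊢
      have h1 : |a - c| ≤ 1 := by
        rw [abs_le]; constructor <;> nlinarith [sq_nonneg (b - d)]
      have h2 : |b - d| ≤ 1 := by
        rw [abs_le]; constructor <;> nlinarith [sq_nonneg (a - c)]
      rw [abs_le] at h1 h2
      rcases (show a - c = -1 ∨ a - c = 0 ∨ a - c = 1 by omega) with h3 | h3 | h3 <;>
      rcases (show b - d = -1 ∨ b - d = 0 ∨ b - d = 1 by omega) with h4 | h4 | h4 <;>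
      rw [h3, h4] at h <;> omega
    rcases hc with h | h | h | h
    · exact key _ _ hw hw' _ h
    · exact key _ _ hw hw' _ h
    · rw [netC_symm]; exact key _ _ hw' hw _ h
    · rw [netC_symm]; exact key _ _ hw' hw _ h
  refine hC.trans ?_
  unfold latA netA
  have p1 := Real.sqrt_pos.2 (latL_pos n N hm (Sum.inl ⟨w, hw⟩))
  have p2 := Real.sqrt_pos.2 (latL_pos n N hm (Sum.inl ⟨w', hw'⟩))
  have q1 : √(latL n N m (Sum.inl ⟨w, hw⟩)) ≤ 1 := Real.sqrt_le_one.2 (latL_inl_le _ _ _ _)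
  have q2 : √(latL n N m (Sum.inl ⟨w', hw'⟩)) ≤ 1 := Real.sqrt_le_one.2 (latL_inl_le _ _ _ _)
  unfold latL at p1 p2 q1 q2
  rw [le_div_iff₀ (mul_pos p1 p2)]
  have : √(netL (eS n N) (eT n N) (eM n N m) (Sum.inl ⟨w, hw⟩)) * √(netL (eS n N) (eT n N) (eM n N m) (Sum.inl ⟨w', hw'⟩)) ≤ 1 :=
    mul_le_one₀ q1 p2.le q2
  have h0 := netC_nonneg (eS n N) (eT n N) (Sum.inl ⟨w, hw⟩) (Sum.inl ⟨w', hw'⟩)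
  nlinarith

lemma latA_ne {n N : ℤ} {m : ℝ} {w w' : {w : Lat // w ∈ Wf n N}}
    (h : latA n N m (Sum.inl w) (Sum.inl w') ≠ 0) : |linf w.1 - linf w'.1| ≤ 1 := by
  have h1 : netC (eS n N) (eT n N) (Sum.inl w) (Sum.inl w') ≠ 0 := by
    intro h0; apply h; unfold latA netA; rw [h0, zero_div]
  unfold netC at h1
  split_ifs at h1 with h2
  · exact absurd rfl h1
  have h3 : ∃ e : Et N, (eS n N e = Sum.inl w ∧ eT n N e = Sum.inl w') ∨ (eS n N e = Sum.inl w' ∧ eT n N e = Sum.inl w) := by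
    by_contra hno
    push Not at hno
    apply h1
    rw [sum_eq_zero, zero_div]
    intro e _
    have := hno e
    rw [if_neg (fun h => this.1 h.1 h.2), if_neg (fun h => this.2 h.1 h.2), add_zero]
  have h4 : ∀ (a : Lat) (i : Bool), |linf a - linf (a + dir i)| ≤ 1 := by
    intro a i
    have h5 := abs_sub_abs_le_abs_sub a.1 (a.1 + 1)
    have h6 := abs_sub_abs_le_abs_sub (a.1 + 1) a.1
    have h7 := abs_sub_abs_le_abs_sub a.2 (a.2 + 1)
    have h8 := abs_sub_abs_le_abs_sub (a.2 + 1) a.2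
    simp at h5 h6 h7 h8
    unfold linf dir
    cases i <;> simp only [if_true, Bool.false_eq_true, if_false, Prod.fst_add, Prod.snd_add, add_zero] <;>
      rw [abs_le] <;> omega
  obtain ⟨e, ⟨a, b⟩ | ⟨a, b⟩⟩ := h3
  · rw [← proj_eq_inl a, ← proj_eq_inl b]; exact h4 _ _
  · rw [← proj_eq_inl a, ← proj_eq_inl b, abs_sub_comm]; exact h4 _ _

lemma lat_qf (n N : ℤ) {m : ℝ} (hm : 0 < m) (g : Vt n N → ℝ) :
    qf (latA n N m) (fun u => √(latL n N m u) * g u) =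
      En (N + 1) (fun w => g (proj n N w)) / 4 + m * (g (Sum.inr false) ^ 2 + g (Sum.inr true) ^ 2) := by
  have := net_qf (eS n N) (eT n N) (eM n N m) (latL_pos n N hm) g
  rw [sum_En] at this
  unfold latA latL
  rw [this, Fintype.sum_sum_type]
  simp [eM]; ring

lemma lat_PosW (n N : ℤ) (hnN : n ≤ N) {m : ℝ} (hm : 0 < m) : PosW (latA n N m) := by
  refine net_PosW _ _ _ (latL_pos n N hm) ?_ ?_
  · rintro (u | u)
    · exact le_rfl
    · exact hm.le
  · intro g hg hu
    have hb : ∀ i, g (Sum.inr i) = 0 := fun i => (hu (Sum.inr i)).resolve_left (by simp [eM, hm.ne'])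
    have key : ∀ k : ℕ, ∀ x y : ℤ, |y| ≤ N + 1 → -(N+1) ≤ x → N + 1 - x = k → g (proj n N (x, y)) = 0 := by
      intro k
      induction k with
      | zero =>
        intro x y hy hx hk
        rw [proj_d hnN, hb]
        unfold linf
        refine lt_max_of_lt_left ?_
        rw [abs_of_nonneg] <;> simp <;> omega
      | succ k ih =>
        intro x y hy hx hk
        have h1 := hg (⟨⟨(x, y), by
          rw [abs_le] at hy
          rw [Finset.mem_product, Finset.mem_Icc, Finset.mem_Icc]; push_cast at hk; simp only; omega⟩, false⟩ : Et N)
        unfold eS eT at h1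
        rw [h1]
        simp only [dir, Prod.mk_add_mk, add_zero, Bool.false_eq_true, if_false]
        exact ih _ _ hy (by omega) (by push_cast at hk; omega)
    funext u
    rcases u with w | i
    · have hw := mem_Wf.1 w.2
      unfold linf at hw
      rw [max_le_iff] at hw
      have h1 := abs_le.1 hw.2.1
      have := key (N + 1 - w.1.1).toNat w.1.1 w.1.2 (by omega) (by omega) (by rw [Int.toNat_of_nonneg]; omega)
      rw [Prod.mk.eta, proj_inl w.2] at this
      exact this
    · exact hb i

lemma line_tele (f : ℤ → ℝ) (p q : ℤ) (h : p ≤ q) :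
    ∑ k ∈ Finset.Ico p q, (f (k + 1) - f k) = f q - f p := by
  induction q, h using Int.leInduction with
  | base => simp
  | succ q hq ih =>
    rw [← Finset.insert_Ico_right_eq_Ico_add_one hq, Finset.sum_insert (by simp), ih]; ring

/-- One-dimensional energy. -/
def lineE (T : ℤ) (f : ℤ → ℝ) : ℝ := ∑ k ∈ Finset.Icc (-T) T, (f (k + 1) - f k) ^ 2

lemma lineE_nonneg (T : ℤ) (f : ℤ → ℝ) : 0 ≤ lineE T f := sum_nonneg fun _ _ => sq_nonneg _

lemma line_le (f : ℤ → ℝ) (T p q : ℤ) (h : p ≤ q) (hp : -T ≤ p) (hq : q ≤ T + 1) :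
    (f q - f p) ^ 2 ≤ ((q - p : ℤ) : ℝ) * lineE T f := by
  rw [← line_tele f p q h]
  refine sq_sum_le_card_mul_sum_sq.trans ?_
  have h1 : ((Finset.Ico p q).card : ℝ) = ((q - p : ℤ) : ℝ) := by
    rw [Int.card_Ico, ← Int.cast_natCast, Int.toNat_of_nonneg (by omega)]
  rw [h1]
  refine mul_le_mul_of_nonneg_left ?_ (by exact_mod_cast (by omega : (0:ℤ) ≤ q - p))
  refine Finset.sum_le_sum_of_subset_of_nonneg ?_ (fun _ _ _ => sq_nonneg _)
  intro k hk
  rw [Finset.mem_Ico] at hk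
  rw [Finset.mem_Icc]; omega

lemma line_le' (f : ℤ → ℝ) (T p q l : ℤ) (hp : -T ≤ p) (hp' : p ≤ T + 1) (hq : -T ≤ q) (hq' : q ≤ T + 1)
    (hl : |p - q| ≤ l) : (f q - f p) ^ 2 ≤ (l : ℝ) * lineE T f := by
  rw [abs_le] at hl
  rcases le_total p q with h | h
  · refine (line_le f T p q h hp hq').trans (mul_le_mul_of_nonneg_right ?_ (lineE_nonneg _ _))
    exact_mod_cast (by omega : q - p ≤ l)
  · have := line_le f T q p h hq hp'
    rw [show (f q - f p) ^ 2 = (f p - f q) ^ 2 by ring]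
    refine this.trans (mul_le_mul_of_nonneg_right ?_ (lineE_nonneg _ _))
    exact_mod_cast (by omega : p - q ≤ l)

lemma En_eq (T : ℤ) (G : Lat → ℝ) : En T G =
    ∑ x ∈ Finset.Icc (-T) T, lineE T (fun y => G (x, y)) + ∑ y ∈ Finset.Icc (-T) T, lineE T (fun x => G (x, y)) := by
  unfold En lineE
  rw [sum_comm (s := Finset.Icc (-T) T) (t := Finset.Icc (-T) T)
    (f := fun y x => (G (x + 1, y) - G (x, y)) ^ 2), ← sum_add_distrib]
  refine sum_congr rfl fun x _ => ?_
  rw [← sum_add_distrib]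

lemma sum_pm (S : ℤ → ℝ) (hS : ∀ x, 0 ≤ S x) (a b T : ℤ) (ha : 0 ≤ a) (hb : b ≤ T) :
    ∑ s ∈ Finset.Icc (a + 1) b, (S s + S (-s)) ≤ ∑ x ∈ Finset.Icc (-T) T, S x := by
  rw [sum_add_distrib]
  have h1 : ∑ s ∈ Finset.Icc (a + 1) b, S (-s) = ∑ s ∈ Finset.Icc (-b) (-(a+1)), S s := by
    refine Finset.sum_bij' (fun s _ => -s) (fun s _ => -s) ?_ ?_ ?_ ?_ ?_
    · intro s hs; rw [Finset.mem_Icc] at hs ⊢; omega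
    · intro s hs; rw [Finset.mem_Icc] at hs ⊢; omega
    · intro s _; simp
    · intro s _; simp
    · intro s _; rfl
  rw [h1, ← Finset.sum_union]
  · refine Finset.sum_le_sum_of_subset_of_nonneg ?_ (fun _ _ _ => hS _)
    intro k hk
    rw [Finset.mem_union, Finset.mem_Icc, Finset.mem_Icc] at hk
    rw [Finset.mem_Icc]; omega
  · rw [Finset.disjoint_left]
    intro k hk hk'
    rw [Finset.mem_Icc] at hk hk'; omega

lemma ring_sum (T : ℤ) (G : Lat → ℝ) (a b : ℤ) (ha : 0 ≤ a) (hab : a ≤ b) (hb : b ≤ T) (δ : ℝ)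
    (h : ∀ s, a < s → s ≤ b → ∃ t, (t = s ∨ t = -s) ∧
      (δ ≤ lineE T (fun y => G (t, y)) ∨ δ ≤ lineE T (fun x => G (x, t)))) :
    ((b - a : ℤ) : ℝ) * δ ≤ En T G := by
  have h1 := sum_pm (fun x => lineE T (fun y => G (x, y))) (fun x => lineE_nonneg _ _) a b T ha hb
  have h2 := sum_pm (fun y => lineE T (fun x => G (x, y))) (fun x => lineE_nonneg _ _) a b T ha hb
  rw [En_eq]
  refine le_trans ?_ (add_le_add h1 h2)
  rw [← sum_add_distrib]
  have h3 : ∑ _s ∈ Finset.Icc (a + 1) b, δ = ((b - a : ℤ) : ℝ) * δ := by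
    rw [sum_const, Int.card_Icc, nsmul_eq_mul, ← Int.cast_natCast, Int.toNat_of_nonneg (by omega)]
    congr 2; ring
  rw [← h3]
  refine sum_le_sum fun s hs => ?_
  rw [Finset.mem_Icc] at hs
  obtain ⟨t, ht, h4⟩ := h s (by omega) hs.2
  have n1 := lineE_nonneg T (fun y => G (s, y))
  have n2 := lineE_nonneg T (fun y => G (-s, y))
  have n3 := lineE_nonneg T (fun x => G (x, s))
  have n4 := lineE_nonneg T (fun x => G (x, -s))
  rcases ht with rfl | rfl <;> rcases h4 with h4 | h4 <;> linarith

lemma linf_cases {w : Lat} {s : ℤ} (h : linf w = s) : ∃ t, (t = s ∨ t = -s) ∧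
    ((w.1 = t ∧ |w.2| ≤ s) ∨ (w.2 = t ∧ |w.1| ≤ s)) := by
  unfold linf at h
  rcases le_total |w.1| |w.2| with h1 | h1
  · rw [max_eq_right h1] at h
    rcases abs_choice w.2 with h2 | h2
    · exact ⟨w.2, Or.inl (by omega), Or.inr ⟨rfl, by omega⟩⟩
    · exact ⟨w.2, Or.inr (by omega), Or.inr ⟨rfl, by omega⟩⟩
  · rw [max_eq_left h1] at h
    rcases abs_choice w.1 with h2 | h2
    · exact ⟨w.1, Or.inl (by omega), Or.inl ⟨rfl, by omega⟩⟩
    · exact ⟨w.1, Or.inr (by omega), Or.inl ⟨rfl, by omega⟩⟩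

lemma low_d (T a : ℤ) (ha : 1 ≤ a) (hT : T = 4 * a + 1) (G : Lat → ℝ) (hG : ∀ w, T ≤ linf w → G w = 1)
    (hz : ∀ s, a < s → s ≤ 2 * a → ∃ w, linf w = s ∧ G w = 0) : 1 / 10 ≤ En T G := by
  have hTp : (0:ℝ) < ((2 * T : ℤ) : ℝ) := by exact_mod_cast (by omega : (0:ℤ) < 2 * T)
  have h := ring_sum T G a (2 * a) (by omega) (by omega) (by omega) (1 / ((2 * T : ℤ) : ℝ)) (by
    intro s hs hs'
    obtain ⟨w, hw, h0⟩ := hz s hs hs'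
    obtain ⟨t, ht, h1 | h1⟩ := linf_cases hw
    · refine ⟨t, ht, Or.inl ?_⟩
      have h2 := abs_le.1 h1.2
      have := line_le' (fun y => G (t, y)) T w.2 T (2 * T) (by omega) (by omega) (by omega) (by omega) (by rw [abs_le]; omega)
      have e1 : G (t, w.2) = 0 := by rw [← h1.1]; exact h0
      have e2 : G (t, T) = 1 := hG _ (le_max_of_le_right (le_abs_self _))
      simp only [e1, e2] at this
      rw [div_le_iff₀ hTp]; linarith
    · refine ⟨t, ht, Or.inr ?_⟩
      have h2 := abs_le.1 h1.2
      have := line_le' (fun x => G (x, t)) T w.1 T (2 * T) (by omega) (by omega) (by omega) (by omega) (by rw [abs_le]; omega)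
      have e1 : G (w.1, t) = 0 := by rw [← h1.1]; exact h0
      have e2 : G (T, t) = 1 := hG _ (le_max_of_le_left (le_abs_self _))
      simp only [e1, e2] at this
      rw [div_le_iff₀ hTp]; linarith)
  refine le_trans ?_ h
  rw [mul_one_div, le_div_iff₀ hTp]
  subst hT
  push_cast
  have : (1:ℝ) ≤ a := by exact_mod_cast ha
  linarith

lemma low_b (T n : ℤ) (hn : 1 ≤ n) (hT : 4 * n ≤ T) (G : Lat → ℝ) (hG : ∀ w, linf w ≤ n → G w = 1)
    (hz : ∀ s, 2 * n < s → s ≤ 4 * n → ∃ w, linf w = s ∧ G w = 0) : 1 / 16 ≤ En T G := by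
  have hnp : (1:ℝ) ≤ n := by exact_mod_cast hn
  -- either a full side is small or each ring oscillates
  by_cases hA : ∃ s t, 2 * n < s ∧ s ≤ 4 * n ∧ (t = s ∨ t = -s) ∧
      ((∀ y, |y| ≤ s → G (t, y) < 1 / 2) ∨ (∀ x, |x| ≤ s → G (x, t) < 1 / 2))
  · obtain ⟨s, t, hs, hs', ht, hc⟩ := hA
    have fin : ∀ S : ℤ → ℝ, (∀ x, 0 ≤ S x) → (∀ y ∈ Finset.Icc (-n) n, 1 / (16 * (n:ℝ)) ≤ S y) →
        1 / 16 ≤ ∑ y ∈ Finset.Icc (-T) T, S y := by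
      intro S hS h
      have h1 : ∑ y ∈ Finset.Icc (-n) n, 1 / (16 * (n:ℝ)) ≤ ∑ y ∈ Finset.Icc (-T) T, S y :=
        (sum_le_sum h).trans (Finset.sum_le_sum_of_subset_of_nonneg
          (fun k hk => by rw [Finset.mem_Icc] at hk ⊢; omega) (fun _ _ _ => hS _))
      refine le_trans ?_ h1
      rw [sum_const, Int.card_Icc, nsmul_eq_mul, ← Int.cast_natCast, Int.toNat_of_nonneg (by omega),
        mul_one_div, le_div_iff₀ (by positivity)]
      push_cast; linarith
    have gen : ∀ f : ℤ → ℝ, f 0 = 1 → f t < 1 / 2 → 1 / (16 * (n:ℝ)) ≤ lineE T f := by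
      intro f h0 h1
      have := line_le' f T 0 t (4 * n) (by omega) (by omega) (by omega) (by omega) (by rw [abs_le]; omega)
      rw [div_le_iff₀ (by positivity)]
      push_cast at this
      rw [h0] at this
      nlinarith
    rw [En_eq]
    rcases hc with hc | hc
    · have := fin (fun y => lineE T (fun x => G (x, y))) (fun _ => lineE_nonneg _ _) (fun y hy => by
        rw [Finset.mem_Icc] at hy
        refine gen _ (hG _ ?_) (hc y (by rw [abs_le]; omega))
        unfold linf; simp only [abs_zero]; rw [max_le_iff, abs_le]; omega)
      have h2 : 0 ≤ ∑ x ∈ Finset.Icc (-T) T, lineE T (fun y => G (x, y)) :=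
        sum_nonneg fun _ _ => lineE_nonneg _ _
      linarith
    · have := fin (fun x => lineE T (fun y => G (x, y))) (fun _ => lineE_nonneg _ _) (fun y hy => by
        rw [Finset.mem_Icc] at hy
        refine gen _ (hG _ ?_) (hc y (by rw [abs_le]; omega))
        unfold linf; simp only [abs_zero]; rw [max_le_iff, abs_le]; omega)
      have h2 : 0 ≤ ∑ y ∈ Finset.Icc (-T) T, lineE T (fun x => G (x, y)) :=
        sum_nonneg fun _ _ => lineE_nonneg _ _
      linarith
  · push Not at hA
    have h := ring_sum T G (2 * n) (4 * n) (by omega) (by omega) hT (1 / (32 * (n:ℝ))) (by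
      intro s hs hs'
      have gen : ∀ (f : ℤ → ℝ) (p q : ℤ), |p| ≤ s → |q| ≤ s → f p = 0 → 1 / 2 ≤ f q → 1 / (32 * (n:ℝ)) ≤ lineE T f := by
        intro f p q hp hq h0 h1
        rw [abs_le] at hp hq
        have := line_le' f T p q (8 * n) (by omega) (by omega) (by omega) (by omega) (by rw [abs_le]; omega)
        rw [div_le_iff₀ (by positivity)]
        push_cast at this
        rw [h0] at this
        nlinarith
      obtain ⟨w, hw, h0⟩ := hz s hs hs'
      obtain ⟨t, ht, h1 | h1⟩ := linf_cases hw
      · obtain ⟨y, hy, hy'⟩ := (hA s t hs hs' ht).1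
        exact ⟨t, ht, Or.inl (gen _ w.2 y h1.2 hy (by rw [← h1.1]; exact h0) hy')⟩
      · obtain ⟨y, hy, hy'⟩ := (hA s t hs hs' ht).2
        exact ⟨t, ht, Or.inr (gen _ w.1 y h1.2 hy (by rw [← h1.1]; exact h0) hy')⟩)
    refine le_trans ?_ h
    rw [mul_one_div, le_div_iff₀ (by positivity)]
    push_cast; linarith

/-- Truncated harmonic sum. -/
def hS (n N : ℤ) (s : ℤ) : ℝ := ∑ k ∈ Finset.Ico n (min s (N + 1)), 1 / (k : ℝ)

/-- Squared increments. -/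
def qS (n N : ℤ) (k : ℤ) : ℝ := if k ∈ Finset.Ico n (N + 1) then (1 / (k : ℝ)) ^ 2 else 0

lemma qS_nonneg (n N k : ℤ) : 0 ≤ qS n N k := by unfold qS; split_ifs <;> positivity

lemma hS_step (n N s : ℤ) : (hS n N (s + 1) - hS n N s) ^ 2 = qS n N s := by
  unfold hS qS
  by_cases h : s ∈ Finset.Ico n (N + 1)
  · rw [if_pos h]
    rw [Finset.mem_Ico] at h
    rw [min_eq_left (by omega), min_eq_left (by omega), ← Finset.insert_Ico_right_eq_Ico_add_one h.1,
      Finset.sum_insert (by simp)]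
    ring
  · rw [if_neg h]
    rw [Finset.mem_Ico] at h
    by_cases h1 : s < n
    · rw [Finset.Ico_eq_empty (by rw [not_lt]; exact (min_le_left _ _).trans (by omega)),
        Finset.Ico_eq_empty (by rw [not_lt]; exact (min_le_left _ _).trans (by omega))]
      simp
    · rw [min_eq_right (by omega), min_eq_right (by omega)]; simp

lemma linf_dir (a : Lat) (i : Bool) : |linf a - linf (a + dir i)| ≤ 1 := by
  have h5 := abs_sub_abs_le_abs_sub a.1 (a.1 + 1)
  have h6 := abs_sub_abs_le_abs_sub (a.1 + 1) a.1
  have h7 := abs_sub_abs_le_abs_sub a.2 (a.2 + 1)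
  have h8 := abs_sub_abs_le_abs_sub (a.2 + 1) a.2
  simp at h5 h6 h7 h8
  unfold linf dir
  cases i <;> simp only [if_true, Bool.false_eq_true, if_false, Prod.fst_add, Prod.snd_add, add_zero] <;>
    rw [abs_le] <;> omega

lemma hS_diff (n N a b : ℤ) (h : |a - b| ≤ 1) :
    (hS n N b - hS n N a) ^ 2 ≤ qS n N a + qS n N (a - 1) := by
  rw [abs_le] at h
  rcases (show b = a ∨ b = a + 1 ∨ b = a - 1 by omega) with rfl | rfl | rfl
  · rw [sub_self]; have := qS_nonneg n N b; have := qS_nonneg n N (b - 1); simp; linarith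
  · rw [hS_step]; have := qS_nonneg n N (a - 1); linarith
  · have := hS_step n N (a - 1)
    rw [sub_add_cancel] at this
    have h2 := qS_nonneg n N a
    nlinarith

lemma sum_linf (T : ℤ) (F : ℤ → ℝ) (hF : ∀ k, 0 ≤ F k) :
    ∑ x ∈ Finset.Icc (-T) T, ∑ y ∈ Finset.Icc (-T) T, F (linf (x, y)) ≤
      2 * ∑ x ∈ Finset.Icc (-T) T, (2 * ((|x| : ℤ) : ℝ) + 1) * F |x| := by
  have h1 : ∀ x : ℤ, ∑ y ∈ Finset.Icc (-T) T, (if |y| ≤ |x| then F |x| else 0) ≤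
      (2 * ((|x| : ℤ) : ℝ) + 1) * F |x| := by
    intro x
    rw [← Finset.sum_filter, sum_const, nsmul_eq_mul]
    refine mul_le_mul_of_nonneg_right ?_ (hF _)
    have : (Finset.filter (fun y => |y| ≤ |x|) (Finset.Icc (-T) T)).card ≤ (Finset.Icc (-|x|) |x|).card := by
      apply Finset.card_le_card
      intro y hy
      rw [mem_filter, abs_le] at hy
      rw [Finset.mem_Icc]; exact hy.2
    have h2 : ((Finset.Icc (-|x|) |x|).card : ℝ) = 2 * ((|x| : ℤ) : ℝ) + 1 := by
      rw [Int.card_Icc, ← Int.cast_natCast, Int.toNat_of_nonneg (by have := abs_nonneg x; omega)]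
      push_cast; ring
    rw [← h2]; exact_mod_cast this
  have h2 : ∀ x y : ℤ, F (linf (x, y)) ≤ (if |y| ≤ |x| then F |x| else 0) + (if |x| ≤ |y| then F |y| else 0) := by
    intro x y
    unfold linf
    have a1 := hF |x|
    have a2 := hF |y|
    rcases le_total |x| |y| with h | h
    · rw [max_eq_right h, if_pos h]; split_ifs <;> linarith
    · rw [max_eq_left h, if_pos h]; split_ifs <;> linarith
  calc _ ≤ ∑ x ∈ Finset.Icc (-T) T, ∑ y ∈ Finset.Icc (-T) T,
        ((if |y| ≤ |x| then F |x| else 0) + (if |x| ≤ |y| then F |y| else 0)) :=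
        sum_le_sum fun x _ => sum_le_sum fun y _ => h2 x y
    _ = ∑ x ∈ Finset.Icc (-T) T, ∑ y ∈ Finset.Icc (-T) T, (if |y| ≤ |x| then F |x| else 0) +
        ∑ y ∈ Finset.Icc (-T) T, ∑ x ∈ Finset.Icc (-T) T, (if |x| ≤ |y| then F |y| else 0) := by
        simp only [sum_add_distrib]
        congr 1
        exact sum_comm
    _ ≤ _ := by
        rw [two_mul]
        exact add_le_add (sum_le_sum fun x _ => h1 x) (sum_le_sum fun x _ => h1 x)

lemma sum_abs_le (T : ℤ) (P : ℤ → ℝ) (hP : ∀ k, 0 ≤ P k) (h0 : P 0 = 0) :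
    ∑ x ∈ Finset.Icc (-T) T, P |x| ≤ 2 * ∑ k ∈ Finset.Icc 1 T, P k := by
  have hsub : Finset.Icc (-T) T ⊆ insert 0 (Finset.Icc 1 T ∪ (Finset.Icc 1 T).image (fun k => -k)) := by
    intro x hx
    rw [Finset.mem_Icc] at hx
    rw [Finset.mem_insert, Finset.mem_union, Finset.mem_Icc, Finset.mem_image]
    rcases lt_trichotomy x 0 with h | h | h
    · exact Or.inr (Or.inr ⟨-x, Finset.mem_Icc.2 (by omega), by simp⟩)
    · exact Or.inl h
    · exact Or.inr (Or.inl (by omega))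
  refine (Finset.sum_le_sum_of_subset_of_nonneg hsub (fun _ _ _ => hP _)).trans ?_
  rw [Finset.sum_insert]
  · rw [abs_zero, h0, zero_add, Finset.sum_union, Finset.sum_image (by intro a _ b _ h; simpa using h), two_mul]
    · apply le_of_eq
      congr 1
      · refine sum_congr rfl fun k hk => ?_
        rw [Finset.mem_Icc] at hk; rw [abs_of_nonneg (by omega)]
      · refine sum_congr rfl fun k hk => ?_
        rw [Finset.mem_Icc] at hk; rw [abs_neg, abs_of_nonneg (by omega)]
    · rw [Finset.disjoint_left]
      intro k hk hk'
      rw [Finset.mem_image] at hk'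
      obtain ⟨l, hl, rfl⟩ := hk'
      rw [Finset.mem_Icc] at hk hl; omega
  · rw [Finset.mem_union, Finset.mem_image, Finset.mem_Icc]
    rintro (h | ⟨l, hl, h⟩)
    · omega
    · rw [Finset.mem_Icc] at hl; omega

lemma sum_q (n N : ℤ) (hn : 1 ≤ n) (A B : ℤ) (c : ℤ) (hc : 0 ≤ c) :
    ∑ k ∈ Finset.Icc A B, (2 * (k:ℝ) + c) * qS n N k ≤ (2 + c) * hS n N (N + 1) := by
  have h1 : ∀ k : ℤ, (2 * (k:ℝ) + c) * qS n N k ≤ if k ∈ Finset.Ico n (N + 1) then (2 + c) * (1 / (k:ℝ)) else 0 := by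
    intro k
    unfold qS
    split_ifs with h
    · rw [Finset.mem_Ico] at h
      have hk : (1:ℝ) ≤ k := by exact_mod_cast (by omega : (1:ℤ) ≤ k)
      have hc' : (0:ℝ) ≤ c := by exact_mod_cast hc
      rw [div_pow, one_pow, mul_one_div, mul_one_div, div_le_div_iff₀ (by positivity) (by positivity)]
      nlinarith [mul_nonneg hc' (by linarith : (0:ℝ) ≤ k - 1)]
    · simp
  refine (sum_le_sum fun k _ => h1 k).trans ?_
  rw [Finset.sum_ite_mem]
  have hc' : (0:ℝ) ≤ c := by exact_mod_cast hc
  unfold hS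
  rw [min_self, mul_sum]
  refine Finset.sum_le_sum_of_subset_of_nonneg Finset.inter_subset_right fun k hk _ => ?_
  rw [Finset.mem_Ico] at hk
  have hk : (1:ℝ) ≤ k := by exact_mod_cast (by omega : (1:ℤ) ≤ k)
  positivity

lemma En_hS (n N : ℤ) (hn : 1 ≤ n) :
    En (N + 1) (fun w => hS n N (linf w)) ≤ 64 * hS n N (N + 1) := by
  unfold En
  set T := N + 1
  have h1 : ∑ x ∈ Finset.Icc (-T) T, ∑ y ∈ Finset.Icc (-T) T,
      ((hS n N (linf (x, y + 1)) - hS n N (linf (x, y))) ^ 2 + (hS n N (linf (x + 1, y)) - hS n N (linf (x, y))) ^ 2) ≤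
      ∑ x ∈ Finset.Icc (-T) T, ∑ y ∈ Finset.Icc (-T) T,
        (fun k => 2 * (qS n N k + qS n N (k - 1))) (linf (x, y)) := by
    refine sum_le_sum fun x _ => sum_le_sum fun y _ => ?_
    have a1 := linf_dir (x, y) true
    have a2 := linf_dir (x, y) false
    simp only [dir, Prod.mk_add_mk, add_zero, if_true, Bool.false_eq_true, if_false] at a1 a2
    have b1 := hS_diff n N _ _ a1
    have b2 := hS_diff n N _ _ a2
    simp only
    linarith
  have hn0 : ∀ k, 0 ≤ 2 * (qS n N k + qS n N (k - 1)) := fun k => by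
    have := qS_nonneg n N k; have := qS_nonneg n N (k - 1); linarith
  refine h1.trans ((sum_linf T _ hn0).trans ?_)
  have q0 : ∀ k ≤ 0, qS n N k = 0 := fun k hk => by
    unfold qS; rw [if_neg]; rw [Finset.mem_Ico]; omega
  have h2 : ∑ x ∈ Finset.Icc (-T) T, (2 * ((|x| : ℤ) : ℝ) + 1) * (2 * (qS n N |x| + qS n N (|x| - 1))) ≤
      2 * ∑ k ∈ Finset.Icc 1 T, (2 * ((|k| : ℤ) : ℝ) + 1) * (2 * (qS n N k + qS n N (k - 1))) := by
    have := sum_abs_le T (fun k => (2 * ((|k| : ℤ) : ℝ) + 1) * (2 * (qS n N k + qS n N (k - 1))))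
      (fun k => mul_nonneg (by positivity) (hn0 k)) (by simp [q0])
    simpa only [abs_abs] using this
  have h3 : ∑ k ∈ Finset.Icc 1 T, (2 * ((|k| : ℤ) : ℝ) + 1) * (2 * (qS n N k + qS n N (k - 1))) =
      2 * (∑ k ∈ Finset.Icc 1 T, (2 * (k : ℝ) + (1:ℤ)) * qS n N k + ∑ k ∈ Finset.Icc 0 (T - 1), (2 * (k : ℝ) + (3:ℤ)) * qS n N k) := by
    have h4 : ∑ k ∈ Finset.Icc 0 (T - 1), (2 * (k : ℝ) + (3:ℤ)) * qS n N k =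
        ∑ k ∈ Finset.Icc 1 T, (2 * (k : ℝ) + 1) * qS n N (k - 1) := by
      refine Finset.sum_bij' (fun s _ => s + 1) (fun s _ => s - 1) ?_ ?_ ?_ ?_ ?_
      · intro s hs; rw [Finset.mem_Icc] at hs ⊢; omega
      · intro s hs; rw [Finset.mem_Icc] at hs ⊢; omega
      · intro s _; simp
      · intro s _; simp
      · intro s _; rw [add_sub_cancel_right]; push_cast; ring
    rw [h4, ← sum_add_distrib, mul_sum]
    refine sum_congr rfl fun k hk => ?_
    rw [Finset.mem_Icc] at hk; rw [abs_of_nonneg (by omega : 0 ≤ k)]; push_cast; ring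
  have h5 := sum_q n N hn 1 T 1 (by norm_num)
  have h6 := sum_q n N hn 0 (T - 1) 3 (by norm_num)
  rw [h3] at h2
  change _ ≤ 64 * hS n N (N + 1)
  push_cast at h5 h6 h2 ⊢
  linarith

lemma hS_log (n N : ℤ) (hn : 1 ≤ n) (hN : n ≤ N) : log (N / n) ≤ hS n N (N + 1) := by
  unfold hS
  rw [min_self]
  have hn' : (1:ℝ) ≤ n := by exact_mod_cast hn
  have hN' : (n:ℝ) ≤ N := by exact_mod_cast hN
  have h1 := line_tele (fun k => log (k:ℝ)) n (N + 1) (by omega)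
  have h2 : log (N / n) ≤ log ((N + 1 : ℤ) : ℝ) - log n := by
    rw [Real.log_div (by linarith) (by linarith)]
    have := Real.log_le_log (by linarith) (show (N:ℝ) ≤ ((N + 1 : ℤ):ℝ) by push_cast; linarith)
    linarith
  refine h2.trans ?_
  rw [← h1]
  refine sum_le_sum fun k hk => ?_
  rw [Finset.mem_Ico] at hk
  have hk : (1:ℝ) ≤ k := by exact_mod_cast (by omega : (1:ℤ) ≤ k)
  push_cast
  rw [← Real.log_div (by linarith) (by linarith)]
  have := Real.log_le_sub_one_of_pos (show (0:ℝ) < ((k:ℝ) + 1) / k by positivity)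
  refine this.trans (le_of_eq ?_)
  field_simp; ring

lemma En_smul (T : ℤ) (c : ℝ) (G : Lat → ℝ) : En T (fun w => c * G w) = c ^ 2 * En T G := by
  unfold En
  rw [mul_sum]
  refine sum_congr rfl fun x _ => ?_
  rw [mul_sum]
  refine sum_congr rfl fun y _ => ?_
  ring

lemma En_nonneg (T : ℤ) (G : Lat → ℝ) : 0 ≤ En T G :=
  sum_nonneg fun _ _ => sum_nonneg fun _ _ => by positivity

lemma lat_qf2 (n N : ℤ) {m : ℝ} (hm : 0 < m) {l : ℝ} (hl : 0 < l) (g : Vt n N → ℝ) :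
    qf (latA n N m) (fun u => √(latL n N m u) * ((√l)⁻¹ * g u)) =
      (En (N + 1) (fun w => g (proj n N w)) / 4 + m * (g (Sum.inr false) ^ 2 + g (Sum.inr true) ^ 2)) / l := by
  rw [lat_qf n N hm, En_smul]
  rw [mul_pow, mul_pow, inv_pow, Real.sq_sqrt hl.le]
  field_simp

lemma lat_rep (n N : ℤ) {m : ℝ} (hm : 0 < m) (f : Vt n N → ℝ) (v : Vt n N) :
    ∃ g : Vt n N → ℝ, g v = f v ∧ (∀ u, f u = 0 → g u = 0) ∧
      qf (latA n N m) f = (En (N + 1) (fun w => g (proj n N w)) / 4 +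
        m * (g (Sum.inr false) ^ 2 + g (Sum.inr true) ^ 2)) / latL n N m v := by
  have hp : ∀ u, 0 < √(latL n N m u) := fun u => Real.sqrt_pos.2 (latL_pos n N hm u)
  refine ⟨fun u => √(latL n N m v) * f u / √(latL n N m u), ?_, ?_, ?_⟩
  · have := hp v; field_simp
  · intro u hu; simp [hu]
  · rw [← lat_qf2 n N hm (latL_pos n N hm v) (fun u => √(latL n N m v) * f u / √(latL n N m u))]
    congr 1
    funext u
    have := hp v; have := hp u
    field_simp

/-- Level of a network vertex. -/
def lev (n N : ℤ) (u : Vt n N) : ℤ := Sum.elim (fun w => linf w.1) (fun _ => 0) u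

lemma ring_hit {n N : ℤ} {m : ℝ} {K : Finset (Vt n N)} (hb : Sum.inr false ∉ K) (hd : Sum.inr true ∉ K)
    {u v : Vt n N} (h : Relation.ReflTransGen (fun x y => x ∈ K ∧ y ∈ K ∧ latA n N m x y ≠ 0) u v)
    (hu : u ∈ K) {s : ℤ} (h1 : lev n N u < s) (h2 : s ≤ lev n N v) : ∃ x ∈ K, lev n N x = s := by
  by_contra hno
  push Not at hno
  have : v ∈ K ∧ lev n N v < s := by
    clear h2
    induction h with
    | refl => exact ⟨hu, h1⟩
    | @tail b c _ hbc ih =>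
      refine ⟨hbc.2.1, ?_⟩
      have h3 := hno _ hbc.2.1
      have h4 : |lev n N b - lev n N c| ≤ 1 := by
        obtain ⟨hb1, hc1, hA⟩ := hbc
        rcases b with b | b
        · rcases c with c | c
          · exact latA_ne hA
          · cases c
            · exact absurd hc1 hb
            · exact absurd hc1 hd
        · cases b
          · exact absurd hb1 hb
          · exact absurd hb1 hd
      rw [abs_le] at h4
      omega
  omega

/-- Inner set. -/
def iI (n N : ℤ) (u : Vt n N) : Prop := ∃ w, u = Sum.inl w ∧ linf w.1 ≤ 2 * n

/-- Outer set. -/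
def oO (n N a : ℤ) (u : Vt n N) : Prop := ∃ w, u = Sum.inl w ∧ 2 * a ≤ linf w.1

lemma lat_main (n a : ℤ) (hn : 1 ≤ n) (ha : 2 * n ≤ a) (hH : 204800 ≤ hS n (4 * a) (4 * a + 1)) :
    ∃ m : ℝ, 0 < m ∧ (1 / 10) * ∏ s : Finset (Sym2 (Vt n (4 * a))), exp (lam (latA n (4 * a) m) s) ≤
      ∑ χ : Finset (Finset (Sym2 (Vt n (4 * a)))), if χ ∈ NoCross (Sum.inr false) (Sum.inr true)
        (iI n (4 * a)) (oO n (4 * a) a) then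
        ∏ s ∈ χ, (exp (lam (latA n (4 * a) m) s) - 1) else 0 := by
  set N := 4 * a with hN
  set H := hS n N (N + 1) with hHd
  have hHp : 0 < H := by linarith
  set m := 16 / H with hmd
  have hm : 0 < m := by positivity
  refine ⟨m, hm, ?_⟩
  set b : Vt n N := Sum.inr false with hbdef
  set d : Vt n N := Sum.inr true with hddef
  have hLb := latL_pos n N hm b
  have hLd := latL_pos n N hm d
  have hsb := Real.sqrt_pos.2 hLb
  have hsd := Real.sqrt_pos.2 hLd
  have hSn : ∀ s ≤ n, hS n N s = 0 := by
    intro s hs; unfold hS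
    rw [Finset.Ico_eq_empty, Finset.sum_empty]
    rw [not_lt]; exact (min_le_left _ _).trans hs
  have hSN : ∀ s, N < s → hS n N s = H := by
    intro s hs; rw [hHd]; unfold hS; rw [min_self, min_eq_right (by omega)]
  -- test functions
  set g : Vt n N → ℝ := Sum.elim (fun w => 1 - H⁻¹ * hS n N (linf w.1)) (fun i => if i then 0 else 1) with hg
  set g' : Vt n N → ℝ := fun u => 1 - g u with hg'
  have hgp : ∀ w, g (proj n N w) = 1 - H⁻¹ * hS n N (linf w) := by
    intro w
    by_cases h1 : linf w ≤ n
    · rw [proj_b h1, hSn _ h1]; simp [hg]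
    by_cases h2 : N < linf w
    · rw [proj_d (by omega) h2, hSN _ h2, inv_mul_cancel₀ hHp.ne']; simp [hg]
    · rw [proj_inl (mem_Wf.2 ⟨by omega, by omega⟩)]; simp [hg]
  have hE : En (N + 1) (fun w => g (proj n N w)) / 4 ≤ m := by
    have e1 : En (N + 1) (fun w => g (proj n N w)) = H⁻¹ ^ 2 * En (N + 1) (fun w => hS n N (linf w)) := by
      rw [← En_smul]
      simp_rw [hgp]
      unfold En
      refine sum_congr rfl fun x _ => sum_congr rfl fun y _ => ?_
      ring
    have e2 := En_hS n N hn
    rw [e1, hmd]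
    have : H⁻¹ ^ 2 * En (N + 1) (fun w => hS n N (linf w)) ≤ H⁻¹ ^ 2 * (64 * H) :=
      mul_le_mul_of_nonneg_left e2 (by positivity)
    have e3 : H⁻¹ ^ 2 * (64 * H) = 4 * (16 / H) := by field_simp; norm_num
    linarith
  have hE' : En (N + 1) (fun w => g' (proj n N w)) / 4 ≤ m := by
    have : En (N + 1) (fun w => g' (proj n N w)) = En (N + 1) (fun w => g (proj n N w)) := by
      unfold En
      refine sum_congr rfl fun x _ => sum_congr rfl fun y _ => ?_
      simp only [hg']
      ring
    rw [this]; exact hE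
  have gb : g b = 1 := by simp [hg, hbdef]
  have gd : g d = 0 := by simp [hg, hddef]
  have gb' : g' b = 0 := by simp [hg', gb]
  have gd' : g' d = 1 := by simp [hg', gd]
  have key := F_main (A := latA n N m) (lat_PosW n N (by omega) hm)
    (fun x => by unfold latA netA netC; simp) (b := b) (d := d) (by simp [hbdef, hddef])
    (e := 2 * m / latL n N m b) (m := m / latL n N m b) (c := (1 / 64) / latL n N m b)
    (e' := 2 * m / latL n N m d) (c' := (1 / 64) / latL n N m d) (by positivity) (by positivity)
    (h := fun u => √(latL n N m u) * ((√(latL n N m b))⁻¹ * g u))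
    (h' := fun u => √(latL n N m u) * ((√(latL n N m d))⁻¹ * g' u))
    (by simp only [gb]; field_simp) (by simp only [gd]; simp)
    (by
      rw [lat_qf2 n N hm hLb]
      change (_ + m * (g b ^ 2 + g d ^ 2)) / _ ≤ _
      rw [gb, gd]
      refine div_le_div_of_nonneg_right ?_ hLb.le
      linarith)
    (by simp only [gd']; field_simp)
    (by
      rw [lat_qf2 n N hm hLd]
      change (_ + m * (g' b ^ 2 + g' d ^ 2)) / _ ≤ _
      rw [gb', gd']
      refine div_le_div_of_nonneg_right ?_ hLd.le
      linarith)
    (by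
      intro f hf
      obtain ⟨k, hk, -, hq⟩ := lat_rep n N hm f b
      rw [hq]
      refine div_le_div_of_nonneg_right ?_ hLb.le
      have := En_nonneg (N + 1) (fun w => k (proj n N w))
      have e1 : k (Sum.inr false) = 1 := hk.trans hf
      rw [e1]
      nlinarith [mul_nonneg hm.le (sq_nonneg (k (Sum.inr true)))])
    (iI n N) (oO n N a) (by rintro ⟨w, h, -⟩; exact Sum.inr_ne_inl h) (by rintro ⟨w, h, -⟩; exact Sum.inr_ne_inl h)
    (by
      rintro K hbK hdK ⟨u, v, ⟨w, rfl, hw⟩, ⟨w', rfl, hw'⟩, hpath, huK⟩ f hf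
      have hring : ∀ (k : Vt n N → ℝ), (∀ u, f u = 0 → k u = 0) → ∀ s, 2 * n < s → s ≤ 2 * a →
          ∃ p, linf p = s ∧ k (proj n N p) = 0 := by
        intro k hk s hs hs'
        obtain ⟨x, hx, hxs⟩ := ring_hit hbK hdK hpath huK (s := s) (lt_of_le_of_lt hw hs) (hs'.trans hw')
        rcases x with x | x
        · exact ⟨x.1, hxs, by rw [proj_inl x.2]; exact hk _ (hf _ hx)⟩
        · cases x
          · exact absurd hx hbK
          · exact absurd hx hdK
      constructor
      · intro hfb
        obtain ⟨k, hk, hk0, hq⟩ := lat_rep n N hm f b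
        rw [hq]
        refine div_le_div_of_nonneg_right ?_ hLb.le
        have h1 := low_b (N + 1) n hn (by omega) (fun w => k (proj n N w))
          (fun w hw => by simp only [proj_b hw]; exact hk.trans hfb)
          (fun s h1 h2 => hring k hk0 s h1 (by omega))
        have h2 : 0 ≤ m * (k (Sum.inr false) ^ 2 + k (Sum.inr true) ^ 2) := by positivity
        linarith
      · intro hfd
        obtain ⟨k, hk, hk0, hq⟩ := lat_rep n N hm f d
        rw [hq]
        refine div_le_div_of_nonneg_right ?_ hLd.le
        have h1 := low_d (N + 1) a (by omega) (by omega) (fun w => k (proj n N w))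
          (fun w hw => by simp only [proj_d (show n ≤ N by omega) (show N < linf w by omega)]; exact hk.trans hfd)
          (fun s h1 h2 => hring k hk0 s (by omega) h2)
        have h2 : 0 ≤ m * (k (Sum.inr false) ^ 2 + k (Sum.inr true) ^ 2) := by positivity
        linarith)
  refine le_trans (mul_le_mul_of_nonneg_right ?_ (prod_nonneg fun _ _ => (Real.exp_pos _).le)) key
  have hms : m ≤ 1 / 12800 := by
    rw [hmd, div_le_div_iff₀ hHp (by norm_num)]; linarith
  have e1 : m / latL n N m b / (2 * m / latL n N m b) = 1 / 2 := by field_simp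
  have e2 : 2 * m / latL n N m b / (1 / 64 / latL n N m b) = 128 * m := by field_simp; norm_num
  have e3 : 2 * m / latL n N m d / (1 / 64 / latL n N m d) = 128 * m := by field_simp; norm_num
  rw [e1, e2, e3]
  have s1 : √(128 * m) ≤ 1 / 10 := by
    rw [Real.sqrt_le_left (by norm_num)]; linarith
  have s2 : (7 : ℝ) / 10 ≤ √(1 / 2) := by
    rw [Real.le_sqrt' (by norm_num)]; norm_num
  linarith

lemma exists_scale : ∃ a0 : ℤ, 8 ≤ a0 ∧ ∀ n : ℤ, 1 ≤ n → 204800 ≤ hS n (4 * (a0 * n)) (4 * (a0 * n) + 1) := by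
  obtain ⟨k, hk⟩ := exists_nat_ge (exp 204800)
  refine ⟨k + 8, by omega, fun n hn => ?_⟩
  have hn' : (1:ℝ) ≤ n := by exact_mod_cast hn
  refine le_trans ?_ (hS_log n _ hn (by nlinarith))
  rw [Real.le_log_iff_exp_le]
  · rw [le_div_iff₀ (by linarith)]
    push_cast
    nlinarith [Real.exp_pos 204800, (Nat.cast_nonneg k : (0:ℝ) ≤ k)]
  · push_cast
    have : (0:ℝ) ≤ k := Nat.cast_nonneg k
    positivity

lemma flat_of_comm (u : List Lat) : ∀ (q : ℕ) (v : List Lat), v ++ u = u ++ v → v.length = q * u.length →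
    v = (List.replicate q u).flatten := by
  intro q
  induction q with
  | zero => intro v _ h; simp at h; simp [h]
  | succ q ih =>
    intro v h hl
    have hle : u.length ≤ v.length := by rw [hl]; nlinarith
    obtain ⟨v', rfl⟩ : u <+: v := by
      have h1 : u <+: v ++ u := by rw [h]; exact List.prefix_append _ _
      exact List.prefix_of_prefix_length_le h1 (List.prefix_append _ _) hle
    rw [List.append_assoc, List.append_cancel_left_eq] at h
    rw [List.replicate_succ, List.flatten_cons, ← ih v' h]
    rw [List.length_append] at hl
    linarith

lemma flat_of_rotate {w : List Lat} {p q : ℕ} (hr : w.rotate p = w) (hp : p ≤ w.length) (h : w.length = q * p)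
    (hq : 1 ≤ q) : w = (List.replicate q (w.take p)).flatten := by
  rw [List.rotate_eq_drop_append_take hp] at hr
  obtain ⟨q, rfl⟩ : ∃ q', q = q' + 1 := ⟨q - 1, by omega⟩
  have h2 := flat_of_comm (w.take p) q (w.drop p) (by rw [hr, List.take_append_drop]) (by
    rw [List.length_drop, List.length_take, min_eq_left hp, h]; rw [add_mul]; omega)
  rw [List.replicate_succ, List.flatten_cons, ← h2, List.take_append_drop]

lemma iter_rot (k : ℕ) (w : List Lat) : (fun v : List Lat => v.rotate 1)^[k] w = w.rotate k := by
  induction k generalizing w with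
  | zero => simp
  | succ k ih => rw [Function.iterate_succ_apply, ih, List.rotate_rotate, add_comm]

lemma mult_period (γ : ULoop) : ∃ p : ℕ, 0 < p ∧ γ.steps ≤ p * γ.mult ∧
    ∀ i < p, ∀ k < p, γ.out.word.rotate i = γ.out.word.rotate k → i = k := by
  set w := γ.out.word with hw
  have hlen : 0 < w.length := List.length_pos_iff.2 γ.out.ne
  have hper : Function.IsPeriodicPt (fun v : List Lat => v.rotate 1) w.length w := by
    unfold Function.IsPeriodicPt Function.IsFixedPt; rw [iter_rot, List.rotate_length]
  refine ⟨Function.minimalPeriod (fun v : List Lat => v.rotate 1) w, hper.minimalPeriod_pos hlen, ?_, ?_⟩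
  · obtain ⟨q, hq⟩ := hper.minimalPeriod_dvd
    set p := Function.minimalPeriod (fun v : List Lat => v.rotate 1) w with hp
    have hp0 : 0 < p := hper.minimalPeriod_pos hlen
    have hq1 : 1 ≤ q := by
      rcases Nat.eq_zero_or_pos q with h | h
      · rw [h, mul_zero] at hq; omega
      · exact h
    have hrot : w.rotate p = w := by
      have := Function.isPeriodicPt_minimalPeriod (fun v : List Lat => v.rotate 1) w
      unfold Function.IsPeriodicPt Function.IsFixedPt at this
      rwa [iter_rot] at this
    have hle : p ≤ w.length := by rw [hq]; nlinarith
    have hfl := flat_of_rotate hrot hle (q := q) (by rw [mul_comm]; exact hq) hq1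
    have : q ≤ γ.mult := by
      apply le_csSup
      · refine ⟨w.length, ?_⟩
        rintro k ⟨u, hu, hk⟩
        have h3 : w.length = k * u.length := by rw [hw, hk]; simp
        have : 0 < u.length := List.length_pos_iff.2 hu
        rw [h3]; nlinarith
      · refine ⟨w.take p, ?_, hfl⟩
        intro h0
        have := congrArg List.length h0
        rw [List.length_take, min_eq_left hle, List.length_nil] at this
        omega
    show w.length ≤ _
    rw [hq]
    exact Nat.mul_le_mul_left _ this
  · intro i hi k hk h
    have := Function.iterate_injOn_Iio_minimalPeriod (f := (fun v : List Lat => v.rotate 1)) (x := w)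
    refine this hi hk ?_
    simpa only [iter_rot] using h

lemma ulo_eq {γ γ' : ULoop} {i k : ℕ} (h : γ.out.word.rotate i = γ'.out.word.rotate k) : γ = γ' := by
  have h1 : γ.out.word ~r γ'.out.word :=
    (List.IsRotated.forall γ.out.word i).symm.trans (h ▸ List.IsRotated.forall γ'.out.word k)
  obtain ⟨m, hm⟩ := h1
  have := Quot.sound (r := loopRot) (a := γ.out) (b := γ'.out) ⟨m, hm.symm⟩
  have e1 : Quot.mk loopRot γ.out = γ := Quot.out_eq γ
  have e2 : Quot.mk loopRot γ'.out = γ' := Quot.out_eq γ'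
  rw [e1, e2] at this; exact this

/-- Words which are rotations of a loop of `S`. -/
def rots (S : Set ULoop) : Set (List Lat) := {w | ∃ γ ∈ S, ∃ k, w = γ.out.word.rotate k}

lemma loop_mass (S : Set ULoop) : ∑' γ : S, (loopWeight γ.1 : ℝ≥0∞) ≤
    ∑' w : rots S, (4 : ℝ≥0∞)⁻¹ ^ w.1.length / w.1.length := by
  choose p hp hm hinj using mult_period
  have h1 : ∀ γ : ULoop, (loopWeight γ : ℝ≥0∞) ≤ ∑' _ : Fin (p γ), (4 : ℝ≥0∞)⁻¹ ^ γ.steps / γ.steps := by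
    intro γ
    have hlen : 0 < γ.steps := List.length_pos_iff.2 γ.out.ne
    have hmu : 0 < γ.mult := by
      rcases Nat.eq_zero_or_pos γ.mult with h | h
      · have := hm γ; rw [h, mul_zero] at this; omega
      · exact h
    rw [tsum_fintype, sum_const, Finset.card_univ, Fintype.card_fin, nsmul_eq_mul]
    have : loopWeight γ ≤ (p γ : ℝ≥0) * ((4:ℝ≥0)⁻¹ ^ γ.steps / γ.steps) := by
      unfold loopWeight
      rw [← mul_div_assoc, div_le_div_iff₀ (by exact_mod_cast hmu) (by exact_mod_cast hlen)]
      have h2 : (γ.steps : ℝ≥0) ≤ (p γ : ℝ≥0) * γ.mult := by exact_mod_cast hm γ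
      calc (4:ℝ≥0)⁻¹ ^ γ.steps * γ.steps ≤ (4:ℝ≥0)⁻¹ ^ γ.steps * ((p γ : ℝ≥0) * γ.mult) := by gcongr
        _ = _ := by ring
    refine (ENNReal.coe_le_coe.2 this).trans (le_of_eq ?_)
    rw [ENNReal.coe_mul, ENNReal.coe_div (by exact_mod_cast hlen.ne'), ENNReal.coe_pow,
      ENNReal.coe_inv (by norm_num)]
    simp
  refine (ENNReal.tsum_le_tsum fun γ : S => h1 γ.1).trans ?_
  rw [← ENNReal.tsum_sigma' (β := fun γ : S => Fin (p γ.1)) (f := fun x => (4 : ℝ≥0∞)⁻¹ ^ x.1.1.steps / x.1.1.steps)]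
  let Φ : (Σ γ : S, Fin (p γ.1)) → rots S := fun x => ⟨x.1.1.out.word.rotate x.2, x.1.1, x.1.2, x.2, rfl⟩
  have hΦ : Function.Injective Φ := by
    rintro ⟨⟨γ, hγ⟩, i⟩ ⟨⟨γ', hγ'⟩, k⟩ h
    have h' : γ.out.word.rotate i = γ'.out.word.rotate k := congrArg Subtype.val h
    obtain rfl := ulo_eq h'
    have := hinj γ i i.2 k k.2 h'
    have : i = k := Fin.ext this
    subst this; rfl
  refine le_trans (le_of_eq ?_) (ENNReal.tsum_comp_le_tsum_of_injective hΦ (fun w : rots S => (4 : ℝ≥0∞)⁻¹ ^ w.1.length / w.1.length))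
  refine tsum_congr fun x => ?_
  simp only [Φ, List.length_rotate]; rfl

lemma chain_rot_one {w : List Lat} (h : (w ++ w.take 1).IsChain Adj) : (w.rotate 1 ++ (w.rotate 1).take 1).IsChain Adj := by
  cases w with
  | nil => simpa using h
  | cons x l =>
    cases l with
    | nil => simpa using h
    | cons y l =>
      simp only [List.rotate_cons_succ, List.rotate_zero, List.cons_append, List.take_succ_cons, List.take_zero] at h ⊢
      rw [List.isChain_cons_cons] at h
      have := List.IsChain.append h.2 (List.isChain_singleton y) (by
        intro a ha b hb
        rw [← List.cons_append, List.getLast?_append] at ha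
        simp at ha hb
        subst ha; subst hb; exact h.1)
      simpa using this

lemma chain_rot {w : List Lat} (h : (w ++ w.take 1).IsChain Adj) (k : ℕ) :
    (w.rotate k ++ (w.rotate k).take 1).IsChain Adj := by
  induction k with
  | zero => simpa using h
  | succ k ih => rw [← List.rotate_rotate]; exact chain_rot_one ih

lemma rots_chain {S : Set ULoop} {w : List Lat} (h : w ∈ rots S) : (w ++ w.take 1).IsChain Adj := by
  obtain ⟨γ, _, k, rfl⟩ := h
  exact chain_rot γ.out.adj k

lemma rots_ne {S : Set ULoop} {w : List Lat} (h : w ∈ rots S) : w ≠ [] := by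
  obtain ⟨γ, _, k, rfl⟩ := h
  simpa [List.rotate_eq_nil_iff] using γ.out.ne

section
variable {V : Type*} [Fintype V] [DecidableEq V]

/-- Edge support of a cyclic word. -/
def esW : List V → Finset (Sym2 V)
  | [] => ∅
  | x :: l => es x l x

lemma es_snoc : ∀ (l : List V) (x y z : V), es x (l ++ [y]) z = insert s(y, z) (es x l y)
  | [], x, y, z => by simp only [List.nil_append, es]; rw [Finset.pair_comm]
  | a :: l, x, y, z => by simp only [List.cons_append, es]; rw [es_snoc l a y z, Finset.insert_comm]

lemma esW_rot_one (w : List V) : esW (w.rotate 1) = esW w := by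
  cases w with
  | nil => rfl
  | cons x l =>
    cases l with
    | nil => simp
    | cons y l =>
      simp only [List.rotate_cons_succ, List.rotate_zero, List.cons_append, esW]
      rw [es_snoc]
      simp only [es]

lemma esW_rot (w : List V) (k : ℕ) : esW (w.rotate k) = esW w := by
  induction k with
  | zero => simp
  | succ k ih => rw [← List.rotate_rotate, esW_rot_one, ih]

lemma lw_ge {A : Matrix V V ℝ} (P : Lat → V) (W : Set Lat)
    (hA : ∀ u v, u ∈ W → v ∈ W → Adj u v → 1 / 4 ≤ A (P u) (P v)) : ∀ (l : List Lat) (x y : Lat), x ∈ W → y ∈ W →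
    (∀ v ∈ l, v ∈ W) → (x :: l ++ [y]).IsChain Adj → (1 / 4 : ℝ) ^ (l.length + 1) ≤ lw A (P x) (l.map P) (P y)
  | [], x, y, hx, hy, _, h => by
      simp only [List.nil_append, List.cons_append, List.isChain_cons_cons] at h
      simpa [lw] using hA x y hx hy h.1
  | z :: l, x, y, hx, hy, hl, h => by
      simp only [List.cons_append, List.isChain_cons_cons] at h
      have h1 := lw_ge P W hA l z y (hl z (by simp)) hy (fun v hv => hl v (by simp [hv])) h.2
      have h2 := hA x z hx (hl z (by simp)) h.1
      simp only [List.map_cons, lw, List.length_cons]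
      rw [pow_succ, mul_comm]
      exact mul_le_mul h2 h1 (by positivity) (le_trans (by norm_num) h2)

lemma ofReal_lam {A : Matrix V V ℝ} (hA : PosW A) (s : Finset (Sym2 V)) :
    ofReal (lam A s) = (2:ℝ≥0∞)⁻¹ * ∑' y : (Σ n : ℕ, V × (Fin n → V)),
      ofReal ((if es y.2.1 (List.ofFn y.2.2) y.2.1 = s then lw A y.2.1 (List.ofFn y.2.2) y.2.1 else 0) / (y.1 + 1)) := by
  have hnn : ∀ (n : ℕ) (x : V) (w : Fin n → V), 0 ≤ (if es x (List.ofFn w) x = s then lw A x (List.ofFn w) x else 0) := by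
    intro n x w
    split_ifs
    · exact lw_nonneg hA.nonneg _ _ _
    · exact le_rfl
  unfold lam
  rw [ENNReal.ofReal_div_of_pos (by norm_num), ENNReal.ofReal_tsum_of_nonneg _ (hA.summable_cw s), ENNReal.div_eq_inv_mul]
  · congr 1
    · simp
    rw [ENNReal.tsum_sigma']
    refine tsum_congr fun n => ?_
    rw [tsum_fintype, Fintype.sum_prod_type]
    unfold cw
    rw [sum_div, ENNReal.ofReal_sum_of_nonneg]
    · refine sum_congr rfl fun x _ => ?_
      rw [sum_div, ENNReal.ofReal_sum_of_nonneg]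
      intro w _; exact div_nonneg (hnn n x w) (by positivity)
    · intro x _
      exact div_nonneg (sum_nonneg fun w _ => hnn n x w) (by positivity)
  · intro n; exact div_nonneg (cw_nonneg hA.nonneg n s) (by positivity)

lemma exists_ofFn (l : List V) (h : l ≠ []) : ∃ y : (Σ n : ℕ, V × (Fin n → V)), l = y.2.1 :: List.ofFn y.2.2 := by
  cases l with
  | nil => simp at h
  | cons x l => exact ⟨⟨l.length, x, l.get⟩, by simp⟩
end

/-- Loops contained in the annulus `{n < |v - z| ≤ N}`. -/
def annL (z : Lat) (n N : ℤ) : Set ULoop := {γ | ∀ v ∈ γ.verts, v - z ∈ Wf n N}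

/-- Loops of the annulus with given projected edge support. -/
def Gam (z : Lat) (n N : ℤ) (s : Finset (Sym2 (Vt n N))) : Set ULoop :=
  {γ | γ ∈ annL z n N ∧ esW (γ.out.word.map (fun v => proj n N (v - z))) = s}

lemma inten_le {D : Set Lat} {α : ℝ} (hα : α ≤ 1 / 2) (γ : ULoop) : inten D α γ ≤ (2:ℝ≥0∞)⁻¹ * loopWeight γ := by
  unfold inten
  rw [ENNReal.coe_mul]
  refine mul_le_mul' ?_ ?_
  · have : α.toNNReal ≤ (2:ℝ≥0)⁻¹ := by
      rw [← NNReal.coe_le_coe, Real.coe_toNNReal']; simp; linarith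
    refine (ENNReal.coe_le_coe.2 this).trans (le_of_eq ?_)
    rw [ENNReal.coe_inv (by norm_num)]; simp
  · unfold nuD; split_ifs
    · exact le_rfl
    · simp

lemma proj_inj {n N : ℤ} {z u v : Lat} (hu : u - z ∈ Wf n N) (h : proj n N (u - z) = proj n N (v - z)) : u = v := by
  rw [proj_inl hu] at h
  have := proj_eq_inl h.symm
  simp at this
  exact this.symm

lemma map_inj_on {α β : Type*} {f : α → β} : ∀ {l l' : List α}, (∀ a ∈ l, ∀ b, f a = f b → a = b) → l.map f = l'.map f → l = l'
  | [], l', _, h => by simpa using h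
  | a :: l, [], _, h => by simp at h
  | a :: l, b :: l', hi, h => by
      simp only [List.map_cons, List.cons.injEq] at h
      rw [hi a (by simp) b h.1, map_inj_on (fun c hc => hi c (by simp [hc])) h.2]

lemma gam_mass {D : Set Lat} {α : ℝ} (hα : α ≤ 1 / 2) (z : Lat) {n N : ℤ} (hnN : n ≤ N) {m : ℝ} (hm : 0 < m)
    (s : Finset (Sym2 (Vt n N))) :
    ∑' γ : Gam z n N s, inten D α γ ≤ ofReal (lam (latA n N m) s) := by
  have hA := lat_PosW n N hnN hm
  refine (ENNReal.tsum_le_tsum fun γ : Gam z n N s => inten_le (D := D) hα γ.1).trans ?_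
  rw [ENNReal.tsum_mul_left, ofReal_lam hA]
  refine mul_le_mul' le_rfl ((loop_mass _).trans ?_)
  set P : Lat → Vt n N := fun v => proj n N (v - z) with hP
  have hW : ∀ w ∈ rots (Gam z n N s), (∀ v ∈ w, v - z ∈ Wf n N) ∧ esW (w.map P) = s := by
    rintro w ⟨γ, hγ, k, rfl⟩
    refine ⟨fun v hv => hγ.1 v ?_, ?_⟩
    · rw [List.mem_rotate] at hv; exact hv
    · rw [List.map_rotate, esW_rot]; exact hγ.2
  have hex : ∀ w : rots (Gam z n N s), ∃ y : (Σ n' : ℕ, Vt n N × (Fin n' → Vt n N)), w.1.map P = y.2.1 :: List.ofFn y.2.2 :=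
    fun w => exists_ofFn _ (by simpa using rots_ne w.2)
  choose Φ hΦ using hex
  have hinj : Function.Injective Φ := by
    intro w w' h
    refine Subtype.ext (map_inj_on (f := P) ?_ (by rw [hΦ, hΦ, h]))
    intro a ha b hb
    exact proj_inj ((hW w.1 w.2).1 a ha) hb
  refine le_trans (ENNReal.tsum_le_tsum fun w => ?_) (ENNReal.tsum_comp_le_tsum_of_injective hinj _)
  obtain ⟨w, hw⟩ := w
  obtain ⟨h1, h2⟩ := hW w hw
  have h3 := hΦ ⟨w, hw⟩
  have hch := rots_chain hw
  simp only at h3 ⊢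
  generalize Φ ⟨w, hw⟩ = y at h3
  cases w with
  | nil => simp at h3
  | cons x l =>
    rw [List.map_cons, List.cons.injEq] at h3
    simp only [List.map_cons, esW] at h2
    rw [← h3.1, ← h3.2, if_pos h2]
    have hlen : (y.1 : ℝ) = l.length := by
      have := congrArg List.length h3.2
      simp at this
      exact_mod_cast this.symm
    have h4 := lw_ge (A := latA n N m) P {v | v - z ∈ Wf n N} (by
      intro u v hu hv huv
      simp only [hP]
      rw [proj_inl hu, proj_inl hv]
      refine latA_adj hm hu hv ?_
      simpa [Adj] using huv) l x x (h1 x (by simp)) (h1 x (by simp)) (fun v hv => h1 v (by simp [hv])) (by simpa using hch)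
    rw [hlen, ENNReal.ofReal_div_of_pos (by positivity)]
    refine ENNReal.div_le_div ?_ ?_
    · rw [List.length_cons]
      refine le_trans (le_of_eq ?_) (ofReal_le_ofReal h4)
      rw [ENNReal.ofReal_pow (by norm_num)]
      congr 1
      rw [one_div, ENNReal.ofReal_inv_of_pos (by norm_num)]; norm_num
    · rw [List.length_cons]
      rw [ENNReal.ofReal_add (by positivity) (by norm_num)]
      simp

/-- No chain of touching loops inside the annulus from `B_{2n}` to distance `2a`. -/
def Nev (z : Lat) (n a : ℤ) : Set Config :=
  {ω | ¬ ∃ γ γ', γ ∈ ω.loops ∩ annL z n (4 * a) ∧ linkedL (ω.loops ∩ annL z n (4 * a)) γ γ' ∧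
    (∃ v ∈ γ.verts, linf (v - z) ≤ 2 * n) ∧ ∃ v ∈ γ'.verts, 2 * a ≤ linf (v - z)}

lemma Nev_dec (z : Lat) (n a : ℤ) : ∀ ω ω' : Config, (∀ γ, ω' γ ≤ ω γ) → ω ∈ Nev z n a → ω' ∈ Nev z n a := by
  intro ω ω' h hω ⟨γ, γ', h1, h2, h3⟩
  have hsub : ω'.loops ⊆ ω.loops := by
    intro γ hγ h0
    have := h γ
    rw [h0] at this
    exact hγ (by omega)
  refine hω ⟨γ, γ', ⟨hsub h1.1, h1.2⟩, ?_, h3⟩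
  exact Relation.ReflTransGen.mono (fun a b hab => ⟨⟨hsub hab.1.1, hab.1.2⟩, ⟨hsub hab.2.1.1, hab.2.1.2⟩, hab.2.2⟩) _ _ h2

lemma es_supp {V : Type*} [DecidableEq V] : ∀ (l : List V) (x y : V) (b : V), tch (es x l y) b → b = x ∨ b ∈ l ∨ b = y
  | [], x, y, b, ⟨e, he, hb⟩ => by
      simp only [es, Finset.mem_singleton] at he
      subst he
      rcases Sym2.mem_iff.1 hb with h | h <;> simp [h]
  | z :: l, x, y, b, ⟨e, he, hb⟩ => by
      simp only [es, Finset.mem_insert] at he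
      rcases he with rfl | he
      · rcases Sym2.mem_iff.1 hb with h | h <;> simp [h]
      · rcases es_supp l z y b ⟨e, he, hb⟩ with h | h | h <;> simp [h]

lemma es_tch_mem {V : Type*} [DecidableEq V] : ∀ (l : List V) (x y : V) (b : V), b = x ∨ b ∈ l ∨ b = y → tch (es x l y) b
  | [], x, y, b, h => by
      refine ⟨s(x, y), by simp [es], ?_⟩
      rcases h with h | h | h
      · simp [h]
      · simp at h
      · simp [h]
  | z :: l, x, y, b, h => by
      by_cases hx : b = x
      · exact ⟨s(x, z), by simp [es], by simp [hx]⟩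
      · have : b = z ∨ b ∈ l ∨ b = y := by
          rcases h with h | h | h
          · exact absurd h hx
          · rcases List.mem_cons.1 h with h | h
            · exact Or.inl h
            · exact Or.inr (Or.inl h)
          · exact Or.inr (Or.inr h)
        obtain ⟨e, he, hb⟩ := es_tch_mem l z y b this
        exact ⟨e, by simp [es, he], hb⟩

lemma nev_of_chi {z : Lat} {n a : ℤ} {ω : Config}
    (h : chi (Gam z n (4 * a)) ω ∈ NoCross (Sum.inr false) (Sum.inr true) (iI n (4 * a)) (oO n (4 * a) a)) :
    ω ∈ Nev z n a := by
  set N := 4 * a with hN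
  set P : Lat → Vt n N := fun v => proj n N (v - z) with hP
  set c := chi (Gam z n N) ω with hc
  set E := ((c ∩ Fz (Sum.inr false) (Sum.inr true)).sup id : Finset (Sym2 (Vt n N))) with hE
  rintro ⟨γ, γ', hγ, hlink, ⟨v, hv, hvn⟩, v', hv', hva⟩
  have key : ∀ γ ∈ ω.loops ∩ annL z n N, ∀ u ∈ γ.verts, ∀ v ∈ γ.verts, cn E (P u) (P v) := by
    intro γ hγ u hu v hv
    set s := esW (γ.out.word.map P) with hs
    have hverts : ∀ q ∈ γ.out.word.map P, ∃ w, q = Sum.inl w := by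
      intro q hq
      obtain ⟨y, hy, rfl⟩ := List.mem_map.1 hq
      exact ⟨_, proj_inl (hγ.2 y hy)⟩
    have hsc : s ∈ c ∩ Fz (Sum.inr false) (Sum.inr true) := by
      rw [Finset.mem_inter]
      constructor
      · rw [hc, chi, mem_filter]
        exact ⟨Finset.mem_univ _, γ, ⟨hγ.2, rfl⟩, hγ.1⟩
      · rw [Fz, mem_filter]
        have : ∀ i : Bool, ¬ tch s (Sum.inr i : Vt n N) := by
          intro i ht
          rw [hs] at ht
          cases hw : γ.out.word with
          | nil => exact γ.out.ne hw
          | cons x l =>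
            rw [hw] at ht hverts
            simp only [List.map_cons, esW] at ht
            have : (Sum.inr i : Vt n N) ∈ (x :: l).map P := by
              rw [List.map_cons]
              rcases es_supp _ _ _ _ ht with h | h | h <;> simp only [List.mem_cons] <;> tauto
            obtain ⟨w, hw⟩ := hverts _ this
            cases hw
        exact ⟨Finset.mem_univ _, this _, this _⟩
    have hsub : s ⊆ E := Finset.le_sup (f := id) hsc
    cases hw : γ.out.word with
    | nil => exact absurd hw γ.out.ne
    | cons x l =>
      have hs' : s = es (P x) (l.map P) (P x) := by rw [hs, hw]; rfl
      have hall : ∀ u ∈ γ.verts, cn s (P x) (P u) := by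
        intro u hu
        rw [hs']
        refine (es_conn (l.map P) (P x) (P x)).2 _ (es_tch_mem _ _ _ _ ?_)
        have hu : u ∈ γ.out.word := hu
        rw [hw] at hu
        rcases List.mem_cons.1 hu with rfl | h
        · exact Or.inl rfl
        · exact Or.inr (Or.inl (List.mem_map_of_mem h))
      exact cn_mono hsub (Relation.ReflTransGen.trans (cn_symm (hall u hu)) (hall v hv))
  have hγ' : γ' ∈ ω.loops ∩ annL z n N ∧ ∀ u ∈ γ'.verts, cn E (P v) (P u) := by
    clear hv'
    induction hlink with
    | refl => exact ⟨hγ, fun u hu => key γ hγ v hv u hu⟩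
    | tail _ hbc ih =>
      obtain ⟨hb, hc', y, hy1, hy2⟩ := hbc
      exact ⟨hc', fun u hu => Relation.ReflTransGen.trans (ih.2 y hy1) (key _ hc' y hy2 u hu)⟩
  refine h ⟨P v, P v', ?_, ?_, hγ'.2 v' hv'⟩
  · exact ⟨⟨v - z, hγ.2 v hv⟩, proj_inl _, hvn⟩
  · exact ⟨⟨v' - z, hγ'.1.2 v' hv'⟩, proj_inl _, hva⟩

lemma nev_event {D : Set Lat} {α : ℝ} {Ps : Measure Config} (hPs : IsLoopSoup D α Ps) (hα : α ≤ 1 / 2)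
    {W : Type*} [MeasurableSpace W] {ρ : Measure W} [IsProbabilityMeasure ρ] (z : Lat) {n a : ℤ} (hn : 1 ≤ n)
    (ha : 2 * n ≤ a) (hH : 204800 ≤ hS n (4 * a) (4 * a + 1))
    {X : Set (W × Config)} (hX : ∀ w ω ω', (∀ γ, ω' γ ≤ ω γ) → (w, ω) ∈ X → (w, ω') ∈ X) :
    ofReal (1 / 10) * ρ.prod Ps X ≤ ρ.prod Ps (X ∩ {u | u.2 ∈ Nev z n a}) := by
  obtain ⟨m, hm, hmain⟩ := lat_main n a hn ha hH
  have hA := lat_PosW n (4 * a) (by omega) hm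
  have h := harris hPs (ρ := ρ) (Gam z n (4 * a)) (by
    intro i j hij
    rw [Set.disjoint_left]
    intro γ h1 h2
    exact hij (h1.2.symm.trans h2.2)) (lam (latA n (4 * a) m)) (fun s => lam_nonneg hA.nonneg s)
    (fun s => gam_mass hα z (by omega) hm s) hX
    (NoCross (Sum.inr false) (Sum.inr true) (iI n (4 * a)) (oO n (4 * a) a)) (fun c hc c' h => NoCross_mono h hc)
  set Z := ∏ s : Finset (Sym2 (Vt n (4 * a))), exp (lam (latA n (4 * a) m) s) with hZ
  have hZ0 : 0 < Z := Finset.prod_pos fun _ _ => Real.exp_pos _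
  have h2 : ofReal Z * (ofReal (1 / 10) * ρ.prod Ps X) ≤
      ofReal Z * ρ.prod Ps (X ∩ {u | u.2 ∈ Nev z n a}) := by
    calc _ = ofReal (1 / 10 * Z) * ρ.prod Ps X := by
          rw [ofReal_mul (by norm_num)]; ring
      _ ≤ _ := by
          refine (mul_le_mul' (ofReal_le_ofReal hmain) le_rfl).trans ?_
          refine le_trans (le_of_eq ?_) (h.trans (mul_le_mul' le_rfl (measure_mono ?_)))
          · congr 2
          · rintro u ⟨h1, h2⟩
            exact ⟨h1, nev_of_chi h2⟩
  exact (ENNReal.mul_le_mul_iff_right (by simpa using hZ0) ENNReal.ofReal_ne_top).1 h2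

/-- Unit steps. -/
def del4 (i : Fin 4) : Lat := if i = 0 then (1, 0) else if i = 1 then (-1, 0) else if i = 2 then (0, 1) else (0, -1)

/-- Step words. -/
abbrev Wd : Type := List (Fin 4)

/-- End point of a word started from `x`. -/
def pos : Lat → Wd → Lat
  | x, [] => x
  | x, i :: s => pos (x + del4 i) s

/-- Vertices visited after the start. -/
def vis : Lat → Wd → List Lat
  | _, [] => []
  | x, i :: s => (x + del4 i) :: vis (x + del4 i) s

/-- Weight of a word. -/
def wt (s : Wd) : ℝ≥0∞ := (4 : ℝ≥0∞)⁻¹ ^ s.length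

lemma pos_append : ∀ (s t : Wd) (x : Lat), pos x (s ++ t) = pos (pos x s) t
  | [], _, _ => rfl
  | i :: s, t, x => pos_append s t (x + del4 i)

lemma vis_append : ∀ (s t : Wd) (x : Lat), vis x (s ++ t) = vis x s ++ vis (pos x s) t
  | [], _, _ => rfl
  | i :: s, t, x => by simp only [List.cons_append, vis, pos, vis_append s t (x + del4 i)]

lemma vis_length : ∀ (s : Wd) (x : Lat), (vis x s).length = s.length
  | [], _ => rfl
  | i :: s, x => by simp [vis, vis_length s]

lemma pos_mem : ∀ (s : Wd) (x : Lat), pos x s ∈ x :: vis x s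
  | [], x => by simp [pos]
  | i :: s, x => by
      have := pos_mem s (x + del4 i)
      simp only [pos, vis]; exact List.mem_cons_of_mem _ this

lemma pos_mem_vis {s : Wd} (x : Lat) (h : s ≠ []) : pos x s ∈ vis x s := by
  cases s with
  | nil => exact absurd rfl h
  | cons i s => exact pos_mem s (x + del4 i)

lemma pos_snoc (s : Wd) (i : Fin 4) (x : Lat) : pos x (s ++ [i]) = pos x s + del4 i := by
  rw [pos_append]; rfl

lemma vis_snoc (s : Wd) (i : Fin 4) (x : Lat) : vis x (s ++ [i]) = vis x s ++ [pos x s + del4 i] := by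
  rw [vis_append]; rfl

lemma del4_inj {i k : Fin 4} (h : del4 i = del4 k) : i = k := by
  revert i k; decide

lemma adj_del4 {a b : Lat} (h : Adj a b) : ∃ i, b = a + del4 i := by
  rcases adj_cases h with h | h | h | h
  · exact ⟨0, Prod.ext (by simp [del4]; omega) (by simp [del4]; omega)⟩
  · exact ⟨1, Prod.ext (by simp [del4]; omega) (by simp [del4]; omega)⟩
  · exact ⟨2, Prod.ext (by simp [del4]; omega) (by simp [del4]; omega)⟩
  · exact ⟨3, Prod.ext (by simp [del4]; omega) (by simp [del4]; omega)⟩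

lemma exists_vis : ∀ (l : List Lat) (x : Lat), (x :: l).IsChain Adj → ∃ s, vis x s = l
  | [], _, _ => ⟨[], rfl⟩
  | y :: l, x, h => by
      rw [List.isChain_cons_cons] at h
      obtain ⟨i, rfl⟩ := adj_del4 h.1
      obtain ⟨s, hs⟩ := exists_vis l _ h.2
      exact ⟨i :: s, by simp [vis, hs]⟩

lemma vis_split : ∀ (l1 l2 : List Lat) (s : Wd) (x : Lat), vis x s = l1 ++ l2 →
    ∃ s1 s2, s = s1 ++ s2 ∧ vis x s1 = l1 ∧ vis (pos x s1) s2 = l2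
  | [], l2, s, x, h => ⟨[], s, rfl, rfl, h⟩
  | y :: l1, l2, [], x, h => by simp [vis] at h
  | y :: l1, l2, i :: s, x, h => by
      simp only [vis, List.cons_append, List.cons.injEq] at h
      obtain ⟨s1, s2, rfl, h1, h2⟩ := vis_split l1 l2 s _ h.2
      exact ⟨i :: s1, s2, rfl, by rw [vis, h1, h.1], by simpa [pos] using h2⟩

lemma tsum_words (g : Wd → ℝ≥0∞) : ∑' s, g s = g [] + ∑ i, ∑' s, g (i :: s) := by
  let e : (Unit ⊕ (Fin 4 × Wd)) ≃ Wd :=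
    { toFun := fun o => match o with
        | Sum.inl _ => []
        | Sum.inr p => p.1 :: p.2
      invFun := fun l => match l with
        | [] => Sum.inl ()
        | i :: s => Sum.inr (i, s)
      left_inv := by rintro (_ | ⟨i, s⟩) <;> rfl
      right_inv := by rintro (_ | ⟨i, s⟩) <;> rfl }
  rw [← e.tsum_eq]
  have h1 : HasSum ((fun c => g (e c)) ∘ Sum.inl) (g []) := by
    have h3 := hasSum_fintype ((fun c => g (e c)) ∘ (Sum.inl : Unit → Unit ⊕ (Fin 4 × Wd)))
    rw [Finset.univ_unique, Finset.sum_singleton] at h3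
    exact h3
  have h2 : HasSum ((fun c => g (e c)) ∘ Sum.inr) (∑ i, ∑' s, g (i :: s)) := by
    have h3 : ∑' c, ((fun c => g (e c)) ∘ Sum.inr) c = ∑ i, ∑' s, g (i :: s) := by
      rw [ENNReal.tsum_prod', tsum_fintype]
      rfl
    rw [← h3]
    exact ENNReal.summable.hasSum
  exact (HasSum.sum h1 h2).tsum_eq

lemma wt_append (s t : Wd) : wt (s ++ t) = wt s * wt t := by simp [wt, pow_add]

lemma trunc_le (n : ℕ) : ∀ (r F : Wd → ℝ≥0∞), (∀ s, r s + (4:ℝ≥0∞)⁻¹ * ∑ i, F (s ++ [i]) ≤ F s) →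
    ∑' s, (if s.length < n then wt s * r s else 0) ≤ F [] := by
  induction n with
  | zero => intro r F _; simp
  | succ n ih =>
    intro r F h
    rw [tsum_words]
    have h0 := h []
    refine le_trans ?_ h0
    simp only [List.length_nil, Nat.zero_lt_succ, if_true, wt, pow_zero, one_mul, List.nil_append]
    refine add_le_add le_rfl ?_
    rw [mul_sum]
    refine sum_le_sum fun i _ => ?_
    have := ih (fun s => r (i :: s)) (fun s => F (i :: s)) (fun s => h (i :: s))
    calc _ = (4:ℝ≥0∞)⁻¹ * ∑' s : Wd, (if s.length < n then wt s * r (i :: s) else 0) := by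
          rw [← ENNReal.tsum_mul_left]
          refine tsum_congr fun s => ?_
          by_cases hs : s.length < n
          · simp [hs, wt, pow_succ]; ring
          · simp [hs]
      _ ≤ _ := mul_le_mul' le_rfl this

lemma tsum_le_of_trunc {g : Wd → ℝ≥0∞} {B : ℝ≥0∞} (h : ∀ n : ℕ, ∑' s, (if s.length < n then g s else 0) ≤ B) :
    ∑' s, g s ≤ B := by
  rw [ENNReal.tsum_eq_iSup_sum]
  refine iSup_le fun A => ?_
  refine le_trans ?_ (h (A.sup List.length + 1))
  refine le_trans (sum_le_sum fun s hs => ?_) (ENNReal.sum_le_tsum A)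
  rw [if_pos (Nat.lt_succ_of_le (Finset.le_sup (f := List.length) hs))]

/-- The potential lemma. -/
lemma potential (r F : Wd → ℝ≥0∞) (h : ∀ s, r s + (4:ℝ≥0∞)⁻¹ * ∑ i, F (s ++ [i]) ≤ F s) :
    ∑' s, wt s * r s ≤ F [] := tsum_le_of_trunc fun n => trunc_le n r F h

/-- Mass of a set of words. -/
def wm (Q : Set Wd) : ℝ≥0∞ := ∑' s : Q, wt s.1

lemma wm_eq (Q : Set Wd) : wm Q = ∑' s, wt s * (if s ∈ Q then 1 else 0) := by
  rw [wm, tsum_subtype Q wt]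
  refine tsum_congr fun s => ?_
  by_cases h : s ∈ Q <;> simp [h]

lemma wm_mono {Q Q' : Set Wd} (h : Q ⊆ Q') : wm Q ≤ wm Q' :=
  ENNReal.tsum_mono_subtype _ h

lemma wm_singleton : wm {([] : Wd)} = 1 := by simp [wm, wt]

/-- Concatenation. -/
def conc (Q1 : Set Wd) (Q2 : Wd → Set Wd) : Set Wd := {s | ∃ s1 ∈ Q1, ∃ s2 ∈ Q2 s1, s = s1 ++ s2}

lemma wm_conc_le {Q1 : Set Wd} {Q2 : Wd → Set Wd} {B : ℝ≥0∞} (h : ∀ s ∈ Q1, wm (Q2 s) ≤ B) :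
    wm (conc Q1 Q2) ≤ wm Q1 * B := by
  have hex : ∀ s : conc Q1 Q2, ∃ y : (Σ s1 : Q1, Q2 s1.1), s.1 = y.1.1 ++ y.2.1 := by
    rintro ⟨s, s1, h1, s2, h2, rfl⟩
    exact ⟨⟨⟨s1, h1⟩, ⟨s2, h2⟩⟩, rfl⟩
  choose Φ hΦ using hex
  have hinj : Function.Injective Φ := fun s t hst => Subtype.ext (by rw [hΦ, hΦ, hst])
  calc wm (conc Q1 Q2) = ∑' s : conc Q1 Q2, (fun y : (Σ s1 : Q1, Q2 s1.1) => wt y.1.1 * wt y.2.1) (Φ s) := by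
        refine tsum_congr fun s => ?_
        rw [hΦ s, wt_append]
    _ ≤ ∑' y : (Σ s1 : Q1, Q2 s1.1), wt y.1.1 * wt y.2.1 := ENNReal.tsum_comp_le_tsum_of_injective hinj _
    _ = ∑' s1 : Q1, wt s1.1 * wm (Q2 s1.1) := by
        rw [ENNReal.tsum_sigma']
        refine tsum_congr fun s => ?_
        rw [wm, ← ENNReal.tsum_mul_left]
    _ ≤ ∑' s1 : Q1, wt s1.1 * B := ENNReal.tsum_le_tsum fun s => mul_le_mul' le_rfl (h s.1 s.2)
    _ = _ := by rw [ENNReal.tsum_mul_right, wm]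

/-- Prefix-free sets. -/
def PFree (Q : Set Wd) : Prop := ∀ s ∈ Q, ∀ t ∈ Q, s <+: t → s = t

lemma pf_conc {Q1 : Set Wd} {Q2 : Wd → Set Wd} (h1 : PFree Q1) (h2 : ∀ s ∈ Q1, PFree (Q2 s)) : PFree (conc Q1 Q2) := by
  rintro _ ⟨s1, hs1, s2, hs2, rfl⟩ _ ⟨t1, ht1, t2, ht2, rfl⟩ h
  have h3 : s1 <+: t1 ++ t2 := (List.prefix_append _ _).trans h
  have h4 : t1 <+: t1 ++ t2 := List.prefix_append _ _
  have : s1 = t1 := by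
    rcases List.prefix_or_prefix_of_prefix h3 h4 with h | h
    · exact h1 _ hs1 _ ht1 h
    · exact (h1 _ ht1 _ hs1 h).symm
  subst this
  rw [List.prefix_append_right_inj] at h
  rw [h2 s1 hs1 _ hs2 _ ht2 h]

lemma wm_conc_ge {Q1 : Set Wd} {Q2 : Wd → Set Wd} {B : ℝ≥0∞} (h1 : PFree Q1) (h : ∀ s ∈ Q1, B ≤ wm (Q2 s)) :
    wm Q1 * B ≤ wm (conc Q1 Q2) := by
  let Φ : (Σ s1 : Q1, Q2 s1.1) → conc Q1 Q2 := fun y => ⟨y.1.1 ++ y.2.1, y.1.1, y.1.2, y.2.1, y.2.2, rfl⟩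
  have hinj : Function.Injective Φ := by
    rintro ⟨⟨s1, hs1⟩, ⟨s2, hs2⟩⟩ ⟨⟨t1, ht1⟩, ⟨t2, ht2⟩⟩ h
    have h' : s1 ++ s2 = t1 ++ t2 := congrArg Subtype.val h
    have h3 : s1 <+: t1 ++ t2 := h' ▸ List.prefix_append _ _
    have h4 : t1 <+: t1 ++ t2 := List.prefix_append _ _
    have : s1 = t1 := by
      rcases List.prefix_or_prefix_of_prefix h3 h4 with h | h
      · exact h1 _ hs1 _ ht1 h
      · exact (h1 _ ht1 _ hs1 h).symm
    subst this
    rw [List.append_cancel_left_eq] at h'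
    subst h'; rfl
  calc wm Q1 * B = ∑' s1 : Q1, wt s1.1 * B := by rw [ENNReal.tsum_mul_right, wm]
    _ ≤ ∑' s1 : Q1, wt s1.1 * wm (Q2 s1.1) := ENNReal.tsum_le_tsum fun s => mul_le_mul' le_rfl (h s.1 s.2)
    _ = ∑' y : (Σ s1 : Q1, Q2 s1.1), wt (Φ y).1 := by
        rw [ENNReal.tsum_sigma']
        refine tsum_congr fun s => ?_
        rw [wm, ← ENNReal.tsum_mul_left]
        refine tsum_congr fun t => ?_
        rw [← wt_append]
    _ ≤ _ := ENNReal.tsum_comp_le_tsum_of_injective hinj (fun s : conc Q1 Q2 => wt s.1)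

/-- Kraft inequality. -/
lemma kraft {Q : Set Wd} (h : PFree Q) : wm Q ≤ 1 := by
  rw [wm_eq]
  refine (potential _ (fun s => if ∃ t ∈ Q, t <+: s ∧ t ≠ s then 0 else 1) ?_).trans (by split_ifs <;> simp)
  intro s
  by_cases h1 : ∃ t ∈ Q, t <+: s ∧ t ≠ s
  · rw [if_pos h1]
    obtain ⟨t, ht, h2, h3⟩ := h1
    have hs : s ∉ Q := fun hs => h3 (h t ht s hs h2)
    rw [if_neg hs, sum_eq_zero, mul_zero, add_zero]
    intro i _
    rw [if_pos]
    exact ⟨t, ht, h2.trans (List.prefix_append _ _), fun he => by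
      have := h2.length_le; rw [he] at this; simp at this⟩
  · rw [if_neg h1]
    by_cases hs : s ∈ Q
    · rw [if_pos hs, sum_eq_zero, mul_zero, add_zero]
      intro i _
      rw [if_pos]
      exact ⟨s, hs, List.prefix_append _ _, by simp⟩
    · rw [if_neg hs, zero_add]
      calc _ ≤ (4:ℝ≥0∞)⁻¹ * ∑ i : Fin 4, 1 := by
            gcongr; split_ifs <;> simp
        _ = 1 := by simp; exact ENNReal.inv_mul_cancel (by norm_num) (by norm_num)

lemma mem_vis_iff : ∀ (s : Wd) (x v : Lat), v ∈ x :: vis x s ↔ ∃ t, t <+: s ∧ v = pos x t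
  | [], x, v => by simp [vis, pos]
  | i :: s, x, v => by
      rw [vis, List.mem_cons, mem_vis_iff s (x + del4 i) v]
      constructor
      · rintro (h | ⟨t, ht, rfl⟩)
        · exact ⟨[], List.nil_prefix, h⟩
        · exact ⟨i :: t, (List.prefix_cons_inj i).2 ht, rfl⟩
      · rintro ⟨t, ht, rfl⟩
        cases t with
        | nil => exact Or.inl rfl
        | cons k t =>
          rw [List.cons_prefix_cons] at ht
          obtain ⟨rfl, ht⟩ := ht
          exact Or.inr ⟨t, ht, rfl⟩

/-- First hitting words (time zero included). -/
def FH (x : Lat) (A : Set Lat) : Set Wd := {s | pos x s ∈ A ∧ ∀ t, t <+: s → t ≠ s → pos x t ∉ A}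

lemma FH_pf (x : Lat) (A : Set Lat) : PFree (FH x A) := by
  intro s hs t ht h
  by_contra hne
  exact ht.2 s h hne hs.1

lemma prefix_snoc {t s : Wd} {i : Fin 4} (h : t <+: s ++ [i]) (hne : t ≠ s ++ [i]) : t <+: s := by
  rcases List.prefix_concat_iff.1 (by simpa using h) with h | h
  · exact absurd (by simpa using h) hne
  · exact h

/-- Words not hitting `A` strictly before their end. -/
def NH (x : Lat) (A : Set Lat) : Set Wd := {s | ∀ t, t <+: s → t ≠ s → pos x t ∉ A}

lemma NH_snoc {x : Lat} {A : Set Lat} {s : Wd} {i : Fin 4} : s ++ [i] ∈ NH x A ↔ s ∈ NH x A ∧ pos x s ∉ A := by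
  constructor
  · intro h
    refine ⟨fun t ht hne => h t (ht.trans (List.prefix_append _ _)) ?_, h s (List.prefix_append _ _) (by simp)⟩
    intro he
    have := ht.length_le; rw [he] at this; simp at this
  · rintro ⟨h1, h2⟩ t ht hne
    have := prefix_snoc ht hne
    by_cases he : t = s
    · rw [he]; exact h2
    · exact h1 t this he

/-- Real step inequality transported to extended reals. -/
lemma pot_step {f : Lat → ℝ} {v : Lat} {u : ℝ} (hu : 0 ≤ u) (h0 : ∀ i, 0 ≤ f (v + del4 i))
    (h : u + (∑ i, f (v + del4 i)) / 4 ≤ f v) :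
    ofReal u + (4:ℝ≥0∞)⁻¹ * ∑ i, ofReal (f (v + del4 i)) ≤ ofReal (f v) := by
  rw [← ENNReal.ofReal_sum_of_nonneg (fun i _ => h0 i)]
  have : (4:ℝ≥0∞)⁻¹ = ofReal (1 / 4) := by
    rw [one_div, ENNReal.ofReal_inv_of_pos (by norm_num)]; norm_num
  rw [this, ← ofReal_mul (by norm_num), ← ENNReal.ofReal_add hu (mul_nonneg (by norm_num) (sum_nonneg fun i _ => h0 i))]
  exact ofReal_le_ofReal (by linarith)

lemma sum_del4 (f : Lat → ℝ) (v : Lat) : ∑ i, f (v + del4 i) = f (v.1 + 1, v.2) + f (v.1 - 1, v.2) + f (v.1, v.2 + 1) + f (v.1, v.2 - 1) := by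
  rw [Fin.sum_univ_four]
  have h0 : v + del4 0 = (v.1 + 1, v.2) := by ext <;> simp [del4]
  have h1 : v + del4 1 = (v.1 - 1, v.2) := by ext <;> simp [del4]; rfl
  have h2 : v + del4 2 = (v.1, v.2 + 1) := by ext <;> simp [del4]
  have h3 : v + del4 3 = (v.1, v.2 - 1) := by ext <;> simp [del4]; rfl
  rw [h0, h1, h2, h3]

lemma linf_del4 (v : Lat) (i : Fin 4) : linf (v + del4 i) ≤ linf v + 1 ∧ linf v ≤ linf (v + del4 i) + 1 := by
  have h : (del4 i).1 ≤ 1 ∧ -1 ≤ (del4 i).1 ∧ (del4 i).2 ≤ 1 ∧ -1 ≤ (del4 i).2 := by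
    fin_cases i <;> simp [del4]
  obtain ⟨h1, h2, h3, h4⟩ := h
  unfold linf
  simp only [Prod.fst_add, Prod.snd_add]
  constructor
  · refine max_le ?_ ?_
    · have := le_max_left |v.1| |v.2|
      have := abs_le.1 this
      exact abs_le.2 ⟨by omega, by omega⟩
    · have := le_max_right |v.1| |v.2|
      have := abs_le.1 this
      exact abs_le.2 ⟨by omega, by omega⟩
  · refine max_le ?_ ?_
    · have := le_max_left |v.1 + (del4 i).1| |v.2 + (del4 i).2|
      have := abs_le.1 this
      exact abs_le.2 ⟨by omega, by omega⟩
    · have := le_max_right |v.1 + (del4 i).1| |v.2 + (del4 i).2|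
      have := abs_le.1 this
      exact abs_le.2 ⟨by omega, by omega⟩

lemma surv_sum {x c : Lat} {ρ : ℤ} {A : Set Lat} (hx : linf (x - c) ≤ ρ + 1) (hA : ∀ v, v ∉ A → linf (v - c) ≤ ρ) :
    ∑' s, wt s * (if s ∈ NH x A then 1 else 0) ≠ ⊤ := by
  set f : Lat → ℝ := fun v => 2 * ((ρ:ℝ) + 1) ^ 2 + 1 - ((v.1 - c.1 : ℝ) ^ 2 + (v.2 - c.2 : ℝ) ^ 2) with hf
  have hfp : ∀ v, linf (v - c) ≤ ρ + 1 → 1 ≤ f v := by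
    intro v hv
    have h1 := abs_le.1 ((le_max_left _ _).trans hv)
    have h2 := abs_le.1 ((le_max_right _ _).trans hv)
    simp only [Prod.fst_sub, Prod.snd_sub] at h1 h2
    have e1 : -((ρ:ℝ) + 1) ≤ v.1 - c.1 := by exact_mod_cast h1.1
    have e2 : (v.1 - c.1 : ℝ) ≤ ρ + 1 := by exact_mod_cast h1.2
    have e3 : -((ρ:ℝ) + 1) ≤ v.2 - c.2 := by exact_mod_cast h2.1
    have e4 : (v.2 - c.2 : ℝ) ≤ ρ + 1 := by exact_mod_cast h2.2
    simp only [hf]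
    nlinarith
  refine ne_top_of_le_ne_top ?_ (potential _ (fun s => if s ∈ NH x A then ofReal (f (pos x s)) else 0) ?_)
  · split_ifs <;> simp
  intro s
  by_cases hs : s ∈ NH x A
  · have hlin : linf (pos x s - c) ≤ ρ + 1 := by
      rcases List.eq_nil_or_concat' s with rfl | ⟨t, i, rfl⟩
      · exact hx
      · rw [NH_snoc] at hs
        have := hA _ hs.2
        rw [pos_snoc, add_sub_right_comm]
        exact (linf_del4 _ _).1.trans (by omega)
    rw [if_pos hs, if_pos hs]
    by_cases h2 : pos x s ∈ A
    · rw [sum_eq_zero, mul_zero, add_zero]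
      · have := hfp _ hlin
        rw [← ENNReal.ofReal_one]; exact ofReal_le_ofReal this
      · intro i _
        rw [if_neg]; rw [NH_snoc]; tauto
    · have h3 := hA _ h2
      have := pot_step (f := f) (v := pos x s) (u := 1) (by norm_num) (fun i => by
        have := hfp (pos x s + del4 i) (by
          rw [add_sub_right_comm]; exact (linf_del4 _ _).1.trans (by omega))
        linarith) (by rw [sum_del4]; simp only [hf]; push_cast; linarith)
      rw [ENNReal.ofReal_one] at this
      refine le_trans (le_of_eq ?_) this
      congr 2
      refine sum_congr rfl fun i _ => ?_
      rw [if_pos (NH_snoc.2 ⟨hs, h2⟩), pos_snoc]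
  · rw [if_neg hs, if_neg hs, sum_eq_zero, mul_zero, add_zero]
    intro i _
    rw [if_neg]; rw [NH_snoc]; tauto

lemma low (n : ℕ) : ∀ (r F : Wd → ℝ≥0∞), (∀ s, F s ≤ r s + (4:ℝ≥0∞)⁻¹ * ∑ i, F (s ++ [i])) →
    F [] ≤ ∑' s, (if s.length < n then wt s * r s else 0) + ∑' s, (if s.length = n then wt s * F s else 0) := by
  induction n with
  | zero =>
    intro r F h
    rw [tsum_eq_single (f := fun s : Wd => if s.length = 0 then wt s * F s else 0) []]
    · simp [wt]
    · intro s hs; rw [if_neg]; simpa using hs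
  | succ n ih =>
    intro r F h
    rw [tsum_words, tsum_words (fun s : Wd => if s.length = n + 1 then wt s * F s else 0)]
    simp only [List.length_nil, Nat.zero_lt_succ, if_true, wt, pow_zero, one_mul, List.length_cons]
    rw [if_neg (by omega), zero_add, add_assoc, ← sum_add_distrib]
    refine (h []).trans (add_le_add le_rfl ?_)
    rw [mul_sum]
    refine sum_le_sum fun i _ => ?_
    have := ih (fun s => r (i :: s)) (fun s => F (i :: s)) (fun s => h (i :: s))
    refine (mul_le_mul' le_rfl this).trans (le_of_eq ?_)
    rw [mul_add, ← ENNReal.tsum_mul_left, ← ENNReal.tsum_mul_left]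
    congr 1
    · refine tsum_congr fun s => ?_
      by_cases hs : s.length < n
      · simp [hs, wt, pow_succ]; ring
      · simp [hs]
    · refine tsum_congr fun s => ?_
      by_cases hs : s.length = n
      · simp [hs, wt, pow_succ]; ring
      · simp [hs]

/-- Mass of words of length `n` not having hit `A` strictly before. -/
def surv (x : Lat) (A : Set Lat) (n : ℕ) : ℝ≥0∞ := ∑' s : Wd, if s.length = n then wt s * (if s ∈ NH x A then 1 else 0) else 0

lemma surv_tendsto {x c : Lat} {ρ : ℤ} {A : Set Lat} (hx : linf (x - c) ≤ ρ + 1) (hA : ∀ v, v ∉ A → linf (v - c) ≤ ρ) :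
    Filter.Tendsto (surv x A) Filter.atTop (nhds 0) := by
  refine ENNReal.tendsto_atTop_zero_of_tsum_ne_top ?_
  unfold surv
  rw [ENNReal.tsum_comm]
  convert surv_sum hx hA using 3 with s
  rw [tsum_eq_single s.length]
  · simp
  · intro n hn; rw [if_neg hn.symm]

lemma fh_total {x c : Lat} {ρ : ℤ} {A : Set Lat} (hx : linf (x - c) ≤ ρ + 1) (hA : ∀ v, v ∉ A → linf (v - c) ≤ ρ) :
    1 ≤ wm (FH x A) := by
  have key : ∀ n, 1 ≤ wm (FH x A) + surv x A n := by
    intro n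
    have := low n (fun s => if s ∈ FH x A then 1 else 0) (fun s => if s ∈ NH x A then 1 else 0) (by
      intro s
      by_cases hs : s ∈ NH x A
      · by_cases h2 : pos x s ∈ A
        · rw [if_pos hs, if_pos (show s ∈ FH x A from ⟨h2, hs⟩)]; simp
        · rw [if_pos hs]
          have : ∀ i, s ++ [i] ∈ NH x A := fun i => NH_snoc.2 ⟨hs, h2⟩
          simp only [this, if_true]
          simp [ENNReal.inv_mul_cancel]
      · rw [if_neg hs]; exact zero_le)
    have h0 : ([] : Wd) ∈ NH x A := by
      intro t ht hne; exact absurd (List.prefix_nil.1 ht) hne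
    rw [if_pos h0] at this
    refine this.trans (add_le_add ?_ le_rfl)
    rw [wm_eq]
    refine ENNReal.tsum_le_tsum fun s => ?_
    split_ifs <;> simp
  have := (surv_tendsto hx hA).const_add (wm (FH x A))
  rw [add_zero] at this
  exact ge_of_tendsto' this key

/-- Coordinate along direction `d`. -/
def adv (d : Fin 4) (v : Lat) : ℤ := (del4 d).1 * v.1 + (del4 d).2 * v.2

/-- Coordinate transversal to direction `d`. -/
def lat (d : Fin 4) (v : Lat) : ℤ := (del4 d).2 * v.1 + (del4 d).1 * v.2

def co (d : Fin 4) (f : Bool) (v : Lat) : Lat := (adv d v, if f then lat d v else - lat d v)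

lemma co_add (d : Fin 4) (f : Bool) (u v : Lat) : co d f (u + v) = co d f u + co d f v := by
  cases f <;> ext <;> simp [co, adv, lat] <;> ring

lemma co_linf (d : Fin 4) (f : Bool) (v : Lat) : linf (co d f v) = linf v := by
  cases f <;> fin_cases d <;> simp [co, adv, lat, linf, del4, max_comm]

lemma exists_perm (d : Fin 4) (f : Bool) : ∃ π : Equiv.Perm (Fin 4), ∀ i, co d f (del4 (π i)) = del4 i := by
  have h : ∀ (d : Fin 4) (f : Bool) (i : Fin 4), ∃ k, co d f (del4 k) = del4 i := by
    unfold co adv lat; decide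
  choose g hg using h d f
  have hi : Function.Injective g := fun i k e => del4_inj (by rw [← hg i, ← hg k, e])
  exact ⟨Equiv.ofBijective g (Finite.injective_iff_bijective.1 hi), hg⟩

def prm (d : Fin 4) (f : Bool) : Equiv.Perm (Fin 4) := (exists_perm d f).choose

lemma prm_spec (d : Fin 4) (f : Bool) (i : Fin 4) : co d f (del4 (prm d f i)) = del4 i := (exists_perm d f).choose_spec i

lemma co_pos (d : Fin 4) (f : Bool) : ∀ (s : Wd) (x : Lat), co d f (pos x (s.map (prm d f))) = pos (co d f x) s
  | [], _ => rfl
  | i :: s, x => by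
      rw [List.map_cons, pos, co_pos d f s, co_add, prm_spec]; rfl

lemma co_pos0 (d : Fin 4) (f : Bool) (s : Wd) : co d f (pos 0 (s.map (prm d f))) = pos 0 s := by
  rw [co_pos]; congr 1; cases f <;> simp [co, adv, lat]

lemma map_symm (π : Equiv.Perm (Fin 4)) (s : Wd) : (s.map π.symm).map π = s := by simp

lemma pos_trans : ∀ (s : Wd) (x y : Lat), pos (x + y) s = x + pos y s
  | [], _, _ => rfl
  | i :: s, x, y => by rw [pos, add_assoc, pos_trans s]; rfl

lemma pos_eq (s : Wd) (x : Lat) : pos x s = x + pos 0 s := by rw [← pos_trans, add_zero]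

def farS (w : ℤ) : Set Lat := {v | w ≤ linf v}

def HS0 (w : ℤ) : Set Wd := {s | s ∈ FH 0 (farS w) ∧ (pos 0 s).1 = w ∧ 0 ≤ (pos 0 s).2}

lemma linf_zero : linf 0 = 0 := by simp [linf]

lemma fh_bound {w : ℤ} (hw : 1 ≤ w) {s : Wd} (hs : s ∈ FH 0 (farS w)) : ∀ t, t <+: s → linf (pos 0 t) ≤ w := by
  intro t ht
  by_cases he : t = s
  · subst he
    rcases List.eq_nil_or_concat' t with rfl | ⟨t', i, rfl⟩
    · rw [pos, linf_zero]; omega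
    · have := hs.2 t' (List.prefix_append _ _) (by simp)
      rw [pos_snoc]
      have h2 := (linf_del4 (pos 0 t') i).1
      have : ¬ w ≤ linf (pos 0 t') := this
      omega
  · have : ¬ w ≤ linf (pos 0 t) := hs.2 t ht he
    omega

lemma wm_map (π : Equiv.Perm (Fin 4)) (Q : Set Wd) : wm (List.map π '' Q) = wm Q := by
  have hinj : Function.Injective (List.map π) := List.map_injective_iff.2 π.injective
  rw [wm, tsum_image (fun s => wt s) hinj.injOn]
  exact tsum_congr fun s => by simp [wt]

lemma HS0_mass {w : ℤ} (hw : 1 ≤ w) : (8:ℝ≥0∞)⁻¹ ≤ wm (HS0 w) := by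
  have hcov : FH 0 (farS w) ⊆ ⋃ p : Fin 4 × Bool, List.map (prm p.1 p.2) '' HS0 w := by
    intro s hs
    have h1 := fh_bound hw hs s List.prefix_rfl
    have h2 : w ≤ linf (pos 0 s) := hs.1
    have hex : ∃ d f, (co d f (pos 0 s)).1 = w ∧ 0 ≤ (co d f (pos 0 s)).2 := by
      generalize pos 0 s = v at h1 h2
      have h3 : ∃ d, adv d v = w := by
        have h4 : linf v = w := le_antisymm h1 h2
        rcases max_choice |v.1| |v.2| with h | h <;> rw [linf, h] at h4 <;>
          rcases abs_choice (α := ℤ) _ |>.imp (fun h => h.symm.trans h4) (fun h => h.symm.trans h4) with h5 | h5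
        · exact ⟨0, by simp [adv, del4, h5]⟩
        · exact ⟨1, by simp [adv, del4, h5]⟩
        · exact ⟨2, by simp [adv, del4, h5]⟩
        · exact ⟨3, by simp [adv, del4, h5]⟩
      obtain ⟨d, hd⟩ := h3
      rcases le_total 0 (lat d v) with h | h
      · exact ⟨d, true, hd, by simpa [co] using h⟩
      · exact ⟨d, false, hd, by simpa [co] using h⟩
    obtain ⟨d, f, h3, h4⟩ := hex
    refine mem_iUnion.2 ⟨(d, f), s.map (prm d f).symm, ?_, map_symm _ _⟩
    have key : ∀ t : Wd, co d f (pos 0 t) = pos 0 (t.map (prm d f).symm) := fun t => by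
      rw [← co_pos0 d f (t.map (prm d f).symm), map_symm]
    refine ⟨⟨?_, ?_⟩, by rw [← key]; exact h3, by rw [← key]; exact h4⟩
    · rw [← key]; change w ≤ _; rw [co_linf]; exact hs.1
    · intro t ht hne
      have h5 := ht.map (prm d f); rw [map_symm] at h5
      have h6 := hs.2 _ h5 (fun he => hne (by rw [← he]; simp))
      rw [← co_pos0 d f]
      change ¬ w ≤ _; rw [co_linf]; exact h6
  have h := (fh_total (x := 0) (c := 0) (ρ := w) (A := farS w) (by rw [sub_zero, linf_zero]; omega) (by
    intro v hv; have : ¬ w ≤ linf v := hv; rw [sub_zero]; omega)).trans (wm_mono hcov)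
  have h2 := h.trans (ENNReal.tsum_iUnion_le (fun s => wt s) _)
  change 1 ≤ ∑ p : Fin 4 × Bool, wm _ at h2
  simp only [wm_map, sum_const, Finset.card_univ, Fintype.card_prod, Fintype.card_fin, Fintype.card_bool, nsmul_eq_mul] at h2
  rw [ENNReal.inv_le_iff_le_mul (by simp) (by simp)]
  exact h2.trans (by norm_num)

/-- There is a prefix-free family of mass at least `p` with property `P`. -/
def RW (p : ℝ≥0∞) (P : Wd → Prop) : Prop := ∃ Q, PFree Q ∧ p ≤ wm Q ∧ ∀ s ∈ Q, P s

lemma RW.comp {p q : ℝ≥0∞} {P : Wd → Prop} {P2 : Wd → Wd → Prop} (h : RW p P) (h2 : ∀ s, P s → RW q (P2 s)) :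
    RW (p * q) (fun s => ∃ s1 s2, s = s1 ++ s2 ∧ P s1 ∧ P2 s1 s2) := by
  obtain ⟨Q, hQ, hp, hP⟩ := h
  choose! Q2 h3 h4 h5 using h2
  refine ⟨conc Q Q2, pf_conc hQ fun s hs => h3 s (hP s hs), ?_, ?_⟩
  · exact (mul_le_mul' hp le_rfl).trans (wm_conc_ge hQ fun s hs => h4 s (hP s hs))
  · rintro _ ⟨s1, h1, s2, h2, rfl⟩
    exact ⟨s1, s2, rfl, hP _ h1, h5 _ (hP _ h1) _ h2⟩

lemma RW.mono {p : ℝ≥0∞} {P P' : Wd → Prop} (h : RW p P) (h' : ∀ s, P s → P' s) : RW p P' := by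
  obtain ⟨Q, h1, h2, h3⟩ := h
  exact ⟨Q, h1, h2, fun s hs => h' s (h3 s hs)⟩

lemma halfside {w : ℤ} (hw : 1 ≤ w) (d : Fin 4) (f : Bool) : RW (8:ℝ≥0∞)⁻¹ (fun s =>
    adv d (pos 0 s) = w ∧ 0 ≤ (co d f (pos 0 s)).2 ∧ ∀ t, t <+: s → linf (pos 0 t) ≤ w) := by
  refine ⟨List.map (prm d f) '' HS0 w, ?_, ?_, ?_⟩
  · rintro _ ⟨s, hs, rfl⟩ _ ⟨t, ht, rfl⟩ h
    have := h.map (prm d f).symm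
    simp only [List.map_map, Equiv.symm_comp_self, List.map_id_fun, id] at this
    rw [FH_pf _ _ s hs.1 t ht.1 this]
  · rw [wm_map]; exact HS0_mass hw
  · rintro _ ⟨s, hs, rfl⟩
    refine ⟨?_, ?_, ?_⟩
    · have := congrArg Prod.fst (co_pos0 d f s); exact this.trans hs.2.1
    · rw [co_pos0]; exact hs.2.2
    · intro t ht
      have h5 := ht.map (prm d f).symm
      simp only [List.map_map, Equiv.symm_comp_self, List.map_id_fun, id] at h5
      have := fh_bound hw hs.1 _ h5
      rw [← co_pos0 d f, map_symm, co_linf] at this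
      exact this

lemma adv_add (d : Fin 4) (u v : Lat) : adv d (u + v) = adv d u + adv d v := by simp [adv]; ring

lemma lat_add (d : Fin 4) (u v : Lat) : lat d (u + v) = lat d u + lat d v := by simp [lat]; ring

lemma adv_lat_le (d : Fin 4) (v : Lat) : |adv d v| ≤ linf v ∧ |lat d v| ≤ linf v := by
  fin_cases d <;> simp [adv, lat, linf, del4]

/-- Conclusion of a steering stage. -/
def Steer (d : Fin 4) (w k l : ℤ) (x : Lat) (s : Wd) : Prop :=
  adv d (pos x s) = adv d x + k * w ∧ |lat d (pos x s) - l| ≤ w ∧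
    ∀ v ∈ x :: vis x s, |lat d v - l| ≤ 2 * w ∧ adv d x - w ≤ adv d v ∧ adv d v ≤ adv d x + k * w

lemma steer {w : ℤ} (hw : 1 ≤ w) (d : Fin 4) (l : ℤ) (k : ℕ) : ∀ x : Lat, |lat d x - l| ≤ w →
    RW ((8:ℝ≥0∞)⁻¹ ^ k) (Steer d w k l x) := by
  induction k with
  | zero =>
    intro x hx
    refine ⟨{[]}, ?_, by rw [wm_singleton]; simp, ?_⟩
    · intro s hs t ht _; rw [mem_singleton_iff] at hs ht; rw [hs, ht]
    · rintro s rfl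
      refine ⟨by simp [pos], hx, ?_⟩
      intro v hv
      simp only [vis, List.mem_singleton] at hv
      subst hv
      exact ⟨by omega, by omega, by simp⟩
  | succ k ih =>
    intro x hx
    rw [pow_succ']
    refine ((halfside hw d (decide (lat d x ≤ l))).comp (P2 := fun s1 => Steer d w k l (pos x s1)) ?_).mono ?_
    · rintro s ⟨h1, h2, h3⟩
      refine ih _ ?_
      have h4 := (adv_lat_le d (pos 0 s)).2.trans (h3 s List.prefix_rfl)
      rw [pos_eq, lat_add]
      rw [abs_le] at hx h4 ⊢
      by_cases h : lat d x ≤ l <;> simp [co, h] at h2 <;> omega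
    · rintro _ ⟨s1, s2, rfl, ⟨h1, h2, h3⟩, h4, h5, h6⟩
      have e1 : adv d (pos x s1) = adv d x + w := by rw [pos_eq, adv_add, h1]
      rw [e1] at h4 h6
      push_cast
      refine ⟨by rw [pos_append, h4]; ring, by rw [pos_append]; exact h5, ?_⟩
      intro v hv
      rw [vis_append, ← List.cons_append, List.mem_append] at hv
      have hk : (0:ℤ) ≤ k * w := by positivity
      rcases hv with hv | hv
      · obtain ⟨t, ht, rfl⟩ := (mem_vis_iff _ _ _).1 hv
        have h7 := h3 t ht
        obtain ⟨h8, h9⟩ := adv_lat_le d (pos 0 t)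
        rw [pos_eq, adv_add, lat_add]
        rw [abs_le] at *
        refine ⟨⟨by linarith, by linarith⟩, by linarith, by linarith⟩
      · obtain ⟨h7, h8, h9⟩ := h6 v (List.mem_cons_of_mem _ hv)
        exact ⟨h7, by linarith, by linarith⟩

/-- A succession of steering stages. -/
def Tour (w : ℤ) : List (Fin 4 × ℕ) → Lat → Wd → Prop
  | [], _, s => s = []
  | q :: L, x, s => ∃ s1 s2, s = s1 ++ s2 ∧ Steer q.1 w q.2 (lat q.1 x) x s1 ∧ Tour w L (pos x s1) s2

lemma tour {w : ℤ} (hw : 1 ≤ w) : ∀ (L : List (Fin 4 × ℕ)) (x : Lat),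
    RW ((8:ℝ≥0∞)⁻¹ ^ (L.map Prod.snd).sum) (Tour w L x)
  | [], x => by
      refine ⟨{[]}, ?_, by rw [wm_singleton]; simp, fun s hs => hs⟩
      intro s hs t ht _; rw [mem_singleton_iff] at hs ht; rw [hs, ht]
  | q :: L, x => by
      rw [List.map_cons, List.sum_cons, pow_add]
      exact (steer hw q.1 (lat q.1 x) q.2 x (by simpa using (by omega : 0 ≤ w))).comp fun s1 _ => tour hw L (pos x s1)

/-- The trace of `l` surrounds the box of radius `2w` around `z`. -/
def Circ (z : Lat) (w : ℤ) (l : List Lat) : Prop :=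
  ∀ q : Plane, |q 0 - z.1| < 2 * w → |q 1 - z.2| < 2 * w → ¬ HasLog (traceL l) q

lemma Circ.mono {z : Lat} {w : ℤ} {l l' : List Lat} (h : Circ z w l) (hi : l <:+: l') : Circ z w l' :=
  fun q h1 h2 h3 => h q h1 h2 (h3.mono (traceL_infix hi))

lemma tr_ge (l : List Lat) (i : Fin 2) (c : ℝ) (h : ∀ a ∈ l, c ≤ emb a i) : ∀ p ∈ traceL l, c ≤ p i := by
  have hc : Convex ℝ {p : Plane | c ≤ p i} :=
    convex_halfSpace_ge (f := fun p : Plane => p i) ⟨fun _ _ => rfl, fun _ _ => rfl⟩ c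
  exact fun p hp => traceL_subset_convex hc h hp

lemma tr_le (l : List Lat) (i : Fin 2) (c : ℝ) (h : ∀ a ∈ l, emb a i ≤ c) : ∀ p ∈ traceL l, p i ≤ c := by
  have hc : Convex ℝ {p : Plane | p i ≤ c} :=
    convex_halfSpace_le (f := fun p : Plane => p i) ⟨fun _ _ => rfl, fun _ _ => rfl⟩ c
  exact fun p hp => traceL_subset_convex hc h hp

lemma linf_gt {w : ℤ} {v : Lat} (h : w < v.1 ∨ v.1 < -w ∨ w < v.2 ∨ v.2 < -w) : w < linf v := by
  unfold linf
  rw [lt_max_iff, lt_abs, lt_abs]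
  omega

/-- Combinatorial data of a circuit: top, left, bottom and right arcs. -/
lemma circ_of {z : Lat} {w : ℤ} (hw : 1 ≤ w) {l2 l3 l4 l1 L : List Lat}
    (i2 : l2 <:+: L) (i3 : l3 <:+: L) (i4 : l4 <:+: L) (i1 : l1 <:+: L)
    {a b c d e : Lat} (ha : a ∈ l2) (hb : b ∈ l2) (hb' : b ∈ l3) (hc : c ∈ l3) (hc' : c ∈ l4) (hd : d ∈ l4) (hd' : d ∈ l1)
    (he : e ∈ l1)
    (k2 : ∀ v ∈ l2, z.2 + 3 * w ≤ v.2) (k3 : ∀ v ∈ l3, v.1 ≤ z.1 - 3 * w) (k4 : ∀ v ∈ l4, v.2 ≤ z.2 - 3 * w)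
    (k1 : ∀ v ∈ l1, z.1 + 3 * w ≤ v.1)
    (m1 : ∀ v ∈ l1, v.1 < a.1 ∧ b.1 < v.1) (m2 : ∀ v ∈ l2, d.2 < v.2 ∧ v.2 < e.2) : Circ z w L := by
  intro q h1 h2
  rw [abs_lt] at h1 h2
  have hw' : (1:ℝ) ≤ w := by exact_mod_cast hw
  have b1 := tr_ge l1 0 (z.1 + 3 * w) (fun v hv => by rw [emb_zero]; exact_mod_cast k1 v hv)
  have b2 := tr_ge l2 1 (z.2 + 3 * w) (fun v hv => by rw [emb_one]; exact_mod_cast k2 v hv)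
  have b3 := tr_le l3 0 (z.1 - 3 * w) (fun v hv => by rw [emb_zero]; have := (Int.cast_le (R := ℝ)).2 (k3 v hv); push_cast at this; linarith)
  have b4 := tr_le l4 1 (z.2 - 3 * w) (fun v hv => by rw [emb_one]; have := (Int.cast_le (R := ℝ)).2 (k4 v hv); push_cast at this; linarith)
  refine not_hasLog_of_circuit (traceL_infix i1) (traceL_infix i2) (traceL_infix i3) (traceL_infix i4)
    (isPreconnected_traceL _) (isPreconnected_traceL _) (isPreconnected_traceL _) (isPreconnected_traceL _)
    (fun x hx => by linarith [b1 x hx]) (fun x hx => by linarith [b2 x hx])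
    (fun x hx => by linarith [b3 x hx]) (fun x hx => by linarith [b4 x hx])
    ?_ ⟨_, emb_mem_traceL hb, emb_mem_traceL hb'⟩ ⟨_, emb_mem_traceL hc, emb_mem_traceL hc'⟩
    ⟨_, emb_mem_traceL hd, emb_mem_traceL hd'⟩
  rw [inter_comm]
  refine crossing (joinedIn_traceL ha hb) (joinedIn_traceL hd' he) ?_ ?_ ?_ ?_
  · intro p hp
    have := tr_le l1 0 (a.1 - 1) (fun v hv => by
      rw [emb_zero]; have := (Int.cast_le (R := ℝ)).2 (Int.le_sub_one_of_lt (m1 v hv).1); push_cast at this; linarith) p hp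
    rw [emb_zero]; linarith
  · intro p hp
    have := tr_ge l1 0 (b.1 + 1) (fun v hv => by
      rw [emb_zero]; exact_mod_cast (show b.1 + 1 ≤ v.1 by have := (m1 v hv).2; omega)) p hp
    rw [emb_zero]; linarith
  · intro p hp
    have := tr_ge l2 1 (d.2 + 1) (fun v hv => by
      rw [emb_one]; exact_mod_cast (show d.2 + 1 ≤ v.2 by have := (m2 v hv).1; omega)) p hp
    rw [emb_one]; linarith
  · intro p hp
    have := tr_le l2 1 (e.2 - 1) (fun v hv => by
      rw [emb_one]; have := (Int.cast_le (R := ℝ)).2 (Int.le_sub_one_of_lt (m2 v hv).2); push_cast at this; linarith) p hp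
    rw [emb_one]; linarith

lemma adv0 (v : Lat) : adv 0 v = v.1 := by simp [adv, del4]
lemma adv1 (v : Lat) : adv 1 v = -v.1 := by simp [adv, del4]
lemma adv2 (v : Lat) : adv 2 v = v.2 := by simp [adv, del4]
lemma adv3 (v : Lat) : adv 3 v = -v.2 := by simp [adv, del4]
lemma lat0 (v : Lat) : lat 0 v = v.2 := by simp [lat, del4]
lemma lat1 (v : Lat) : lat 1 v = -v.2 := by simp [lat, del4]
lemma lat2 (v : Lat) : lat 2 v = v.1 := by simp [lat, del4]
lemma lat3 (v : Lat) : lat 3 v = -v.1 := by simp [lat, del4]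

def tourL (d : Fin 4) : List (Fin 4 × ℕ) := [(d, 128), (0, 512), (2, 640), (1, 1024), (3, 1280), (0, 660), (2, 1900)]

lemma tour_sum (d : Fin 4) : ((tourL d).map Prod.snd).sum = 6144 := by simp [tourL]

lemma circuit {z x : Lat} {w : ℤ} (hw : 1 ≤ w) (hx : linf (x - z) = 128 * w) :
    RW ((8:ℝ≥0∞)⁻¹ ^ 6144) (fun s => (∀ v ∈ x :: vis x s, w < linf (v - z)) ∧ Circ z w (x :: vis x s)) := by
  have hx1 := abs_le.1 ((le_max_left _ _).trans hx.le)
  have hx2 := abs_le.1 ((le_max_right _ _).trans hx.le)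
  have hx3 : x.1 - z.1 = 128 * w ∨ x.1 - z.1 = - (128 * w) ∨ x.2 - z.2 = 128 * w ∨ x.2 - z.2 = -(128 * w) := by
    rcases max_choice |(x - z).1| |(x - z).2| with h | h <;> rw [linf, h] at hx <;>
      rcases (abs_eq (by omega)).1 hx with h | h <;> simp only [Prod.fst_sub, Prod.snd_sub] at h <;> tauto
  simp only [Prod.fst_sub, Prod.snd_sub] at hx1 hx2
  obtain ⟨d, hd⟩ : ∃ d : Fin 4, (d = 2 ∧ z.2 ≤ x.2) ∨ (d = 3 ∧ x.2 ≤ z.2) := by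
    rcases le_total z.2 x.2 with h | h
    · exact ⟨2, Or.inl ⟨rfl, h⟩⟩
    · exact ⟨3, Or.inr ⟨rfl, h⟩⟩
  have ht := tour hw (tourL d) x
  rw [tour_sum] at ht
  refine ht.mono ?_
  rintro s ⟨s1, _, rfl, ⟨a1, b1, c1⟩, s2, _, rfl, ⟨a2, b2, c2⟩, s3, _, rfl, ⟨a3, b3, c3⟩, s4, _, rfl, ⟨a4, b4, c4⟩,
    s5, _, rfl, ⟨a5, b5, c5⟩, s6, _, rfl, ⟨a6, b6, c6⟩, s7, _, rfl, ⟨a7, b7, c7⟩, rfl⟩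
  set x1 := pos x s1
  set x2 := pos x1 s2 with hx2e
  set x3 := pos x2 s3 with hx3e
  set x4 := pos x3 s4 with hx4e
  set x5 := pos x4 s5 with hx5e
  set x6 := pos x5 s6 with hx6e
  set x7 := pos x6 s7 with hx7e
  simp only [adv0, adv1, adv2, adv3, lat0, lat1, lat2, lat3, abs_le] at a2 a3 a4 a5 a6 a7 b2 b3 b4 b5 b6 b7 c2 c3 c4 c5 c6 c7
  have e1 : (128 * w ≤ x1.2 - z.2 ∧ x1.2 - z.2 ≤ 256 * w ∨ -(256 * w) ≤ x1.2 - z.2 ∧ x1.2 - z.2 ≤ -(128 * w)) ∧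
      -(129 * w) ≤ x1.1 - z.1 ∧ x1.1 - z.1 ≤ 129 * w ∧ ∀ v ∈ x :: vis x s1, w < linf (v - z) := by
    rcases hd with ⟨rfl, hd⟩ | ⟨rfl, hd⟩ <;> simp only [adv2, adv3, lat2, lat3, abs_le] at a1 b1 c1 <;> push_cast at a1 b1 c1
    · refine ⟨Or.inl ⟨by omega, by omega⟩, by omega, by omega, fun v hv => linf_gt ?_⟩
      have := c1 v hv
      simp only [Prod.fst_sub, Prod.snd_sub]; omega
    · refine ⟨Or.inr ⟨by omega, by omega⟩, by omega, by omega, fun v hv => linf_gt ?_⟩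
      have := c1 v hv
      simp only [Prod.fst_sub, Prod.snd_sub]; omega
  clear a1 b1 c1 hd hx1 hx2 hx3
  obtain ⟨e1, e2, e3, c1⟩ := e1
  push_cast at a2 a3 a4 a5 a6 a7 c2 c3 c4 c5 c6 c7
  have hv : x :: vis x (s1 ++ (s2 ++ (s3 ++ (s4 ++ (s5 ++ (s6 ++ (s7 ++ []))))))) =
      (x :: vis x s1) ++ (vis x1 s2 ++ (vis x2 s3 ++ (vis x3 s4 ++ (vis x4 s5 ++ (vis x5 s6 ++ vis x6 s7))))) := by
    simp only [vis_append, List.append_nil, List.cons_append]; rfl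
  constructor
  · intro v h
    rw [hv] at h
    simp only [List.mem_append] at h
    rcases h with h | h | h | h | h | h | h
    · exact c1 v h
    · have := c2 v (List.mem_cons_of_mem _ h)
      exact linf_gt (by simp only [Prod.fst_sub, Prod.snd_sub]; omega)
    · have := c3 v (List.mem_cons_of_mem _ h)
      exact linf_gt (by simp only [Prod.fst_sub, Prod.snd_sub]; omega)
    · have := c4 v (List.mem_cons_of_mem _ h)
      exact linf_gt (by simp only [Prod.fst_sub, Prod.snd_sub]; omega)
    · have := c5 v (List.mem_cons_of_mem _ h)
      exact linf_gt (by simp only [Prod.fst_sub, Prod.snd_sub]; omega)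
    · have := c6 v (List.mem_cons_of_mem _ h)
      exact linf_gt (by simp only [Prod.fst_sub, Prod.snd_sub]; omega)
    · have := c7 v (List.mem_cons_of_mem _ h)
      exact linf_gt (by simp only [Prod.fst_sub, Prod.snd_sub]; omega)
  · have inf : ∀ (t u r : Wd), pos x t ∈ x :: vis x t → (pos x t :: vis (pos x t) u) <:+: x :: vis x (t ++ (u ++ r)) := by
      intro t u r _
      rw [vis_append, vis_append]
      rcases List.eq_nil_or_concat' t with rfl | ⟨t', i, rfl⟩
      · exact ⟨[], vis (pos x u) r, by simp [vis, pos]⟩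
      · exact ⟨x :: vis x t', vis (pos (pos x (t' ++ [i])) u) r, by simp [vis_snoc, pos_snoc]⟩
    have j2 := inf (s1 ++ (s2 ++ s3)) s4 (s5 ++ (s6 ++ s7)) (pos_mem _ _)
    have j3 := inf (s1 ++ (s2 ++ (s3 ++ s4))) s5 (s6 ++ s7) (pos_mem _ _)
    have j4 := inf (s1 ++ (s2 ++ (s3 ++ (s4 ++ s5)))) s6 s7 (pos_mem _ _)
    have j1 := inf (s1 ++ (s2 ++ (s3 ++ (s4 ++ (s5 ++ s6))))) s7 [] (pos_mem _ _)
    simp only [pos_append, List.append_assoc, List.append_nil] at j1 j2 j3 j4 ⊢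
    refine circ_of hw j2 j3 j4 j1 (a := x3) (b := x4) (c := x5) (d := x6) (e := x7) (by simp [x3, x2, x1]) (pos_mem _ _)
      (by simp [x4, x3, x2, x1]) (pos_mem _ _)
      (by simp [x5, x4, x3, x2, x1]) (pos_mem _ _) (by simp [x6, x5, x4, x3, x2, x1]) (pos_mem _ _) ?_ ?_ ?_ ?_ ?_ ?_
    · intro v h; have := c4 v h; omega
    · intro v h; have := c5 v h; omega
    · intro v h; have := c6 v h; omega
    · intro v h; have := c7 v h; omega
    · intro v h; have := c7 v h; omega
    · intro v h; have := c4 v h; omega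

def pc : ℝ≥0∞ := (8:ℝ≥0∞)⁻¹ ^ 6144

lemma pc_ne_zero : pc ≠ 0 := pow_ne_zero _ (by simp)

lemma pc_le : pc ≤ 1 := pow_le_one' (by simp) _

/-- Circuit-free first hitting words. -/
def CF (x z : Lat) (w : ℤ) : Set Wd := {s | s ∈ FH x (box z w) ∧ ¬ Circ z w (x :: vis x s)}

lemma vis_prefix {s t : Wd} (x : Lat) (h : s <+: t) : x :: vis x s <+: x :: vis x t := by
  obtain ⟨u, rfl⟩ := h
  rw [vis_append]; exact ⟨vis (pos x s) u, by simp⟩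

lemma wm_union {P Q : Set Wd} (h : Disjoint P Q) : wm (P ∪ Q) = wm P + wm Q :=
  Summable.tsum_union_disjoint (f := wt) h ENNReal.summable ENNReal.summable

lemma cf_mass {z x : Lat} {w : ℤ} (hw : 1 ≤ w) (hx : linf (x - z) = 128 * w) : wm (CF x z w) ≤ 1 - pc := by
  obtain ⟨Q, h1, h2, h3⟩ := circuit hw hx
  have n1 : ∀ s ∈ CF x z w, ∀ t ∈ Q, ¬ s <+: t := by
    intro s hs t ht h
    have := (h3 t ht).1 (pos x s) ((mem_vis_iff _ _ _).2 ⟨s, h, rfl⟩)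
    exact absurd hs.1.1 (not_le.2 this)
  have n2 : ∀ s ∈ CF x z w, ∀ t ∈ Q, ¬ t <+: s := fun s hs t ht h =>
    hs.2 ((h3 t ht).2.mono (vis_prefix x h).isInfix)
  have hd : Disjoint (CF x z w) Q := Set.disjoint_left.2 fun s hs ht => n1 s hs s ht List.prefix_rfl
  have hpf : PFree (CF x z w ∪ Q) := by
    rintro s (hs | hs) t (ht | ht) h
    · exact FH_pf _ _ s hs.1 t ht.1 h
    · exact absurd h (n1 s hs t ht)
    · exact absurd h (n2 t ht s hs)
    · exact h1 s hs t ht h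
  have := kraft hpf
  rw [wm_union hd] at this
  exact (ENNReal.le_sub_of_add_le_right (ne_top_of_le_ne_top ENNReal.one_ne_top pc_le)
    ((add_le_add le_rfl h2).trans this))

/-- Green words. -/
def GR (y x z : Lat) (M : ℤ) : Set Wd := {s | pos y s = x ∧ ∀ v ∈ y :: vis y s, linf (v - z) ≤ M}

lemma green_real (v x : Lat) : (if v = x then (1:ℝ) else 0) * log 2 * 4 + 4 * log (((v.1 - x.1 : ℝ)) ^ 2 + (v.2 - x.2 : ℝ) ^ 2 + 1) ≤
    log ((v.1 + 1 - x.1 : ℝ) ^ 2 + (v.2 - x.2 : ℝ) ^ 2 + 1) + log ((v.1 - 1 - x.1 : ℝ) ^ 2 + (v.2 - x.2 : ℝ) ^ 2 + 1) +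
    log ((v.1 - x.1 : ℝ) ^ 2 + (v.2 + 1 - x.2 : ℝ) ^ 2 + 1) + log ((v.1 - x.1 : ℝ) ^ 2 + (v.2 - 1 - x.2 : ℝ) ^ 2 + 1) := by
  by_cases h : v = x
  · subst h; simp; norm_num; linarith
  · rw [if_neg h, zero_mul, zero_mul, zero_add]
    have e : (4:ℝ) = (4:ℕ) := by norm_num
    rw [e, ← Real.log_pow, ← Real.log_mul (by positivity) (by positivity), ← Real.log_mul (by positivity) (by positivity),
      ← Real.log_mul (by positivity) (by positivity)]
    refine Real.log_le_log (by positivity) ?_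
    set a : ℝ := v.1 - x.1
    set b : ℝ := v.2 - x.2
    rw [show (v.1 + 1 - x.1 : ℝ) = a + 1 by ring, show (v.1 - 1 - x.1 : ℝ) = a - 1 by ring, show (v.2 + 1 - x.2 : ℝ) = b + 1 by ring,
      show (v.2 - 1 - x.2 : ℝ) = b - 1 by ring]
    have : ((a + 1) ^ 2 + b ^ 2 + 1) * ((a - 1) ^ 2 + b ^ 2 + 1) * (a ^ 2 + (b + 1) ^ 2 + 1) * (a ^ 2 + (b - 1) ^ 2 + 1)
      = (a ^ 2 + b ^ 2 + 1) ^ 4 + 2 * (a ^ 2 + b ^ 2 + 1) ^ 2 + 8 * (a ^ 2 + b ^ 2 + 1) + 5 + 16 * a ^ 2 * b ^ 2 := by ring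
    rw [this]
    have : 0 ≤ 2 * (a ^ 2 + b ^ 2 + 1) ^ 2 + 8 * (a ^ 2 + b ^ 2 + 1) + 5 + 16 * a ^ 2 * b ^ 2 := by positivity
    linarith

lemma green_bound {y x z : Lat} {M : ℤ} (hx : linf (x - z) ≤ M) :
    wm (GR y x z M) ≤ ofReal (log ((8 * ((M:ℝ) + 1) ^ 2 + 1) / ((y.1 - x.1 : ℝ) ^ 2 + (y.2 - x.2 : ℝ) ^ 2 + 1)) / log 2) := by
  have h2 : 0 < log 2 := Real.log_pos (by norm_num)
  set f : Lat → ℝ := fun v => log ((8 * ((M:ℝ) + 1) ^ 2 + 1) / ((v.1 - x.1 : ℝ) ^ 2 + (v.2 - x.2 : ℝ) ^ 2 + 1)) / log 2 with hf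
  have hM : (0:ℝ) ≤ M := by exact_mod_cast (abs_nonneg _).trans ((le_max_left _ _).trans hx)
  have hf' : ∀ v, f v = (log (8 * ((M:ℝ) + 1) ^ 2 + 1) - log ((v.1 - x.1 : ℝ) ^ 2 + (v.2 - x.2 : ℝ) ^ 2 + 1)) / log 2 := by
    intro v; simp only [hf]; rw [Real.log_div (by positivity) (by positivity)]
  have hfp : ∀ v, linf (v - z) ≤ M + 1 → 0 ≤ f v := by
    intro v hv
    simp only [hf]
    refine div_nonneg (Real.log_nonneg ?_) h2.le
    rw [one_le_div (by positivity)]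
    have h1 := abs_le.1 ((le_max_left _ _).trans hv)
    have h2 := abs_le.1 ((le_max_right _ _).trans hv)
    have h3 := abs_le.1 ((le_max_left _ _).trans hx)
    have h4 := abs_le.1 ((le_max_right _ _).trans hx)
    simp only [Prod.fst_sub, Prod.snd_sub] at h1 h2 h3 h4
    have e1 : -(2 * ((M:ℝ) + 1)) ≤ v.1 - x.1 := by exact_mod_cast (by omega : -(2 * (M + 1)) ≤ v.1 - x.1)
    have e2 : (v.1 - x.1 : ℝ) ≤ 2 * (M + 1) := by exact_mod_cast (by omega : v.1 - x.1 ≤ 2 * (M + 1))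
    have e3 : -(2 * ((M:ℝ) + 1)) ≤ v.2 - x.2 := by exact_mod_cast (by omega : -(2 * (M + 1)) ≤ v.2 - x.2)
    have e4 : (v.2 - x.2 : ℝ) ≤ 2 * (M + 1) := by exact_mod_cast (by omega : v.2 - x.2 ≤ 2 * (M + 1))
    have := sq_le_sq' e1 e2
    have := sq_le_sq' e3 e4
    linarith
  rw [wm_eq]
  refine (potential _ (fun s => if ∀ t, t <+: s → linf (pos y t - z) ≤ M then ofReal (f (pos y s)) else 0) ?_).trans ?_
  swap
  · split_ifs
    · exact le_rfl
    · exact zero_le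
  intro s
  by_cases hs : ∀ t, t <+: s → linf (pos y t - z) ≤ M
  · rw [if_pos hs]
    have hl := hs s List.prefix_rfl
    have := pot_step (f := f) (v := pos y s) (u := if pos y s = x then 1 else 0) (by split_ifs <;> norm_num) (fun i => hfp _ (by
      rw [add_sub_right_comm]; exact (linf_del4 _ _).1.trans (by omega))) (by
        rw [sum_del4]; simp only [hf']
        have := green_real (pos y s) x
        push_cast
        rw [← mul_le_mul_iff_left₀ h2, add_mul, div_mul_cancel₀ _ h2.ne']
        field_simp
        linarith)
    refine le_trans (add_le_add ?_ (mul_le_mul' le_rfl (sum_le_sum fun i _ => ?_))) this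
    · by_cases h : s ∈ GR y x z M
      · rw [if_pos h, if_pos h.1]; simp
      · rw [if_neg h]; exact zero_le
    · rw [← pos_snoc]; split_ifs
      · exact le_rfl
      · exact zero_le
  · rw [if_neg hs, if_neg (fun h => hs fun t ht => h.2 _ ((mem_vis_iff _ _ _).2 ⟨t, ht, rfl⟩)), sum_eq_zero, mul_zero, add_zero]
    intro i _
    exact if_neg fun h => hs fun t ht => h t (ht.trans (List.prefix_append _ _))

/-- Words entering the box of radius `m/2` without returning to radius `m`. -/
def GB (x z : Lat) (m : ℤ) : Set Wd := {s | s ∈ FH x (box z m) ∧ ∀ t, t <+: s → t ≠ [] → linf (pos x t - z) < 2 * m}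

lemma gambler {x z : Lat} {m : ℤ} (hm : 1 ≤ m) (hx : linf (x - z) = 2 * m) : wm (GB x z m) ≤ ofReal (1 / (4 * m)) := by
  have hm' : (1:ℝ) ≤ m := by exact_mod_cast hm
  obtain ⟨d, hd⟩ : ∃ d, adv d (x - z) = 2 * m := by
    rcases max_choice |(x - z).1| |(x - z).2| with h | h <;> rw [linf, h] at hx <;>
      rcases (abs_eq (by omega)).1 hx with h5 | h5
    · exact ⟨0, by rw [adv0]; exact h5⟩
    · exact ⟨1, by rw [adv1]; omega⟩
    · exact ⟨2, by rw [adv2]; exact h5⟩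
    · exact ⟨3, by rw [adv3]; omega⟩
  set f : Lat → ℝ := fun v => (2 * m - adv d (v - z)) / m with hf
  have hdel : ∀ v i, f (v + del4 i) = f v - adv d (del4 i) / m := by
    intro v i
    simp only [hf]; rw [add_sub_right_comm, adv_add]; push_cast; ring
  have hsum : ∀ v, ∑ i, f (v + del4 i) = 4 * f v := by
    intro v
    simp only [hdel, Fin.sum_univ_four]
    have : adv d (del4 0) + adv d (del4 1) + adv d (del4 2) + adv d (del4 3) = 0 := by
      simp [adv, del4]
    have : (adv d (del4 0) + adv d (del4 1) + adv d (del4 2) + adv d (del4 3) : ℝ) = 0 := by exact_mod_cast this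
    field_simp; linarith
  rw [wm_eq]
  set F : Wd → ℝ≥0∞ := fun s => if s = [] then ofReal (1 / (4 * m)) else
    if (∀ t, t <+: s → t ≠ [] → linf (pos x t - z) < 2 * m) ∧ s ∈ NH x (box z m) then ofReal (f (pos x s)) else 0 with hF
  have hF1 : ∀ s i, F (s ++ [i]) ≤ ofReal (f (pos x s + del4 i)) := by
    intro s i
    simp only [hF]; rw [if_neg (by simp), pos_snoc]
    split_ifs
    · exact le_rfl
    · exact zero_le
  refine (potential _ F ?_).trans (by simp [hF])
  intro s
  by_cases h0 : s = []
  · subst h0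
    have hn : ([] : Wd) ∉ GB x z m := by
      intro h
      have : linf (x - z) ≤ m := h.1.1
      omega
    rw [if_neg hn, zero_add]
    refine (mul_le_mul' le_rfl (sum_le_sum fun i _ => hF1 [] i)).trans ?_
    have hfx : f x = 0 := by simp only [hf, hd]; push_cast; simp
    simp only [hdel, pos, hfx, hF, if_true, zero_sub]
    have : ∀ i, ofReal (-((adv d (del4 i) : ℝ) / m)) ≤ if adv d (del4 i) = -1 then ofReal (1 / m) else 0 := by
      intro i
      split_ifs with h
      · rw [h]; push_cast; rw [neg_div, neg_neg]
      · rw [ENNReal.ofReal_of_nonpos]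
        have : ∀ d i, adv d (del4 i) ≠ -1 → 0 ≤ adv d (del4 i) := by unfold adv; decide
        have h3 : (0:ℝ) ≤ adv d (del4 i) := by exact_mod_cast this d i h
        have : 0 ≤ (adv d (del4 i) : ℝ) / m := by positivity
        linarith
    refine (mul_le_mul' le_rfl (sum_le_sum fun i _ => this i)).trans ?_
    rw [← Finset.sum_filter, sum_const]
    have hc : ∀ d : Fin 4, (Finset.univ.filter fun i => adv d (del4 i) = -1).card = 1 := by
      unfold adv; intro d; fin_cases d <;> rfl
    have e4 : (4:ℝ≥0∞)⁻¹ = ofReal (1 / 4) := by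
      rw [one_div, ENNReal.ofReal_inv_of_pos (by norm_num)]; norm_num
    rw [show (Finset.univ.filter fun i => adv d (del4 i) = -1).card = 1 by convert hc d, one_smul, e4, ← ofReal_mul (by norm_num)]
    refine ofReal_le_ofReal (le_of_eq ?_)
    field_simp
  · by_cases hs : (∀ t, t <+: s → t ≠ [] → linf (pos x t - z) < 2 * m) ∧ s ∈ NH x (box z m)
    · have hFs : F s = ofReal (f (pos x s)) := by simp only [hF]; rw [if_neg h0, if_pos hs]
      rw [hFs]
      have hlt := hs.1 s List.prefix_rfl h0
      by_cases hb : pos x s ∈ box z m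
      · rw [sum_eq_zero, mul_zero, add_zero]
        · have h1 : (1:ℝ) ≤ f (pos x s) := by
            have h2 := (le_abs_self _).trans ((adv_lat_le d (pos x s - z)).1.trans hb)
            have h3 : ((adv d (pos x s - z) : ℤ) : ℝ) ≤ m := by exact_mod_cast h2
            simp only [hf]; rw [one_le_div (by linarith)]; linarith
          have := ofReal_le_ofReal h1
          rw [ENNReal.ofReal_one] at this
          refine le_trans ?_ this
          split_ifs <;> simp
        · intro i _
          simp only [hF]
          rw [if_neg (by simp), if_neg]
          rw [NH_snoc]; tauto
      · rw [if_neg (fun h => hb h.1.1), zero_add]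
        have := pot_step (f := f) (v := pos x s) (u := 0) le_rfl (fun i => by
          have h1 := (le_abs_self _).trans (adv_lat_le d (pos x s + del4 i - z)).1
          have h2 := (linf_del4 (pos x s - z) i).1
          rw [← add_sub_right_comm] at h2
          have h3 : ((adv d (pos x s + del4 i - z) : ℤ) : ℝ) ≤ 2 * m := by exact_mod_cast (by omega : adv d (pos x s + del4 i - z) ≤ 2 * m)
          exact div_nonneg (by linarith) (by linarith)) (by rw [hsum]; linarith)
        rw [ENNReal.ofReal_zero, zero_add] at this
        exact (mul_le_mul' le_rfl (sum_le_sum fun i _ => hF1 s i)).trans this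
    · have hn : s ∉ GB x z m := fun h => hs ⟨h.2, h.1.2⟩
      rw [if_neg hn, sum_eq_zero, mul_zero, add_zero]
      · exact zero_le
      · intro i _
        simp only [hF]
        rw [if_neg (by simp), if_neg]
        rintro ⟨h1, h2⟩
        exact hs ⟨fun t ht => h1 t (ht.trans (List.prefix_append _ _)), (NH_snoc.1 h2).1⟩

/-- The loop `γ` rooted at `x` has step word `s`. -/
def Rooted (γ : ULoop) (x : Lat) (s : Wd) : Prop := ∃ i l, γ.out.word.rotate i = x :: l ∧ vis x s = l ++ [x]

lemma rooted_of {γ : ULoop} {i : ℕ} {x : Lat} {l : List Lat} (h : γ.out.word.rotate i = x :: l) :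
    ∃ s, vis x s = l ++ [x] ∧ Rooted γ x s := by
  have := chain_rot γ.out.adj i
  rw [h] at this
  obtain ⟨s, hs⟩ := exists_vis (l ++ [x]) x (by simpa using this)
  exact ⟨s, hs, i, l, h, hs⟩

lemma Rooted.inj {γ γ' : ULoop} {x : Lat} {s : Wd} (h : Rooted γ x s) (h' : Rooted γ' x s) : γ = γ' := by
  obtain ⟨i, l, h1, h2⟩ := h
  obtain ⟨i', l', h1', h2'⟩ := h'
  have : l = l' := List.append_cancel_right (h2.symm.trans h2')
  exact ulo_eq (h1.trans (by rw [h1', this]))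

lemma Rooted.weight {γ : ULoop} {x : Lat} {s : Wd} (h : Rooted γ x s) : (loopWeight γ : ℝ≥0∞) ≤ wt s := by
  obtain ⟨i, l, h1, h2⟩ := h
  have h3 : γ.steps = s.length := by
    rw [← vis_length s x, h2, ULoop.steps, ← List.length_rotate (n := i), h1]; simp
  have : loopWeight γ ≤ (4:ℝ≥0)⁻¹ ^ s.length := by
    rw [loopWeight, h3]
    rcases Nat.eq_zero_or_pos γ.mult with h | h
    · rw [h]; simp
    · exact div_le_self (by positivity) (by exact_mod_cast h)
  rw [wt]
  refine (ENNReal.coe_le_coe.2 this).trans (le_of_eq ?_)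
  push_cast; rfl

lemma Rooted.mem {γ : ULoop} {x v : Lat} {s : Wd} (h : Rooted γ x s) (hv : v ∈ x :: vis x s) : v ∈ γ.verts := by
  obtain ⟨i, l, h1, h2⟩ := h
  have : v ∈ γ.out.word.rotate i := by
    rw [h1]; rw [h2] at hv; simp only [List.mem_cons, List.mem_append, List.not_mem_nil, or_false] at hv ⊢; tauto
  exact List.mem_rotate.1 this

lemma Rooted.trace {γ : ULoop} {x : Lat} {s : Wd} (h : Rooted γ x s) : γ.trace = traceL (x :: vis x s) := by
  obtain ⟨i, l, h1, h2⟩ := h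
  rw [trace_eq_ctrace, ← ctrace_rotate _ i, h1, h2]; rfl

lemma mass_le (S : Set ULoop) (X : Finset Lat) (W : Lat → Set Wd) (h : ∀ γ ∈ S, ∃ x ∈ X, ∃ s ∈ W x, Rooted γ x s) :
    ∑' γ : S, (loopWeight γ.1 : ℝ≥0∞) ≤ ∑ x ∈ X, wm (W x) := by
  choose x hx s hs hr using fun γ : S => h γ.1 γ.2
  let Φ : S → (Σ x : X, W x.1) := fun γ => ⟨⟨x γ, hx γ⟩, ⟨s γ, hs γ⟩⟩
  have hinj : Function.Injective Φ := by
    intro γ γ' e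
    have e1 : x γ = x γ' := congrArg (fun p : (Σ x : X, W x.1) => p.1.1) e
    have e2 : s γ = s γ' := congrArg (fun p : (Σ x : X, W x.1) => p.2.1) e
    have := hr γ'
    rw [← e1, ← e2] at this
    exact Subtype.ext ((hr γ).inj this)
  calc ∑' γ : S, (loopWeight γ.1 : ℝ≥0∞) ≤ ∑' γ : S, (fun p : (Σ x : X, W x.1) => wt p.2.1) (Φ γ) :=
        ENNReal.tsum_le_tsum fun γ => (hr γ).weight
    _ ≤ ∑' p : (Σ x : X, W x.1), wt p.2.1 := ENNReal.tsum_comp_le_tsum_of_injective hinj _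
    _ = ∑' x : X, wm (W x.1) := ENNReal.tsum_sigma' _
    _ = ∑ x ∈ X, wm (W x) := by rw [tsum_fintype, Finset.sum_coe_sort X (fun x => wm (W x))]

lemma pos_of_vis {x y : Lat} {s : Wd} {l : List Lat} (h : vis x s = l ++ [y]) : pos x s = y := by
  rcases List.eq_nil_or_concat' s with rfl | ⟨t, i, rfl⟩
  · simp [vis] at h
  · rw [vis_snoc] at h
    rw [pos_snoc]; simpa using (List.append_inj' h rfl).2

lemma exists_FH {x : Lat} {A : Set Lat} : ∀ {s : Wd}, (∃ v ∈ x :: vis x s, v ∈ A) → ∃ s1 s2, s = s1 ++ s2 ∧ s1 ∈ FH x A := by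
  intro s
  induction s using List.reverseRecOn with
  | nil =>
    rintro ⟨v, hv, hA⟩
    simp only [vis, List.mem_singleton] at hv
    subst hv
    exact ⟨[], [], rfl, hA, fun t ht hne => absurd (List.prefix_nil.1 ht) hne⟩
  | append_singleton s i ih =>
    intro h
    by_cases h2 : ∃ v ∈ x :: vis x s, v ∈ A
    · obtain ⟨s1, s2, rfl, h3⟩ := ih h2
      exact ⟨s1, s2 ++ [i], by simp, h3⟩
    · refine ⟨s ++ [i], [], by simp, ?_, ?_⟩
      · obtain ⟨v, hv, hA⟩ := h
        rw [vis_snoc, ← List.cons_append, List.mem_append, List.mem_singleton] at hv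
        rcases hv with hv | rfl
        · exact absurd ⟨v, hv, hA⟩ h2
        · rw [pos_snoc]; exact hA
      · intro t ht hne hA
        exact h2 ⟨_, (mem_vis_iff _ _ _).2 ⟨t, prefix_snoc ht hne, rfl⟩, hA⟩

lemma FH_rest {x : Lat} {A B : Set Lat} (hBA : B ⊆ A) {s1 s2 : Wd} (h1 : s1 ∈ FH x A)
    (h : ∃ v ∈ x :: vis x (s1 ++ s2), v ∈ B) : ∃ v ∈ pos x s1 :: vis (pos x s1) s2, v ∈ B := by
  obtain ⟨v, hv, hB⟩ := h
  rw [vis_append, ← List.cons_append, List.mem_append] at hv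
  rcases hv with hv | hv
  · obtain ⟨t, ht, rfl⟩ := (mem_vis_iff _ _ _).1 hv
    by_cases he : t = s1
    · exact ⟨_, List.mem_cons_self, he ▸ hB⟩
    · exact absurd (hBA hB) (h1.2 t ht he)
  · exact ⟨v, List.mem_cons_of_mem _ hv, hB⟩

lemma FH_exact {x z : Lat} {w : ℤ} (hx : w ≤ linf (x - z)) {s : Wd} (hs : s ∈ FH x (box z w)) : linf (pos x s - z) = w := by
  refine le_antisymm hs.1 ?_
  rcases List.eq_nil_or_concat' s with rfl | ⟨t, i, rfl⟩
  · exact hx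
  · have h1 := hs.2 t (List.prefix_append _ _) (by simp)
    have h1 : ¬ linf (pos x t - z) ≤ w := h1
    have h2 := (linf_del4 (pos x t - z) i).2
    rw [← add_sub_right_comm] at h2
    rw [pos_snoc]; omega

lemma infix_rest (x : Lat) (s1 s2 : Wd) : (pos x s1 :: vis (pos x s1) s2) <:+: x :: vis x (s1 ++ s2) := by
  rw [vis_append]
  rcases List.eq_nil_or_concat' s1 with rfl | ⟨t, i, rfl⟩
  · exact ⟨[], [], by simp [vis, pos]⟩
  · exact ⟨x :: vis x t, [], by simp [vis_snoc, pos_snoc]⟩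

/-- Words to `x` through the successive scales, circuit-free at each of them. -/
def DQ (x z : Lat) (n M : ℤ) : ℕ → Lat → Set Wd
  | 0, y => GR y x z M
  | k + 1, y => conc (CF y z (128 ^ k * n)) (fun s => DQ x z n M k (pos y s))

lemma DQ_mass {x z : Lat} {n M : ℤ} (hn : 1 ≤ n) {B : ℝ≥0∞} (hB : ∀ y, linf (y - z) = n → wm (GR y x z M) ≤ B) :
    ∀ (k : ℕ) (y : Lat), linf (y - z) = 128 ^ k * n → wm (DQ x z n M k y) ≤ (1 - pc) ^ k * B
  | 0, y, h => by rw [pow_zero, one_mul]; exact hB y (by simpa using h)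
  | k + 1, y, h => by
      have hw : 1 ≤ 128 ^ k * n := by have : (0:ℤ) < 128 ^ k * n := by positivity
                                      omega
      have h' : linf (y - z) = 128 * (128 ^ k * n) := by rw [h]; ring
      refine (wm_conc_le fun s hs => DQ_mass hn hB k _ (FH_exact (by omega) hs.1)).trans ?_
      rw [pow_succ', mul_assoc]
      exact mul_le_mul' (cf_mass hw h') le_rfl

lemma DQ_mem {x z : Lat} {n M : ℤ} (hn : 1 ≤ n) : ∀ (k : ℕ) (y : Lat) (s : Wd), s ∈ GR y x z M →
    (∃ v ∈ y :: vis y s, v ∈ box z n) → (∀ i < k, ¬ Circ z (128 ^ i * n) (y :: vis y s)) → s ∈ DQ x z n M k y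
  | 0, _, _, h, _, _ => h
  | k + 1, y, s, h, h2, h3 => by
      have hsub : box z n ⊆ box z (128 ^ k * n) := fun v hv => by
        have h1 : (1:ℤ) ≤ 128 ^ k := one_le_pow₀ (by norm_num)
        have : n ≤ 128 ^ k * n := by nlinarith
        exact le_trans (show linf (v - z) ≤ n from hv) this
      obtain ⟨s1, s2, rfl, h4⟩ := exists_FH (A := box z (128 ^ k * n)) (h2.imp fun v hv => ⟨hv.1, hsub hv.2⟩)
      have hi := infix_rest y s1 s2
      refine ⟨s1, ⟨h4, fun hc => h3 k (by omega) (hc.mono (vis_prefix y (List.prefix_append _ _)).isInfix)⟩, s2,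
        DQ_mem hn k _ _ ⟨by rw [← pos_append]; exact h.1, fun v hv => h.2 v (hi.subset hv)⟩ (FH_rest hsub h4 h2) ?_, rfl⟩
      exact fun i hi' hc => h3 i (by omega) (hc.mono hi)

lemma no_circ {γ : ULoop} {x z : Lat} {s : Wd} {n w : ℤ} (h : Rooted γ x s) (hn : 1 ≤ n) (hw : n ≤ w)
    (hf : (loopFrontier γ ∩ boxP z n).Nonempty) : ¬ Circ z w (x :: vis x s) := by
  intro hc
  obtain ⟨p, hp, h0, h1⟩ := hf
  rw [loopFrontier] at hp
  refine notMem_frontier_of_noLog (isCompact_trace γ) one_pos ?_ hp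
  intro q hq
  rw [h.trace]
  have hd : ∀ i, |q i - p i| < 1 := fun i => lt_of_le_of_lt (by
    have := PiLp.norm_apply_le (q - p) i
    rwa [← dist_eq_norm] at this) hq
  have e1 : (1:ℝ) ≤ n := by exact_mod_cast hn
  have e2 : (n:ℝ) ≤ w := by exact_mod_cast hw
  have d0 := abs_lt.1 (hd 0)
  have d1 := abs_lt.1 (hd 1)
  rw [abs_le] at h0 h1
  exact hc q (abs_lt.2 ⟨by linarith, by linarith⟩) (abs_lt.2 ⟨by linarith, by linarith⟩)

lemma last_split {α : Type*} (P : α → Prop) : ∀ (l : List α), (∃ v ∈ l, P v) → ∃ A x B, l = A ++ x :: B ∧ P x ∧ ∀ v ∈ B, ¬ P v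
  | [], h => by simp at h
  | a :: l, h => by
      by_cases h2 : ∃ v ∈ l, P v
      · obtain ⟨A, x, B, rfl, h3⟩ := last_split P l h2
        exact ⟨a :: A, x, B, rfl, h3⟩
      · obtain ⟨v, hv, hP⟩ := h
        rcases List.mem_cons.1 hv with rfl | hv
        · exact ⟨[], v, l, rfl, hP, fun u hu hu' => h2 ⟨u, hu, hu'⟩⟩
        · exact absurd ⟨v, hv, hP⟩ h2

/-- Cutting a loop at its last point at distance `2m` before visiting the box of radius `n`. -/
lemma cut {γ : ULoop} {z : Lat} {n m : ℤ} (hm : 1 ≤ m) (hnm : n ≤ m) (h1 : ∃ v ∈ γ.verts, 2 * m < linf (v - z))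
    (h2 : ∃ v ∈ γ.verts, linf (v - z) ≤ n) :
    ∃ x s1 s2, linf (x - z) = 2 * m ∧ s1 ∈ GB x z m ∧ Rooted γ x (s1 ++ s2) ∧ pos (pos x s1) s2 = x ∧
      ∃ v ∈ pos x s1 :: vis (pos x s1) s2, v ∈ box z n := by
  obtain ⟨y, hy, hyn⟩ := h2
  obtain ⟨u, hu, hum⟩ := h1
  obtain ⟨C, E, hCE⟩ := List.append_of_mem (show y ∈ γ.out.word from hy)
  have hr : γ.out.word.rotate C.length = y :: (E ++ C) := by rw [hCE, List.rotate_append_length_eq]; simp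
  have hu' : u ∈ y :: (E ++ C) := by
    have : u ∈ γ.out.word := hu
    rw [hCE] at this; simp at this ⊢; tauto
  obtain ⟨A, x, B, hl, hx, hB⟩ := last_split (fun v => 2 * m ≤ linf (v - z)) (E ++ C) (by
    rcases List.mem_cons.1 hu' with rfl | h
    · omega
    · exact ⟨u, h, by omega⟩)
  have hr2 : γ.out.word.rotate (C.length + (y :: A).length) = x :: (B ++ y :: A) := by
    rw [← List.rotate_rotate, hr, hl, ← List.cons_append, List.rotate_append_length_eq]; rfl
  obtain ⟨s, hs, hR⟩ := rooted_of hr2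
  obtain ⟨t1, t2, rfl, ht1, ht2⟩ := vis_split (B ++ [y]) (A ++ [x]) s x (by rw [hs]; simp)
  have hBy : ∀ v ∈ B ++ [y], linf (v - z) < 2 * m := by
    intro v hv
    rcases List.mem_append.1 hv with hv | hv
    · exact not_le.1 (hB v hv)
    · rw [List.mem_singleton] at hv; subst hv; omega
  have hxe : linf (x - z) = 2 * m := by
    refine le_antisymm ?_ hx
    cases t1 with
    | nil => simp [vis] at ht1
    | cons i t1 =>
      have h3 := hBy (x + del4 i) (by rw [← ht1]; simp [vis])
      have h4 := (linf_del4 (x - z) i).2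
      rw [← add_sub_right_comm] at h4; omega
  have hyb : pos x t1 = y := pos_of_vis ht1
  have hvis : ∃ v ∈ x :: vis x (t1 ++ t2), v ∈ box z n := ⟨y, (mem_vis_iff _ _ _).2 ⟨t1, List.prefix_append _ _, hyb.symm⟩, hyn⟩
  have hsub : box z n ⊆ box z m := fun v hv => le_trans (show linf (v - z) ≤ n from hv) hnm
  obtain ⟨s1, s2, he, hF⟩ := exists_FH (A := box z m) (hvis.imp fun v hv => ⟨hv.1, hsub hv.2⟩)
  have hpre : s1 <+: t1 := by
    rcases List.prefix_or_prefix_of_prefix (show s1 <+: t1 ++ t2 from he ▸ List.prefix_append _ _) (List.prefix_append t1 t2) with h | h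
    · exact h
    · by_cases h' : t1 = s1
      · rw [h']
      · exact absurd (hsub (show y ∈ box z n from hyn)) (hyb ▸ hF.2 t1 h h')
  refine ⟨x, s1, s2, hxe, ⟨hF, fun t ht hne => ?_⟩, he ▸ hR, ?_, FH_rest hsub hF (he ▸ hvis)⟩
  · obtain ⟨r, hr⟩ := ht.trans hpre
    refine hBy _ ?_
    rw [← ht1, ← hr, vis_append]
    exact List.mem_append_left _ (pos_mem_vis x hne)
  · rw [← pos_append, ← he]; exact pos_of_vis hs

/-- The ring of radius `m`. -/
def ring4 (z : Lat) (m : ℤ) : Finset Lat :=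
  ((Finset.univ : Finset (Fin 4)) ×ˢ Finset.Icc (-m) m).image (fun p => z + (m * (del4 p.1).1 + p.2 * (del4 p.1).2, m * (del4 p.1).2 + p.2 * (del4 p.1).1))
    |>.filter fun x => linf (x - z) = m

lemma mem_ring4 {z x : Lat} {m : ℤ} (hm : 0 ≤ m) (h : linf (x - z) = m) : x ∈ ring4 z m := by
  have h1 := abs_le.1 ((le_max_left _ _).trans h.le)
  have h2 := abs_le.1 ((le_max_right _ _).trans h.le)
  refine mem_filter.2 ⟨Finset.mem_image.2 ?_, h⟩
  simp only [Prod.fst_sub, Prod.snd_sub] at h1 h2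
  have h3 : ∃ d : Fin 4, ∃ t ∈ Finset.Icc (-m) m, (m * (del4 d).1 + t * (del4 d).2, m * (del4 d).2 + t * (del4 d).1) = x - z := by
    rcases max_choice |(x - z).1| |(x - z).2| with h' | h' <;> rw [linf, h'] at h <;>
      rcases (abs_eq hm).1 h with h5 | h5 <;> simp only [Prod.fst_sub, Prod.snd_sub] at h5
    · exact ⟨0, x.2 - z.2, Finset.mem_Icc.2 ⟨by omega, by omega⟩, Prod.ext (by simp [del4]; omega) (by simp [del4])⟩
    · exact ⟨1, -(x.2 - z.2), Finset.mem_Icc.2 ⟨by omega, by omega⟩, Prod.ext (by simp [del4]; omega) (by simp [del4])⟩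
    · exact ⟨2, x.1 - z.1, Finset.mem_Icc.2 ⟨by omega, by omega⟩, Prod.ext (by simp [del4]) (by simp [del4]; omega)⟩
    · exact ⟨3, -(x.1 - z.1), Finset.mem_Icc.2 ⟨by omega, by omega⟩, Prod.ext (by simp [del4]) (by simp [del4]; omega)⟩
  obtain ⟨d, t, ht, he⟩ := h3
  exact ⟨(d, t), Finset.mem_product.2 ⟨Finset.mem_univ _, ht⟩, by simp only; rw [he]; abel⟩

lemma ring4_card (z : Lat) {m : ℤ} (hm : 1 ≤ m) : ((ring4 z (2 * m)).card : ℝ) ≤ 20 * m := by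
  have h : (ring4 z (2 * m)).card ≤ 4 * (Finset.Icc (-(2 * m)) (2 * m)).card :=
    (Finset.card_filter_le _ _).trans (Finset.card_image_le.trans (by rw [Finset.card_product]; simp))
  rw [Int.card_Icc] at h
  have : ((ring4 z (2 * m)).card : ℤ) ≤ 20 * m := by omega
  exact_mod_cast this

/-- Loops of a given scale. -/
def scL (z : Lat) (n : ℤ) (c : ℤ) (k : ℕ) : Set ULoop := {γ | (∀ v ∈ γ.verts, linf (v - z) ≤ c * (128 ^ k * n)) ∧
  (∃ v ∈ γ.verts, 2 * (128 ^ k * n) < linf (v - z)) ∧ (∃ v ∈ γ.verts, linf (v - z) ≤ n) ∧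
  (k = 0 ∨ (loopFrontier γ ∩ boxP z n).Nonempty)}

def Gm (c : ℤ) : ℝ≥0∞ := ofReal (log (8 * ((c:ℝ) + 1) ^ 2 + 1) / log 2)

lemma scL_mass (z : Lat) {n c : ℤ} (hn : 1 ≤ n) (hc : 2 ≤ c) (k : ℕ) :
    ∑' γ : scL z n c k, (loopWeight γ.1 : ℝ≥0∞) ≤ 5 * ((1 - pc) ^ k * Gm c) := by
  set m : ℤ := 128 ^ k * n with hm
  have h128 : ∀ i : ℕ, n ≤ 128 ^ i * n := fun i => by
    have h1 : (1:ℤ) ≤ 128 ^ i := one_le_pow₀ (by norm_num)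
    nlinarith
  have hnm : n ≤ m := h128 k
  have hm1 : 1 ≤ m := hn.trans hnm
  have hm' : (1:ℝ) ≤ m := by exact_mod_cast hm1
  have hc' : (2:ℝ) ≤ c := by exact_mod_cast hc
  refine (mass_le _ (ring4 z (2 * m)) (fun x => conc (GB x z m) (fun s => DQ x z n (c * m) k (pos x s))) ?_).trans ?_
  · rintro γ ⟨h1, h2, h3, h4⟩
    obtain ⟨x, s1, s2, hx, hs1, hR, hp, hv⟩ := cut hm1 hnm h2 h3
    have hi := infix_rest x s1 s2
    refine ⟨x, mem_ring4 (by omega) hx, s1 ++ s2, ⟨s1, hs1, s2, DQ_mem hn k _ _ ⟨hp, fun v hv => h1 v (hR.mem (hi.subset hv))⟩ hv ?_, rfl⟩, hR⟩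
    intro i hik hC
    rcases h4 with h4 | h4
    · omega
    · exact no_circ hR hn (h128 i) h4 (hC.mono hi)
  · have hx : ∀ x ∈ ring4 z (2 * m), wm (conc (GB x z m) (fun s => DQ x z n (c * m) k (pos x s))) ≤
        ofReal (1 / (4 * m)) * ((1 - pc) ^ k * Gm c) := by
      intro x hx
      have hx : linf (x - z) = 2 * m := (mem_filter.1 hx).2
      refine (wm_conc_le fun s hs => DQ_mass hn (fun y hy => ?_) k _ (FH_exact (by omega) hs.1)).trans (mul_le_mul' (gambler hm1 hx) le_rfl)
      refine (green_bound (by nlinarith)).trans (ofReal_le_ofReal ?_)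
      refine div_le_div_of_nonneg_right (Real.log_le_log (by positivity) ?_) (Real.log_nonneg (by norm_num))
      rw [div_le_iff₀ (by positivity)]
      have hdist : (m:ℝ) ^ 2 ≤ (y.1 - x.1 : ℝ) ^ 2 + (y.2 - x.2 : ℝ) ^ 2 := by
        have hy1 := abs_le.1 ((le_max_left _ _).trans hy.le)
        have hy2 := abs_le.1 ((le_max_right _ _).trans hy.le)
        simp only [Prod.fst_sub, Prod.snd_sub] at hy1 hy2
        have hz : m ^ 2 ≤ (y.1 - x.1) ^ 2 + (y.2 - x.2) ^ 2 := by
          rcases max_choice |(x - z).1| |(x - z).2| with h' | h' <;> rw [linf, h'] at hx <;>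
            rcases (abs_eq (by omega)).1 hx with h5 | h5 <;> simp only [Prod.fst_sub, Prod.snd_sub] at h5
          · have : m ≤ x.1 - y.1 := by omega
            nlinarith [sq_nonneg (y.2 - x.2)]
          · have : m ≤ y.1 - x.1 := by omega
            nlinarith [sq_nonneg (y.2 - x.2)]
          · have : m ≤ x.2 - y.2 := by omega
            nlinarith [sq_nonneg (y.1 - x.1)]
          · have : m ≤ y.2 - x.2 := by omega
            nlinarith [sq_nonneg (y.1 - x.1)]
        exact_mod_cast hz
      push_cast
      have h5 : (c * m + 1 : ℝ) ^ 2 ≤ (c + 1) ^ 2 * m ^ 2 := by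
        rw [← mul_pow]; refine pow_le_pow_left₀ (by positivity) (by nlinarith) 2
      have h6 : (0:ℝ) ≤ 8 * ((c:ℝ) + 1) ^ 2 + 1 := by positivity
      have := mul_le_mul_of_nonneg_left hdist h6
      nlinarith
    refine (sum_le_sum hx).trans ?_
    rw [sum_const, nsmul_eq_mul, ← mul_assoc]
    refine mul_le_mul' ?_ le_rfl
    have := ring4_card z hm1
    rw [← ENNReal.ofReal_natCast, ← ofReal_mul (by positivity), ← ENNReal.ofReal_ofNat]
    refine ofReal_le_ofReal ?_
    rw [mul_one_div, div_le_iff₀ (by positivity)]; linarith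

/-- Loops leaving `B_{2n}(z)` whose frontier comes close to `z`. -/
def CC (z : Lat) (n : ℤ) : Set ULoop :=
  {γ | (∃ v ∈ γ.verts, 2 * n < linf (v - z)) ∧ (loopFrontier γ ∩ boxP z n).Nonempty}

/-- Small loops through `v`. -/
def CS (v : Lat) : Set ULoop := {γ | v ∈ γ.verts ∧ γ.verts ⊆ box v 2}

lemma fr_vert {γ : ULoop} {z : Lat} {n : ℤ} (hn : 0 ≤ n) (h : (loopFrontier γ ∩ boxP z n).Nonempty) :
    ∃ v ∈ γ.verts, linf (v - z) ≤ n := by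
  obtain ⟨p, hp, hb⟩ := h
  exact verts_box_of_trace hn (loopFrontier_subset γ hp) hb

lemma verts_bdd (γ : ULoop) (z : Lat) : ∃ M : ℕ, ∀ v ∈ γ.verts, linf (v - z) ≤ M := by
  have hf : γ.verts.Finite := List.finite_toSet _
  obtain ⟨M, hM⟩ := (hf.image (fun v => linf (v - z))).bddAbove
  exact ⟨M.toNat, fun v hv => (hM ⟨v, hv, rfl⟩).trans (Int.self_le_toNat M)⟩

lemma CC_subset (z : Lat) {n : ℤ} (hn : 1 ≤ n) : CC z n ⊆ ⋃ k, scL z n 256 k := by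
  rintro γ ⟨h1, h2⟩
  have h3 := fr_vert (by omega) h2
  have hex : ∃ k : ℕ, ∀ v ∈ γ.verts, linf (v - z) ≤ 256 * (128 ^ k * n) := by
    obtain ⟨M, hM⟩ := verts_bdd γ z
    refine ⟨M, fun v hv => (hM v hv).trans ?_⟩
    have h4 : (M:ℤ) ≤ 128 ^ M := by exact_mod_cast (Nat.lt_pow_self (by norm_num : 1 < 128)).le
    nlinarith
  refine mem_iUnion.2 ⟨Nat.find hex, Nat.find_spec hex, ?_, h3, Or.inr h2⟩
  rcases hk : Nat.find hex with _ | k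
  · simpa using h1
  · have := Nat.find_min hex (m := k) (by omega)
    push Not at this
    obtain ⟨v, hv, h⟩ := this
    exact ⟨v, hv, by rw [pow_succ]; linarith⟩

lemma CC_mass : ∃ C : ℝ, 0 ≤ C ∧ ∀ z n, 1 ≤ n → ∑' γ : CC z n, (loopWeight γ.1 : ℝ≥0∞) ≤ ofReal C := by
  have hfin : 5 * (pc⁻¹ * Gm 256) ≠ ∞ :=
    ENNReal.mul_ne_top (by simp) (ENNReal.mul_ne_top (by simpa using pc_ne_zero) ENNReal.ofReal_ne_top)
  refine ⟨(5 * (pc⁻¹ * Gm 256)).toReal, ENNReal.toReal_nonneg, fun z n hn => ?_⟩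
  rw [ENNReal.ofReal_toReal hfin]
  refine (ENNReal.tsum_mono_subtype (fun γ : ULoop => (loopWeight γ : ℝ≥0∞)) (CC_subset z hn)).trans ((ENNReal.tsum_iUnion_le_tsum (fun γ : ULoop => (loopWeight γ : ℝ≥0∞)) (fun k => scL z n 256 k)).trans ?_)
  refine (ENNReal.tsum_le_tsum fun k => scL_mass z hn (by norm_num) k).trans ?_
  rw [ENNReal.tsum_mul_left, ENNReal.tsum_mul_right, ENNReal.tsum_geometric, ENNReal.sub_sub_cancel (by simp) pc_le]

lemma CS_mass : ∃ C : ℝ, 0 ≤ C ∧ ∀ v, ∑' γ : CS v, (loopWeight γ.1 : ℝ≥0∞) ≤ ofReal C := by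
  refine ⟨log 73 / log 2, by positivity, fun v => (mass_le (CS v) {v} (fun x => GR x x x 2) ?_).trans ?_⟩
  · rintro γ ⟨h1, h2⟩
    obtain ⟨l1, l2, h3⟩ := List.append_of_mem h1
    have h4 : γ.out.word.rotate l1.length = v :: (l2 ++ l1) := by
      rw [h3, List.rotate_append_length_eq]; rfl
    obtain ⟨s, hs, hR⟩ := rooted_of h4
    exact ⟨v, by simp, s, ⟨pos_of_vis hs, fun w hw => h2 (hR.mem hw)⟩, hR⟩
  · rw [Finset.sum_singleton]
    refine (green_bound (by simp [linf])).trans ?_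
    norm_num

lemma mass_union {S T : Set ULoop} {a b : ℝ} (ha : 0 ≤ a) (hb : 0 ≤ b) {D : Set Lat} {α : ℝ} (hα : α ≤ 1 / 2)
    (h1 : ∑' γ : S, (loopWeight γ.1 : ℝ≥0∞) ≤ ofReal a)
    (h2 : ∑' γ : T, (loopWeight γ.1 : ℝ≥0∞) ≤ ofReal b) :
    ∑' γ : (S ∪ T : Set ULoop), inten D α γ ≤ ofReal (a + b) := by
  rw [ENNReal.ofReal_add ha hb]
  have h0 : ∀ γ : ULoop, inten D α γ ≤ (loopWeight γ : ℝ≥0∞) := fun γ => by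
    refine (inten_le hα γ).trans ?_
    have h2 : (2⁻¹ : ℝ≥0∞) ≤ 1 := by simp
    calc _ ≤ 1 * (loopWeight γ : ℝ≥0∞) := mul_le_mul' h2 le_rfl
      _ = _ := one_mul _
  refine (ENNReal.tsum_le_tsum fun γ : (S ∪ T : Set ULoop) => h0 γ.1).trans ?_
  exact (ENNReal.tsum_union_le (fun γ : ULoop => (loopWeight γ : ℝ≥0∞)) S T).trans (add_le_add h1 h2)

lemma trace_ne {γ : ULoop} {z : Lat} {n : ℤ} (hv : (loopFrontier γ ∩ embS (box z n)).Nonempty) :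
    (loopFrontier γ ∩ boxP z n).Nonempty := by
  obtain ⟨_, hp, w, hw, rfl⟩ := hv
  exact ⟨_, hp, emb_mem_boxP.2 hw⟩

lemma good_of {ω : Config} {z : Lat} {n a0 : ℤ} (hn : 1 ≤ n) (ha : 8 ≤ a0)
    (h1 : ω ∈ NoLoop (scL z n (4 * a0) 0 ∪ CC z (2 * (a0 * n)))) (h2 : ω ∈ Nev z n (a0 * n)) :
    Good ω z n (2 * (a0 * n) - 1) := by
  set a := a0 * n with hadef
  have han : 8 * n ≤ a := by rw [hadef]; nlinarith
  have hcc : ∀ γ ∈ ω.loops, (loopFrontier γ ∩ boxP z (2 * a)).Nonempty → γ.verts ⊆ box z (4 * a) := by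
    intro γ hγ hne v hv
    by_contra hc
    refine hγ (h1 γ (Or.inr ⟨⟨v, hv, ?_⟩, hne⟩))
    have : ¬ linf (v - z) ≤ 4 * a := hc
    omega
  refine ⟨?_, fun γ hγ hne => ?_⟩
  swap
  · rw [sub_add_cancel] at hne ⊢
    convert hcc γ hγ hne using 2
    ring
  have hsc : ∀ γ ∈ ω.loops, (loopFrontier γ ∩ boxP z (2 * a)).Nonempty →
      γ.verts ⊆ box z (2 * n) ∨ γ ∈ annL z n (4 * a) := by
    intro γ hγ hne
    by_contra hc
    push Not at hc
    obtain ⟨hc1, hc2⟩ := hc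
    have h4 := hcc γ hγ hne
    refine hγ (h1 γ (Or.inl ⟨fun v hv => ?_, ?_, ?_, Or.inl rfl⟩))
    · have : linf (v - z) ≤ 4 * a := h4 hv
      rw [pow_zero, one_mul, mul_assoc]; exact this
    · obtain ⟨v, hv, h5⟩ := Set.not_subset.1 hc1
      refine ⟨v, hv, ?_⟩
      have : ¬ linf (v - z) ≤ 2 * n := h5
      rw [pow_zero, one_mul]; omega
    · by_contra h5
      push Not at h5
      exact hc2 fun v hv => mem_Wf.2 ⟨h5 v hv, h4 hv⟩
  set A := ω.loops ∩ annL z n (4 * a)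
  have hb : ∀ γ : ULoop, (γ.verts ⊆ box z (2 * n) ∨
        ∃ γ' ∈ A, linkedL A γ' γ ∧ γ ∈ A ∧ ∃ v ∈ γ'.verts, linf (v - z) ≤ 2 * n) → loopFrontier γ ⊆ boxP z (2 * a - 1) := by
    intro γ hγ
    refine (loopFrontier_subset γ).trans (trace_subset_boxP ?_)
    intro v hv
    change linf (v - z) ≤ 2 * a - 1
    rcases hγ with h | ⟨γ', h3, h4, -, h5⟩
    · have : linf (v - z) ≤ 2 * n := h hv
      omega
    · by_contra h6
      exact h2 ⟨γ', γ, h3, h4, h5, v, hv, by omega⟩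
  have key : ∀ S S', S ∈ frontiers ω.loops → linkedS (frontiers ω.loops) S S' → (S ∩ embS (box z n)).Nonempty →
      ∃ γ ∈ ω.loops, S' = loopFrontier γ ∧ (γ.verts ⊆ box z (2 * n) ∨
        ∃ γ' ∈ A, linkedL A γ' γ ∧ γ ∈ A ∧ ∃ v ∈ γ'.verts, linf (v - z) ≤ 2 * n) := by
    intro S S' hS hl hne
    induction hl with
    | refl =>
      obtain ⟨γ, hγ, rfl⟩ := hS
      have h3 := trace_ne hne
      refine ⟨γ, hγ, rfl, ?_⟩
      rcases hsc γ hγ (h3.mono (inter_subset_inter_right _ (boxP_mono z (by omega)))) with h | h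
      · exact Or.inl h
      · obtain ⟨v, hv, hvn⟩ := fr_vert (by omega) h3
        have := (mem_Wf.1 (h v hv)).1
        omega
    | @tail S1 S2 _ hst ih =>
      obtain ⟨γ, hγ, rfl, hI⟩ := ih
      obtain ⟨-, ⟨γ2, hγ2, rfl⟩, p, hp1, hp2⟩ := hst
      refine ⟨γ2, hγ2, rfl, ?_⟩
      rcases hsc γ2 hγ2 ⟨p, hp2, boxP_mono z (by omega) (hb γ hI hp1)⟩ with h | h
      · exact Or.inl h
      right
      rcases hI with h3 | ⟨γ', h3, h4, h5, h6⟩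
      · refine ⟨γ2, ⟨hγ2, h⟩, .refl, ⟨hγ2, h⟩, ?_⟩
        exact verts_box_of_trace (by omega) (loopFrontier_subset γ2 hp2) (trace_subset_boxP h3 (loopFrontier_subset γ hp1))
      · exact ⟨γ', h3, h4.tail ⟨h5, ⟨hγ2, h⟩, touches_of_trace ⟨p, loopFrontier_subset γ hp1, loopFrontier_subset γ2 hp2⟩⟩, ⟨hγ2, h⟩, h6⟩
  intro S S' hS hl hne
  obtain ⟨γ, -, rfl, h⟩ := key S S' hS hl hne
  exact hb γ h

lemma adj_add_del4 (a : Lat) (i : Fin 4) : Adj a (a + del4 i) := by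
  fin_cases i <;> simp [Adj, del4]

def cyl (x : Lat) (s : Wd) : Set (ℕ → Lat) := {w | ∀ i ≤ s.length, w i = pos x (s.take i)}

lemma pos_take_succ (x : Lat) {s : Wd} {i : ℕ} (hi : i < s.length) : pos x (s.take (i + 1)) = pos x (s.take i) + del4 s[i] := by
  rw [List.take_succ_eq_append_getElem hi, pos_snoc]

lemma cyl_meas (x : Lat) (s : Wd) : MeasurableSet (cyl x s) := by
  have : cyl x s = ⋂ i : ℕ, ⋂ (_ : i ≤ s.length), (fun w : ℕ → Lat => w i) ⁻¹' {pos x (s.take i)} := by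
    ext w; simp [cyl]
  rw [this]
  exact .iInter fun i => .iInter fun _ => measurable_pi_apply i (measurableSet_singleton _)

lemma cyl_disj {x : Lat} {s t : Wd} (hl : s.length = t.length) (hne : s ≠ t) : Disjoint (cyl x s) (cyl x t) := by
  rw [Set.disjoint_left]
  intro w h1 h2
  have : ∀ i ≤ s.length, s.take i = t.take i := by
    intro i
    induction i with
    | zero => simp
    | succ i ih =>
      intro hi
      have h3 := ih (by omega)
      have h4 := (h1 _ hi).symm.trans (h2 _ (by omega))
      rw [pos_take_succ x hi, pos_take_succ x (by omega), h3] at h4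
      rw [List.take_succ_eq_append_getElem hi, List.take_succ_eq_append_getElem (by omega), h3, del4_inj (add_left_cancel h4)]
  have h5 := this s.length le_rfl
  rw [List.take_length, hl, List.take_length] at h5
  exact hne h5

lemma cyl_mu {x : Lat} {μ : Measure (ℕ → Lat)} (h : IsSRW x μ) (s : Wd) : μ (cyl x s) = wt s := by
  refine h.2 s.length (fun i => pos x (s.take i)) (by simp [pos]) fun i hi => ?_
  simp only [pos_take_succ x hi]
  exact adj_add_del4 _ _

lemma bdry_iff {R : ℤ} {v : Lat} (h : linf v = R) : v ∈ bdry (box 0 R) := by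
  refine ⟨by simp [box, h], ?_⟩
  simp only [box, Set.mem_ofPred_eq, sub_zero]
  obtain ⟨a, b⟩ := v
  simp only [linf] at h ⊢
  have h1 : |a| ≤ R := h ▸ le_max_left _ _
  have h2 : |b| ≤ R := h ▸ le_max_right _ _
  rcases max_choice |a| |b| with h' | h' <;> rw [h'] at h
  · rcases abs_choice a with h3 | h3 <;> rw [h3] at h
    · exact ⟨(a + 1, b), by have := le_abs_self (a+1); simp; omega, by simp⟩
    · exact ⟨(a - 1, b), by have := neg_le_abs (a-1); simp; omega, by simp⟩
  · rcases abs_choice b with h3 | h3 <;> rw [h3] at h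
    · exact ⟨(a, b + 1), by have := le_abs_self (b+1); simp; omega, by simp⟩
    · exact ⟨(a, b - 1), by have := neg_le_abs (b-1); simp; omega, by simp⟩

lemma linf_add_le (a b : Lat) : linf (a + b) ≤ linf a + linf b := by
  simp only [linf, Prod.fst_add, Prod.snd_add]
  exact max_le ((abs_add_le _ _).trans (add_le_add (le_max_left _ _) (le_max_left _ _)))
    ((abs_add_le _ _).trans (add_le_add (le_max_right _ _) (le_max_right _ _)))

lemma linf_of_bdry {R : ℤ} {v : Lat} (h : v ∈ bdry (box 0 R)) : linf v = R := by
  obtain ⟨h1, w, h2, h3⟩ := h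
  simp only [box, Set.mem_ofPred_eq, sub_zero] at h1 h2
  have := linf_add_le v (w - v)
  have h4 : linf (w - v) = linf (v - w) := by simp [linf, abs_sub_comm]
  rw [add_sub_cancel] at this
  omega

lemma srw_hits {x : Lat} {μ : Measure (ℕ → Lat)} (h : IsSRW x μ) {R : ℤ} (hx : linf x ≤ R - 1) :
    μ {w | ∀ t, w t ∉ bdry (box 0 R)} = 0 := by
  have := h.1
  set B := {w : ℕ → Lat | ∀ t, w t ∉ bdry (box 0 R)} with hB
  set A : Set Lat := {v | ¬ linf v ≤ R - 1} with hA
  have key : ∀ n, μ B ≤ surv x A n := by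
    intro n
    set C := ⋃ s : List.Vector (Fin 4) n, cyl x s.1
    have hC : μ C = 1 := by
      have hd : Pairwise fun s t : List.Vector (Fin 4) n => Disjoint (cyl x s.1) (cyl x t.1) :=
        fun s t hst => cyl_disj (s.2.trans t.2.symm) fun h => hst (Subtype.ext h)
      refine (measure_iUnion hd fun s => cyl_meas x _).trans ?_
      simp only [cyl_mu h, wt]
      rw [tsum_fintype, sum_congr rfl (fun s _ => by rw [s.2])]
      rw [sum_const, Finset.card_univ, card_vector, Fintype.card_fin, nsmul_eq_mul]
      push_cast
      rw [← mul_pow, ENNReal.mul_inv_cancel (by simp) (by simp), one_pow]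
    have hC0 : μ Cᶜ = 0 := by
      rw [prob_compl_eq_zero_iff (.iUnion fun s => cyl_meas x _)]; exact hC
    have hsub : B ⊆ Cᶜ ∪ ⋃ s : List.Vector (Fin 4) n, (if s.1 ∈ NH x A then cyl x s.1 else ∅) := by
      intro w hw
      by_cases hwC : w ∈ C
      swap
      · exact Or.inl hwC
      right
      obtain ⟨s, hs⟩ := mem_iUnion.1 hwC
      refine mem_iUnion.2 ⟨s, ?_⟩
      rw [if_pos]
      · exact hs
      have hin : ∀ i ≤ s.1.length, linf (pos x (s.1.take i)) ≤ R - 1 := by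
        intro i
        induction i with
        | zero => intro _; simpa [pos] using hx
        | succ i ih =>
          intro hi
          have h1 := ih (by omega)
          have h2 : linf (pos x (s.1.take (i+1))) ≠ R := fun h3 => hw (i+1) (by rw [hs _ hi]; exact bdry_iff h3)
          have h3 := (linf_del4 (pos x (s.1.take i)) s.1[i]).1
          rw [← pos_take_succ x hi] at h3
          omega
      intro t ht _ hc
      have := hin t.length ht.length_le
      rw [← List.prefix_iff_eq_take.1 ht] at this
      exact hc this
    refine (measure_mono hsub).trans ((measure_union_le _ _).trans ?_)
    rw [hC0, zero_add]
    refine (measure_iUnion_le _).trans ?_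
    have hs : surv x A n = ∑' s : {s : Wd | s.length = n}, wt s.1 * (if s.1 ∈ NH x A then 1 else 0) := by
      rw [tsum_subtype {s : Wd | s.length = n} (fun s => wt s * (if s ∈ NH x A then 1 else 0))]
      refine tsum_congr fun s => ?_
      simp [Set.indicator_apply]
    rw [hs]
    refine ENNReal.tsum_le_tsum fun s : List.Vector (Fin 4) n => ?_
    show _ ≤ wt s.1 * (if s.1 ∈ NH x A then 1 else 0)
    split_ifs with h1
    · rw [cyl_mu h, mul_one]
    · simp
  have ht := surv_tendsto (x := x) (c := 0) (ρ := R - 1) (A := A) (by rw [sub_zero]; omega) (fun v hv => by rw [sub_zero]; exact not_not.1 hv)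
  exact le_antisymm (ge_of_tendsto' ht key) zero_le

section
/-- Decreasing events which cost at most the factor `c`, conditionally on any decreasing event. -/
def Cheap {W : Type} [MeasurableSpace W] (ρ : Measure W) (Ps : Measure Config) (c : ℝ≥0∞) (G : Set Config) : Prop :=
  (∀ ω ω' : Config, (∀ γ, ω' γ ≤ ω γ) → ω ∈ G → ω' ∈ G) ∧
  ∀ X : Set (W × Config), (∀ w ω ω', (∀ γ, ω' γ ≤ ω γ) → (w, ω) ∈ X → (w, ω') ∈ X) →
    c * ρ.prod Ps X ≤ ρ.prod Ps (X ∩ {u | u.2 ∈ G})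

section
variable {W : Type} [MeasurableSpace W] {ρ : Measure W} {Ps : Measure Config}

lemma Cheap.inter {c c' : ℝ≥0∞} {G G' : Set Config} (h : Cheap ρ Ps c G) (h' : Cheap ρ Ps c' G') :
    Cheap ρ Ps (c * c') (G ∩ G') := by
  refine ⟨fun ω ω' hω hG => ⟨h.1 ω ω' hω hG.1, h'.1 ω ω' hω hG.2⟩, fun X hX => ?_⟩
  have h1 := h'.2 X hX
  have h2 := h.2 (X ∩ {u | u.2 ∈ G'}) fun w ω ω' hω hG => ⟨hX w ω ω' hω hG.1, h'.1 ω ω' hω hG.2⟩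
  calc c * c' * ρ.prod Ps X = c * (c' * ρ.prod Ps X) := mul_assoc _ _ _
    _ ≤ c * ρ.prod Ps (X ∩ {u | u.2 ∈ G'}) := mul_le_mul' le_rfl h1
    _ ≤ _ := h2
    _ ≤ ρ.prod Ps (X ∩ {u | u.2 ∈ G ∩ G'}) := measure_mono fun u hu => ⟨hu.1.1, hu.2, hu.1.2⟩

lemma Cheap.mono {c c' : ℝ≥0∞} {G : Set Config} (h : Cheap ρ Ps c G) (hc : c' ≤ c) : Cheap ρ Ps c' G :=
  ⟨h.1, fun X hX => (mul_le_mul' hc le_rfl).trans (h.2 X hX)⟩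

lemma Cheap.finset {ι : Type*} {c : ℝ≥0∞} (G : ι → Set Config) (h : ∀ i, Cheap ρ Ps c (G i)) (s : Finset ι) :
    Cheap ρ Ps (c ^ s.card) {ω | ∀ i ∈ s, ω ∈ G i} := by
  induction s using Finset.induction_on with
  | empty => exact ⟨fun _ _ _ _ => by simp, fun X _ => by simp⟩
  | insert i s hi ih =>
    have := (h i).inter ih
    rw [← pow_succ', ← Finset.card_insert_of_notMem hi] at this
    convert this using 1
    ext ω
    simp

variable {D : Set Lat} {α : ℝ} [IsProbabilityMeasure ρ]

lemma cheap_kill (hPs : IsLoopSoup D α Ps) (Γ : Set ULoop) {l : ℝ} (hl : 0 ≤ l)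
    (hΓ : ∑' γ : Γ, inten D α γ ≤ ofReal l) : Cheap ρ Ps (ofReal (exp (-l))) (NoLoop Γ) :=
  ⟨fun _ _ h hω γ hγ => Nat.le_zero.1 ((h γ).trans (hω γ hγ).le), fun _ hX => kill_event hPs Γ hl hΓ hX⟩

end

/-- Uniform local events. -/
lemma exists_local : ∃ c : ℝ, 0 < c ∧ ∃ a0 : ℤ, 8 ≤ a0 ∧ ∀ R : ℤ, 2 ≤ R → ∃ m n N : ℤ, 1 ≤ m ∧ 0 ≤ n ∧ n ≤ N ∧ m ≤ n + 1 ∧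
    R ≤ 16 * a0 * m ∧ 18 * (N + n) < 7 * R ∧ ∀ z : Lat, ∃ G : Set Config, (∀ ω ∈ G, Good ω z n N) ∧
      ∀ (W : Type) [MeasurableSpace W] (ρ : Measure W) [IsProbabilityMeasure ρ] (Ps : Measure Config) (D : Set Lat) (α : ℝ),
        IsLoopSoup D α Ps → α ≤ 1 / 2 → Cheap ρ Ps (ofReal c) G := by
  obtain ⟨C1, hC1, h1⟩ := CC_mass
  obtain ⟨C2, hC2, h2⟩ := CS_mass
  obtain ⟨a0, ha0, hsc⟩ := exists_scale
  set C3 : ℝ := (5 * Gm (4 * a0)).toReal with hC3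
  have hC30 : 0 ≤ C3 := ENNReal.toReal_nonneg
  set cA : ℝ := exp (-(C3 + C1)) * (1 / 10) with hcA
  set cB : ℝ := exp (-(C2 + C1)) with hcB
  have hA0 : 0 < cA := by positivity
  have hB0 : 0 < cB := by positivity
  refine ⟨min cA cB, lt_min hA0 hB0, a0, ha0, fun R hR => ?_⟩
  by_cases hbig : 8 * a0 ≤ R
  · have hn1 : 1 ≤ R / (8 * a0) := by
      rw [Int.le_ediv_iff_mul_le (by omega)]; omega
    have hn2 := Int.ediv_mul_le R (b := 8 * a0) (by omega)
    have hn3 := Int.lt_ediv_add_one_mul_self R (b := 8 * a0) (by omega)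
    set n := R / (8 * a0) with hn
    have e1 : n * (8 * a0) = 8 * (a0 * n) := by ring
    have e2 : (n + 1) * (8 * a0) = 8 * (a0 * n) + 8 * a0 := by ring
    have e3 : a0 ≤ a0 * n := by nlinarith
    have e4 : 8 * n ≤ a0 * n := by nlinarith
    have e5 : 16 * a0 * n = 16 * (a0 * n) := by ring
    refine ⟨n, n, 2 * (a0 * n) - 1, hn1, by omega, by omega, by omega, by omega, by omega, fun z =>
      ⟨NoLoop (scL z n (4 * a0) 0 ∪ CC z (2 * (a0 * n))) ∩ Nev z n (a0 * n), fun ω hω => good_of hn1 ha0 hω.1 hω.2, ?_⟩⟩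
    intro W _ ρ _ Ps D α hPs hα
    have hA : ∑' γ : scL z n (4 * a0) 0, (loopWeight γ.1 : ℝ≥0∞) ≤ ofReal C3 := by
      rw [hC3, ENNReal.ofReal_toReal (ENNReal.mul_ne_top (by simp) (by unfold Gm; exact ENNReal.ofReal_ne_top))]
      simpa using scL_mass z hn1 (c := 4 * a0) (by omega) 0
    have k1 := cheap_kill (ρ := ρ) hPs _ (by positivity) (mass_union hC30 hC1 (D := D) hα hA (h1 z (2 * (a0 * n)) (by omega)))
    have k2 : Cheap ρ Ps (ofReal (1 / 10)) (Nev z n (a0 * n)) :=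
      ⟨Nev_dec z n (a0 * n), fun X hX => nev_event hPs hα z hn1 (by omega) (hsc n hn1) hX⟩
    refine (k1.inter k2).mono ?_
    rw [← ofReal_mul (by positivity)]
    exact ofReal_le_ofReal (min_le_left _ _)
  · refine ⟨1, 0, 0, le_rfl, le_rfl, le_rfl, by omega, by omega, by omega, fun z => ⟨NoLoop (CS z ∪ CC z 1), fun ω hω => ?_, ?_⟩⟩
    · have hcc : ∀ γ ∈ ω.loops, (loopFrontier γ ∩ boxP z (0 + 1)).Nonempty → γ.verts ⊆ box z (2 * (0 + 1)) := by
        intro γ hγ hne v hv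
        by_contra hc
        have : ¬ linf (v - z) ≤ 2 * (0 + 1) := hc
        exact hγ (hω γ (Or.inr ⟨⟨v, hv, by omega⟩, hne⟩))
      refine ⟨?_, hcc⟩
      rintro _ S' ⟨γ, hγ, rfl⟩ - hne
      exfalso
      have h3 := trace_ne hne
      obtain ⟨v, hv, h4⟩ := fr_vert le_rfl h3
      have hvz : v = z := by
        have := mem_box_iff.1 (show v ∈ box z 0 from h4)
        simp only [abs_nonpos_iff, sub_eq_zero] at this
        exact Prod.ext this.1 this.2
      exact hγ (hω γ (Or.inl ⟨hvz ▸ hv, hcc γ hγ (h3.mono (inter_subset_inter_right _ (boxP_mono z (by omega))))⟩))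
    · intro W _ ρ _ Ps D α hPs hα
      refine (cheap_kill (ρ := ρ) hPs _ (by positivity) (mass_union hC2 hC1 (D := D) hα (h2 z) (h1 z 1 le_rfl))).mono ?_
      exact ofReal_le_ofReal (min_le_right _ _)

/-- Covering by boxes. -/
lemma cover {a0 R m n N r : ℤ} (hrR : 2 * r ≤ R) (hm : 1 ≤ m) (hmn : m ≤ n + 1)
    (hR : R ≤ 16 * a0 * m) (hN : 18 * (N + n) < 7 * R) {h v : Lat} (hh : linf h = R) (hv : 9 * linf (v - h) ≤ R) :
    ∃ p ∈ (Finset.Icc (-(2 * a0)) (2 * a0)) ×ˢ (Finset.Icc (-(2 * a0)) (2 * a0)),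
      v ∈ box (h.1 + m * p.1, h.2 + m * p.2) n ∧ Disjoint (boxP (h.1 + m * p.1, h.2 + m * p.2) N) (boxP 0 r) := by
  have hd : ∀ t : ℤ, 9 * |t| ≤ R → -(2 * a0) ≤ t / m ∧ t / m ≤ 2 * a0 ∧ 0 ≤ t - m * (t / m) ∧ t - m * (t / m) ≤ n := by
    intro t ht
    have h1 := Int.emod_nonneg t (b := m) (by omega)
    have h2 := Int.emod_lt_of_pos t (b := m) (by omega)
    have h3 := Int.mul_ediv_add_emod t m
    have h4 := le_abs_self t
    have h5 := neg_le_abs t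
    have e : 16 * a0 * m = 16 * (a0 * m) := by ring
    refine ⟨?_, ?_, by omega, by omega⟩
    · by_contra hc
      have : m * (t / m) ≤ m * (-(2 * a0) - 1) := mul_le_mul_of_nonneg_left (by omega) (by omega)
      have e2 : m * (-(2 * a0) - 1) = -2 * (a0 * m) - m := by ring
      nlinarith
    · by_contra hc
      have : m * (2 * a0 + 1) ≤ m * (t / m) := mul_le_mul_of_nonneg_left (by omega) (by omega)
      have e2 : m * (2 * a0 + 1) = 2 * (a0 * m) + m := by ring
      nlinarith
  have hx := hd (v - h).1 (by have := le_max_left |(v - h).1| |(v - h).2|; unfold linf at hv; omega)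
  have hy := hd (v - h).2 (by have := le_max_right |(v - h).1| |(v - h).2|; unfold linf at hv; omega)
  set p := (v - h).1 / m
  set q := (v - h).2 / m
  have hbox : v ∈ box (h.1 + m * p, h.2 + m * q) n := by
    rw [mem_box_iff, abs_le, abs_le]
    simp only [Prod.fst_sub, Prod.snd_sub] at hx hy
    simp only
    omega
  refine ⟨(p, q), by simp only [Finset.mem_product, Finset.mem_Icc]; tauto, hbox, ?_⟩
  rw [Set.disjoint_left]
  rintro u ⟨h1, h2⟩ ⟨h3, h4⟩
  simp only [Prod.fst_zero, Prod.snd_zero, Int.cast_zero, sub_zero] at h3 h4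
  rw [mem_box_iff] at hbox
  have l1 := (le_max_left |(v - h).1| |(v - h).2|).trans_eq (show _ = linf (v - h) from rfl)
  have l2 := (le_max_right |(v - h).1| |(v - h).2|).trans_eq (show _ = linf (v - h) from rfl)
  have gen : ∀ (u' : ℝ) (c v' h' : ℤ), |u' - c| ≤ N → |u'| ≤ r → |v' - c| ≤ n → |v' - h'| ≤ linf (v - h) → |h'| = R → False := by
    intro u' c v' h' i1 i2 i3 i4 i5
    have j1 : |(v':ℝ) - c| ≤ n := by exact_mod_cast i3
    have j2 : 9 * |(v':ℝ) - h'| ≤ R := by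
      have : 9 * |v' - h'| ≤ R := by omega
      exact_mod_cast this
    have j3 : |(h':ℝ)| = R := by exact_mod_cast i5
    have j4 : 18 * ((N:ℝ) + n) < 7 * R := by exact_mod_cast hN
    have j5 : 2 * (r:ℝ) ≤ R := by exact_mod_cast hrR
    rw [abs_le] at i1 i2 j1
    have j6 := abs_le.1 (show |(v':ℝ) - h'| ≤ R / 9 by linarith)
    rcases abs_choice (h':ℝ) with e | e <;> rw [e] at j3 <;> linarith
  rcases max_choice |h.1| |h.2| with e | e <;> rw [linf, e] at hh
  · exact gen (u 0) _ v.1 h.1 h1 h3 hbox.1 l1 hh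
  · exact gen (u 1) _ v.2 h.2 h2 h4 hbox.2 l2 hh
end

/-- The packets hitting `A` first at the points `h`. -/
def HitAt {j : ℕ} (A : Set Lat) (h : Fin j → Lat) : Set (Fin j → ℕ → Lat) :=
  {ws | ∀ i, ∃ t, ws i t = h i ∧ h i ∈ A ∧ ∀ s < t, ws i s ∉ A}

lemma hitAt_hitPt {j : ℕ} {A : Set Lat} {h : Fin j → Lat} {ws : Fin j → ℕ → Lat} (hw : ws ∈ HitAt A h) (i : Fin j) :
    hitPt (ws i) A = h i ∧ h i ∈ A := by
  obtain ⟨t, h1, h2, h3⟩ := hw i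
  have : hitTime (ws i) A = t := by
    refine le_antisymm (Nat.sInf_le (by rw [Set.mem_ofPred_eq, h1]; exact h2)) ?_
    by_contra hc
    refine h3 _ (not_le.1 hc) (Nat.sInf_mem (s := {k | ws i k ∈ A}) ⟨t, ?_⟩)
    rw [Set.mem_ofPred_eq, h1]; exact h2
  exact ⟨by rw [hitPt, this, h1], h2⟩

lemma hitAt_meas {j : ℕ} (A : Set Lat) (h : Fin j → Lat) : MeasurableSet (HitAt A h) := by
  have hm : ∀ i t, Measurable fun ws : Fin j → ℕ → Lat => ws i t := fun i t =>
    (measurable_pi_apply t).comp (measurable_pi_apply i)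
  have : HitAt A h = ⋂ i, ⋃ t, ((fun ws : Fin j → ℕ → Lat => ws i t) ⁻¹' {v | v = h i ∧ h i ∈ A} ∩
      ⋂ s, ⋂ (_ : s < t), (fun ws : Fin j → ℕ → Lat => ws i s) ⁻¹' Aᶜ) := by
    ext ws
    simp [HitAt, and_assoc]
  rw [this]
  refine .iInter fun i => .iUnion fun t => .inter (hm i t (Set.to_countable _).measurableSet) (.iInter fun s => .iInter fun _ => hm i s (Set.to_countable _).measurableSet)

lemma hitAt_disj {j : ℕ} (A : Set Lat) {h h' : Fin j → Lat} (hne : h ≠ h') : Disjoint (HitAt A h) (HitAt A h') := by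
  rw [Set.disjoint_left]
  intro ws h1 h2
  exact hne (funext fun i => (hitAt_hitPt h1 i).1.symm.trans (hitAt_hitPt h2 i).1)

lemma hitAt_cover {j : ℕ} (A : Set Lat) {ws : Fin j → ℕ → Lat} (h : ∀ i, ∃ t, ws i t ∈ A) : ∃ h, ws ∈ HitAt A h := by
  refine ⟨fun i => ws i (Nat.find (h i)), fun i => ⟨Nat.find (h i), rfl, Nat.find_spec (h i), fun s hs => Nat.find_min (h i) hs⟩⟩

/-- Splitting over a countable measurable partition. -/
lemma split_le {Ω ι : Type*} [MeasurableSpace Ω] [Countable ι] {P : Measure Ω} {H : ι → Set Ω} (hm : ∀ i, MeasurableSet (H i))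
    (hd : Pairwise fun i k => Disjoint (H i) (H k)) (h0 : P (⋃ i, H i)ᶜ = 0) {X Y : Set Ω} {c : ℝ≥0∞}
    (h : ∀ i, c * P (X ∩ H i) ≤ P (Y ∩ H i)) : c * P X ≤ P Y := by
  have h1 : P X ≤ ∑' i, P (X ∩ H i) := by
    calc P X ≤ P ((⋃ i, H i)ᶜ ∪ ⋃ i, X ∩ H i) := measure_mono fun x hx => by
          by_cases hxH : x ∈ ⋃ i, H i
          · rw [← Set.inter_iUnion]; exact Or.inr ⟨hx, hxH⟩
          · exact Or.inl hxH
      _ ≤ 0 + ∑' i, P (X ∩ H i) := (measure_union_le _ _).trans (add_le_add h0.le (measure_iUnion_le _))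
      _ = _ := zero_add _
  calc c * P X ≤ c * ∑' i, P (X ∩ H i) := mul_le_mul' le_rfl h1
    _ = ∑' i, c * P (X ∩ H i) := ENNReal.tsum_mul_left.symm
    _ ≤ ∑' i, P (toMeasurable P Y ∩ H i) := ENNReal.tsum_le_tsum fun i =>
        (h i).trans (measure_mono (inter_subset_inter_left _ (subset_toMeasurable P Y)))
    _ = P (⋃ i, toMeasurable P Y ∩ H i) := (measure_iUnion (fun i k hik => (hd hik).mono inter_subset_right inter_subset_right)
        fun i => (measurableSet_toMeasurable P Y).inter (hm i)).symm
    _ ≤ P (toMeasurable P Y) := measure_mono (iUnion_subset fun i => inter_subset_left)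
    _ = P Y := measure_toMeasurable Y

lemma main_aux (j : ℕ) (hj : 1 ≤ j) : ∃ c : ℝ, 0 < c ∧
      ∀ (r R : ℤ) (D : Set Lat) (α : ℝ) (Lr : Set ULoop) (U : Set Lat) (x : Fin j → Lat)
        (μ1 : Fin j → Measure (ℕ → Lat)) (Ps : Measure Config),
        1 ≤ r → 2 * r ≤ R → α ≤ 1 / 2 → (∀ γ ∈ Lr, ULoop.verts γ ⊆ box 0 r) → U ⊆ box 0 r →
        (∀ i, x i ∈ box 0 r) → (∀ i, IsSRW (x i) (μ1 i)) → IsLoopSoup D α Ps →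
        ∀ E : Set Config, DecreasingEvent E →
          ofReal c * ((Measure.pi μ1).prod Ps) {u | 0 < qualityDisc Lr U r u.1 u.2 R ∧ u.2 ∈ E} ≤
            ((Measure.pi μ1).prod Ps) {u | 1 / (10 * (j : ℝ)) < qualityDisc Lr U r u.1 u.2 R ∧ u.2 ∈ E} := by
  obtain ⟨c, hc, a0, ha0, hloc⟩ := exists_local
  set T : Finset (Fin j × (ℤ × ℤ)) := Finset.univ ×ˢ ((Finset.Icc (-(2 * a0)) (2 * a0)) ×ˢ (Finset.Icc (-(2 * a0)) (2 * a0))) with hT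
  refine ⟨c ^ T.card, by positivity, ?_⟩
  intro r R D α Lr U x μ1 Ps hr hrR hα hLr hU hx hμ hPs E hE
  obtain ⟨m, n, N, hm, hn, hnN, hmn, hRm, hN, hG⟩ := hloc R (by omega)
  choose G hGood hCheap using hG
  have hpr : ∀ i, IsProbabilityMeasure (μ1 i) := fun i => (hμ i).1
  have hprs : IsProbabilityMeasure Ps := hPs.1
  set A := bdry (box 0 R) with hA
  have hnull : (Measure.pi μ1).prod Ps (⋃ h : Fin j → Lat, HitAt A h ×ˢ (univ : Set Config))ᶜ = 0 := by
    have h1 : Measure.pi μ1 (⋃ h : Fin j → Lat, HitAt A h)ᶜ = 0 := by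
      refine measure_mono_null (t := ⋃ i, (fun ws : Fin j → ℕ → Lat => ws i) ⁻¹' {w | ∀ t, w t ∉ A}) ?_ ?_
      · intro ws hws
        by_contra hcc
        refine hws (mem_iUnion.2 (hitAt_cover A fun i => ?_))
        by_contra h2
        push Not at h2
        exact hcc (mem_iUnion.2 ⟨i, h2⟩)
      · refine measure_iUnion_null fun i => Measure.pi_eval_preimage_null _ (srw_hits (hμ i) ?_)
        have : linf (x i - 0) ≤ r := hx i
        rw [sub_zero] at this
        omega
    refine measure_mono_null (t := (⋃ h : Fin j → Lat, HitAt A h)ᶜ ×ˢ (univ : Set Config)) (fun u hu => ⟨fun h2 => hu ?_, trivial⟩) ?_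
    · obtain ⟨h, hh⟩ := mem_iUnion.1 h2
      exact mem_iUnion.2 ⟨h, hh, trivial⟩
    · rw [Measure.prod_prod, h1, zero_mul]
  refine split_le (fun h => (hitAt_meas A h).prod .univ) ?_ hnull fun h => ?_
  · intro h h' hne
    exact Set.disjoint_prod.2 (Or.inl (hitAt_disj A hne))
  by_cases hemp : (HitAt A h).Nonempty
  swap
  · rw [Set.not_nonempty_iff_eq_empty.1 hemp]; simp
  have hlin : ∀ i, linf (h i) = R := fun i => linf_of_bdry (hitAt_hitPt hemp.some_mem i).2
  have hch := Cheap.finset (ρ := Measure.pi μ1) (Ps := Ps) (c := ofReal c)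
    (fun q : Fin j × (ℤ × ℤ) => G ((h q.1).1 + m * q.2.1, (h q.1).2 + m * q.2.2))
    (fun q => hCheap _ _ _ _ D α hPs hα) T
  rw [← ENNReal.ofReal_pow hc.le] at hch
  refine (hch.2 _ ?_).trans (measure_mono ?_)
  · rintro w ω ω' hω ⟨⟨h1, h2⟩, h3, -⟩
    exact ⟨⟨quality_decreasing (by omega) hj hω h1, hE ω ω' hω h2⟩, h3, trivial⟩
  · rintro ⟨w, ω⟩ ⟨⟨⟨h1, h2⟩, h3⟩, h4⟩
    refine ⟨⟨quality_of_good hLr hU hj (fun i v hv => ?_) h1, h2⟩, h3⟩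
    rw [(hitAt_hitPt h3.1 i).1] at hv
    have hv' : 9 * linf (v - h i) ≤ R := by
      have h5 : ((linf (v - h i) : ℤ) : ℝ) ≤ 1 / (9 * (j:ℝ)) * (R:ℝ) := hv
      have hj' : (1:ℝ) ≤ j := by exact_mod_cast hj
      have hR0 : (0:ℝ) ≤ R := by exact_mod_cast (by omega : (0:ℤ) ≤ R)
      have h6 : 1 / (9 * (j:ℝ)) ≤ 1 / 9 := one_div_le_one_div_of_le (by norm_num) (by linarith)
      have h7 := mul_le_mul_of_nonneg_right h6 hR0
      have h8 : (9:ℝ) * (linf (v - h i) : ℤ) ≤ R := by linarith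
      exact_mod_cast h8
    obtain ⟨p, hp, h5, h6⟩ := cover hrR hm hmn hRm hN (hlin i) hv'
    exact ⟨_, n, N, hnN, h5, h6, hGood _ _ (h4 (i, p) (by rw [hT]; exact Finset.mem_product.2 ⟨Finset.mem_univ _, hp⟩))⟩
end

/-- separation lemma for one packet, with non-disconnection. For
every `j ≥ 1` there is `c(j) > 0` such that for all `1 ≤ r ≤ R/2`, every `D ⊇ B_R`,
every intensity `α ∈ (0,1/2]` and every initial configuration `(L_r, U, V, x̄)`, one
has `P(Q^j(R) > 1/(10j)) ≥ c · P(Q^j(R) > 0)`, and the same with the quality modified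
by any decreasing event of the loop soup. -/
theorem separation_one_packet_disconnection :
    ∀ j : ℕ, 1 ≤ j →
    ∃ c : ℝ, 0 < c ∧
      ∀ (r R : ℤ) (D : Set Lat) (α : ℝ) (Lr : Set ULoop) (U Vs : Set Lat)
        (x : Fin j → Lat)
        (μ1 : Fin j → Measure (ℕ → Lat)) (Ps : Measure Config)
        (P : Measure ((Fin j → ℕ → Lat) × Config)),
        1 ≤ r → 2 * r ≤ R → box 0 R ⊆ D → 0 < α → α ≤ 1 / 2 →
        (∀ γ ∈ Lr, ULoop.verts γ ⊆ box 0 r) →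
        Vs ⊆ box 0 r → (Vs ∩ bdry (box 0 r)).Nonempty → U ⊆ box 0 r →
        embS U ∩ Fill (LamS (embS Vs) (traces Lr)) = ∅ →
        (∀ i, x i ∈ Vs ∩ bdry (box 0 r)) →
        (∀ i, IsSRW (x i) (μ1 i)) → IsLoopSoup D α Ps →
        P = (Measure.pi μ1).prod Ps →
        (ENNReal.ofReal c * P {u | 0 < qualityDisc Lr U r u.1 u.2 R} ≤
            P {u | 1 / (10 * (j : ℝ)) < qualityDisc Lr U r u.1 u.2 R}) ∧
        ∀ E : Set Config, DecreasingEvent E →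
          ENNReal.ofReal c * P {u | 0 < qualityDisc Lr U r u.1 u.2 R ∧ u.2 ∈ E} ≤
            P {u | 1 / (10 * (j : ℝ)) < qualityDisc Lr U r u.1 u.2 R ∧ u.2 ∈ E} := by
  intro j hj
  obtain ⟨c, hc, h⟩ := main_aux j hj
  refine ⟨c, hc, ?_⟩
  intro r R D α Lr U Vs x μ1 Ps P hr hrR _ _ hα hLr hVs _ hU _ hx hμ hPs hP
  subst hP
  have key := h r R D α Lr U x μ1 Ps hr hrR hα hLr hU (fun i => hVs (hx i).1) hμ hPs
  refine ⟨?_, key⟩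
  have := key univ fun _ _ _ _ => trivial
  simpa using this

end RWLSPaper
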